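/- Every three-dimensional lattice polytope P with exactly two interior lattice points satisfies Vol(∂P) ≤ 102, and equality holds if and only if P is unimodular equivalent to the simplex S₂³ = conv{(0,0,0),(2,0,0),(0,3,0),(0,0,18)}. -/

import Mathlib

open Set MeasureTheory

noncomputable section

/-- The canonical embedding of lattice points `ℤ^d` into `ℝ^d`. -/
def castPt {d : ℕ} (v : Fin d → ℤ) : Fin d → ℝ := fun i => (v i : ℝ)

/-- A lattice polytope: the convex hull of a nonempty finite set of lattice points. -/
def IsLatticePolytope {d : ℕ} (P : Set (Fin d → ℝ)) : Prop :=
  ∃ V : Finset (Fin d → ℤ), V.Nonempty ∧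
    P = convexHull ℝ (castPt '' (V : Set (Fin d → ℤ)))

/-- The interior lattice points of a full-dimensional polytope `P`. -/
def intLatPts {d : ℕ} (P : Set (Fin d → ℝ)) : Set (Fin d → ℤ) :=
  {x | castPt x ∈ interior P}

/-- Unimodular equivalence: an affine lattice automorphism in `GL_d(ℤ) ⋉ ℤ^d` maps `P` onto `Q`. -/
def UnimodEquiv {d : ℕ} (P Q : Set (Fin d → ℝ)) : Prop :=
  ∃ (A : Matrix (Fin d) (Fin d) ℤ) (b : Fin d → ℤ), IsUnit A.det ∧
    (fun x : Fin d → ℝ => (A.map (Int.cast : ℤ → ℝ)).mulVec x + castPt b) '' P = Q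

/-- A three-dimensional lattice polytope with exactly `k` interior lattice points. -/
def IsKPoint3Polytope (k : ℕ) (P : Set (Fin 3 → ℝ)) : Prop :=
  IsLatticePolytope P ∧ affineSpan ℝ P = ⊤ ∧ (intLatPts P).ncard = k

/-- The polytopes satisfying `Q` form exactly `n` unimodular equivalence classes: there are
`n` representatives and every polytope satisfying `Q` is equivalent to exactly one of them. -/
def HasNClassesUpToEquiv (Q : Set (Fin 3 → ℝ) → Prop) (n : ℕ) : Prop :=
  ∃ S : Finset (Set (Fin 3 → ℝ)), S.card = n ∧ (∀ P ∈ S, Q P) ∧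
    ∀ P, Q P → ∃! R, R ∈ S ∧ UnimodEquiv P R

/-- The simplex `S₂³ = conv{(0,0,0),(2,0,0),(0,3,0),(0,0,18)}`. -/
def S23 : Set (Fin 3 → ℝ) :=
  convexHull ℝ {![0,0,0], ![2,0,0], ![0,3,0], ![0,0,18]}

/-- `F` is a (nonempty) face of `P`: the set of maximisers over `P` of some linear functional. -/
def IsFaceOf {d : ℕ} (F P : Set (Fin d → ℝ)) : Prop :=
  F.Nonempty ∧ ∃ (ℓ : (Fin d → ℝ) →ₗ[ℝ] ℝ) (c : ℝ),
    (∀ x ∈ P, ℓ x ≤ c) ∧ F = {x ∈ P | ℓ x = c}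

/-- The dimension of (the affine hull of) a subset of `ℝ^d`. -/
def faceDim {d : ℕ} (F : Set (Fin d → ℝ)) : ℕ :=
  Module.finrank ℝ (affineSpan ℝ F).direction

/-- A facet of a three-dimensional polytope: a two-dimensional face. -/
def IsFacetOf (F P : Set (Fin 3 → ℝ)) : Prop :=
  IsFaceOf F P ∧ faceDim F = 2

/-- `a` is the normalised (lattice) area of the two-dimensional lattice polytope
`F ⊂ ℝ³`, computed with respect to the affine lattice `aff(F) ∩ ℤ³`: there is an
integral affine map `ℝ³ → ℝ²` restricting to a bijection from `aff(F) ∩ ℤ³` to `ℤ²`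
(and injective on `aff(F)`), and `a` is `2!` times the Euclidean area of the image of `F`. -/
def IsNormalisedAreaOf (F : Set (Fin 3 → ℝ)) (a : ℝ) : Prop :=
  ∃ (M : Matrix (Fin 2) (Fin 3) ℤ) (b : Fin 2 → ℤ),
    Set.BijOn (fun v : Fin 3 → ℤ => M.mulVec v + b)
      {v : Fin 3 → ℤ | castPt v ∈ affineSpan ℝ F} Set.univ ∧
    Set.InjOn (fun x : Fin 3 → ℝ => (M.map (Int.cast : ℤ → ℝ)).mulVec x + castPt b)
      (affineSpan ℝ F : Set (Fin 3 → ℝ)) ∧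
    a = 2 * (volume
      ((fun x : Fin 3 → ℝ => (M.map (Int.cast : ℤ → ℝ)).mulVec x + castPt b) '' F)).toReal

/-! ## The planar certificate machine -/

/-- Orientation determinant of three lattice points. -/
def cr3 (a b c : ℤ × ℤ) : ℤ :=
  (b.1 - a.1) * (c.2 - a.2) - (b.2 - a.2) * (c.1 - a.1)

/-- Combinatorial data of the projection of a 2-point polytope along a long lattice chord. -/
structure Cfg (mode : Bool) (LA LB : ℕ) (Y I : Set (ℤ × ℤ)) (F : ℤ × ℤ → ℝ)
    (n s : ℤ × ℤ → ℕ) (q1 : ℤ × ℤ) : Prop where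
  fin : Y.Finite
  sub : I ⊆ Y
  comb : ∀ k l m r : ℤ × ℤ, ∀ a b c : ℤ, k ∈ Y → l ∈ Y → m ∈ Y → 0 ≤ a → 0 ≤ b → 0 ≤ c →
    0 < a + b + c → a * k.1 + b * l.1 + c * m.1 = (a + b + c) * r.1 →
    a * k.2 + b * l.2 + c * m.2 = (a + b + c) * r.2 →
    r ∈ Y ∧ (a : ℝ) * F k + b * F l + c * F m ≤ (a + b + c) * F r ∧
    (((0 < a ∧ k ∈ I) ∨ (0 < b ∧ l ∈ I) ∨ (0 < c ∧ m ∈ I) ∨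
      (0 < a ∧ 0 < b ∧ 0 < c ∧ cr3 k l m ≠ 0)) → r ∈ I)
  Fnn : ∀ y ∈ Y, 0 ≤ F y
  F0 : (LA : ℝ) ≤ F (0, 0)
  zY : (0, 0) ∈ Y
  zI : (0, 0) ∉ I
  qI : (0, 1) ∈ I
  Fle : ∀ r ∈ I, F r ≤ 1 + s r
  sU : mode = false → s (0, 1) = 2 ∧ ∀ r, r ≠ (0, 1) → s r = 0
  sN : mode = true → q1 ≠ (0, 1) ∧ s (0, 1) = 1 ∧ s q1 = 1 ∧ ∀ r, r ≠ (0, 1) → r ≠ q1 → s r = 0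
  nle : ∀ y ∈ Y, (n y : ℝ) ≤ F y + 1
  ncap : ∀ y ∈ Y, n y ≤ LB + 1
  bey : ∀ k : ℤ × ℤ, k ≠ (0, 1) → |k.1| ≤ 12 → ∃ y ∈ Y, cr3 (0, 1) k y < 0

namespace Mach

def px (c : ℕ) : ℕ := c / 128
def py (c : ℕ) : ℕ := c % 128
/-- Decoding of a point code. -/
def dec (c : ℕ) : ℤ × ℤ := ((px c : ℤ) - 16, (py c : ℤ) - 16)
def cO : ℕ := 2064
def cQ : ℕ := 2065
def crp (a b c : ℕ) : ℕ := px a * py b + px b * py c + px c * py a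
def crn (a b c : ℕ) : ℕ := px a * py c + px b * py a + px c * py b
def mem (c : ℕ) (l : List ℕ) : Bool := l.any (fun d => Nat.beq d c)

structure St where
  K : List ℕ
  I : List ℕ
  B : List (ℕ × ℕ)
  q : ℕ
  ns : List ℕ

structure Par where
  mode : Bool
  LA : ℕ
  th : ℕ
  TT : List (List ℕ)

inductive Res where
  | fail : Res
  | dead : Res
  | one : St → Res
  | two : St → St → Res

def cval (p : Par) (s : St) (r : ℕ) : ℕ :=
  bif p.mode then
    bif Nat.beq r cQ then 2 else
    bif Nat.beq s.q 0 then (bif mem r s.ns then 1 else 2) else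
    (bif Nat.beq r s.q then 2 else 1)
  else bif Nat.beq r cQ then 3 else 1

def key (s : St) (r : ℕ) : Bool := s.B.any (fun e => Nat.beq e.1 r)

/-- `r` lies in the positively oriented triangle `y k l`. -/
def tri (y k l r : ℕ) : Bool :=
  Nat.blt (crn y k l) (crp y k l) && Nat.ble (crn r k l) (crp r k l) &&
  Nat.ble (crn y r l) (crp y r l) && Nat.ble (crn y k r) (crp y k r)

def wD (y k l : ℕ) : ℕ := crp y k l - crn y k l

def inter (s : St) (y k l r : ℕ) : Bool :=
  mem r s.I ||
  (Nat.blt 0 (wD r k l) && Nat.blt 0 (wD y r l) && Nat.blt 0 (wD y k r)) ||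
  (Nat.beq k cQ && Nat.blt 0 (wD y r l)) || (Nat.beq l cQ && Nat.blt 0 (wD y k r)) ||
  (Nat.beq y cQ && Nat.blt 0 (wD r k l))

def z (p : Par) (k : ℕ) : ℕ := bif Nat.beq k cO then p.LA else 0

/-- the lower bound for `D * F r` coming from `F 0 ≥ LA`. -/
def lowb (p : Par) (y k l r : ℕ) : ℕ :=
  z p y * wD r k l + z p k * wD y r l + z p l * wD y k r

def killP (p : Par) (s : St) (nk : Bool) (k l r y : ℕ) : Bool :=
  tri y k l r && (nk || (inter s y k l r &&
    (Nat.beq r cO || Nat.blt (cval p s r * wD y k l) (lowb p y k l r))))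

def hfP (p : Par) (s : St) (k l r y : ℕ) : Bool :=
  tri y k l r && inter s y k l r && Nat.blt (wD y k l) (lowb p y k l r)

def filt (s : St) (f : ℕ → Bool) : Res :=
  bif s.K.any (fun k => key s k && f k) then .dead
  else .one { s with B := s.B.filter (fun e => !f e.1) }

def bnd (p : Par) (s : St) (k l r : ℕ) (e : ℕ × ℕ) : ℕ × ℕ :=
  bif tri e.1 k l r && inter s e.1 k l r && Nat.blt 0 (wD r k l) then
    (e.1, min e.2 ((cval p s r * wD e.1 k l - (z p k * wD e.1 r l + z p l * wD e.1 k r)) / wD r k l))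
  else e

def wsum (s : St) : List (ℕ × ℕ) → ℕ
  | [] => 0
  | e :: t => (bif mem e.1 s.I then 2 else e.2 + 1) + wsum s t

def step (p : Par) (o : ℕ) (s : St) : Res :=
  let t := o % 16
  let o1 := o / 16
  let k := o1 % 4096
  let o2 := o1 / 4096
  let l := o2 % 4096
  let o3 := o2 / 4096
  let r := o3 % 4096
  let o4 := o3 / 4096
  let y := o4 % 4096
  match t with
  | 0 => bif Nat.blt (wsum s s.B + 2) p.th then .dead else .fail
  | 1 => bif p.TT.any (fun T => s.B.all (fun e => mem e.1 T)) then .dead else .fail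
  | 2 => bif mem y s.K && mem k s.K && mem l s.K && tri y k l r then
      .one { s with K := r :: s.K, I := bif inter s y k l r then r :: s.I else s.I }
      else .fail
  | 3 => bif mem k s.K && mem l s.K then filt s (killP p s (!key s r) k l r) else .fail
  | 4 => bif mem k s.K && mem l s.K then
      .one { s with B := s.B.map (bnd p s k l r) } else .fail
  | 5 =>
    let o5 := o4 / 4096
    let k2 := y
    let l2 := o5 % 4096
    let r2 := o5 / 4096
    bif p.mode && mem k s.K && mem l s.K && mem k2 s.K && mem l2 s.K && !Nat.beq r r2 &&
      !Nat.beq r cQ && !Nat.beq r2 cQ then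
      filt s (fun y => hfP p s k l r y && hfP p s k2 l2 r2 y) else .fail
  | 6 => bif p.mode && Nat.beq s.q 0 && !Nat.beq r cQ && mem y s.K && mem k s.K && mem l s.K &&
      hfP p s k l r y then .one { s with q := r } else .fail
  | 7 => .two { s with K := k :: s.K } { s with B := s.B.filter (fun e => !Nat.beq e.1 k) }
  | 8 => bif p.mode && Nat.beq s.q 0 then
      .two { s with q := k } { s with ns := k :: s.ns } else .fail
  | 9 => bif !Nat.beq k cQ && Nat.ble 4 (px k) && Nat.ble (px k) 28 &&
      s.B.all (fun e => Nat.ble (crn cQ k e.1) (crp cQ k e.1)) then .dead else .fail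
  | 10 => bif !Nat.beq k cQ && Nat.ble 4 (px k) && Nat.ble (px k) 28 &&
      s.B.all (fun e => Nat.ble (crp cQ k e.1) (crn cQ k e.1)) then .dead else .fail
  | _ => .fail

def run (p : Par) : List ℕ → St → List St → Bool
  | [], _, _ => false
  | o :: os, s, stk =>
    match step p o s with
    | .fail => false
    | .dead => match stk with
      | [] => true
      | s' :: stk' => run p os s' stk'
    | .one s' => run p os s' stk
    | .two a b => run p os a (b :: stk)

structure Sem (s : St) (Y I : Set (ℤ × ℤ)) (n : ℤ × ℤ → ℕ) (q1 : ℤ × ℤ) : Prop where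
  hK : ∀ k ∈ s.K, dec k ∈ Y
  hI : ∀ k ∈ s.I, dec k ∈ I
  hB : ∀ y ∈ Y, ∃ e ∈ s.B, dec e.1 = y
  hU : ∀ e ∈ s.B, dec e.1 ∈ Y → n (dec e.1) ≤ e.2 + 1
  hq : s.q ≠ 0 → dec s.q = q1
  hns : ∀ r ∈ s.ns, dec r ≠ q1

theorem dec_inj {a b : ℕ} (h : dec a = dec b) : a = b := by
  simp only [dec, px, py, Prod.mk.injEq] at h
  omega

theorem beq_ff {a b : ℕ} : Nat.beq a b = false ↔ a ≠ b := by
  rw [← Bool.not_eq_true, Nat.beq_eq]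

theorem mem_iff {c : ℕ} {l : List ℕ} : mem c l = true ↔ c ∈ l := by
  simp [mem]

theorem dec_cO : dec cO = (0, 0) := by decide
theorem dec_cQ : dec cQ = (0, 1) := by decide

theorem cr_dec (a b c : ℕ) : cr3 (dec a) (dec b) (dec c) = (crp a b c : ℤ) - crn a b c := by
  simp only [cr3, dec, crp, crn]; push_cast; ring

theorem key_iff {s : St} {r : ℕ} : key s r = true ↔ ∃ e ∈ s.B, e.1 = r := by
  simp [key]

section sound
variable {mode : Bool} {LA LB : ℕ} {Y I : Set (ℤ × ℤ)} {F : ℤ × ℤ → ℝ}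
    {n sp : ℤ × ℤ → ℕ} {q1 : ℤ × ℤ} {th : ℕ} {TT : List (List ℕ)} {s : St}

theorem cval_le (C : Cfg mode LA LB Y I F n sp q1) (S : Sem s Y I n q1) {r : ℕ}
    (hr : dec r ∈ I) : F (dec r) ≤ cval ⟨mode, LA, th, TT⟩ s r := by
  have h := C.Fle _ hr
  have key : 1 + sp (dec r) ≤ cval ⟨mode, LA, th, TT⟩ s r := by
    have hQ : ∀ r, dec r = (0, 1) ↔ r = cQ :=
      fun r => ⟨fun h => dec_inj (h.trans dec_cQ.symm), fun h => h ▸ dec_cQ⟩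
    cases mode with
    | false =>
      obtain ⟨h1, h2⟩ := C.sU rfl
      by_cases hr : r = cQ
      · subst hr; simp [cval, dec_cQ, h1]
      · have := h2 (dec r) (by rwa [Ne, hQ])
        simp [cval, this, beq_ff.2 hr]
    | true =>
      obtain ⟨h0, h1, h2, h3⟩ := C.sN rfl
      by_cases hr : r = cQ
      · subst hr; simp [cval, dec_cQ, h1]
      · have hrne : dec r ≠ (0, 1) := by rwa [Ne, hQ]
        by_cases hrq : dec r = q1
        · rw [hrq, h2]
          by_cases hs : s.q = 0
          · have : r ∉ s.ns := fun h => S.hns r h hrq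
            have hm : mem r s.ns = false := by rw [← Bool.not_eq_true, mem_iff]; exact this
            simp [cval, beq_ff.2 hr, hs, hm]
          · have : r = s.q := dec_inj (hrq.trans (S.hq hs).symm)
            simp [cval, beq_ff.2 hr, beq_ff.2 (this ▸ hs : r ≠ 0), ← this]
        · rw [h3 _ hrne hrq]
          simp only [cval]
          simp only [cond_true]
          cases Nat.beq r cQ <;> cases Nat.beq s.q 0 <;> cases mem r s.ns <;>
            cases Nat.beq r s.q <;> simp
  have : ((1 + sp (dec r) : ℕ) : ℝ) ≤ cval ⟨mode, LA, th, TT⟩ s r := by exact_mod_cast key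
  push_cast at this
  linarith

theorem z_le (C : Cfg mode LA LB Y I F n sp q1) {k : ℕ} (hk : dec k ∈ Y) :
    (z ⟨mode, LA, th, TT⟩ k : ℝ) ≤ F (dec k) := by
  by_cases h : k = cO
  · subst h; simp [z, dec_cO]; exact C.F0
  · simp [z, beq_ff.2 h]; exact C.Fnn _ hk

theorem tri_spec {y k l r : ℕ} (h : tri y k l r = true) :
    0 < wD y k l ∧ (wD y k l : ℤ) = wD r k l + wD y r l + wD y k r ∧
    (wD r k l : ℤ) * (dec y).1 + wD y r l * (dec k).1 + wD y k r * (dec l).1 =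
      wD y k l * (dec r).1 ∧
    (wD r k l : ℤ) * (dec y).2 + wD y r l * (dec k).2 + wD y k r * (dec l).2 =
      wD y k l * (dec r).2 ∧ cr3 (dec y) (dec k) (dec l) ≠ 0 := by
  simp only [tri, Bool.and_eq_true, Nat.blt_eq, Nat.ble_eq] at h
  obtain ⟨⟨⟨h1, h2⟩, h3⟩, h4⟩ := h
  have e1 : ((wD y k l : ℕ) : ℤ) = cr3 (dec y) (dec k) (dec l) := by
    rw [cr_dec, wD]; push_cast [h1.le]; ring
  have e2 : ((wD r k l : ℕ) : ℤ) = cr3 (dec r) (dec k) (dec l) := by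
    rw [cr_dec, wD]; push_cast [h2]; ring
  have e3 : ((wD y r l : ℕ) : ℤ) = cr3 (dec y) (dec r) (dec l) := by
    rw [cr_dec, wD]; push_cast [h3]; ring
  have e4 : ((wD y k r : ℕ) : ℤ) = cr3 (dec y) (dec k) (dec r) := by
    rw [cr_dec, wD]; push_cast [h4]; ring
  have hp : 0 < wD y k l := by rw [wD]; omega
  refine ⟨hp, ?_, ?_, ?_, ?_⟩
  · rw [e1, e2, e3, e4]; simp only [cr3]; ring
  · rw [e1, e2, e3, e4]; simp only [cr3]; ring
  · rw [e1, e2, e3, e4]; simp only [cr3]; ring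
  · rw [← e1]; positivity

theorem tri_sound (C : Cfg mode LA LB Y I F n sp q1) (S : Sem s Y I n q1) {y k l r : ℕ}
    (hy : dec y ∈ Y) (hk : dec k ∈ Y) (hl : dec l ∈ Y) (h : tri y k l r = true) :
    dec r ∈ Y ∧ (wD r k l : ℝ) * F (dec y) + wD y r l * F (dec k) + wD y k r * F (dec l) ≤
      wD y k l * F (dec r) ∧ (inter s y k l r = true → dec r ∈ I) ∧ (0:ℝ) < wD y k l := by
  obtain ⟨hp, hs, h1, h2, h3⟩ := tri_spec h
  obtain ⟨c1, c2, c3⟩ := C.comb (dec y) (dec k) (dec l) (dec r) (wD r k l) (wD y r l) (wD y k r)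
    hy hk hl (by positivity) (by positivity) (by positivity) (by rw [← hs]; positivity)
    (by rw [← hs]; exact h1) (by rw [← hs]; exact h2)
  refine ⟨c1, ?_, ?_, by exact_mod_cast hp⟩
  · have : (wD y k l : ℝ) = wD r k l + wD y r l + wD y k r := by exact_mod_cast hs
    rw [this]; push_cast at c2; exact c2
  · intro hi
    simp only [inter, Bool.or_eq_true, Bool.and_eq_true, Nat.blt_eq, Nat.beq_eq] at hi
    rcases hi with (((hi | hi) | hi) | hi) | hi
    · exact S.hI _ (mem_iff.1 hi)
    · exact c3 (Or.inr (Or.inr (Or.inr ⟨by exact_mod_cast hi.1.1, by exact_mod_cast hi.1.2,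
        by exact_mod_cast hi.2, h3⟩)))
    · exact c3 (Or.inr (Or.inl ⟨by exact_mod_cast hi.2, by rw [hi.1, dec_cQ]; exact C.qI⟩))
    · exact c3 (Or.inr (Or.inr (Or.inl ⟨by exact_mod_cast hi.2, by rw [hi.1, dec_cQ]; exact C.qI⟩)))
    · exact c3 (Or.inl ⟨by exact_mod_cast hi.2, by rw [hi.1, dec_cQ]; exact C.qI⟩)

theorem lowb_le (C : Cfg mode LA LB Y I F n sp q1) (S : Sem s Y I n q1) {y k l r : ℕ}
    (hy : dec y ∈ Y) (hk : dec k ∈ Y) (hl : dec l ∈ Y) (h : tri y k l r = true) :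
    (lowb ⟨mode, LA, th, TT⟩ y k l r : ℝ) ≤ wD y k l * F (dec r) := by
  refine le_trans ?_ (tri_sound C S hy hk hl h).2.1
  have a1 := z_le (th := th) (TT := TT) C hy
  have a2 := z_le (th := th) (TT := TT) C hk
  have a3 := z_le (th := th) (TT := TT) C hl
  simp only [lowb]; push_cast
  have b1 := mul_le_mul_of_nonneg_right a1 (Nat.cast_nonneg (α := ℝ) (wD r k l))
  have b2 := mul_le_mul_of_nonneg_right a2 (Nat.cast_nonneg (α := ℝ) (wD y r l))
  have b3 := mul_le_mul_of_nonneg_right a3 (Nat.cast_nonneg (α := ℝ) (wD y k r))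
  linarith

theorem kill_sound (C : Cfg mode LA LB Y I F n sp q1) (S : Sem s Y I n q1) {y k l r : ℕ}
    (hk : dec k ∈ Y) (hl : dec l ∈ Y)
    (h : killP ⟨mode, LA, th, TT⟩ s (!key s r) k l r y = true) : dec y ∉ Y := by
  intro hy
  simp only [killP, Bool.and_eq_true, Bool.or_eq_true, Nat.beq_eq, Nat.blt_eq] at h
  obtain ⟨ht, h⟩ := h
  obtain ⟨c1, c2, c3, c4⟩ := tri_sound C S hy hk hl ht
  rcases h with h | ⟨hi, h | h⟩
  · obtain ⟨e, he, hd⟩ := S.hB _ c1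
    have : key s r = true := key_iff.2 ⟨e, he, dec_inj hd⟩
    simp [this] at h
  · have := c3 hi
    rw [h, dec_cO] at this
    exact C.zI this
  · have hI := c3 hi
    have a := cval_le (th := th) (TT := TT) C S hI
    have b := lowb_le (th := th) (TT := TT) C S hy hk hl ht
    have : ((cval ⟨mode, LA, th, TT⟩ s r * wD y k l : ℕ) : ℝ) < lowb ⟨mode, LA, th, TT⟩ y k l r := by
      exact_mod_cast h
    push_cast at this
    nlinarith

theorem hf_sound (C : Cfg mode LA LB Y I F n sp q1) (S : Sem s Y I n q1) (hm : mode = true)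
    {y k l r : ℕ} (hy : dec y ∈ Y)
    (hk : dec k ∈ Y) (hl : dec l ∈ Y) (hr : r ≠ cQ)
    (h : hfP ⟨mode, LA, th, TT⟩ s k l r y = true) : dec r = q1 := by
  simp only [hfP, Bool.and_eq_true, Nat.blt_eq] at h
  obtain ⟨⟨ht, hi⟩, h⟩ := h
  obtain ⟨c1, c2, c3, c4⟩ := tri_sound C S hy hk hl ht
  have b := lowb_le (th := th) (TT := TT) C S hy hk hl ht
  have : (wD y k l : ℝ) < lowb ⟨mode, LA, th, TT⟩ y k l r := by exact_mod_cast h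
  by_contra hne
  have h0 := (C.sN hm).2.2.2 (dec r) (fun h => hr (dec_inj (h.trans dec_cQ.symm))) hne
  have := C.Fle _ (c3 hi)
  rw [h0] at this
  push_cast at this
  nlinarith

theorem bnd_fst (p : Par) (k l r : ℕ) (e : ℕ × ℕ) : (bnd p s k l r e).1 = e.1 := by
  simp only [bnd]; cases (tri e.1 k l r && inter s e.1 k l r && Nat.blt 0 (wD r k l)) <;> rfl

theorem bnd_sound (C : Cfg mode LA LB Y I F n sp q1) (S : Sem s Y I n q1) {k l r : ℕ}
    {e : ℕ × ℕ} (he : dec e.1 ∈ Y) (hn : n (dec e.1) ≤ e.2 + 1)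
    (hk : dec k ∈ Y) (hl : dec l ∈ Y) :
    n (dec e.1) ≤ (bnd ⟨mode, LA, th, TT⟩ s k l r e).2 + 1 := by
  simp only [bnd]
  cases h : (tri e.1 k l r && inter s e.1 k l r && Nat.blt 0 (wD r k l)) with
  | false => exact hn
  | true =>
    simp only [Bool.and_eq_true, Nat.blt_eq] at h
    obtain ⟨⟨ht, hi⟩, h0⟩ := h
    simp only [cond_true]
    rw [← Nat.sub_le_iff_le_add, le_min_iff]
    refine ⟨by omega, ?_⟩
    rw [Nat.le_div_iff_mul_le h0]
    obtain ⟨c1, c2, c3, c4⟩ := tri_sound C S he hk hl ht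
    have a := cval_le (th := th) (TT := TT) C S (c3 hi)
    have a2 := z_le (th := th) (TT := TT) C hk
    have a3 := z_le (th := th) (TT := TT) C hl
    have b2 := mul_le_mul_of_nonneg_right a2 (Nat.cast_nonneg (α := ℝ) (wD e.1 r l))
    have b3 := mul_le_mul_of_nonneg_right a3 (Nat.cast_nonneg (α := ℝ) (wD e.1 k r))
    have b4 := mul_le_mul_of_nonneg_left a c4.le
    have hn' := C.nle _ he
    rcases Nat.eq_zero_or_pos (n (dec e.1)) with h5 | h5
    · rw [h5]; simp
    have h6 : (((n (dec e.1) - 1 : ℕ)) : ℝ) ≤ F (dec e.1) := by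
      rw [Nat.cast_sub h5]; push_cast; linarith
    have b5 := mul_le_mul_of_nonneg_right h6 (Nat.cast_nonneg (α := ℝ) (wD r k l))
    apply Nat.le_sub_of_add_le
    have : (((n (dec e.1) - 1) * wD r k l + (z ⟨mode, LA, th, TT⟩ k * wD e.1 r l +
      z ⟨mode, LA, th, TT⟩ l * wD e.1 k r) : ℕ) : ℝ) ≤
      ((cval ⟨mode, LA, th, TT⟩ s r * wD e.1 k l : ℕ) : ℝ) := by
      rw [Nat.cast_add, Nat.cast_add, Nat.cast_mul, Nat.cast_mul, Nat.cast_mul, Nat.cast_mul]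
      linarith
    exact_mod_cast this

theorem sum_le_wsum (C : Cfg mode LA LB Y I F n sp q1) (S : Sem s Y I n q1)
    (B : List (ℕ × ℕ)) (hB : ∀ e ∈ B, e ∈ s.B) :
    ∀ A : Finset (ℤ × ℤ), (∀ y ∈ A, y ∈ Y ∧ ∃ e ∈ B, dec e.1 = y) →
      ∑ y ∈ A, (n y : ℤ) ≤ wsum s B + ∑ y ∈ A, (sp y : ℤ) := by
  induction B with
  | nil =>
    intro A hA
    have : A = ∅ := Finset.eq_empty_of_forall_notMem (fun y hy => by simpa using (hA y hy).2)
    simp [this, wsum]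
  | cons e t ih =>
    intro A hA
    have ih' := ih (fun e he => hB e (List.mem_cons_of_mem _ he)) (A.erase (dec e.1)) (by
      intro y hy
      rw [Finset.mem_erase] at hy
      obtain ⟨h1, e', h2, h3⟩ := hA y hy.2
      refine ⟨h1, e', ?_, h3⟩
      rcases List.mem_cons.1 h2 with h | h
      · subst h; exact absurd h3.symm hy.1
      · exact h)
    by_cases hm : dec e.1 ∈ A
    · rw [← Finset.add_sum_erase A _ hm, ← Finset.add_sum_erase A (fun y => (sp y : ℤ)) hm]
      have hY := (hA _ hm).1
      have : (n (dec e.1) : ℤ) ≤ ((bif mem e.1 s.I then 2 else e.2 + 1 : ℕ) : ℤ) + sp (dec e.1) := by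
        cases hI : mem e.1 s.I with
        | true =>
          have h1 := C.Fle _ (S.hI _ (mem_iff.1 hI))
          have h2 := C.nle _ hY
          have : (n (dec e.1) : ℝ) ≤ ((2 + sp (dec e.1) : ℕ) : ℝ) := by push_cast; linarith
          have : n (dec e.1) ≤ 2 + sp (dec e.1) := by exact_mod_cast this
          simp only [cond_true]; push_cast; omega
        | false =>
          have := S.hU e (hB e (by simp)) hY
          simp only [cond_false]; push_cast; omega
      simp only [wsum]
      push_cast at *
      linarith
    · rw [Finset.erase_eq_of_notMem hm] at ih'
      simp only [wsum]
      push_cast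
      have : (0:ℤ) ≤ ((bif mem e.1 s.I then 2 else e.2 + 1 : ℕ) : ℤ) := by positivity
      linarith

theorem sp_sum (C : Cfg mode LA LB Y I F n sp q1) (A : Finset (ℤ × ℤ)) :
    ∑ y ∈ A, (sp y : ℤ) ≤ 2 := by
  cases mode with
  | false =>
    obtain ⟨h1, h2⟩ := C.sU rfl
    calc ∑ y ∈ A, (sp y : ℤ) ≤ ∑ y ∈ A ∪ {(0, 1)}, (sp y : ℤ) :=
          Finset.sum_le_sum_of_subset_of_nonneg Finset.subset_union_left (by intros; positivity)
      _ = ∑ y ∈ {((0, 1) : ℤ × ℤ)}, (sp y : ℤ) :=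
          (Finset.sum_subset Finset.subset_union_right (fun y _ hy => by
            rw [h2 y (by simpa using hy)]; rfl)).symm
      _ ≤ 2 := by simp [h1]
  | true =>
    obtain ⟨h0, h1, h2, h3⟩ := C.sN rfl
    calc ∑ y ∈ A, (sp y : ℤ) ≤ ∑ y ∈ A ∪ {(0, 1), q1}, (sp y : ℤ) :=
          Finset.sum_le_sum_of_subset_of_nonneg Finset.subset_union_left (by intros; positivity)
      _ = ∑ y ∈ {((0, 1) : ℤ × ℤ), q1}, (sp y : ℤ) :=
          (Finset.sum_subset Finset.subset_union_right (fun y _ hy => by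
            simp only [Finset.mem_insert, Finset.mem_singleton, not_or] at hy
            rw [h3 y hy.1 hy.2]; rfl)).symm
      _ ≤ 2 := by rw [Finset.sum_pair (Ne.symm h0)]; simp [h1, h2]

/-- The assumptions that the certificate refutes. -/
structure Goal (Y : Set (ℤ × ℤ)) (n : ℤ × ℤ → ℕ) (th : ℕ) (TT : List (List ℕ)) : Prop where
  hs : ∃ A : Finset (ℤ × ℤ), (↑A : Set (ℤ × ℤ)) = Y ∧ th ≤ ∑ y ∈ A, n y
  hT : ∀ T ∈ TT, ∃ y ∈ Y, ∀ t ∈ T, dec t ≠ y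

def Good (Y I : Set (ℤ × ℤ)) (n : ℤ × ℤ → ℕ) (q1 : ℤ × ℤ) : Res → Prop
  | .fail => True
  | .dead => False
  | .one s => Sem s Y I n q1
  | .two a b => Sem a Y I n q1 ∨ Sem b Y I n q1

theorem filt_sound (S : Sem s Y I n q1) (f : ℕ → Bool) (hf : ∀ y, f y = true → dec y ∉ Y) :
    Good Y I n q1 (filt s f) := by
  simp only [filt]
  cases h : s.K.any (fun k => key s k && f k) with
  | true =>
    simp only [List.any_eq_true, Bool.and_eq_true] at h
    obtain ⟨k, hk, -, h2⟩ := h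
    exact hf k h2 (S.hK k hk)
  | false =>
    refine ⟨S.hK, S.hI, ?_, ?_, S.hq, S.hns⟩
    · intro y hy
      obtain ⟨e, he, hd⟩ := S.hB y hy
      refine ⟨e, ?_, hd⟩
      simp only [List.mem_filter, Bool.not_eq_true']
      refine ⟨he, ?_⟩
      by_contra hc
      rw [Bool.not_eq_false] at hc
      exact hf _ hc (hd ▸ hy)
    · intro e he
      exact S.hU e (List.mem_filter.1 he).1

theorem step_sound (C : Cfg mode LA LB Y I F n sp q1) (G : Goal Y n th TT) (o : ℕ)
    (S : Sem s Y I n q1) : Good Y I n q1 (step ⟨mode, LA, th, TT⟩ o s) := by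
  unfold step
  extract_lets t o1 k o2 l o3 r o4 y o5 k2 l2 r2
  clear_value t k l r y l2 r2
  split
  · cases h : Nat.blt (wsum s s.B + 2) th with
    | false => trivial
    | true =>
      obtain ⟨A, hA, hs⟩ := G.hs
      have h1 := sum_le_wsum C S s.B (fun _ h => h) A (fun y hy => by
        have : y ∈ Y := hA ▸ hy
        exact ⟨this, S.hB y this⟩)
      have h2 := sp_sum C A
      rw [Nat.blt_eq] at h
      have h3 : (th : ℤ) ≤ ∑ y ∈ A, (n y : ℤ) := by exact_mod_cast hs
      simp only [cond_true, Good]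
      have : ((wsum s s.B : ℤ)) + 2 < th := by exact_mod_cast h
      linarith
  · cases h : TT.any (fun T => s.B.all (fun e => mem e.1 T)) with
    | false => trivial
    | true =>
      simp only [List.any_eq_true, List.all_eq_true] at h
      obtain ⟨T, hT, h⟩ := h
      obtain ⟨y, hy, hn⟩ := G.hT T hT
      obtain ⟨e, he, hd⟩ := S.hB y hy
      exact hn e.1 (mem_iff.1 (h e he)) hd
  · cases h : (mem y s.K && mem k s.K && mem l s.K && tri y k l r) with
    | false => trivial
    | true =>
      simp only [Bool.and_eq_true, mem_iff] at h
      obtain ⟨⟨⟨hy, hk⟩, hl⟩, ht⟩ := h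
      obtain ⟨c1, c2, c3, c4⟩ := tri_sound C S (S.hK _ hy) (S.hK _ hk) (S.hK _ hl) ht
      refine ⟨?_, ?_, S.hB, S.hU, S.hq, S.hns⟩
      · intro a ha
        rcases List.mem_cons.1 ha with rfl | ha
        · exact c1
        · exact S.hK a ha
      · cases hi : inter s y k l r with
        | false => exact S.hI
        | true =>
          intro a ha
          rcases List.mem_cons.1 ha with rfl | ha
          · exact c3 hi
          · exact S.hI a ha
  · cases h : (mem k s.K && mem l s.K) with
    | false => trivial
    | true =>
      simp only [Bool.and_eq_true, mem_iff] at h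
      exact filt_sound S _ (fun y hy => kill_sound C S (S.hK _ h.1) (S.hK _ h.2) hy)
  · cases h : (mem k s.K && mem l s.K) with
    | false => trivial
    | true =>
      simp only [Bool.and_eq_true, mem_iff] at h
      refine ⟨S.hK, S.hI, ?_, ?_, S.hq, S.hns⟩
      · intro y hy
        obtain ⟨e, he, hd⟩ := S.hB y hy
        exact ⟨_, List.mem_map.2 ⟨e, he, rfl⟩, by rw [bnd_fst]; exact hd⟩
      · intro e' he' hY
        obtain ⟨e, he, rfl⟩ := List.mem_map.1 he'
        rw [bnd_fst] at hY ⊢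
        exact bnd_sound C S hY (S.hU e he hY) (S.hK _ h.1) (S.hK _ h.2)
  · simp only [k2]
    cases h : (mode && mem k s.K && mem l s.K && mem y s.K && mem l2 s.K && !Nat.beq r r2 &&
      !Nat.beq r cQ && !Nat.beq r2 cQ) with
    | false => trivial
    | true =>
      simp only [Bool.and_eq_true, mem_iff, Bool.not_eq_true', beq_ff] at h
      obtain ⟨⟨⟨⟨⟨⟨⟨hm, hk⟩, hl⟩, hk2⟩, hl2⟩, hrr⟩, hr⟩, hr2⟩ := h
      refine filt_sound S _ (fun w hw hY => ?_)
      rw [Bool.and_eq_true] at hw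
      have e1 := hf_sound C S hm hY (S.hK _ hk) (S.hK _ hl) hr hw.1
      have e2 := hf_sound C S hm hY (S.hK _ hk2) (S.hK _ hl2) hr2 hw.2
      exact hrr (dec_inj (e1.trans e2.symm))
  · cases h : (mode && Nat.beq s.q 0 && !Nat.beq r cQ && mem y s.K && mem k s.K && mem l s.K &&
      hfP ⟨mode, LA, th, TT⟩ s k l r y) with
    | false => trivial
    | true =>
      simp only [Bool.and_eq_true, mem_iff, Bool.not_eq_true', beq_ff] at h
      obtain ⟨⟨⟨⟨⟨⟨hm, hq⟩, hr⟩, hy⟩, hk⟩, hl⟩, hh⟩ := h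
      exact ⟨S.hK, S.hI, S.hB, S.hU,
        fun _ => hf_sound C S hm (S.hK _ hy) (S.hK _ hk) (S.hK _ hl) hr hh, S.hns⟩
  · by_cases hY : dec k ∈ Y
    · left
      refine ⟨?_, S.hI, S.hB, S.hU, S.hq, S.hns⟩
      intro a ha
      rcases List.mem_cons.1 ha with rfl | ha
      · exact hY
      · exact S.hK a ha
    · right
      refine ⟨S.hK, S.hI, ?_, fun e he => S.hU e (List.mem_filter.1 he).1, S.hq, S.hns⟩
      intro y hy
      obtain ⟨e, he, hd⟩ := S.hB y hy
      refine ⟨e, ?_, hd⟩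
      simp only [List.mem_filter, Bool.not_eq_true', beq_ff]
      refine ⟨he, fun hc => hY ?_⟩
      rw [← hc, hd]; exact hy
  · cases h : (mode && Nat.beq s.q 0) with
    | false => trivial
    | true =>
      by_cases hq : dec k = q1
      · left
        exact ⟨S.hK, S.hI, S.hB, S.hU, fun _ => hq, S.hns⟩
      · right
        refine ⟨S.hK, S.hI, S.hB, S.hU, S.hq, ?_⟩
        intro a ha
        rcases List.mem_cons.1 ha with rfl | ha
        · exact hq
        · exact S.hns a ha
  · cases h : (!Nat.beq k cQ && Nat.ble 4 (px k) && Nat.ble (px k) 28 &&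
      s.B.all (fun e => Nat.ble (crn cQ k e.1) (crp cQ k e.1))) with
    | false => trivial
    | true =>
      simp only [Bool.and_eq_true, Bool.not_eq_true', beq_ff, Nat.ble_eq,
        List.all_eq_true] at h
      obtain ⟨⟨⟨h1, h2⟩, h3⟩, h4⟩ := h
      obtain ⟨y, hy, hc⟩ := C.bey (dec k) (fun h => h1 (dec_inj (h.trans dec_cQ.symm)))
        (by simp only [dec]; rw [abs_le]; omega)
      obtain ⟨e, he, rfl⟩ := S.hB y hy
      rw [← dec_cQ, cr_dec] at hc
      have := h4 e he
      omega
  · cases h : (!Nat.beq k cQ && Nat.ble 4 (px k) && Nat.ble (px k) 28 &&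
      s.B.all (fun e => Nat.ble (crp cQ k e.1) (crn cQ k e.1))) with
    | false => trivial
    | true =>
      simp only [Bool.and_eq_true, Bool.not_eq_true', beq_ff, Nat.ble_eq,
        List.all_eq_true] at h
      obtain ⟨⟨⟨h1, h2⟩, h3⟩, h4⟩ := h
      have hk : dec k ≠ (0, 1) := fun h => h1 (dec_inj (h.trans dec_cQ.symm))
      obtain ⟨y, hy, hc⟩ := C.bey (-(dec k).1, 2 - (dec k).2)
        (by intro h; apply hk; simp only [Prod.mk.injEq] at h; ext <;> simp <;> omega)
        (by simp only [dec]; rw [abs_le]; omega)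
      obtain ⟨e, he, rfl⟩ := S.hB y hy
      have h5 := h4 e he
      have h6 := cr_dec cQ k e.1
      rw [dec_cQ] at h6
      have : cr3 (0, 1) (-(dec k).1, 2 - (dec k).2) (dec e.1) = - cr3 (0, 1) (dec k) (dec e.1) := by
        simp only [cr3]; ring
      omega
  · trivial

theorem run_sound (C : Cfg mode LA LB Y I F n sp q1) (G : Goal Y n th TT) :
    ∀ (os : List ℕ) (s : St) (stk : List St), run ⟨mode, LA, th, TT⟩ os s stk = true →
      ¬ Sem s Y I n q1 ∧ ∀ s' ∈ stk, ¬ Sem s' Y I n q1 := by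
  intro os
  induction os with
  | nil => intro s stk h; simp [run] at h
  | cons o os ih =>
    intro s stk h
    have key := fun S => step_sound (s := s) C G o S
    unfold run at h
    revert key h
    cases step ⟨mode, LA, th, TT⟩ o s with
    | fail => intro key h; simp at h
    | dead =>
      intro key h
      refine ⟨fun S => key S, ?_⟩
      cases stk with
      | nil => simp
      | cons s' stk' =>
        obtain ⟨a, b⟩ := ih _ _ h
        intro s'' hs
        rcases List.mem_cons.1 hs with rfl | hs
        · exact a
        · exact b _ hs
    | one s' =>
      intro key h
      obtain ⟨a, b⟩ := ih _ _ h
      exact ⟨fun S => a (key S), b⟩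
    | two s1 s2 =>
      intro key h
      obtain ⟨a, b⟩ := ih _ _ h
      refine ⟨fun S => (key S).elim a (b s2 (by simp)), fun s' hs => b s' (by simp [hs])⟩

end sound
end Mach

namespace Mach

/-- The possible lattice points of the projection in each case. -/
def Vs : Bool → ℕ → List ℕ
  | false, 0 => [1296, 1424, 1429, 1552, 1556, 1680, 1683, 1808, 1809, 1810, 1812, 1936, 1937, 1938, 1939, 1940,
   1941, 2064, 2065, 2066, 2067, 2068, 2192, 2193, 2194, 2195, 2196, 2197, 2320, 2321, 2322, 2324,
   2448, 2451, 2576, 2580, 2704, 2709, 2832]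
  | false, 1 => [1048, 1175, 1302, 1429, 1556, 1560, 1681, 1683, 1684, 1686, 1809, 1810, 1811, 1812, 1814, 1937,
   1938, 1939, 1940, 1941, 2064, 2065, 2066, 2067, 2068, 2192, 2193, 2194, 2195, 2196, 2319, 2320,
   2321, 2322, 2324, 2446, 2448, 2449, 2451, 2576, 2580, 2704, 2832, 2960, 3088]
  | false, 2 => [1308, 1434, 1560, 1684, 1686, 1689, 1811, 1812, 1813, 1814, 1816, 1938, 1939, 1940, 1941, 2064,
   2065, 2066, 2067, 2068, 2192, 2193, 2194, 2195, 2319, 2320, 2321, 2322, 2324, 2446, 2448, 2451,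
   2576, 2704, 2832]
  | false, 3 => [1689, 1813, 1814, 1816, 1939, 1940, 1941, 2064, 2065, 2066, 2067, 2068, 2192, 2193, 2194, 2319,
   2320, 2322, 2448]
  | false, 4 => [1816, 1940, 1941, 2064, 2065, 2066, 2067, 2068, 2192, 2193, 2320]
  | false, 5 => [1941, 2064, 2065, 2066, 2192]
  | true, 0 => [784, 912, 921, 1040, 1048, 1168, 1175, 1296, 1298, 1299, 1302, 1424, 1426, 1429, 1552, 1553,
   1554, 1556, 1560, 1680, 1681, 1682, 1683, 1684, 1686, 1808, 1809, 1810, 1811, 1812, 1813, 1814,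
   1936, 1937, 1938, 1939, 1940, 2064, 2065, 2066, 2192, 2193, 2194, 2195, 2196, 2320, 2321, 2322,
   2323, 2324, 2325, 2326, 2448, 2449, 2450, 2451, 2452, 2454, 2576, 2577, 2578, 2579, 2580, 2584,
   2704, 2706, 2709, 2832, 2834, 2835, 2836, 2838, 2960, 2967, 3088, 3092, 3096, 3216, 3219, 3225,
   3344]
  | true, 1 => [534, 540, 667, 789, 794, 921, 1044, 1048, 1175, 1298, 1299, 1300, 1302, 1305, 1308, 1425, 1426,
   1427, 1429, 1430, 1434, 1553, 1554, 1555, 1556, 1557, 1558, 1560, 1681, 1682, 1683, 1684, 1685,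
   1686, 1809, 1810, 1811, 1812, 1813, 1814, 1937, 1938, 1939, 1940, 2064, 2065, 2066, 2192, 2193,
   2194, 2195, 2319, 2320, 2321, 2322, 2323, 2324, 2446, 2447, 2448, 2449, 2450, 2451, 2573, 2574,
   2575, 2576, 2577, 2578, 2580, 2700, 2701, 2702, 2704, 2705, 2709, 2827, 2828, 2829, 2830, 2832,
   2835, 2838, 2960, 3083, 3084, 3088, 3210, 3216, 3339, 3344, 3472, 3592, 3594, 3600]
  | true, 2 => [804, 930, 1052, 1056, 1182, 1304, 1305, 1308, 1430, 1432, 1434, 1557, 1558, 1560, 1561, 1562,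
   1684, 1685, 1686, 1687, 1688, 1811, 1812, 1813, 1814, 1938, 1939, 1940, 2064, 2065, 2066, 2192,
   2193, 2194, 2319, 2320, 2321, 2322, 2446, 2447, 2448, 2449, 2450, 2573, 2574, 2576, 2577, 2578,
   2700, 2702, 2704, 2828, 2829, 2832, 2960, 3084, 3088, 3216, 3344]
  | true, 3 => [1561, 1562, 1687, 1688, 1813, 1814, 1939, 1940, 2064, 2065, 2066, 2192, 2193, 2319, 2320, 2446,
   2447, 2573, 2574]
  | true, 4 => [1940, 2064, 2065, 2066, 2192]
  | _, _ => []

/-- Viability of a far point. -/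
def viab (mode : Bool) (D u : ℕ) : Bool :=
  bif mode then
    (List.range D).all (fun j => Nat.beq (j * u % D) 0 || Nat.ble D (2 * (j * u % D + j))) &&
    Nat.ble ((List.range D).countP
      (fun j => !Nat.beq (j * u % D) 0 && Nat.blt (4 * (j * u % D + j)) (3 * D))) 1
  else (List.range D).all (fun j => Nat.beq (j * u % D) 0 || Nat.ble (3 * D) (4 * (j * u % D + j)))

/-- Half height bound. -/
def EE (mode : Bool) : ℕ := bif mode then 4 else 8

/-- the candidate `(D, y - D)` (right side) is coded for `y` in the range -/
def rightC (mode : Bool) (bb D : ℕ) : List ℕ :=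
  ((List.range ((EE mode - bb) * D + D + 1)).filter
    (fun y => Nat.blt 0 y && viab mode D ((200 * D - y) % D))).map
    (fun y => (D + 16) * 128 + (y + 16 - D))

def leftC (mode : Bool) (bb D : ℕ) : List ℕ :=
  ((List.range (EE mode * D + D + 1)).filter
    (fun y => Nat.blt (bb * D) y && viab mode D ((200 * D - y) % D))).map
    (fun y => (16 - D) * 128 + (y + 16 - D))

/-- Initial candidate list. -/
def B0 (mode : Bool) (bb : ℕ) : List ℕ :=
  (List.range (EE mode / 2 + 1)).map (fun y => 2064 + y) ++
  (List.range 13).flatMap (fun d => rightC mode bb (d + 1) ++ leftC mode bb (d + 1))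

def stI (bb LB : ℕ) (B : List ℕ) : St :=
  ⟨[cO, cQ, 2192, 1936 + bb], [cQ], B.map (fun c => (c, LB)), 0, []⟩

def Tex : List (List ℕ) := [[1683, 1810, 1937, 2064, 2065, 2192, 2320],
  [1810, 1937, 2064, 2065, 2192, 2320, 2448]]

theorem rV0_0 : run ⟨false, 4, 0, [Vs false 0]⟩
  [554186148099, 554177691923, 520094775555, 588822642947, 554722949379, 554731340035,
   520363211011, 589091078403, 589359513859, 520631646467, 35095, 520103231747, 486280364291,
   33063, 588814254371, 520094908675, 623719317795, 1, 554731403523, 35111, 554731473171,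
   588814256419, 520103297283, 30999, 623719381267, 1, 520103299347, 28935, 623719379203, 1, 35127,
   623719385395, 1, 37191, 2555854114095378, 589082689811, 35114, 589091143939, 31015,
   2131373637859586, 520086520067, 588814252323, 589091141907, 1, 520371667203, 37159,
   2553654822338834, 588814252291, 623450818835, 28967, 1990636149504258, 520094775555, 41255,
   2835164158789906, 623182381315, 35098, 588814254355, 588822642947, 33063, 588814254371,
   520094908675, 486272041219, 1, 554731340035, 37127, 554739728643, 486288687363, 31015,
   2131373646182658, 520086520067, 588805929251, 1, 520379990275, 39175, 520388382979, 28967,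
   1990636166215938, 520094775555, 41223, 43271, 520136720643, 35098, 726018326803, 41226,
   691650199827, 39178, 657282072851, 26935, 1850964089796866, 486003472643, 37130, 622905557267,
   31031, 2132473409468674, 520086585603, 486263716131, 1, 28999, 1992835432806658, 520346697987,
   35082]
  (stI 0 0 (B0 false 0)) [] = true := by decide +kernel

theorem rV0_1 : run ⟨false, 4, 0, [Vs false 1]⟩
  [588822642947, 588814252307, 554722949395, 520363211027, 589091078403, 554731340035,
   623710861587, 520371601667, 520631646483, 486817169667, 35095, 588545820947, 520103231747,
   520371667203, 33063, 520094908675, 588814254371, 1, 554731405571, 35111, 588814256419,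
   520103297283, 1, 589091141907, 31015, 520086520067, 588814252323, 1, 520371667203, 37159,
   2553654822338834, 588814252307, 28967, 588814250275, 485718393091, 1, 35098, 588814254355,
   588822642947, 33063, 588814254371, 520094908675, 588545818915, 520363344131, 1, 554731340035,
   37127, 554739728643, 656996864259, 622637125891, 520379990275, 31015, 520086520067,
   588831029539, 1, 520379990275, 39175, 520388382979, 28967, 588839416099, 485718393091,
   451627096323, 1, 41223, 43271, 520136720643, 31001, 726018326803, 41226, 691650199827, 39178,
   657282072851, 26935, 1850964089798914, 451618763043, 1, 37130, 622905557267, 31031,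
   520355021059, 588545816883, 1, 520640037123, 28999, 1992835432806674, 520363278595, 41191,
   588579242243, 41194, 35082]
  (stI 1 0 (B0 false 1)) [] = true := by decide +kernel

theorem rV0_2 : run ⟨false, 4, 0, [Vs false 2]⟩
  [554722949411, 588545816867, 588814252323, 589082687779, 554731340035, 520371601667,
   520908472579, 520640037123, 35095, 588545820947, 520371667203, 1, 588822642947, 588814252323,
   33063, 588545818915, 520363344131, 1, 554731340035, 37127, 622637125891, 520379990275, 1, 31031,
   520355021059, 588545816883, 1, 520640037123, 28999, 588545814851, 486255395075, 1, 35082]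
  (stI 2 0 (B0 false 2)) [] = true := by decide +kernel

theorem rV0_3 : run ⟨false, 4, 0, [Vs false 3]⟩
  [588814252339, 554722949427, 588545816883, 554731340035, 520908472579, 520640037123, 1]
  (stI 3 0 (B0 false 3)) [] = true := by decide +kernel

theorem rV0_4 : run ⟨false, 4, 0, [Vs false 4]⟩
  [554722949443, 588545816899, 554731340035, 520908472579, 1]
  (stI 4 0 (B0 false 4)) [] = true := by decide +kernel

theorem rV0_5 : run ⟨false, 4, 0, [Vs false 5]⟩
  [2269946714622210, 554722949459, 554731340035, 1]
  (stI 5 0 (B0 false 5)) [] = true := by decide +kernel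

theorem rV0_6 : run ⟨false, 4, 0, [Vs false 6]⟩
  [554714958083]
  (stI 6 0 (B0 false 6)) [] = true := by decide +kernel

theorem rV0_7 : run ⟨false, 4, 0, [Vs false 7]⟩
  [554715023619]
  (stI 7 0 (B0 false 7)) [] = true := by decide +kernel

theorem rV0_8 : run ⟨false, 4, 0, [Vs false 8]⟩
  [554715089155]
  (stI 8 0 (B0 false 8)) [] = true := by decide +kernel

theorem rV1_0 : run ⟨true, 4, 0, [Vs true 0]⟩
  [554186148099, 554177691923, 42824767155443879411989, 35740645473883656321285,
   35759664175144401664261, 40481454056592982966533, 554454513923, 554462904579, 520363211011,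
   40499900942503960936709, 35777538962065703598341, 45185950396913061757205, 588822642947,
   520094775555, 726790078739, 383192760579, 452449040643, 658615861507, 589091078403,
   829869293843, 35095, 35759668678744029034757, 520103231747, 35741221934635968200965,
   33380038693166785855749, 383201149187, 452189061379, 33063, 40481454199529494577413,
   35740649977483283824901, 42824190696890599244069, 658347491619, 1, 554731405571, 35111,
   554731473171, 35741226438235595636997, 42824190837628087601445, 30999, 40481454057692494594309,
   658347555091, 1, 520103299347, 28935, 692975726851, 1, 35127, 40481454341366494560517,
   623719385395, 1, 589359642883, 37191, 2555853845594370, 588814258499, 1, 35114, 589091143955,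
   31015, 2131373637859586, 554714626339, 35740073516730972012805, 42824190556153110886693, 1,
   520371667203, 37159, 2553654822338834, 2553654813948166, 520111685891, 623173996835,
   588822642947, 1, 623450882323, 28967, 1990636149504258, 1990636141050118, 588814250275,
   485718393091, 1, 39207, 2694392302305558, 623173998883, 520120074499, 1, 657810620691, 26919,
   1849898661150982, 485710004483, 588814248227, 1, 451652190467, 41255, 2835164158789906,
   2835164158787846, 588847939843, 41258, 24871, 1709161172795654, 1709126813055234, 485735037187,
   43303, 2975901638756630, 588856328451, 657533741347, 1, 726521645331, 45351, 3116673495238930,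
   3116673495236870, 623173992723, 20775, 1427651836346630, 1427617476606210, 451375298819, 49447,
   3398148463560982, 3398182831687954, 691901858051, 35098, 588822642947, 588814254355, 33063,
   588814254371, 35759096721591352981765, 520094908675, 35740649977483283824901, 452180738307, 1,
   554731340035, 37127, 554739728643, 418106081539, 31015, 2131373646182658, 588805929251,
   35740073516730972012805, 520086520067, 1, 520379990275, 39175, 520388382979, 520119943427,
   28967, 1990636166215938, 1990636141050118, 588805927203, 485718393091, 383176046867, 1, 41223,
   383226255619, 26919, 1849898686251270, 1849864326510850, 485710004483, 588797536547, 1,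
   451677296899, 43271, 35743523274045588013317, 24871, 1709161206284550, 1709126846544130,
   485735037187, 45319, 22823, 1568389366579462, 1568355006839042, 451333488899, 588789143843, 1,
   47367, 20775, 1427651886612742, 1427617526872322, 451375298819, 49415, 51463,
   33384645875585652916485, 35098, 863490834707, 49418, 829122707731, 47370, 794754580755, 45322,
   760386453779, 43274, 726018326803, 41226, 691650199827, 16711, 1148410259341574,
   1148307448559874, 417283995907, 39178, 657282072851, 26935, 1850998181099778, 520094775555,
   37130, 622905557267, 31031, 2132473409468674, 35758524764438676928773, 520086585603,
   486263716131, 1, 520640037123, 28999, 1992835164305666, 520078262531, 1, 35082]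
  (stI 0 0 (B0 true 0)) [] = true := by decide +kernel

theorem rV1_1 : run ⟨true, 4, 0, [Vs true 1]⟩
  [40481454057692494594309, 588814252307, 42824190695791087614229, 554454513939,
   42824767155443879411989, 35778110919218379651349, 520371601667, 45185373937260269959445,
   35759664175110578864389, 726790076691, 35759092217957902743829, 554462904579, 658339035411,
   33416927677715374506245, 384543260931, 452994302211, 35095, 42787297348380888434965,
   35741221934635968200965, 35759668678710214623493, 33380038693166785855749, 33063,
   42824190696890599244069, 35740649977483283824901, 1, 554731405571, 35111,
   42824190837628087601445, 35741226438235595636997, 1, 589091141907, 31015,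
   35740073516730972012805, 42824190556153110886693, 1, 520371667203, 37159, 2553654822338834,
   2553654813948182, 623173996835, 520111685891, 1, 28967, 42824190415415622529317,
   33378313814509477855493, 1, 486011928835, 39207, 2694392302305558, 623173998883, 520120074499,
   1, 657810620691, 26919, 1849898661150982, 485710004483, 588814248227, 1, 451652190467, 41255,
   2835164158789906, 2835164158787846, 588814252307, 24871, 1709161172795654, 588814246179,
   451341877507, 1, 45351, 3116673495238930, 3116673495236870, 623173992723, 20775,
   1427651836346630, 416965361923, 520094765347, 1, 35098, 588814254355, 588822642947, 33063,
   588814254371, 35740649977483283824901, 42787297208742911705381, 35759096721557530247429, 1,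
   554731340035, 37127, 554739728643, 45130033985414069522693, 35760240635862898999557, 31015,
   588831029539, 35740073516730972012805, 1, 520379990275, 39175, 520388382979, 520119943427,
   35742370352506873086213, 28967, 588839416099, 33378313814509477855493, 485718393091, 1, 41223,
   486037035267, 26919, 1849898686251270, 485710004483, 588805925155, 1, 451677296899, 43271,
   35743523274045588013317, 24871, 1709161206284550, 451341877507, 588805923107, 1, 45319, 22823,
   1568389366579458, 1568389366579462, 451333488899, 588797532451, 1, 47367, 20775,
   1427651886612738, 1427651886612742, 416965361923, 588797530403, 314154578195, 1, 49415, 51463,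
   33384645875585652916485, 31001, 863490834707, 49418, 829122707731, 47370, 794754580755, 45322,
   760386453779, 43274, 726018326803, 41226, 691650199827, 22839, 1569454761738498,
   1569523212779782, 485710004483, 1, 16711, 1148341808304386, 1148410259341574, 485710004483, 1,
   39178, 657282072851, 26935, 1850964089798914, 33378313814509469532421, 314448245027, 1, 37130,
   622905557267, 31031, 520086585603, 35758524764404845871365, 42787297069104934975797, 1,
   520640037123, 39159, 2691093498986774, 622637127923, 554194475251, 485735104771, 520388313347,
   1, 656996860179, 28999, 1992835432806674, 1992835432808710, 520086520067, 588545814851,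
   486255395075, 1, 41191, 2830765567017234, 554194473203, 40446857544924585165061,
   47472770762085227340005, 793378791651, 1, 26967, 1853197456081158, 486247072003, 588545812819,
   1, 452449108227, 43223, 2970403543744790, 588587565315, 554194479315, 656728434899, 1,
   725179466003, 24935, 1713559487676678, 1713525388048658, 486271902051, 45255, 3110041520472342,
   3110075611775250, 554194475235, 588595888387, 690819739843, 656728426755, 1, 20871,
   1434249434595590, 1434215343290642, 452180595075, 49319, 3389351565230358, 622703837443, 49322,
   35082]
  (stI 1 0 (B0 true 1)) [] = true := by decide +kernel

theorem rV1_2 : run ⟨true, 4, 0, [Vs true 2]⟩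
  [554454513955, 588545816867, 42824190556153110886693, 42787297207643400075557, 520371601667,
   35759664175110578864389, 554462904579, 45130033705038604433701, 35778110919184833609989,
   33416927677715374506245, 35095, 42787297348380888434965, 35759668678710214623493, 1,
   588822642947, 588814252323, 33063, 42787297208742911705381, 35759096721557530247429, 1,
   554731340035, 37127, 45130033985414069522693, 35760240635862898999557, 1, 31031,
   35758524764404845871365, 42787297069104934975797, 1, 520631714051, 39159, 2691093498986774,
   622637127923, 520388313347, 1, 656996860179, 28999, 42787296929466958246213,
   33415216309856957137157, 1, 486548734211, 41191, 2830731475712294, 656728432867, 520396636419,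
   1, 26967, 1853197456081158, 588545812819, 486247072003, 1, 452449108227, 24935,
   1713559487676678, 588545810787, 452147446019, 1, 45255, 3110041520472342, 588595888387,
   690819739843, 1, 20871, 1434249434595590, 520363200899, 418039496963, 1, 35082]
  (stI 2 0 (B0 true 2)) [] = true := by decide +kernel

theorem rV1_3 : run ⟨true, 4, 0, [Vs true 3]⟩
  [554454513971, 42787297069104934975797, 554462904579, 35778110919184833609989, 1]
  (stI 3 0 (B0 true 3)) [] = true := by decide +kernel

theorem rV1_4 : run ⟨true, 4, 0, [Vs true 4]⟩
  [554454513987, 554462904579, 1]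
  (stI 4 0 (B0 true 4)) [] = true := by decide +kernel

theorem rV1_5 : run ⟨true, 4, 0, [Vs true 5]⟩
  [521160458515]
  (stI 5 0 (B0 true 5)) [] = true := by decide +kernel

theorem rV1_6 : run ⟨true, 4, 0, [Vs true 6]⟩
  [521428959507]
  (stI 6 0 (B0 true 6)) [] = true := by decide +kernel

theorem rV1_7 : run ⟨true, 4, 0, [Vs true 7]⟩
  [521697460499]
  (stI 7 0 (B0 true 7)) [] = true := by decide +kernel

theorem rV1_8 : run ⟨true, 4, 0, [Vs true 8]⟩
  [521965961491]
  (stI 8 0 (B0 true 8)) [] = true := by decide +kernel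

theorem rL0_0_4 : run ⟨false, 4, 55, []⟩
  [554462904580, 520103164164, 588822640900, 554454513924, 486003538180, 623450816788,
   520094775556, 588822642948, 554722949380, 554731340036, 451912235268, 658078990612, 35095,
   554462970116, 554731405572, 554731405571, 486280364291, 31015, 2131373637859586, 520086520068,
   588814252324, 554454513956, 520086520067, 554722949412, 554722949411, 37127, 554471293188,
   588831031556, 588831031555, 39175, 588839420164, 554479681796, 588839420163, 589107853603,
   28967, 1990636166215938, 520094775555, 486028638483, 41223, 2832930784180514, 588806004996, 0,
   691650197779, 28935, 1988437109545218, 0, 0, 657282070803, 31031, 2132507785984274,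
   554454513972, 520086585603, 588814252339, 623190769955, 520355021060, 486263718179, 33079,
   2273245257627954, 554722949395, 555008164131, 35111, 2412883225966898, 0, 0, 520648423699,
   33063, 28967, 1990636141181186, 520094775555, 486003603731, 37159, 2553654822338850,
   588814252307, 623459205411, 0, 554739726627, 0, 622905555219, 35111, 2412883225966882,
   588814256419, 554463035652, 554731471108, 28967, 1990636141181186, 520094775555, 486003603731,
   37159, 2553654822338850, 588814256419, 623450882339, 33079, 2273245266082066, 554722949395, 0,
   589074364707, 589091141907, 31031, 2132507777661202, 554454513972, 520086585603, 520355021060,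
   486263718179, 0, 520640100627, 33063, 486272039187, 0, 0, 520371665155, 35111, 588814256420,
   588814256419, 520103297284, 520371734803, 30999, 554454513940, 554722949396, 554722949395,
   623719381267, 28935, 554454511876, 520354885891, 26887, 520094771460, 554454509828,
   520346429699, 37159, 2553654822332674, 588814250243, 623450876163, 24839, 1706962149601538,
   520061225252, 0, 416738797827, 33063, 520094908676, 0, 0, 451098538243, 35127, 2413982754435330,
   554463101188, 588814256435, 520103362819, 589082691892, 623710996787, 33079, 2273245266080002,
   554722947331, 0, 589359640835, 33063, 623694086435, 37159, 2553654822338850, 588814250243, 0,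
   554731467011, 0, 485458280707, 35127, 2413982754437394, 554463101188, 588814256435,
   589082691892, 623710996787, 0, 589359642899, 33063, 623702540579, 0, 0, 520103299347, 28935,
   520103293187, 0, 35127, 588814256435, 589082691892, 623719385395, 0, 589359644931, 0,
   589091143939, 33063, 520094908676, 588814254372, 520363346195, 589091143971, 588814254371,
   520094908675, 30999, 28935, 520354885891, 37127, 26887, 1847699629576450, 520354883843, 0,
   451098546435, 33079, 2273245274337538, 554722947331, 0, 0, 0, 0, 554731405571, 28967,
   1990636149504258, 520094775555, 37159, 2553654822338834, 588814252291, 623450818835, 35098,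
   588822642947, 588814254355, 37127, 588831031555, 554471293188, 39175, 588839424259, 41223,
   588847814915, 35098, 691650199827, 28967, 1990636166215938, 520094775555, 39178, 657282072851,
   31015, 520086520067, 0, 520379990275, 26935, 1850964089796866, 486003472643, 37130,
   622905557267, 31031, 2132473409468674, 520086585603, 520355021060, 486263716131, 0,
   520631646467, 33063, 520094908676, 520631779587, 520094908675, 30999, 28935, 520094773508, 0, 0,
   0, 554731340035, 28999, 1992835432806658, 520346697987, 35082]
  (stI 0 5 (Vs false 0)) [] = true := by decide +kernel

theorem rL0_1_4 : run ⟨false, 4, 55, []⟩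
  [554462904580, 588545818900, 520094843140, 588822640916, 554454513940, 485735104772,
   622637121812, 554722949396, 623450816788, 588822642948, 520371599636, 486540409108,
   520640037124, 35095, 588545820947, 520371667204, 554731405572, 520371667203, 554731405571,
   520640102660, 486817235203, 31015, 588814252324, 520086520067, 554454513956, 588814252323,
   554722949412, 589082687780, 623719315747, 37127, 588831031556, 554471293188, 588831031555,
   554739728643, 28967, 554454511908, 520363208996, 520363208995, 39175, 588839420164,
   554479681796, 588839420163, 589107851555, 520388378884, 520388378883, 26935, 554454509876,
   520363206963, 588814248244, 520656808243, 588814248243, 33063, 2272111402969394,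
   2272179862401314, 0, 37143, 554739796243, 0, 28983, 520363209012, 0, 0, 451937333539, 41223,
   2832930784180514, 0, 691650195747, 0, 657282068771, 26935, 554454509876, 520363206964,
   520363206963, 520648419635, 24903, 1711360464482594, 0, 417837639987, 0, 451928944931, 33063,
   37159, 2553654822338850, 588814250275, 623459205411, 28999, 1992835449516322, 520363208995,
   486540472611, 0, 554739724579, 0, 486020251907, 39175, 588839420164, 588839420163, 589107853603,
   0, 657282070819, 31031, 2132507785984290, 554454513972, 588814252339, 623190769955,
   520355021059, 0, 520648423715, 0, 622905555235, 28967, 554454511908, 520363208996, 520363208995,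
   554722947363, 26935, 520363206964, 520363206963, 520640096563, 0, 451903910179, 35111,
   2412883242742050, 588814256419, 554463035652, 520371732739, 486272037155, 0, 589091139875, 0,
   485995217155, 35111, 554463035652, 554731471108, 520371732739, 554731471107, 0, 589091141923, 0,
   520371665171, 35111, 588814256420, 520103297284, 588814256419, 520371734803, 35127,
   554463101188, 588814256435, 520103362819, 0, 0, 589091141907, 28967, 520371663139, 588814250276,
   37127, 39175, 41223, 28951, 1989536612786434, 520078131459, 485718401283, 43271,
   2973668280922402, 588856197380, 0, 726018322723, 0, 691650195747, 0, 657282068771, 0,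
   622905553187, 0, 33063, 588814254372, 588814254371, 0, 554731405571, 37159, 2553654822338834,
   588814252307, 35098, 588814254355, 588822642947, 37127, 588831031555, 554471293188,
   520379990276, 39175, 588839424259, 41223, 588847814915, 31001, 691650199827, 0, 657282072851,
   26935, 1850964089798914, 554454509876, 451618763043, 24903, 1711360472805666, 520086520067,
   37111, 2550355977343234, 588545822979, 22871, 1571722496078114, 520363202900, 0, 383721300291,
   0, 417837642019, 0, 451928948995, 0, 622905557267, 31031, 2132473409468690, 588545816884,
   520086520067, 520355021059, 588545816883, 31047, 2133607289223458, 554454513988, 588545816899,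
   520355086595, 520623522052, 486800654627, 0, 520908470563, 0, 520631646483, 520640037123, 33063,
   588545818916, 588545818915, 520363344132, 520363344131, 0, 554731340035, 28999,
   1992835432806674, 520363278595, 35082]
  (stI 1 5 (Vs false 1)) [] = true := by decide +kernel

theorem rL0_2_4 : run ⟨false, 4, 55, []⟩
  [554454513956, 588814252324, 588545818900, 588822642964, 554722949412, 622637121812,
   520363278596, 589082687780, 486271975684, 554731340036, 520640037124, 520631712036,
   520908472580, 35095, 588545820947, 554462970116, 520371667204, 554731405572, 520371667203,
   554731405571, 520640102659, 520640102660, 37127, 554471293188, 588831031556, 588831031555,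
   39175, 588839420164, 588839420163, 0, 657282074899, 28999, 554454511940, 0, 0, 622905559315,
   28999, 1992835709632770, 1992869800935682, 554454511940, 588814252339, 486808908099, 0, 35111,
   554463035652, 0, 0, 588814252323, 588822642947, 37127, 588831031555, 0, 31031, 588545816884,
   588545816883, 520355021059, 28999, 520631644484, 26983, 520631642467, 0, 0, 486532153603, 0,
   520631646499, 520631714051, 0]
  (stI 2 5 (Vs false 2)) [] = true := by decide +kernel

theorem rL0_3_4 : run ⟨false, 4, 55, []⟩
  [554454513972, 588545816884, 554722949428, 554731340036, 520640037124, 37127, 554471293188, 0,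
   622905557267, 0]
  (stI 3 5 (Vs false 3)) [] = true := by decide +kernel

theorem rL0_4_4 : run ⟨false, 4, 55, []⟩
  [554731340036, 0]
  (stI 4 5 (Vs false 4)) [] = true := by decide +kernel

theorem rL0_5_4 : run ⟨false, 4, 55, []⟩
  [0]
  (stI 5 5 (Vs false 5)) [] = true := by decide +kernel

theorem rL0_0_6 : run ⟨false, 6, 55, []⟩
  [554462904580, 520103164164, 588822640900, 554462904579, 554454513924, 486003538180,
   623450816788, 520094775555, 588822642947, 554454513923, 451912235268, 658078990612, 35095,
   554462970116, 486280364291, 35111, 554463035652, 588814256419, 520103297283, 554463035651,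
   520103297284, 28935, 520094773507, 554454511876, 485743554819, 554454511875, 26887,
   1847699637956866, 554454509828, 520094771459, 37159, 2553654822336786, 588814248195,
   623450880275, 33063, 2272111126210818, 0, 0, 451115380995, 30999, 589082687764, 37159,
   2553654822336786, 588814250243, 0, 0, 485475123459, 30999, 554454513940, 0, 520103295235, 0,
   589091143939, 31015, 2131373637859586, 554454513956, 520086520067, 588814252323, 589074364707,
   588814252324, 589091141907, 37127, 39175, 554479681796, 554479681795, 28967, 1990636166215938,
   520094775555, 486028638483, 33063, 2272179862403346, 0, 0, 657282070803, 28967,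
   1990636157827330, 520094775555, 0, 622905555219, 0, 520371665155, 28967, 1990636149504258,
   520094775555, 37159, 2553654822338834, 588814252291, 623450818835, 33063, 588814254371,
   520094908675, 588814254372, 520094908676, 30999, 28935, 37127, 26887, 1847699629576450, 0,
   39175, 2692193262272802, 0, 0, 0, 0, 0, 35098, 588814254355, 588822642947, 37127, 588831031555,
   554471293188, 39175, 588839424259, 41223, 588847814915, 35098, 691650199827, 28967,
   1990636166215938, 520094775555, 39178, 657282072851, 31015, 520086520067, 0, 520379990275,
   26935, 1850964089796866, 486003472643, 37130, 622905557267, 31031, 2132473409468674,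
   520086520067, 0, 520631646467, 33063, 520094908675, 520094908676, 486272041219, 0, 35082]
  (stI 0 6 (Vs false 0)) [] = true := by decide +kernel

theorem rL0_1_6 : run ⟨false, 6, 55, []⟩
  [554462904580, 588545818900, 554454513940, 520094843140, 588822640916, 554462904579,
   485735104772, 589082687764, 520363211027, 486540409108, 35095, 588545820947, 554462970116,
   520371667203, 554462970115, 520371667204, 28967, 554454511908, 588814250276, 485718393091,
   588814250275, 554454511907, 520363208995, 37127, 588831031555, 589099462947, 39175,
   554479681796, 41223, 588847808771, 554488070404, 28951, 1989536612786434, 520078131459, 43271,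
   2973668280922402, 588797618436, 0, 726018322723, 31015, 588814252324, 0, 520396773635, 37143,
   588831097092, 0, 0, 691650195747, 26935, 1850998457929986, 554454509876, 520086520067, 0,
   451937333539, 31015, 520086520067, 0, 0, 657282068771, 26935, 1850998441218306, 554454509876,
   520086520067, 588814252323, 0, 0, 622905553187, 26935, 1850998441210146, 520086520067, 0, 0,
   486011928835, 31015, 554454513956, 520086520067, 588814252323, 554454513955, 588814252324, 0,
   520371665171, 35111, 554463035652, 588814256419, 520103297283, 0, 589091141907, 37159,
   2553654822338834, 588814252307, 33063, 588814254371, 0, 35098, 588814254355, 588822642947,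
   37127, 588831031555, 554471293188, 520379990276, 622637125891, 520379990275, 39175,
   588839424259, 41223, 588847814915, 31001, 691650199827, 0, 657282072851, 26935,
   1850964089798914, 554454509876, 520069812484, 451618763043, 24903, 1711360472805666,
   554454507844, 520086520067, 37111, 2550355977343234, 588545822979, 22871, 1571722496078114,
   520321601796, 0, 383721300291, 28983, 1991735921172802, 0, 0, 417837642019, 0, 451928948995, 0,
   622905557267, 31031, 554454513972, 520355021059, 0, 520631646483, 520640037123, 28999,
   1992835432806674, 520363278595, 33063, 520363344131, 520363344132, 0, 35082]
  (stI 1 6 (Vs false 1)) [] = true := by decide +kernel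

theorem rL0_2_6 : run ⟨false, 6, 55, []⟩
  [554454513956, 554462904580, 622637121812, 520363278596, 554462904579, 588814252324,
   554454513955, 588814252323, 486271975684, 520640037123, 520640037124, 37127, 554471293188,
   588831031555, 623190769923, 622637125891, 520379990276, 554471293187, 0, 622905557267, 28999,
   554454511940, 588545814852, 554454511939, 0, 486540411139, 0]
  (stI 2 6 (Vs false 2)) [] = true := by decide +kernel

theorem rL0_3_6 : run ⟨false, 6, 55, []⟩
  [554454513972, 588545816883, 554454513971, 520640037123, 520908472579, 0]
  (stI 3 6 (Vs false 3)) [] = true := by decide +kernel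

theorem rL0_4_6 : run ⟨false, 6, 55, []⟩
  [554462904579, 0]
  (stI 4 6 (Vs false 4)) [] = true := by decide +kernel

theorem rL0_5_6 : run ⟨false, 6, 55, []⟩
  [554446457091]
  (stI 5 6 (Vs false 5)) [] = true := by decide +kernel

theorem rL0_0_7 : run ⟨false, 7, 55, []⟩
  [554462904579, 554454513924, 554462904580, 520103164164, 588822640900, 554454513923,
   486003538180, 623450816788, 520094775555, 588822642947, 451912235268, 658078990612, 35095,
   554462970116, 554462970115, 520371667204, 486280364291, 35111, 554463035652, 588814256419,
   554731473171, 520103297283, 520103297284, 28935, 554454511876, 554731467011, 26887,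
   1847699637956866, 554429348116, 37159, 2553654822336786, 588814248195, 623450880275, 0,
   451115380995, 30999, 554437736724, 589082687764, 623694084371, 0, 37159, 2553654822334722,
   588814256419, 0, 485475123459, 30999, 554454513940, 0, 35127, 623719385395, 0, 35114,
   589091143939, 31015, 2131373637859586, 554454513956, 520086520067, 588814252323, 554714626339,
   588814252324, 37127, 39175, 28967, 1990636166215938, 520094775555, 486028638483, 0,
   657282070803, 0, 0, 520371667203, 28967, 1990636149504258, 520094775555, 37159,
   2553654822338834, 588814252291, 623450818835, 35098, 588814254355, 588822642947, 37127,
   554471293188, 554471293187, 39175, 588839424259, 41223, 588847814915, 35098, 691650199827,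
   28967, 1990636166215938, 520094775555, 39178, 657282072851, 31015, 2131373646182658,
   520086520067, 28967, 1990636157827330, 520094775555, 485995215123, 0, 520379990275, 26935,
   1850964089796866, 486003472643, 37130, 622905557267, 31031, 2132473409468674, 554454513972,
   520086520067, 0, 35082]
  (stI 0 8 (Vs false 0)) [] = true := by decide +kernel

theorem rL0_1_7 : run ⟨false, 7, 55, []⟩
  [554454513940, 554462904579, 588545818900, 520094843140, 588814254356, 554462904580,
   554454513939, 485735104772, 37127, 554471293188, 588831031555, 554471293187, 622637125891,
   520379990275, 623190769923, 39175, 554479681796, 623199158531, 520388378883, 41223,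
   554488070404, 588847808771, 43271, 588856197379, 45319, 588864585987, 31001, 760386453779,
   35095, 588545820947, 28967, 1990704902478082, 588814250275, 588797618436, 588814250276, 0,
   35098, 588856197395, 43274, 726018326803, 35095, 554462978308, 588545820947, 28967,
   554454511908, 588814250275, 485718393091, 28951, 1989536612786434, 520078131459, 31015,
   2131442382442754, 0, 0, 31015, 2131442382442754, 588806004996, 520086520067, 0, 35098,
   588847808787, 41226, 691650199827, 35095, 554462976260, 588545820947, 28967, 554454511908,
   588814250275, 485718393091, 26935, 1850998441210146, 520086520067, 0, 0, 486011928835, 31015,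
   554454513956, 0, 35098, 588839420179, 28967, 554454511908, 485718393091, 0, 39178, 657282072851,
   35095, 588545820947, 554462970116, 520371667204, 486280368387, 28967, 554454511908,
   588814250275, 554731401507, 26935, 1850998441210146, 520086520067, 0, 0, 486011928835, 31015,
   554454513956, 0, 37159, 2553654830727442, 588814254355, 35098, 588831031571, 26935,
   1850964089798914, 554454509876, 520069812484, 451618763043, 24903, 1711360472805666,
   554421221668, 554454507844, 520086520067, 37111, 2550355977343234, 588545822979, 22871,
   1571722496078114, 520321601796, 0, 0, 417837642019, 31015, 554437867812, 0, 0, 451928948995,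
   31015, 554454513956, 0, 37130, 622905557267, 35095, 554462970116, 588545820947, 554462970115,
   520371667203, 28967, 554454511908, 554731401507, 588814250275, 485718393091, 0, 486011928835,
   31015, 554731403555, 0, 35111, 554463035652, 588814256419, 0, 589091141907, 0, 588822642947,
   588814254355, 31031, 554454513972, 520355021059, 0, 520640037123, 28999, 1992835432806674,
   520363278595, 35082]
  (stI 1 8 (Vs false 1)) [] = true := by decide +kernel

theorem rL0_2_7 : run ⟨false, 7, 55, []⟩
  [554454513956, 554462904579, 554454513955, 588814252323, 554462904580, 622637121812,
   520363278596, 37127, 554471293188, 554471293187, 520379990275, 0, 622905557267, 28999,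
   554454511940, 588545814851, 486255395075, 0, 486540411139, 0]
  (stI 2 8 (Vs false 2)) [] = true := by decide +kernel

theorem rL0_3_7 : run ⟨false, 7, 55, []⟩
  [554454513971, 554462904579, 0]
  (stI 3 8 (Vs false 3)) [] = true := by decide +kernel

theorem rL0_4_7 : run ⟨false, 7, 55, []⟩
  [554446391555]
  (stI 4 8 (Vs false 4)) [] = true := by decide +kernel

theorem rL0_5_7 : run ⟨false, 7, 55, []⟩
  [554446457091]
  (stI 5 8 (Vs false 5)) [] = true := by decide +kernel

theorem rL0_0_9 : run ⟨false, 9, 55, []⟩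
  [554462904579, 554454513924, 554462904580, 554454513923, 623450816788, 520094775555,
   588822642947, 35095, 554462970116, 554462970115, 35111, 554463035652, 588814256419,
   520103297283, 554731473171, 28935, 554454511876, 37159, 2553654822334722, 588814256419,
   623450878211, 0, 485475123459, 30999, 554454513940, 623719381267, 0, 35127, 589082691891, 0,
   35114, 589091143939, 28967, 1990636149504258, 520094775555, 486011928835, 37159,
   2553654822338834, 588814252291, 623450818835, 31015, 554454513956, 520086520067, 554454513955,
   0, 35098, 588814254355, 588822642947, 37127, 554471293188, 554471293187, 39175, 588839424259,
   41223, 588847814915, 35098, 691650199827, 28967, 1990636166215938, 520094775555, 39178,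
   657282072851, 31015, 2131373646182658, 554454513956, 520086520067, 28967, 1990636157827330,
   520094775555, 485995215123, 0, 520379990275, 26935, 1850964089796866, 486003472643, 37130,
   622905557267, 31031, 554454513972, 520355021059, 0, 35082]
  (stI 0 10 (Vs false 0)) [] = true := by decide +kernel

theorem rL0_1_9 : run ⟨false, 9, 55, []⟩
  [554454513940, 554462904579, 588545818900, 520094843140, 588814254356, 554462904580,
   588822640916, 554454513939, 485735104772, 623173992724, 37127, 554471293188, 588831031555,
   554471293187, 520379990275, 622637125891, 623190769923, 39175, 554479681796, 623199158531,
   520388378883, 41223, 554488070403, 554488070404, 43271, 554496459012, 45319, 588864585987,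
   31001, 760386453779, 35095, 588545820947, 28967, 554437880068, 588814250275, 554454511908,
   485718393091, 0, 35098, 588856197395, 43274, 726018326803, 35095, 588545820947, 28967,
   554437871892, 554454511908, 520078139652, 588814250275, 485718393091, 0, 35098, 588847808787,
   41226, 691650199827, 35095, 588545820947, 28967, 554437871892, 554454511908, 520078137604,
   588814250275, 485718393091, 0, 486011928835, 31015, 554454513956, 0, 35098, 588839420179, 28967,
   554437875972, 588529178884, 554454511908, 485718393091, 28951, 1989536612784386, 520078131459,
   0, 39178, 657282072851, 35095, 554462970116, 588545820947, 520371667203, 28967, 554454511908,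
   588814250275, 554731401507, 0, 486011928835, 37159, 2553654830727442, 588814254355, 31015,
   554454513956, 0, 35098, 588831031571, 26935, 1850964089798914, 554429550852, 554454509876,
   588520853764, 451618763043, 24903, 1711360472805666, 554446262532, 554454507844, 520086520067,
   37111, 2550355977343234, 588545822979, 0, 417837642019, 28951, 1989536612782338, 520078131459,
   31015, 554437867812, 0, 0, 451928948995, 31015, 554454513956, 0, 37130, 622905557267, 35095,
   554462970116, 588545820947, 554462970115, 28967, 554454511908, 0, 37159, 2553654822338834,
   588814252307, 0, 588814254355, 588822642947, 28999, 1992835432806674, 520363278595,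
   486540411139, 31031, 520355021059, 0, 35082]
  (stI 1 10 (Vs false 1)) [] = true := by decide +kernel

theorem rL0_2_9 : run ⟨false, 9, 55, []⟩
  [554454513956, 554462904579, 554454513955, 554462904580, 588545818900, 622637121812,
   520363278596, 0]
  (stI 2 10 (Vs false 2)) [] = true := by decide +kernel

theorem rL0_3_9 : run ⟨false, 9, 55, []⟩
  [554454513971, 554462904579, 0]
  (stI 3 10 (Vs false 3)) [] = true := by decide +kernel

theorem rL0_4_9 : run ⟨false, 9, 55, []⟩
  [554446391555]
  (stI 4 10 (Vs false 4)) [] = true := by decide +kernel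

theorem rL0_5_9 : run ⟨false, 9, 55, []⟩
  [554446457091]
  (stI 5 10 (Vs false 5)) [] = true := by decide +kernel

theorem rL0_0_11 : run ⟨false, 11, 55, Tex⟩
  [520103164164, 554462904579, 554454513923, 520094775555, 588822642947, 35095, 554462970115,
   35111, 554463035651, 554463035652, 588814256419, 28935, 554437740836, 554454511876, 37159,
   2553654822334722, 588814256419, 623450878211, 0, 35114, 37159, 2553654822338834, 588814252291,
   623450818835, 28967, 1990636149504258, 520094775555, 35098, 588814254355, 588822642947, 37127,
   554471293188, 39175, 588839424259, 41223, 588847814915, 35098, 691650199827, 28967,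
   1990636166215938, 520094775555, 39178, 657282072851, 26935, 1850964089796866, 486003472643,
   451928948995, 31015, 554446262532, 520086520067, 554454513956, 0, 37130, 622905557267, 35082]
  (stI 0 13 (Vs false 0)) [] = true := by decide +kernel

theorem rL0_1_11 : run ⟨false, 11, 55, Tex⟩
  [554454513940, 554462904579, 588545818900, 554454513939, 520094843140, 37127, 554471293188,
   520379990275, 622637125891, 39175, 554479681795, 554479681796, 623199158531, 41223,
   554488070404, 43271, 554496459011, 31001, 726018326803, 35095, 588545820947, 28967,
   554437871892, 554454511908, 520078139652, 554454511907, 0, 35098, 588847808787, 41226,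
   691650199827, 35095, 28967, 554437871892, 554454511908, 520078137604, 554454511907,
   485718393091, 0, 35098, 588839420179, 28967, 485718393091, 28951, 1989536612784386,
   520078131459, 37111, 2550355993991426, 588545825027, 1, 39178, 657282072851, 35095,
   554462970115, 554462970116, 28967, 554437871892, 554454511908, 554454511907, 0, 37159,
   2553654830727442, 588814254355, 35098, 588831031571, 26935, 1850964089798914, 451618763043,
   28951, 1989536612782338, 520078131459, 37111, 2550355993989378, 588545822979, 24903,
   1711360472805666, 554421221668, 554454507844, 0, 31015, 554437867812, 554446262532, 0, 1,
   451928948995, 31015, 554454513956, 554446262532, 0, 37130, 622905557267, 35095, 554462970116,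
   554462970115, 588545820947, 28967, 554437871892, 554454511907, 0, 37159, 2553654822338834,
   588814252307, 35098, 588814254355, 28999, 1992835432806674, 520363278595, 35082]
  (stI 1 13 (Vs false 1)) [] = true := by decide +kernel

theorem rL0_2_11 : run ⟨false, 11, 55, Tex⟩
  [554454513956, 554454513955, 554462904579, 554462904580, 588545818900, 520363278596, 0]
  (stI 2 13 (Vs false 2)) [] = true := by decide +kernel

theorem rL0_3_11 : run ⟨false, 11, 55, Tex⟩
  [554446326019]
  (stI 3 13 (Vs false 3)) [] = true := by decide +kernel

theorem rL0_4_11 : run ⟨false, 11, 55, Tex⟩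
  [554446391555]
  (stI 4 13 (Vs false 4)) [] = true := by decide +kernel

theorem rL0_5_11 : run ⟨false, 11, 55, Tex⟩
  [554446457091]
  (stI 5 13 (Vs false 5)) [] = true := by decide +kernel

theorem rL0_0_14 : run ⟨false, 14, 55, Tex⟩
  [554462904579, 554454513923, 35095, 554462970115, 35111, 554463035651, 35114, 37159,
   2553654822338834, 588814252291, 623450818835, 35098, 588814254355, 588822642947, 37127,
   554471293187, 39175, 520388382979, 41223, 588847814915, 35098, 691650199827, 28967,
   1990636166215938, 520094775555, 39178, 657282072851, 26935, 1850964089796866, 486003472643,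
   37130, 622905557267, 35082]
  (stI 0 18 (Vs false 0)) [] = true := by decide +kernel

theorem rL0_1_14 : run ⟨false, 14, 55, Tex⟩
  [554462904579, 554454513939, 37127, 554471293187, 622637125891, 39175, 41223, 554488070403,
   31001, 691650199827, 35095, 554462970115, 35098, 588839420179, 28967, 485718393091, 28951,
   1989536612784386, 520078131459, 37111, 2550355993991426, 588545825027, 1, 39178, 657282072851,
   35095, 554462970115, 35098, 588831031571, 26935, 1850964089798914, 451618763043, 28951,
   1989536612782338, 520078131459, 37111, 2550355993989378, 588545822979, 1, 37130, 622905557267,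
   35095, 554462970115, 35098, 588814254355, 35082]
  (stI 1 18 (Vs false 1)) [] = true := by decide +kernel

theorem rL0_2_14 : run ⟨false, 14, 55, Tex⟩
  [554454513955, 554462904579, 35082]
  (stI 2 18 (Vs false 2)) [] = true := by decide +kernel

theorem rL0_3_14 : run ⟨false, 14, 55, Tex⟩
  [554446326019]
  (stI 3 18 (Vs false 3)) [] = true := by decide +kernel

theorem rL0_4_14 : run ⟨false, 14, 55, Tex⟩
  [554446391555]
  (stI 4 18 (Vs false 4)) [] = true := by decide +kernel

theorem rL0_5_14 : run ⟨false, 14, 55, Tex⟩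
  [554446457091]
  (stI 5 18 (Vs false 5)) [] = true := by decide +kernel

theorem rL0_0_19 : run ⟨false, 19, 0, []⟩
  [554462904579, 554454513923, 35095, 554462970115, 35111, 554463035651, 35114, 37159,
   2553654822338834, 588814252291, 623450818835, 35098, 588814254355, 588822642947, 37127,
   554471293187, 39175, 554479681795, 35098, 657282072851, 37130, 622905557267, 35082]
  (stI 0 0 (Vs false 0)) [] = true := by decide +kernel

theorem rL0_1_19 : run ⟨false, 19, 0, []⟩
  [554462904579, 554454513939, 35095, 554462970115, 35098, 588814254355, 37127, 554471293187,
   39175, 554479681795, 31001, 657282072851, 37130, 622905557267, 35082]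
  (stI 1 0 (Vs false 1)) [] = true := by decide +kernel

theorem rL0_2_19 : run ⟨false, 19, 0, []⟩
  [554454513955, 554462904579, 35082]
  (stI 2 0 (Vs false 2)) [] = true := by decide +kernel

theorem rL0_3_19 : run ⟨false, 19, 0, []⟩
  [554446326019]
  (stI 3 0 (Vs false 3)) [] = true := by decide +kernel

theorem rL0_4_19 : run ⟨false, 19, 0, []⟩
  [554446391555]
  (stI 4 0 (Vs false 4)) [] = true := by decide +kernel

theorem rL0_5_19 : run ⟨false, 19, 0, []⟩
  [554446457091]
  (stI 5 0 (Vs false 5)) [] = true := by decide +kernel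

theorem rL1_0_4 : run ⟨true, 4, 55, []⟩
  [554462904580, 554454513924, 485735104772, 623173992724, 588822642948, 520094775556, 35095,
   554462970116, 554462970115, 35759668678744029034757, 35741221934635968200965, 35111,
   554463035652, 588814256420, 42824190837628087601445, 554463035651, 382932781331, 588814256419,
   28935, 554454511876, 554454511875, 37127, 2551455773919522, 588814250244, 588814250243, 26887,
   1847699637963026, 554454509828, 554454509827, 35741221934635959740677, 451652253971, 39175,
   2692227630467362, 2692193279052070, 520103297284, 520094771459, 520371736851, 623173994788,
   520103297283, 623199158531, 588839420163, 657819011363, 24839, 1706962149609746, 520103301396,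
   41223, 2832965118822690, 623182520580, 33063, 2272076774859010, 520078065956, 0, 0,
   691591477523, 0, 416763975939, 41223, 2832965118822690, 623182520580, 0, 691650203923, 0,
   657240127763, 24839, 1706962149607698, 22791, 1566190301509906, 554454505732,
   35740640689908563859717, 554454505731, 20743, 1425452813154578, 18695, 1284749684539654,
   588814256420, 588814256419, 485743558916, 0, 313651187971, 37143, 2552555302324518,
   520103297283, 520103297284, 0, 623190765843, 26903, 1848799149588742, 485743558916,
   485709941028, 0, 451358576899, 28952, 520044448036, 0, 485743556884, 0, 348010928387, 37143,
   2552555302324518, 520103297284, 520103297283, 0, 623190765843, 26903, 1848799149588742,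
   588814256420, 0, 451358578947, 0, 382379057411, 28951, 37143, 2552555302324518, 520103297284,
   520103297283, 0, 623190765843, 26903, 1848764789842178, 1848799149588742, 588822778116, 0, 0,
   485726707971, 0, 416738797827, 28951, 1989536629483778, 37143, 2552555302324518, 520103297283,
   623173994788, 0, 623190767891, 0, 485726710019, 0, 451115323651, 39175, 2692193279052070,
   520103297284, 588839420164, 520103297283, 623173994788, 623199158531, 588839420163, 30999,
   41223, 2832965118822690, 623182520580, 0, 0, 0, 657282074899, 30999, 28951, 1989536637948162,
   554454511892, 37143, 2552555302324518, 520078068004, 520103297284, 520094773523, 0,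
   623190767891, 0, 485726712067, 0, 520103227651, 0, 622888782115, 37159, 2553654822334722,
   2553654813952294, 588814250244, 520103297283, 623173996836, 589082685700, 520103297284,
   588814250243, 26887, 1847699637963026, 520094771459, 589082687763, 0, 0, 623425653027,
   623450812675, 26887, 1847699637956866, 554454509828, 554454509827, 35741226438235587111173,
   451652253971, 24839, 1706962149601538, 554420963620, 22791, 1566190301509906, 554454505732,
   35740640689908563859717, 554454505731, 20743, 1425452813154578, 554404186404, 18695,
   1284680965058834, 1284749684539654, 588814256419, 485735024899, 485743558916, 485709941028, 0,
   313651187971, 37143, 2552555302324518, 520103297284, 0, 623123656979, 26903, 1848799149588742,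
   485743558916, 0, 451358576899, 0, 348010928387, 37143, 2552555260381474, 2552555302324518,
   623173994788, 520103297283, 0, 623132045587, 26903, 1848764781385986, 1848799149588742,
   485709941028, 0, 0, 382379057411, 28951, 37143, 2552555302324518, 520103297284, 0, 623140434195,
   26903, 1848764789842178, 0, 0, 485726707971, 0, 416738797827, 28951, 1989536629483778, 37143,
   2552555277158690, 0, 0, 485726710019, 0, 451115380995, 30999, 28951, 554454511892, 554454511891,
   0, 485726712067, 0, 520103293187, 0, 485475123459, 37191, 2555853845594370, 2555854114095378,
   2555854105641238, 554471555332, 588814258499, 520111816963, 0, 623987755299, 30999,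
   554454513940, 554454513939, 40481454057692494594309, 37127, 2551455782373666, 588831031556,
   588814252307, 39175, 2692193279052070, 520103297284, 623173994788, 520103297283, 0,
   657282074899, 28951, 1989536637948162, 554454511892, 554454511891, 0, 0, 622905555219, 37159,
   2553654822336786, 2553654813952294, 520111685892, 588814252307, 0, 623434107171, 623450880275,
   0, 520103295235, 35127, 588814256436, 40481454341366494560517, 588814256435, 623719385395, 0,
   589359644947, 33063, 40481454199529494577413, 658347557155, 37127, 2551455790696738,
   588831031556, 588814254371, 39175, 2692193279052070, 623173992740, 0, 657282074899, 0,
   622905557283, 37159, 2553654822338850, 588814254372, 0, 623450882339, 0, 35114, 589091143955,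
   28967, 1990636149504258, 1990636141050118, 554454511908, 588814250276, 589074362659,
   520103231748, 485718393092, 520371667204, 485718393091, 588814250275, 520103231747,
   589091141907, 28935, 1988402741410066, 485735035140, 37127, 39175, 554479681796, 554479681795,
   41223, 24871, 1709126838153474, 485735035139, 417317548307, 31015, 2131442382442754,
   520086528260, 588814252323, 588814252324, 0, 520396763427, 26887, 1847665253064962,
   485718401284, 485735033091, 43271, 2973668239044898, 588797618436, 0, 725959602451, 0,
   451090161923, 43271, 2973668280922402, 520078141700, 588797618436, 45319, 3114440112304418,
   588797612308, 0, 0, 726018322707, 0, 691650195731, 24871, 1709126829764866, 485735035139,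
   417309159699, 31015, 520086520068, 0, 0, 657282068755, 31015, 520086520068, 588814252323, 0,
   520379986211, 0, 622888775955, 0, 485458280707, 37127, 39175, 554479681796, 554479681795, 41223,
   28951, 24871, 1709126838155522, 485735037187, 417317548307, 31015, 588797540644, 588814252323,
   0, 520346497315, 520396763411, 26919, 485710004483, 0, 0, 485768591619, 0, 691650197779, 0,
   657282070803, 0, 622905555219, 0, 37159, 2553654822338834, 2553654813948166, 554471424260,
   589099600147, 520111685892, 623173996836, 520111685891, 623173996835, 588822642947, 26887,
   1847665009721602, 588789092644, 588814248196, 588814248195, 37127, 2551490133659938,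
   623190769924, 24839, 1706962157998354, 41255, 2835164167174418, 623173990675, 692178745619,
   39175, 2692227630469410, 623190907140, 623199158531, 22791, 1566224669643026, 520111690004, 0,
   382404237571, 0, 657231739155, 22791, 1566224669643026, 588772315428, 520111690004, 20743,
   1425452821543186, 520078070052, 0, 0, 382379057411, 0, 416763973891, 30999, 41255,
   2835164167174418, 623173990675, 692178745619, 0, 520111690003, 0, 622888782099, 24839,
   1706962157990146, 37143, 41255, 2835164158785810, 623173984515, 692170297619, 39207,
   623173998883, 0, 0, 623182379283, 0, 416755577091, 0, 451115319555, 30999, 588814252308,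
   588814252307, 0, 520111687955, 37162, 623450882323, 41255, 2835164158789906, 2835164158787846,
   588847939843, 588814254355, 41258, 692161906963, 31015, 2131373637859586, 554454513956,
   520086520068, 485995215123, 589074364707, 35740073516730972012805, 28935, 1988437109541138,
   485995147523, 37127, 26887, 1847665261449474, 1847699621183750, 588814252324, 520094771460,
   588814252323, 485726781700, 39175, 554479681795, 24839, 1706927773096194, 485726787844, 41223,
   2832930750691618, 588806004996, 0, 691591475475, 0, 416730421507, 41223, 2832930750691618,
   588806004996, 0, 0, 657240125715, 0, 451098546435, 39175, 554479681796, 554479681795, 41223,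
   2832930784180514, 43271, 2973702623951138, 554496459012, 45319, 3114440112306466, 47367,
   3255143232469286, 520086520068, 520086520067, 623173990692, 0, 794754584851, 28951,
   1989536621166854, 588806009092, 588814252324, 0, 485726785811, 39191, 2693292790675750,
   623173990692, 0, 37144, 588814252324, 0, 623173990692, 0, 760386457875, 28951, 1989536621166854,
   588814252324, 0, 485726785811, 39191, 2693327183968546, 2693292790675750, 520086524180, 0,
   657575678227, 0, 726018328851, 28951, 1989536621166854, 588814252324, 0, 485726783763, 37143,
   39191, 2693327183968546, 0, 0, 0, 691650197779, 28951, 1989536621166854, 588814252324,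
   485726781700, 0, 0, 657282070803, 0, 622888778003, 26887, 1847699621183750, 485726781700,
   588814252323, 0, 451098538243, 0, 485458280707, 37127, 39175, 554479681796, 554479681795, 41223,
   2832930784180514, 43271, 2973702623951138, 554496459012, 554496459011, 45319, 3114440112306466,
   554446270724, 47367, 3255211968788770, 3255143232469286, 520086520067, 623173990692,
   623165741332, 0, 794754584851, 28951, 1989536621166854, 588806009092, 588814252323, 0,
   485726785811, 39191, 2693292790675750, 623173990692, 0, 657584066835, 0, 760386457875, 28951,
   1989536621166854, 588814252324, 0, 485726785811, 39191, 2693327183968546, 554446264596, 0, 0,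
   726018328851, 28951, 1989536621166854, 588814252324, 0, 485726783763, 0, 691650197779, 28951,
   1989536621172994, 0, 0, 657282070803, 28951, 1989536621170946, 0, 0, 622905555219, 0,
   520371665155, 39207, 2694392302305554, 2694392302305558, 554479812868, 623173998884,
   589107988755, 520120074500, 623173998883, 520120074499, 24839, 1706927521366274, 22791,
   1566224678023426, 588814244100, 20743, 1425487189668098, 588763928868, 520120070404, 18695,
   1284715341576466, 520078072100, 0, 0, 348019316995, 0, 382395838723, 0, 416755581187, 0, 24871,
   1709161172795654, 1709126813055234, 485735037187, 417292452099, 45351, 3116673495238930,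
   3116673495236870, 623173992723, 760881383699, 26919, 1849898661150978, 1849898661150982,
   1849864301410562, 520094771492, 485986756899, 485710004484, 588814248228, 485710004483,
   588814248227, 37127, 39175, 41223, 43271, 520136720644, 45319, 3114405777664290, 520069755140,
   588789231876, 47367, 3255177600657698, 588789223700, 0, 0, 760386449683, 0, 726018322707, 0,
   691650195731, 0, 657282068755, 0, 622905553171, 0, 43303, 2975901638756630, 2975867279016210,
   588856328451, 657533741348, 588814330148, 657533741347, 0, 20775, 1427651836346630,
   1427617476606210, 451375298819, 33063, 520094908676, 588814254372, 42824190696890599244069,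
   35740649977483283824901, 30999, 28935, 37127, 26887, 1847699629576450, 554429350180, 39175,
   2692193270726946, 24839, 1706927781480722, 41223, 2832965110432034, 22791, 1566190293127442,
   1566224652861702, 588814254372, 588814254371, 485735170308, 0, 382404239619, 43271,
   2973702598787362, 2973668255760678, 520094908676, 623173992740, 520094908675, 0, 726018330899,
   26903, 1848764781469954, 1848799141200134, 588814254372, 588814254371, 0, 451375436051, 39191,
   2693327116861730, 2693292790677798, 520094908676, 0, 35096, 520094908676, 0, 588814254372, 0,
   691591475475, 22791, 1566190293125394, 1566224652861702, 588814254372, 485735170308,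
   588814254371, 0, 382370668803, 37143, 26903, 1848764781388034, 1848799141200134, 588814254371,
   485735170308, 0, 451375436051, 39191, 2693292790677798, 520094908676, 0, 657500180755, 35096,
   520078065956, 0, 588814389524, 0, 623140434195, 26903, 1848764781388034, 1848799141200134,
   485709938980, 0, 451375427859, 0, 416755587331, 41223, 2832965135597858, 43271,
   2973702623953186, 2973668255760678, 520094908676, 520094908675, 623173992740, 0, 726018330899,
   28951, 26903, 1848764781469954, 1848799141200134, 588814389524, 588814254372, 0, 451375427859,
   39191, 2693292790677798, 520094908676, 0, 657567281427, 35096, 520078065956, 0, 588814389524, 0,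
   485735174419, 39191, 2693292790677798, 520094912788, 0, 657567289619, 0, 691650201875, 28951,
   37143, 26903, 1848764781467906, 1848799141200134, 588814254372, 0, 451375436051, 39191,
   2693292790677798, 520078065956, 0, 0, 623199154451, 0, 485735172371, 0, 657240127763, 24839,
   1706927781476626, 22791, 1566190293121298, 1566224652861702, 554412572964, 588814254372,
   588814254371, 485735170308, 0, 382370668803, 37143, 2552555268768034, 26903, 1848764781388034,
   1848799141200134, 485709938980, 485735170308, 0, 451375434003, 39191, 2693292790677798,
   520078065956, 0, 0, 623140434195, 26903, 1848764781388034, 0, 0, 416738797827, 28951, 37143,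
   2552555277156642, 26903, 1848799141200134, 588814389524, 0, 0, 623148822803, 0, 485735168275, 0,
   451098546435, 39175, 2692193262272802, 554454653188, 41223, 2832965135597858, 43271,
   2973702623953186, 2973668255760678, 554454657284, 520094908676, 520094908675, 623173992740, 0,
   726018330899, 28951, 1989536629563650, 26903, 1848799141200134, 588814254372, 0, 451375429907,
   39191, 2693292790677798, 520078065956, 0, 0, 485735174419, 39191, 2693327175581986, 0, 0,
   691650201875, 28951, 1989536629561602, 37143, 26903, 1848799141200134, 588814389524, 0, 0, 0,
   485735172371, 0, 657282070803, 28951, 1989536629559554, 554471289108, 0, 485726720259, 0,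
   622888778003, 26887, 1847699629574418, 554429350180, 24839, 1706927781476626, 22791,
   1566190293121298, 1566224652861702, 588814254371, 485735170308, 0, 382370668803, 37143,
   2552555268768034, 26903, 1848799141200134, 588814254371, 0, 0, 623140434195, 0, 416738797827, 0,
   451098538243, 0, 485458280707, 37127, 39175, 2692193270726946, 554454653188, 41223,
   2832965135597858, 43271, 2973702623953186, 2973668255760678, 520094908675, 623173992740, 0,
   726018330899, 28951, 1989536629563650, 26903, 1848799141200134, 588814389524, 0, 0,
   485735174419, 0, 691650201875, 0, 657282070803, 0, 622905555219, 0, 520094910739, 37127, 39175,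
   41223, 2832965135597858, 43271, 2973668255760678, 623173992740, 0, 726018330899, 0,
   691650201875, 0, 657282072867, 0, 622905557283, 0, 35098, 588814254355, 588822642947, 37127,
   588831031555, 39175, 588839424259, 41223, 588847814915, 520128332036, 43271, 588856205571,
   45319, 588864596227, 47367, 588872986883, 49415, 588881377539, 35098, 829122707731, 20775,
   1427651886612742, 1427617526872322, 451375298819, 47370, 794754580755, 22823, 1568423726321922,
   1568389366579462, 520052977924, 451333488900, 451333488899, 0, 45322, 760386453779, 24871,
   1709161206284550, 1709126846544130, 485735037187, 43274, 726018326803, 26919, 1849898686251266,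
   1849898686251270, 485710004483, 0, 451677296899, 41226, 691650199827, 28967, 1990636166215938,
   1990636141050118, 520119943428, 485718393092, 485718393091, 0, 39178, 657282072851, 26935,
   1850998181099778, 520094775555, 451928948995, 31015, 2131373646182658, 520086520068,
   35740073516730972012805, 520086520067, 28935, 1988437109543170, 26887, 1847699621183750,
   520094771460, 485726781700, 0, 451098538243, 0, 485458284803, 0, 520379990275, 37130,
   622905557267, 28999, 1992835164305666, 1992835432806658, 2130274369700102, 520078262531, 0,
   486540411139, 31031, 2132473409468674, 520086585604, 520086585603, 35758524764438676928773,
   486263716131, 0, 520631646467, 520631714051, 33063, 520094908676, 35759096721591352981765,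
   35740649977483283824901, 520094908675, 452180738307, 30999, 28935, 28967, 1990601772986626,
   1990636141113602, 1990636141183238, 520094773524, 520094773523, 485718393091, 0, 486003601667,
   26887, 1847699629572354, 24839, 1706927781476626, 22791, 1566224652861702, 485735170308, 0,
   382370668803, 0, 416738797827, 0, 451098538243, 0, 485458280707, 31015, 35740073516730972012805,
   28967, 1990636141181186, 520086520068, 0, 485995215123, 0, 520363342099, 0, 520094908675, 0,
   35082]
  (stI 0 4 (Vs true 0)) [] = true := by decide +kernel

theorem rL1_1_4 : run ⟨true, 4, 55, []⟩
  [554462904580, 554454513940, 588545818900, 485735104772, 588814252308, 520094843140,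
   622637121812, 451375366404, 35095, 554462970116, 588545820948, 520103231748, 588545820947,
   554462970115, 520103231747, 42787297348380888434965, 35741221934635968200965,
   35759668678710214623493, 28967, 554454511908, 485718393092, 554454511907, 37127, 28951,
   1989536612782338, 1989536612778246, 520103235844, 588814250276, 588545820947, 520094773524,
   485718393092, 588814250275, 485718393091, 520094773523, 39175, 588839420163, 554479681796,
   589107851555, 554479681795, 41223, 24871, 1709092696662274, 520094771492, 43271,
   2973668222333218, 520136720644, 588797618436, 0, 726018320675, 0, 417317548307, 31015,
   2131442382436626, 0, 0, 691650197779, 0, 657282070803, 0, 485718397187, 485751816451, 39175,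
   554479681796, 554479681795, 42787297628756353517845, 42825920076948486254885, 657827328291,
   41223, 554488070404, 43271, 2973668280922402, 554496459012, 42827072998453093101861,
   554496459011, 520136720644, 520136720643, 45319, 3114440112304418, 588545822996, 588545822995,
   47367, 3255177600659746, 554437884164, 49415, 3395949457142050, 588545825043, 51463,
   3536618209177894, 623249490179, 554530013444, 520120008963, 623157364996, 623173988644, 31015,
   2131545503602962, 623165743380, 0, 41239, 623157354772, 0, 0, 863490840851, 41239,
   2834030279029030, 623157354772, 520120008963, 623173988644, 0, 691960584467, 31015,
   2131442374115590, 623173990692, 0, 26919, 1849898677928198, 588814250276, 0, 37144,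
   588797614356, 588839485700, 0, 623173988644, 0, 829122711827, 39191, 41239, 2834030279029030,
   623157354772, 623173988644, 0, 691952195859, 33063, 2272179862470918, 623173992740, 0, 31015,
   2131442374115590, 623173990692, 0, 26919, 1849898677928198, 588797614356, 0, 37144,
   588797614356, 0, 623173988644, 0, 657592455443, 37111, 2550355993989394, 588545833219, 0,
   794754584851, 39191, 2693327192355106, 554437875988, 588545825043, 41239, 2834030279029030,
   623207612675, 623157354772, 0, 691943805203, 33063, 2272179862470918, 623174129940, 0,
   554739790115, 0, 657584066835, 0, 760386455827, 37111, 2550355993987346, 588545829123, 37143,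
   588545822995, 39191, 2693327192355106, 554437875988, 41239, 2834099040448802, 2834030279029030,
   623207612675, 0, 0, 657575678227, 0, 623215937811, 0, 726018322723, 37111, 2550355993993474,
   588545827075, 37143, 2552555327484194, 588545822995, 520111620356, 520111620355, 39191,
   554479747332, 554479747331, 0, 657567287571, 0, 623207543075, 0, 691650195747, 37111,
   2550355993991426, 588545825027, 37143, 2552555327484194, 588545822995, 520111620356,
   554471358724, 554471358723, 520111620355, 39191, 2693327175577890, 0, 0, 623199154467, 0,
   657282068771, 26935, 1850998441218306, 554454509876, 554454509875, 35760240635862882216245,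
   417527462179, 452465817891, 24903, 1711360464482594, 554421225748, 554454507843, 22871,
   1571688396454178, 554454505812, 554454505811, 520078196995, 35759087436181833537877, 20839,
   1432050419726626, 554404579604, 18807, 1292446534304006, 588545820947, 486280364292, 0,
   315530367331, 37111, 2550355960697090, 2550356010635526, 520313276692, 520371667203, 0, 26951,
   1852097952841990, 588545812803, 486288687364, 0, 452164014435, 0, 349621672275, 37111,
   2550355969020162, 2550356010635526, 588545814836, 520363202899, 520346634516, 0, 622637117747,
   26951, 1852063869851986, 0, 0, 383721300291, 37111, 2550355977343234, 2550356010635526,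
   588545816868, 520379990276, 0, 622637119779, 28983, 520078196995, 0, 0, 417812605235, 37111,
   2550355985666306, 2550356010635526, 588545816868, 588814252323, 520363206963, 0, 622637119779,
   0, 451928944931, 31015, 520086520068, 42824190556153110886693, 520086520067, 37111,
   2550355993989378, 2550356010635526, 588545816868, 588814252324, 588814252323, 0, 622637119779,
   37143, 554471358723, 0, 623190767907, 0, 520379986211, 37111, 2550355993989378, 0, 0,
   622905553187, 28951, 1989536629489922, 1990636149506310, 588814250276, 520078133524,
   588545820947, 520094773524, 588814250275, 520094773523, 0, 485718393091, 26935,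
   1850998441210146, 554454509876, 554454509875, 520086520068, 35759668678710206163253,
   417527462179, 452457494819, 24903, 1711360464482594, 554421225748, 22871, 1571688396454178,
   554454505812, 554454505811, 520078196995, 35759087436181833537877, 20839, 1432050419726626,
   554404579604, 18807, 1292446534304006, 588545820947, 486280364292, 0, 315530367331, 37111,
   2550356010633494, 520313276692, 520363200867, 622637123860, 0, 622587179315, 26951,
   1852097952841990, 486280364292, 0, 0, 349621672275, 37111, 2550356010633494, 520371667203, 0,
   622595502387, 0, 383721300291, 37111, 2550355977341202, 2550356010633494, 622922270979,
   520363204931, 0, 622603827491, 0, 417812605235, 37111, 2550355985664274, 0, 0, 451920621859,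
   31015, 520086520068, 42824190556153110886693, 520086520067, 37111, 622922270979, 0,
   622620473635, 37143, 554471358724, 0, 623182444835, 0, 520371663139, 0, 486011928835, 37159,
   2553654822338834, 2553654813948182, 554471424260, 588545820947, 520111685892, 588822642948,
   623173996836, 554471424259, 520111685891, 623173996835, 588822642947, 0, 623450818835, 31015,
   554454513956, 520086520068, 554454513955, 485995219219, 623450880291, 35740073516730972012805,
   42824190556153110886693, 37127, 39175, 554479681796, 554479681795, 42787297628756353517845,
   41223, 2832930784180514, 554446266628, 691365060867, 43271, 2973702623951138, 588545822996,
   554496459012, 588545822995, 554496459011, 45319, 3114440112306466, 47367, 3255143232469286,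
   520086520067, 623173990692, 0, 794754584851, 28951, 1989536621166854, 588806009092,
   588814252323, 0, 485726785811, 39191, 2693292790675750, 623173990692, 0, 0, 760386457875, 28951,
   1989536621177090, 1989536621166854, 588806000916, 0, 485726785811, 0, 726018328851, 28951,
   1989536621166854, 588814252324, 0, 485726783763, 0, 691650197795, 28951, 1989536621172994,
   1989536621166854, 588839420163, 0, 485726787843, 0, 657282070819, 28951, 1989536621170946,
   1989536621166854, 588545820947, 588814252324, 485726781700, 0, 485726785795, 37111,
   2550356010701058, 2550356010633494, 588545816868, 588814252324, 0, 622637125891, 37143,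
   2552555319097634, 0, 0, 622905555235, 28951, 1989536621166850, 1989536621166854, 588545820947,
   0, 485726783763, 37111, 2550356010633490, 0, 0, 520371665171, 35111, 554463035652, 588814256420,
   588545820964, 588545820963, 486011996435, 623450884387, 42824190837628087601445, 37127,
   2551455790696738, 39175, 2692193279052070, 520103297283, 623173994788, 0, 657282074899, 0,
   622905559331, 0, 589091143955, 24871, 1709161172795650, 1709161172795654, 520094769444,
   485995143459, 588814246180, 520061356308, 588545820947, 485735104772, 451341877508,
   451341877507, 588814246179, 382890834195, 37127, 39175, 41223, 43271, 520136720644, 45319,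
   486053816579, 26903, 1848764747919618, 485701615875, 451366990083, 47367, 3255143274406178,
   520061368580, 588780845316, 49415, 3395915089010978, 51463, 588780849412, 520170275076, 39191,
   588780837140, 26919, 588789225748, 0, 0, 657609232659, 0, 863490838803, 0, 829122709779, 0,
   794754578707, 0, 760386451731, 0, 726018324755, 0, 691650197779, 0, 657282070803, 0,
   622905555219, 0, 417292452099, 41255, 2835164158789906, 2835164158787846, 588814252307,
   692161906963, 26919, 1849898661150978, 1849898661150982, 520094771492, 485995145507,
   588814248228, 588545820947, 520069744916, 485710004483, 588814248227, 0, 39207,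
   2694392302305558, 554479812868, 623173998883, 0, 20775, 1427617476608258, 1427651836346626,
   1427651836346630, 1427686196084994, 520094765348, 554160978195, 520094765347, 0, 33063,
   520094908676, 588814254372, 35740649977483283824901, 42824190696890599244069, 37127, 39175,
   2692193279050018, 554454653188, 42787297628756353517845, 41223, 2832965135597858, 588545822996,
   588545822995, 43271, 2973702623953186, 2973668255760678, 623173992740, 0, 726018330899, 28951,
   1989536629563650, 0, 0, 691650201875, 0, 657282072867, 28951, 554169366803, 0, 0, 622905557283,
   0, 35098, 588822642947, 588814254355, 37127, 588831031555, 554471293188,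
   45148480729453687767317, 39175, 588839424259, 520119943428, 622637127940, 656996866308,
   520119943427, 45148480870191176122645, 622637127939, 35742370352506873086213, 41223,
   588847814915, 43271, 485776982276, 588856205571, 45319, 588864596227, 47367, 588872986883,
   49415, 588881377539, 31001, 829122707731, 20775, 1427686246357250, 1427617526874370,
   1427651886612742, 520044591364, 554160978195, 588545818899, 451325114628, 0, 47370,
   794754580755, 22823, 1568423726321922, 1568389366579462, 520052977924, 554144266515,
   588545818899, 0, 45322, 760386453779, 24871, 1709161206284546, 1709161206284550, 520061364484,
   588512405764, 588545818899, 485701626116, 451341877508, 656988547331, 0, 43274, 726018326803,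
   26919, 1849898686251266, 1849898686251270, 588520792324, 588545818899, 485710004483, 0,
   451677296899, 41226, 691650199827, 28967, 588529178884, 485718393092, 28951, 1989536612784386,
   1989536612778246, 588545818899, 485718393091, 656988543235, 0, 485718393091, 0, 16711,
   1148341808304386, 1148410259341570, 1148410259341574, 588545818899, 485710004483, 0, 22839,
   1569454761738498, 1569523212779778, 1569523212779782, 485710004483, 554144332051, 0, 39178,
   657282072851, 26935, 1850964089798914, 554454509876, 588520853764, 485710070020, 588545812788,
   588545812787, 451618767108, 33378313814509469532421, 485710070019, 24903, 1711360472805666,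
   520086520068, 383427836195, 22871, 1571722496078114, 554412904708, 554454505812, 588504207620,
   588545808724, 588545808723, 20839, 1432050428049698, 520078196996, 520078196995, 18807,
   1292412451322146, 554396258564, 588545804659, 16775, 1152740383289650, 520069873923, 14743,
   1013170589171974, 486271891860, 588545812803, 486288687364, 37111, 2550355935727874,
   588545822979, 622562208067, 24919, 486238687492, 0, 418106075459, 0, 247339434371, 37111,
   2550355944050946, 2550356010635526, 520338313476, 622637125892, 486288687364, 622637125891, 0,
   622637115715, 24919, 1712459984437510, 588545812803, 486288687364, 0, 418106075459, 39159,
   2691093498980674, 2691093498980678, 520338313476, 520363206980, 0, 28984, 520379990276, 0,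
   486288687364, 0, 281439062387, 37111, 2550355952374018, 2550356010635526, 486288687364,
   622637125891, 520379990276, 0, 622637117747, 26951, 520069873923, 24919, 1712459984437510,
   486288687364, 0, 39159, 2691093498980678, 520338313476, 0, 28984, 520338313476, 0, 486288687364,
   0, 452197380403, 28951, 1989400205947186, 1989536612843782, 383671304451, 0, 315530367331,
   37111, 2550355960697090, 2550356010635526, 622637125892, 520379990276, 622637125891, 0,
   622637117747, 26951, 1852063853138274, 554404571460, 520069873923, 24919, 1712459984437510,
   452197384452, 0, 418106077491, 0, 452197380403, 0, 349629995347, 28951, 1989468405201186,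
   1989536621166854, 451870556419, 37111, 2550355969020162, 2550356010635526, 520086520067,
   520379990276, 622637125891, 0, 622637119779, 28983, 520078196995, 26951, 1852063869851986, 0, 0,
   486288685347, 0, 383721300291, 37111, 2550355977343234, 2550356010635526, 588545816868,
   520086520067, 520379990276, 622637125891, 520379990275, 0, 622637119779, 28951,
   1989502504827170, 1989536621166854, 485970182403, 28983, 588545814836, 520078196995, 0,
   486288685347, 0, 417837642019, 28951, 1989536612782338, 1989502513156354, 1989536612778246,
   485978505475, 485718393091, 37111, 2550355993989378, 2550356010635526, 588545814820,
   520379990276, 520094843139, 622637125892, 622637125891, 0, 622620479747, 622637117731, 31015,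
   520086520067, 0, 0, 451928948995, 31015, 520086520068, 588545816868, 35740073516730972012805,
   588545816867, 520086520067, 37111, 2550356010701058, 2131442097225990, 588545816868,
   520086520067, 622637125891, 0, 622637119779, 28967, 28951, 1989536612782338, 0, 0, 0,
   520379990275, 37130, 622905557267, 28999, 1992835432806674, 1992835432808710, 520086520067,
   588545814852, 520371601668, 486255395076, 588545814851, 520363278595, 486255395075, 0,
   486540411139, 41191, 2830731475714322, 2830765567017234, 588847681779, 554487939332,
   554194473203, 40446857544924585165061, 45271, 3111175408550162, 3111106940797206, 520094849268,
   588595953924, 622955698419, 622637127923, 520094843139, 656996860180, 0, 759555918083, 22871,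
   1571619953672450, 1571654044975362, 1571688136278274, 1571790695334150, 520053170404,
   588504211684, 588545808724, 520396636420, 622612160740, 520094843139, 451618763043,
   656728432868, 622888902979, 656728432867, 622637111635, 20839, 1432084535996706, 520086520067,
   39143, 2690028028731618, 622637129955, 656678484259, 18807, 1292446559269154, 588487565540,
   520396632356, 16775, 1152774491240738, 14743, 520363194772, 520288313572, 39159,
   2690957117176210, 520338315508, 0, 26951, 520338317540, 0, 0, 247347757443, 0, 281447385459, 0,
   315538690403, 0, 349654970659, 0, 383746277635, 31015, 2131442113872134, 588545816868,
   520086520067, 622637195492, 520396636420, 656728432867, 622637119779, 0, 520396640499, 39159,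
   2691093498986774, 520094849268, 622637127923, 520094843139, 0, 657013573891, 41194,
   691088163091, 31031, 2132473409468690, 554454513972, 520086585604, 588805994803, 520086585603,
   520355021060, 486532151587, 35758524764404845871365, 28967, 1990636401295618, 486532084003,
   26935, 1850998424568070, 588545816883, 486263718148, 0, 451903910179, 0, 485995280675,
   485995217155, 0, 520631646483, 520631714051, 39159, 2691093498986770, 2691093498986774,
   588839356675, 554479616260, 485735106820, 622637127923, 520094843139, 520388313348,
   554194475251, 520094843140, 485735104771, 520388313347, 24903, 1711292013379842,
   1711326104682754, 588512532724, 520061491444, 588545812788, 622888902979, 22871,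
   1571722504401186, 520086520067, 0, 0, 417829257475, 0, 656996860179, 24935, 1713559487676678,
   1713525388048658, 486271902051, 418357805315, 45255, 3110007429169426, 3110041520472338,
   3110041520472342, 3110075611775250, 588595888388, 554194475235, 588595888387, 520094843139,
   588545896644, 690819739844, 690819739843, 0, 759270768915, 26967, 1853197456081158,
   520363206996, 486247072003, 0, 43223, 2970369452441874, 2970403543744786, 2970403543744790,
   588587565315, 554194479315, 588545894612, 656728434899, 0, 33063, 588545818916, 520094908676,
   520363344132, 520094908675, 42787297208742911705381, 35759096721557530247429, 31015,
   35740073516730972012805, 28967, 26935, 1850998432891138, 554429546788, 35740073516730955301125,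
   24903, 1711326364858658, 520078196996, 520078196995, 22871, 1571688388131106, 1571722479436038,
   486272041220, 0, 383712977219, 37111, 2550355977339170, 0, 0, 417812605235, 0, 451903910179,
   28951, 1989536621166850, 0, 0, 485995217155, 0, 520363344131, 0, 35082]
  (stI 1 4 (Vs true 1)) [] = true := by decide +kernel

theorem rL1_2_4 : run ⟨true, 4, 55, []⟩
  [554454513956, 588545816868, 554462904580, 622637121812, 486271975684, 656728424724,
   520371601668, 690819727636, 452180672772, 622637119780, 418089369860, 486280298756, 37127,
   554471293188, 622637125892, 554471293187, 37111, 2550356010701058, 2551455522259222,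
   588562530564, 588562530563, 622637125891, 520371601667, 0, 622637125891, 39175,
   2692193295825186, 554479681796, 554479681795, 41223, 2832930784180514, 43271, 2973702623951138,
   554496459012, 42827072998453109948677, 588545822995, 554496459011, 45319, 3114440112306466,
   47367, 3255143232469286, 623173990692, 0, 794754584851, 0, 760386457875, 0, 726018328851, 0,
   691650201875, 0, 657282072851, 35095, 588545820948, 35759668678710214623493, 0, 588831031555, 0,
   622905555235, 28999, 554454511940, 554454511939, 622905553219, 28983, 1991735921180930,
   1992835432808710, 520371601668, 486255395075, 520363209011, 0, 486255395075, 26983,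
   1854297244463426, 554454509924, 35777538962032149162341, 453262735667, 24967, 1715758779363650,
   554454507907, 22951, 1577186491398450, 520346763523, 35777534182455103216037, 20935,
   1438648026298674, 18919, 1300143384068358, 486817169668, 0, 317409546691, 0, 351232416163, 0,
   385063543171, 0, 418886412643, 0, 452717539651, 37111, 2550356010627394, 0, 0, 486548734211,
   35095, 588545820948, 554462970116, 622905559315, 554462970115, 42787297348380888434965,
   35759668678710214623493, 0, 588814254355, 588822642947, 31031, 554454513972, 588814252339,
   520355021060, 35758524764404845871365, 42787297069104934975797, 0, 520631646499, 520631714051,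
   41191, 2830731475714322, 2830765567017234, 725196185827, 486573773043, 0, 691088163091, 24935,
   1713559479353602, 520363204964, 0, 418357805315, 39159, 2691093498986770, 384291539203, 0,
   26967, 1853197456081154, 0, 0]
  (stI 2 4 (Vs true 2)) [] = true := by decide +kernel

theorem rL1_3_4 : run ⟨true, 4, 55, []⟩
  [554454513972, 554462904580, 0]
  (stI 3 4 (Vs true 3)) [] = true := by decide +kernel

theorem rL1_4_4 : run ⟨true, 4, 55, []⟩
  [0]
  (stI 4 4 (Vs true 4)) [] = true := by decide +kernel

theorem rL1_0_5 : run ⟨true, 5, 55, []⟩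
  [554462904579, 520094843140, 554454513924, 588814254355, 554454513923, 623173992723, 35095,
   554462970116, 554462970115, 35741221934635968200965, 520103231747, 35111, 554463035652,
   588814256420, 554463035651, 588814256419, 28935, 554454511876, 554731467011, 37159,
   2553654822334722, 588814256419, 623450878211, 37127, 2551455773919522, 0, 0, 485475123459,
   37191, 2555854114095378, 589082689811, 623987755299, 30999, 554454513940, 554454513939, 37127,
   2551455782373666, 0, 0, 520103299347, 35127, 40481454341366494560517, 623719385395, 0,
   589359644947, 35114, 589091143955, 37159, 2553654822338834, 588814252291, 623450818835, 28967,
   1990636149504258, 520094775555, 486011928835, 41255, 2835164158789906, 623182381315,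
   692161906963, 31015, 554454513956, 520086520068, 554454513955, 520086520067, 28935,
   1988437109541138, 0, 0, 520371667203, 39207, 2694392302305558, 588839551236, 623173998883,
   588839551235, 0, 24871, 1709126813055234, 485735037187, 45351, 3116673495238930, 657542119683,
   26919, 1849898661150982, 520094771492, 485710004483, 520094771491, 0, 43303, 2975901638756630,
   588856328451, 43306, 35098, 588822642947, 588814254355, 37127, 554471293188, 554471293187,
   39175, 588839424259, 41223, 588847814915, 520128332036, 520128332035, 43271, 588856205571,
   45319, 588864596227, 485785370883, 47367, 35744676195550211637509, 35098, 794754580755, 45322,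
   760386453779, 24871, 1709126846544130, 485735037187, 43274, 726018326803, 26919,
   1849898686251270, 485710004483, 0, 41226, 691650199827, 28967, 1990636166215938, 520094775555,
   39178, 657282072851, 26935, 1850998181099778, 520094775555, 451928948995, 31015, 554454513956,
   520086520068, 520086520067, 0, 520379990275, 37130, 622905557267, 28999, 1992835432806658,
   520346697987, 486540411139, 31031, 2132473409468674, 554454513972, 520086585604, 520086585603,
   35758524764438676928773, 486263716131, 0, 520631714051, 35082]
  (stI 0 5 (Vs true 0)) [] = true := by decide +kernel

theorem rL1_1_5 : run ⟨true, 5, 55, []⟩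
  [554454513940, 554462904579, 520094843140, 554462904580, 588545818900, 588814254356,
   623173992724, 485735104772, 554454513939, 588814252308, 520363278596, 622637121812,
   451375366404, 657533731092, 588545818899, 520094843139, 656728424724, 417015628036,
   691893469460, 588814252307, 622637121811, 520371601667, 37127, 554471293188, 554471293187,
   588831031555, 42825343616196182835477, 622637125892, 45148480729453687767317, 657818943747,
   622637125891, 45130033985414069522693, 39175, 554479681796, 588839420164, 622637127940,
   657827336451, 656996866308, 554479681795, 520119943427, 41223, 623207547140, 554488070404,
   554488070403, 691381772547, 520128332036, 45187679779135612289301, 520128332035, 43271,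
   691390163203, 45319, 588864585987, 554504847619, 554504847620, 520145109251, 520145109252,
   485785370883, 47367, 45189409161426941018373, 35744676195550211637509, 49415, 51463, 53511,
   55559, 554546790659, 520187052291, 31001, 932227088659, 35095, 28967, 1990808023632146,
   1990704944414982, 554437878036, 520078151940, 588545820947, 485718393091, 554454511908,
   554454511907, 0, 24871, 1709298687183122, 1709161172795650, 1709161172795654, 520061360404,
   588545820947, 485701636356, 520094769444, 451341877507, 520094769443, 0, 35098, 588898140435,
   53514, 897858961683, 35095, 28967, 1990773655505170, 1990704936026374, 554437875988,
   520078149892, 588545820947, 554454511908, 485718393091, 554454511907, 0, 24871,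
   1709264319056146, 1709161172795650, 1709161172795654, 520061358356, 588545820947, 520094769444,
   451341877507, 520094769443, 0, 35098, 588889751827, 51466, 863490834707, 35095, 28967,
   1990773647116562, 1990704927637766, 554437875988, 520078147844, 588545820947, 554454511908,
   485718393091, 0, 24871, 1709264310667538, 1709161172795650, 1709161172795654, 520061358356,
   588545820947, 520094769444, 485701632260, 520094769443, 0, 35098, 588881363219, 49418,
   829122707731, 35095, 588545820948, 588545820947, 28967, 1990704919249158, 554437884164,
   520078145796, 554454511908, 485718393091, 0, 24871, 1709161172795650, 1709161172795654,
   520094769444, 485701630212, 451341877507, 520094769443, 0, 35098, 588872974611, 47370,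
   794754580755, 35095, 35741221934635968200965, 28967, 1990739270600978, 554437873940,
   554454511908, 520078143748, 588545822995, 485718393092, 451627092243, 554454511907, 0, 37159,
   2553654864281874, 588814254355, 24871, 1709161172795650, 1709161172795654, 520094769444,
   520061356308, 588545820947, 485701628164, 451341877507, 0, 35098, 588864586003, 45322,
   760386453779, 35095, 554462980356, 588545820948, 35741221934635968200965, 28967, 554454511908,
   554454511907, 28951, 1989536612788482, 520078131459, 485743493379, 0, 37159, 2553654855893266,
   588814254355, 24871, 1709161172795650, 1709161172795654, 520094769444, 520094769443,
   451341877507, 0, 31015, 2131476750567698, 554454513956, 520086520068, 554731403555,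
   588545822995, 0, 35111, 2412917367537922, 2412917367537926, 588814256420, 520103297283, 0,
   26919, 520094771492, 520094771491, 0, 35098, 588856197395, 24871, 1709161206284546,
   1709161206284550, 588512405764, 520094769444, 485701626116, 588545818899, 0, 43274,
   726018326803, 35095, 554462978308, 588545820948, 588545820947, 657005322499,
   35741221934635968200965, 28967, 554454511908, 28951, 1989536612786434, 520078131459,
   485718395155, 0, 37159, 2553654847504658, 588814254355, 24871, 1709161172795650,
   1709161172795654, 520094769444, 588545820947, 520061356308, 451341877507, 0, 31015,
   554454513956, 554454513955, 0, 35111, 2412917359149314, 554463035652, 588814256420, 0, 26919,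
   520094771492, 520094771491, 0, 35098, 588847808787, 26919, 1849898686251266, 520094771492,
   520069751044, 0, 41226, 691650199827, 35095, 520103231748, 588545820947,
   35741221934635968200965, 520103231747, 28967, 554454511908, 554454511907, 28951,
   1989536612784386, 520078131459, 485718395155, 0, 486011928835, 37159, 2553654839116050,
   588814254355, 24871, 1709161172795650, 1709161172795654, 520094769444, 588545820947,
   485995143459, 520061356308, 0, 41255, 2835164175567122, 623173994771, 31015, 554454513956,
   554454513955, 0, 35111, 2412917350760706, 554463035652, 588814256420, 0, 26919,
   1849898661150978, 520094771491, 485710004483, 0, 35098, 588839420179, 28967, 28951,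
   1989536612784386, 520078131459, 485718393091, 0, 39178, 657282072851, 35095, 588545820948,
   554462970116, 588545820947, 42787297488018865162517, 520103231748, 554462970115, 520103231747,
   35741221934635968200965, 28967, 554454511908, 554731401507, 28951, 1989536612782338,
   520078131459, 485718395155, 0, 486011928835, 37159, 2553654830727442, 588814254355,
   623459207443, 31015, 520086520068, 554454513955, 0, 520371667203, 35111, 2412917342372098,
   588814256420, 554463035652, 0, 24871, 1709161172795650, 520094769444, 520061356308, 0, 41255,
   2835164167178514, 623173994771, 26919, 1849898661150978, 520094771492, 520069744916, 0, 35098,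
   588831031571, 26935, 1850964089798914, 554454509876, 588545812788, 314716680483, 28951,
   1989536612782338, 520078131459, 485718397187, 37111, 2550355993989378, 588545822979,
   622620479747, 622637117731, 24903, 1711360472805666, 554454507844, 520086520067, 22871,
   554412904708, 0, 0, 417837642019, 0, 451928948995, 31015, 554454513956, 520086520068,
   588545816868, 520086520067, 0, 520379990275, 37130, 622905557267, 35095, 554462970116,
   588545820948, 588545820947, 554462970115, 520103231747, 35741221934635968200965, 28967,
   554454511908, 554731401507, 28951, 1989536629489922, 520103231747, 485718393091, 0,
   486011928835, 37159, 2553654822338834, 588814252307, 623450818835, 31015, 520086520068,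
   554454513955, 0, 520371667203, 35111, 588545820964, 554463035651, 0, 589091143955, 24871,
   1709161172795650, 520094769444, 520061356308, 0, 41255, 2835164158789906, 623182381315, 26919,
   1849898661150978, 520094771492, 0, 39207, 2694392302305554, 588839551236, 0, 35098,
   588822642947, 588814254355, 28999, 1992835432806674, 520363278595, 486540411139, 41191,
   2830731475714322, 2830731475714326, 2830765567017234, 520094847220, 554756378867, 554194473203,
   622637195492, 520094843139, 588579242244, 656728432867, 622637123843, 520396636419, 45271,
   588595953923, 0, 759555918083, 22871, 1571688136278274, 588504211684, 20839, 1432084535996706,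
   520086520067, 588545806691, 588545806692, 0, 349654970659, 0, 383746277635, 0, 691088163091,
   31031, 520355021060, 520086585603, 554454513971, 520355021059, 0, 520631714051, 39159,
   2691093498986770, 2691093498986774, 588570919172, 520094843139, 622637127923, 588570919171, 0,
   656996860179, 24935, 1713525388048658, 486271902051, 45255, 3110007429169426, 3110041520472338,
   3110041520472342, 3110075611775250, 588595888387, 554194475235, 520094843139, 588545896644,
   690819739843, 0, 26967, 1853197456081154, 1853197456081158, 486247072003, 0, 43223,
   2970403543744790, 588587565315, 43226, 35082]
  (stI 1 5 (Vs true 1)) [] = true := by decide +kernel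

theorem rL1_2_5 : run ⟨true, 5, 55, []⟩
  [554454513956, 588545818900, 554462904580, 554454513955, 588545816868, 622637121812,
   520363278596, 486271975684, 656728424724, 588545816867, 520371601668, 690819727636,
   452180672772, 42787297207643400075557, 554462904579, 418089369860, 520371601667,
   35759664175110578864389, 37127, 554471293188, 554471293187, 0, 622905557267, 28999,
   554454511940, 554454511939, 0, 486540411139, 35095, 588545820948, 554462970116, 0, 588814254355,
   31031, 554454513972, 0, 520631714051, 41191, 2830731475714322, 0, 0]
  (stI 2 5 (Vs true 2)) [] = true := by decide +kernel

theorem rL1_3_5 : run ⟨true, 5, 55, []⟩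
  [554454513971, 554462904579, 0]
  (stI 3 5 (Vs true 3)) [] = true := by decide +kernel

theorem rL1_4_5 : run ⟨true, 5, 55, []⟩
  [554446391555]
  (stI 4 5 (Vs true 4)) [] = true := by decide +kernel

theorem rL1_0_6 : run ⟨true, 6, 55, []⟩
  [554454513924, 554462904580, 554454513923, 623450816788, 520094775555, 588814254355,
   623173992723, 554462904579, 485735104771, 451912235268, 35095, 554462970116, 554462970115,
   520103231747, 485743493379, 35111, 554463035652, 588814256420, 554463035651, 588814256419,
   28935, 554454511876, 554454511875, 37159, 2553654822334722, 588814256419, 0, 485475123459,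
   37191, 2555854114095378, 589082689811, 623987755299, 30999, 554454513939, 0, 35127,
   40481454341366494560517, 623719385395, 0, 35114, 589091143955, 37159, 2553654822338834,
   588814252291, 623450818835, 28967, 1990636149504258, 520094775555, 486011928835, 41255,
   2835164158789906, 623182381315, 692161906963, 31015, 2131373637859586, 554446190884,
   520086520068, 554454513955, 520086520067, 0, 39207, 588839551235, 39210, 24871,
   1709126813055234, 485735037187, 45351, 3116673495238930, 657542119683, 35098, 588822642947,
   588814254355, 37127, 554471293188, 554471293187, 39175, 588839424259, 41223, 588847814915,
   520128332035, 43271, 45319, 588864596227, 47367, 485793759491, 35098, 794754580755, 45322,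
   760386453779, 24871, 1709126846544130, 485735037187, 43274, 726018326803, 41226, 691650199827,
   28967, 1990636166215938, 520094775555, 39178, 657282072851, 26935, 1850998181099778,
   520094775555, 31015, 554454513956, 520086520068, 520086520067, 0, 520379990275, 37130,
   622905557267, 28999, 1992835432806658, 520346697987, 486540411139, 31031, 2132473409468674,
   554454513972, 520086585604, 520086585603, 520355021060, 418081110307, 0, 35082]
  (stI 0 6 (Vs true 0)) [] = true := by decide +kernel

theorem rL1_1_6 : run ⟨true, 6, 55, []⟩
  [554454513940, 554462904579, 520094843140, 554462904580, 588545818900, 588814252307,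
   554454513939, 622637121812, 451375366404, 657533731092, 485735104771, 588545818899,
   520371601667, 622637121811, 520094843139, 37127, 554471293188, 554471293187, 622637125892,
   622637125891, 39175, 554479681796, 554479681795, 622637127940, 657827336451, 622637127939,
   41223, 588847808771, 554488070403, 520128332035, 622637129987, 45187679779135612289301,
   691381772547, 43271, 554496459012, 520136720644, 45319, 47367, 554513236227, 623232712963,
   520153497859, 485793759491, 31001, 794754580755, 35095, 554462982404, 588545820948,
   588545820947, 485743493379, 28967, 554454511908, 520078143748, 554454511907, 485718393092, 0,
   37159, 2553654864281874, 588814254355, 24871, 1709161172795650, 520061356308, 520094769444,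
   520094769443, 0, 35098, 588864586003, 45322, 760386453779, 35095, 554462980356, 588545820948,
   485743493379, 28967, 554454511908, 520078141700, 554454511907, 485718393092, 0, 37159,
   2553654855893266, 588814254355, 24871, 1709161172795650, 520061356308, 520094769444,
   520094769443, 0, 35098, 588856197395, 24871, 1709161206284546, 1709161206284550, 520061364484,
   520094769444, 485701626116, 0, 43274, 726018326803, 35095, 554462978308, 588545820948,
   588545820947, 520103231748, 485743493379, 28967, 554454511908, 520078139652, 554454511907,
   485718393092, 0, 37159, 2553654847504658, 588814254355, 24871, 1709161172795650, 520094769444,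
   520094769443, 0, 35098, 588847808787, 41226, 691650199827, 35095, 554462976260, 588545820948,
   588545820947, 520103231747, 520103231748, 485743493379, 28967, 554454511908, 485718393092,
   554454511907, 0, 486011928835, 37159, 2553654839116050, 588814254355, 31015, 554454513956,
   554454513955, 0, 35111, 2412917350760706, 2412917350760710, 588814256420, 520103297283, 0,
   24871, 1709161172795650, 520061356308, 520094769443, 0, 41255, 2835164175567122, 623173994771,
   35098, 588839420179, 28967, 28951, 1989536612784386, 520078131459, 485718393091, 0, 39178,
   657282072851, 35095, 554462970116, 588545820948, 588545820947, 520103231747, 554462970115,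
   520103231748, 485743493379, 28967, 554454511908, 485718393092, 554454511907, 0, 486011928835,
   37159, 2553654830727442, 588814254355, 623459207443, 31015, 554454513956, 554454513955, 0,
   35111, 2412917342372098, 2412917342372102, 588814256420, 520103297283, 0, 24871, 520094769443,
   485735108868, 0, 41255, 2835164167178514, 623173994771, 35098, 588831031571, 26935,
   1850964089798914, 554454509876, 28951, 1989536612782338, 520078131459, 485718393091, 37111,
   2550355993989378, 588545822979, 622620479747, 0, 451928948995, 31015, 554454513956,
   520086520067, 0, 520379990275, 37130, 622905557267, 35095, 554462970116, 588545820948,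
   554462970115, 520103231747, 588545820947, 485743493379, 28967, 554454511908, 554454511907, 0,
   486011928835, 37159, 2553654822338834, 588814252307, 623450818835, 31015, 554454513955, 0,
   35111, 554463035652, 554463035651, 0, 24871, 520094769443, 0, 41255, 2835164158789906,
   623182381315, 35098, 588814254355, 588822642947, 28999, 1992835432806674, 520363278595,
   486540411139, 41191, 2830731475714322, 2830731475714326, 2830765567017234, 588579242244,
   520094847220, 554194473203, 588579242243, 520094843139, 656728432867, 0, 691088163091, 31031,
   554454513971, 520086585603, 520355021059, 0, 39159, 588570919171, 39162, 24935,
   1713525388048658, 486271902051, 45255, 3110041520472342, 588595888387, 45258, 35082]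
  (stI 1 6 (Vs true 1)) [] = true := by decide +kernel

theorem rL1_2_6 : run ⟨true, 6, 55, []⟩
  [554454513956, 554462904579, 554454513955, 588545818900, 554462904580, 588545816867,
   622637121812, 520363278596, 588545816868, 486271975684, 656728424724, 520371601667,
   690819727636, 452180672772, 520371601668, 622637119779, 418089369860, 486280298755, 37127,
   554471293187, 0, 622905557267, 28999, 554454511940, 0, 486540411139, 35095, 554462970116, 0, 0]
  (stI 2 6 (Vs true 2)) [] = true := by decide +kernel

theorem rL1_3_6 : run ⟨true, 6, 55, []⟩
  [554454513971, 554462904579, 0]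
  (stI 3 6 (Vs true 3)) [] = true := by decide +kernel

theorem rL1_4_6 : run ⟨true, 6, 55, []⟩
  [554446391555]
  (stI 4 6 (Vs true 4)) [] = true := by decide +kernel

theorem rL1_0_7 : run ⟨true, 7, 55, []⟩
  [554462904579, 554454513923, 588822642947, 520094843139, 588814254355, 623173992723,
   485735104771, 35095, 554462970115, 520103231747, 35111, 554463035651, 588814256420,
   554463035652, 588814256419, 28935, 554437740836, 554454511876, 554454511875, 0, 37191,
   2555854114095378, 589082689811, 35114, 589091143939, 37159, 2553654822338834, 588814252291,
   623450818835, 28967, 1990636149504258, 520094775555, 41255, 2835164158789906, 623182381315,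
   35098, 588814254355, 588822642947, 37127, 554471293188, 554471293187, 39175, 588839424259,
   41223, 588847814915, 43271, 520136720643, 35098, 726018326803, 41226, 691650199827, 28967,
   1990636166215938, 520094775555, 39178, 657282072851, 26935, 1850964089796866, 486003472643,
   451928948995, 31015, 2131373646182658, 554446190884, 554446262532, 520086520068, 520086520067,
   0, 37130, 622905557267, 28999, 1992835432806658, 520346697987, 35082]
  (stI 0 18 (Vs true 0)) [] = true := by decide +kernel

theorem rL1_1_7 : run ⟨true, 7, 55, []⟩
  [554462904579, 554454513939, 520094843140, 588814252307, 520094843139, 417015628036,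
   485735104771, 588545818899, 622637121811, 520371601667, 37127, 554471293188, 622637125892,
   554471293187, 656996864259, 622637125891, 39175, 554479681795, 554479681796, 657013643523,
   41223, 43271, 623215935747, 554496459011, 520136720643, 31001, 726018326803, 35095,
   588545820947, 520103231747, 28967, 554437871892, 554454511908, 520078139652, 554454511907,
   485718393092, 0, 37159, 2553654847504658, 588814254355, 35098, 588847808787, 41226,
   691650199827, 35095, 588545820947, 520103231747, 28967, 554437871892, 554454511908,
   554454511907, 485718393092, 0, 37159, 2553654839116050, 588814254355, 35098, 588839420179,
   28967, 554437875972, 520078137604, 588529178884, 554454511908, 485718393092, 485718393091, 0,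
   39178, 657282072851, 35095, 588545820947, 554462970115, 520103231747, 28967, 554437871892,
   554454511908, 554454511907, 485718393092, 0, 37159, 2553654830727442, 588814254355, 35098,
   588831031571, 26935, 1850964089798914, 554429550852, 554454509876, 588520853764, 451618763043,
   28951, 1989536612782338, 520078131459, 0, 451928948995, 31015, 554454513956, 554446262532,
   520086520067, 0, 37130, 622905557267, 35095, 554462970116, 588545820947, 554462970115,
   520103231747, 28967, 554437871892, 554454511908, 554454511907, 0, 37159, 2553654822338834,
   588814252307, 35098, 588814254355, 28999, 1992835432806674, 520363278595, 41191, 588579242243,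
   41194, 35082]
  (stI 1 18 (Vs true 1)) [] = true := by decide +kernel

theorem rL1_2_7 : run ⟨true, 7, 55, []⟩
  [554454513956, 554462904580, 554454513955, 554462904579, 622637121812, 588545816867,
   486271975684, 520371601667, 622637121811, 486271975683, 37127, 554471293188, 554471293187, 0,
   28999, 554454511940, 554454511939, 0, 35082]
  (stI 2 18 (Vs true 2)) [] = true := by decide +kernel

theorem rL1_3_7 : run ⟨true, 7, 55, []⟩
  [554446326019]
  (stI 3 18 (Vs true 3)) [] = true := by decide +kernel

theorem rL1_4_7 : run ⟨true, 7, 55, []⟩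
  [554446391555]
  (stI 4 18 (Vs true 4)) [] = true := by decide +kernel

theorem rL1_0_19 : run ⟨true, 19, 0, []⟩
  [554462904579, 554454513923, 588822642947, 520094843139, 588814254355, 35095, 554462970115,
   35111, 554463035651, 35114, 37159, 2553654822338834, 588814252291, 623450818835, 35098,
   588822642947, 588814254355, 37127, 554471293187, 39175, 554479681795, 35098, 657282072851,
   37130, 622905557267, 35082]
  (stI 0 0 (Vs true 0)) [] = true := by decide +kernel

theorem rL1_1_19 : run ⟨true, 19, 0, []⟩
  [554462904579, 554454513939, 520094843139, 588545818899, 35095, 554462970115, 35098,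
   588814254355, 37127, 554471293187, 39175, 554479681795, 31001, 657282072851, 37130,
   622905557267, 35082]
  (stI 1 0 (Vs true 1)) [] = true := by decide +kernel

theorem rL1_2_19 : run ⟨true, 19, 0, []⟩
  [554454513955, 554462904579, 35082]
  (stI 2 0 (Vs true 2)) [] = true := by decide +kernel

theorem rL1_3_19 : run ⟨true, 19, 0, []⟩
  [554446326019]
  (stI 3 0 (Vs true 3)) [] = true := by decide +kernel

theorem rL1_4_19 : run ⟨true, 19, 0, []⟩
  [554446391555]
  (stI 4 0 (Vs true 4)) [] = true := by decide +kernel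

end Mach

/-! ## Normalisation of the planar configuration -/

/-- Planar data of a polytope projected along a chord. -/
structure Raw (mode : Bool) (L : ℕ) (Y I : Set (ℤ × ℤ)) (F : ℤ × ℤ → ℝ)
    (n s : ℤ × ℤ → ℕ) (q0 q1 : ℤ × ℤ) : Prop where
  fin : Y.Finite
  sub : I ⊆ Y
  comb : ∀ k l m r : ℤ × ℤ, ∀ a b c : ℤ, k ∈ Y → l ∈ Y → m ∈ Y → 0 ≤ a → 0 ≤ b → 0 ≤ c →
    0 < a + b + c → a * k.1 + b * l.1 + c * m.1 = (a + b + c) * r.1 →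
    a * k.2 + b * l.2 + c * m.2 = (a + b + c) * r.2 →
    r ∈ Y ∧ (a : ℝ) * F k + b * F l + c * F m ≤ (a + b + c) * F r ∧
    (((0 < a ∧ k ∈ I) ∨ (0 < b ∧ l ∈ I) ∨ (0 < c ∧ m ∈ I) ∨
      (0 < a ∧ 0 < b ∧ 0 < c ∧ cr3 k l m ≠ 0)) → r ∈ I)
  Fnn : ∀ y ∈ Y, 0 ≤ F y
  Fpos : ∀ y ∈ I, 0 < F y
  F0 : (L : ℝ) ≤ F (0, 0)
  zY : (0, 0) ∈ Y
  zI : (0, 0) ∉ I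
  qI : q0 ∈ I
  Fle : ∀ r ∈ I, F r ≤ 1 + s r
  sU : mode = false → s q0 = 2 ∧ ∀ r, r ≠ q0 → s r = 0
  sN : mode = true → q1 ≠ q0 ∧ s q0 = 1 ∧ s q1 = 1 ∧ ∀ r, r ≠ q0 → r ≠ q1 → s r = 0
  nle : ∀ y ∈ Y, (n y : ℝ) ≤ F y + 1
  ncap : ∀ y ∈ Y, n y ≤ L + 1
  bey : ∀ k : ℤ × ℤ, k ≠ q0 → ∃ y ∈ Y, cr3 q0 k y < 0

/-- An integral linear map of the plane. -/
def gl (a b c d : ℤ) (p : ℤ × ℤ) : ℤ × ℤ := (a * p.1 + b * p.2, c * p.1 + d * p.2)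

theorem gl_inv {a b c d e : ℤ} (h : a * d - b * c = e) (he : e * e = 1) (p : ℤ × ℤ) :
    gl a b c d (gl (e * d) (-(e * b)) (-(e * c)) (e * a) p) = p := by
  subst h
  ext
  · simp only [gl]; linear_combination p.1 * he
  · simp only [gl]; linear_combination p.2 * he

theorem gl_inv' {a b c d e : ℤ} (h : a * d - b * c = e) (he : e * e = 1) (p : ℤ × ℤ) :
    gl (e * d) (-(e * b)) (-(e * c)) (e * a) (gl a b c d p) = p := by
  subst h
  ext
  · simp only [gl]; linear_combination p.1 * he
  · simp only [gl]; linear_combination p.2 * he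

theorem gl_inj {a b c d e : ℤ} (h : a * d - b * c = e) (he : e * e = 1) :
    Function.Injective (gl a b c d) :=
  Function.LeftInverse.injective (gl_inv' h he)

theorem gl_cr {a b c d e : ℤ} (h : a * d - b * c = e) (k l m : ℤ × ℤ) :
    cr3 (gl a b c d k) (gl a b c d l) (gl a b c d m) = e * cr3 k l m := by
  subst h; simp only [gl, cr3]; ring

section
variable {mode : Bool} {L : ℕ} {Y I : Set (ℤ × ℤ)} {F : ℤ × ℤ → ℝ}
    {n s : ℤ × ℤ → ℕ} {q0 q1 : ℤ × ℤ}

theorem Raw.pull (R : Raw mode L Y I F n s q0 q1) {a b c d e : ℤ} (h : a * d - b * c = e)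
    (he : e * e = 1) {q0' q1' : ℤ × ℤ} (h0 : gl a b c d q0' = q0) (h1 : gl a b c d q1' = q1) :
    Raw mode L (gl a b c d ⁻¹' Y) (gl a b c d ⁻¹' I) (F ∘ gl a b c d) (n ∘ gl a b c d)
      (s ∘ gl a b c d) q0' q1' where
  fin := R.fin.preimage (gl_inj h he).injOn
  sub := fun x hx => R.sub hx
  comb := by
    intro k l m r x y z hk hl hm hx hy hz hp e1 e2
    obtain ⟨c1, c2, c3⟩ := R.comb (gl a b c d k) (gl a b c d l) (gl a b c d m) (gl a b c d r)
      x y z hk hl hm hx hy hz hp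
      (by simp only [gl]; linear_combination a * e1 + b * e2)
      (by simp only [gl]; linear_combination c * e1 + d * e2)
    refine ⟨c1, c2, fun hh => c3 ?_⟩
    rw [gl_cr h]
    have : e ≠ 0 := by rintro rfl; simp at he
    simpa [this] using hh
  Fnn := fun y hy => R.Fnn _ hy
  Fpos := fun y hy => R.Fpos _ hy
  F0 := by simpa [gl] using R.F0
  zY := by simpa [gl] using R.zY
  zI := by simpa [gl] using R.zI
  qI := by simp only [mem_preimage, h0]; exact R.qI
  Fle := fun y hy => R.Fle _ hy
  sU := fun hm => ⟨by simp only [Function.comp, h0]; exact (R.sU hm).1, fun r hr =>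
    (R.sU hm).2 _ (fun hc => hr (gl_inj h he (hc.trans h0.symm)))⟩
  sN := fun hm => ⟨fun hc => (R.sN hm).1 (by rw [← h0, ← h1, hc]),
    by simp only [Function.comp, h0]; exact (R.sN hm).2.1,
    by simp only [Function.comp, h1]; exact (R.sN hm).2.2.1, fun r hr hr' =>
    (R.sN hm).2.2.2 _ (fun hc => hr (gl_inj h he (hc.trans h0.symm)))
      (fun hc => hr' (gl_inj h he (hc.trans h1.symm)))⟩
  nle := fun y hy => R.nle _ hy
  ncap := fun y hy => R.ncap _ hy
  bey := by
    intro k hk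
    rcases mul_self_eq_one_iff.1 he with h3 | h3
    · obtain ⟨y, hy, hc⟩ := R.bey (gl a b c d k) (fun hc => hk (gl_inj h he (hc.trans h0.symm)))
      refine ⟨gl (e * d) (-(e * b)) (-(e * c)) (e * a) y, ?_, ?_⟩
      · rw [mem_preimage, gl_inv h he]; exact hy
      · have := gl_cr h q0' k (gl (e * d) (-(e * b)) (-(e * c)) (e * a) y)
        rw [gl_inv h he, h0] at this
        rw [h3] at this; rw [h3]
        omega
    · have hne : gl a b c d (2 * q0'.1 - k.1, 2 * q0'.2 - k.2) ≠ q0 := by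
        intro hc
        apply hk
        have := gl_inj h he (hc.trans h0.symm)
        rw [Prod.ext_iff] at this ⊢
        simp only at this
        omega
      obtain ⟨y, hy, hc⟩ := R.bey _ hne
      refine ⟨gl (e * d) (-(e * b)) (-(e * c)) (e * a) y, ?_, ?_⟩
      · rw [mem_preimage, gl_inv h he]; exact hy
      · have := gl_cr h q0' (2 * q0'.1 - k.1, 2 * q0'.2 - k.2)
          (gl (e * d) (-(e * b)) (-(e * c)) (e * a) y)
        rw [gl_inv h he, h0] at this
        have h5 : ∀ w, cr3 q0' (2 * q0'.1 - k.1, 2 * q0'.2 - k.2) w = - cr3 q0' k w := by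
          intro w; simp only [cr3]; ring
        rw [h5, h3] at this; rw [h3]
        omega

/-- Two-point combinations. -/
theorem Raw.comb2 (R : Raw mode L Y I F n s q0 q1) (k l r : ℤ × ℤ) (a b : ℤ) (hk : k ∈ Y)
    (hl : l ∈ Y) (ha : 0 ≤ a) (hb : 0 ≤ b) (hp : 0 < a + b)
    (e1 : a * k.1 + b * l.1 = (a + b) * r.1) (e2 : a * k.2 + b * l.2 = (a + b) * r.2) :
    r ∈ Y ∧ (a : ℝ) * F k + b * F l ≤ (a + b) * F r ∧
      (((0 < a ∧ k ∈ I) ∨ (0 < b ∧ l ∈ I)) → r ∈ I) := by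
  obtain ⟨c1, c2, c3⟩ := R.comb k l l r a b 0 hk hl hl ha hb le_rfl (by omega)
    (by linear_combination e1) (by linear_combination e2)
  refine ⟨c1, ?_, fun h => c3 (by tauto)⟩
  push_cast at c2
  linarith

/-- The cap on the fibre length over `q0`. -/
def capq (mode : Bool) : ℕ := bif mode then 2 else 3

theorem Raw.capq (R : Raw mode L Y I F n s q0 q1) : F q0 ≤ capq mode := by
  have h := R.Fle _ R.qI
  cases mode with
  | false => rw [(R.sU rfl).1] at h; simp [_root_.capq]; norm_num at h ⊢; linarith
  | true => rw [(R.sN rfl).2.1] at h; simp [_root_.capq]; norm_num at h ⊢; linarith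

theorem Raw.cap2 (R : Raw mode L Y I F n s q0 q1) {r : ℤ × ℤ} (hr : r ∈ I) (hne : r ≠ q0) :
    F r ≤ 2 ∧ (mode = false → F r ≤ 1) ∧ (r ≠ q1 → F r ≤ 1) := by
  have h := R.Fle _ hr
  cases mode with
  | false =>
    rw [(R.sU rfl).2 r hne] at h
    norm_num at h
    exact ⟨by linarith, fun _ => h, fun _ => h⟩
  | true =>
    obtain ⟨h0, h1, h2, h3⟩ := R.sN rfl
    by_cases hq : r = q1
    · subst hq
      rw [h2] at h
      norm_num at h
      exact ⟨by linarith, by simp, by simp⟩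
    · rw [h3 r hne hq] at h
      norm_num at h
      exact ⟨by linarith, by simp, fun _ => h⟩

theorem Raw.q0_ne (R : Raw mode L Y I F n s q0 q1) : q0 ≠ (0, 0) := by
  intro h; exact R.zI (h ▸ R.qI)

theorem Raw.prim (R : Raw mode L Y I F n s q0 q1) (hL : 4 ≤ L) : Int.gcd q0.1 q0.2 = 1 := by
  by_contra hne
  obtain ⟨g, hg⟩ : ∃ g : ℤ, g = Int.gcd q0.1 q0.2 := ⟨_, rfl⟩
  obtain ⟨x, hx⟩ : g ∣ q0.1 := hg ▸ Int.gcd_dvd_left ..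
  obtain ⟨y, hy⟩ : g ∣ q0.2 := hg ▸ Int.gcd_dvd_right ..
  have hg0 : g ≠ 0 := by
    intro h
    apply R.q0_ne
    rw [h] at hx hy
    ext <;> simp [hx, hy]
  have hg2 : 2 ≤ g := by
    have : (0:ℤ) ≤ g := by rw [hg]; positivity
    omega
  obtain ⟨c1, c2, c3⟩ := R.comb2 (0, 0) q0 (x, y) (g - 1) 1 R.zY (R.sub R.qI) (by omega)
    (by omega) (by omega) (by simp [hx]) (by simp [hy])
  have hI := c3 (Or.inr ⟨by omega, R.qI⟩)
  have hne' : (x, y) ≠ q0 := by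
    intro h
    rw [Prod.ext_iff] at h
    simp only at h
    rw [← h.1] at hx; rw [← h.2] at hy
    have h1 : (g - 1) * x = 0 := by linear_combination -hx
    have h2 : (g - 1) * y = 0 := by linear_combination -hy
    have h3 : g - 1 ≠ 0 := by omega
    apply R.q0_ne
    ext
    · simpa [h3, h.1] using h1
    · simpa [h3, h.2] using h2
  have h2 := (R.cap2 hI hne').1
  have h4 := R.Fpos _ R.qI
  have h5 := R.F0
  have h6 : (4:ℝ) ≤ L := by exact_mod_cast hL
  have h7 : (2:ℝ) ≤ g := by exact_mod_cast hg2
  push_cast at c2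
  nlinarith

/-- If `O, q0, x = (ε D, y)` are in `Y`, then so are the points of the triangle they span. -/
theorem Raw.far (R : Raw mode L Y I F n s (0, 1) q1) (hL : 4 ≤ L) {D ε y j m t : ℤ}
    (hx : (ε * D, y) ∈ Y) (hj : 0 < j) (hm : 0 ≤ m) (hmj : m + j ≤ D)
    (ht : j * y + m = D * t) :
    (ε * j, t) ∈ Y ∧ (0 < m → (ε * j, t) ∈ I ∧ 4 * (D - j - m : ℝ) ≤ D * F (ε * j, t)) := by
  obtain ⟨c1, c2, c3⟩ := R.comb (0, 0) (0, 1) (ε * D, y) (ε * j, t) (D - j - m) m j R.zY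
    (R.sub R.qI) hx (by omega) hm hj.le (by omega) (by simp; ring) (by simp; linear_combination ht)
  refine ⟨c1, fun hm => ⟨c3 (Or.inr (Or.inl ⟨hm, R.qI⟩)), ?_⟩⟩
  have h1 := R.Fnn _ hx
  have h2 := R.Fnn _ (R.sub R.qI)
  have h5 := R.F0
  have h6 : (4:ℝ) ≤ L := by exact_mod_cast hL
  push_cast at c2
  have e : ((D:ℝ) - j - m + m + j) = D := by ring
  rw [e] at c2
  have a1 : (0:ℝ) ≤ D - j - m := by have : (m:ℝ) + j ≤ D := by exact_mod_cast hmj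
                                    linarith
  have a2 : (0:ℝ) ≤ m := by exact_mod_cast hm.le
  have a3 : (0:ℝ) ≤ j := by exact_mod_cast hj.le
  nlinarith [mul_nonneg a2 h2, mul_nonneg a3 h1, mul_le_mul_of_nonneg_left (h6.trans h5) a1]

/-- The viability conditions. `u ≡ -y mod D`. -/
theorem Raw.viable (R : Raw mode L Y I F n s (0, 1) q1) (hL : 4 ≤ L) {D ε y u : ℤ} (hε : ε * ε = 1)
    (hx : (ε * D, y) ∈ Y) (hD : D ∣ y + u) :
    (∀ j, 0 < j → j < D → j * u % D ≠ 0 → D ≤ 2 * (j * u % D + j)) ∧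
    (mode = false → ∀ j, 0 < j → j < D → j * u % D ≠ 0 → 3 * D ≤ 4 * (j * u % D + j)) ∧
    (∀ j j', 0 < j → j < D → j * u % D ≠ 0 → 4 * (j * u % D + j) < 3 * D → 0 < j' → j' < D →
      j' * u % D ≠ 0 → 4 * (j' * u % D + j') < 3 * D → j = j') := by
  have key : ∀ j, 0 < j → j < D → j * u % D ≠ 0 → j * u % D + j ≤ D → ∃ t, (ε * j, t) ∈ I ∧
      4 * (D - j - (j * u % D : ℤ) : ℝ) ≤ D * F (ε * j, t) ∧ (ε * j, t) ≠ (0, 1) := by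
    intro j hj hjD hm hle
    have hm0 : 0 ≤ j * u % D := Int.emod_nonneg _ (by omega)
    have : D ∣ j * y + j * u % D := by
      have h1 : D ∣ j * (y + u) := Dvd.dvd.mul_left hD j
      have h2 : D ∣ j * u - j * u % D := Int.dvd_self_sub_emod
      have := dvd_sub h1 h2
      have e : j * (y + u) - (j * u - j * u % D) = j * y + j * u % D := by ring
      rwa [e] at this
    obtain ⟨t, ht⟩ := this
    obtain ⟨h1, h2⟩ := R.far hL hx hj hm0 hle ht
    obtain ⟨h3, h4⟩ := h2 (lt_of_le_of_ne hm0 (Ne.symm hm))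
    refine ⟨t, h3, h4, ?_⟩
    intro h
    have : ε * j = 0 := (Prod.ext_iff.1 h).1
    rcases mul_eq_zero.1 this with h | h
    · rw [h] at hε; simp at hε
    · omega
  refine ⟨?_, ?_, ?_⟩
  · intro j hj hjD hm
    by_contra hc
    obtain ⟨t, hI, hF, hne⟩ := key j hj hjD hm (by omega)
    have := (R.cap2 hI hne).1
    have hD0 : (0:ℝ) < D := by exact_mod_cast hj.trans hjD
    have h3 : (2:ℝ) * ((j * u % D : ℤ) + j) < D := by exact_mod_cast (not_le.1 hc)
    nlinarith
  · intro hmode j hj hjD hm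
    by_contra hc
    obtain ⟨t, hI, hF, hne⟩ := key j hj hjD hm (by omega)
    have := (R.cap2 hI hne).2.1 hmode
    have hD0 : (0:ℝ) < D := by exact_mod_cast hj.trans hjD
    have h3 : (4:ℝ) * ((j * u % D : ℤ) + j) < 3 * D := by exact_mod_cast (not_le.1 hc)
    nlinarith
  · intro j j' hj hjD hm hb hj' hjD' hm' hb'
    obtain ⟨t, hI, hF, hne⟩ := key j hj hjD hm (by omega)
    obtain ⟨t', hI', hF', hne'⟩ := key j' hj' hjD' hm' (by omega)
    have hD0 : (0:ℝ) < D := by exact_mod_cast hj.trans hjD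
    have e1 : (ε * j, t) = q1 := by
      by_contra hc
      have := (R.cap2 hI hne).2.2 hc
      have h3 : (4:ℝ) * ((j * u % D : ℤ) + j) < 3 * D := by exact_mod_cast hb
      nlinarith
    have e2 : (ε * j', t') = q1 := by
      by_contra hc
      have := (R.cap2 hI' hne').2.2 hc
      have h3 : (4:ℝ) * ((j' * u % D : ℤ) + j') < 3 * D := by exact_mod_cast hb'
      nlinarith
    have : ε * j = ε * j' := (Prod.ext_iff.1 (e1.trans e2.symm)).1
    have h0 : ε ≠ 0 := by rintro rfl; simp at hε
    exact mul_left_cancel₀ h0 this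

end

/-! ## The gate lemma and the initial candidate list -/

theorem mod_of_compl {D u v j q w : ℤ} (huv : u + v = D) (h : j * v = D * q + w) (hw : 0 < w)
    (hwD : w < D) : j * u % D = D - w := by
  have e : j * u = (D - w) + D * (j - q - 1) := by
    have : u = D - v := by omega
    rw [this]; linear_combination -h
  rw [e, Int.add_mul_emod_self_left]
  exact Int.emod_eq_of_lt (by omega) (by omega)

theorem gate {D u : ℤ} (hD : 14 ≤ D) (hu0 : 0 ≤ u) (huD : u < D)
    (H1 : ∀ j, 0 < j → j < D → j * u % D ≠ 0 → D ≤ 2 * (j * u % D + j))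
    (H3 : ∀ j j', 0 < j → j < D → j * u % D ≠ 0 → 4 * (j * u % D + j) < 3 * D → 0 < j' → j' < D →
      j' * u % D ≠ 0 → 4 * (j' * u % D + j') < 3 * D → j = j') : u = 0 ∨ u = D - 1 := by
  by_contra hne
  push Not at hne
  obtain ⟨v, hv⟩ : ∃ v, u + v = D := ⟨D - u, by ring⟩
  have strong : ∀ j q w : ℤ, 0 < j → j < D → j * v = D * q + w → w < D → D + 2 * j < 2 * w →
      False := by
    intro j q w hj hjD h hw h2
    have e := mod_of_compl hv h (by omega) hw
    have := H1 j hj hjD (by omega)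
    omega
  have bad : ∀ j q w : ℤ, 0 < j → j < D → j * v = D * q + w → w < D → D + 4 * j < 4 * w →
      j * u % D ≠ 0 ∧ 4 * (j * u % D + j) < 3 * D := by
    intro j q w hj hjD h hw h2
    have e := mod_of_compl hv h (by omega) hw
    constructor <;> omega
  have two : ∀ j q w j' q' w' : ℤ, 0 < j → j < D → j * v = D * q + w → w < D → D + 4 * j < 4 * w →
      0 < j' → j' < D → j' * v = D * q' + w' → w' < D → D + 4 * j' < 4 * w' → j = j' := by
    intro j q w j' q' w' a1 a2 a3 a4 a5 b1 b2 b3 b4 b5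
    obtain ⟨x1, x2⟩ := bad j q w a1 a2 a3 a4 a5
    obtain ⟨y1, y2⟩ := bad j' q' w' b1 b2 b3 b4 b5
    exact H3 j j' a1 a2 x1 x2 b1 b2 y1 y2
  rcases lt_or_ge v 3 with h3 | h3
  · obtain rfl : v = 2 := by omega
    have := two ((D - 1) / 2) 0 ((D - 1) / 2 * 2) ((D - 1) / 2 - 1) 0 (((D - 1) / 2 - 1) * 2)
      (by omega) (by omega) (by ring) (by omega) (by omega) (by omega) (by omega) (by ring)
      (by omega) (by omega)
    omega
  rcases lt_or_ge (3 * v) D with h4 | h4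
  · have hj0 : (D - 1) / v * v ≤ D - 1 := Int.ediv_mul_le _ (by omega)
    have hj1 : D - 1 < ((D - 1) / v + 1) * v := Int.lt_ediv_add_one_mul_self _ (by omega)
    generalize (D - 1) / v = j at hj0 hj1
    have hj3 : 3 ≤ j := by
      by_contra hc
      have : j + 1 ≤ 3 := by omega
      nlinarith
    have hjv : 0 ≤ (v - 3) * (j - 3) := mul_nonneg (by omega) (by omega)
    have hjD : j < D := by nlinarith
    rcases le_or_gt 17 D with h17 | h17
    · exact strong j 0 (j * v) (by omega) hjD (by ring) (by omega) (by nlinarith)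
    · have hv5 : v ≤ 5 := by omega
      have : D + 2 * j < 2 * (j * v) := by
        interval_cases v <;> omega
      exact strong j 0 (j * v) (by omega) hjD (by ring) (by omega) this
  rcases lt_or_ge (2 * v) D with h5 | h5
  · exact strong 2 0 (2 * v) (by omega) (by omega) (by ring) (by omega) (by omega)
  rcases le_or_gt (2 * v) (D + 2) with h6 | h6
  · have := two 1 0 v 3 1 (3 * v - D) (by omega) (by omega) (by ring) (by omega) (by omega)
      (by omega) (by omega) (by ring) (by omega) (by omega)
    omega
  · exact strong 1 0 v (by omega) (by omega) (by ring) (by omega) (by omega)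

/-- A normalised configuration. -/
structure Nrm (mode : Bool) (L : ℕ) (Y I : Set (ℤ × ℤ)) (F : ℤ × ℤ → ℝ)
    (n s : ℤ × ℤ → ℕ) (q1 : ℤ × ℤ) (bb : ℕ) : Prop where
  R : Raw mode L Y I F n s (0, 1) q1
  hL : 4 ≤ L
  r1 : (1, 0) ∈ Y
  r2 : ∀ t, (1, t) ∈ Y → 0 ≤ t
  l1 : (-1, (bb : ℤ)) ∈ Y
  l2 : ∀ t, (-1, t) ∈ Y → bb ≤ t

section
variable {mode : Bool} {L : ℕ} {Y I : Set (ℤ × ℤ)} {F : ℤ × ℤ → ℝ}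
    {n s : ℤ × ℤ → ℕ} {q0 q1 : ℤ × ℤ} {bb : ℕ}

theorem Raw.col (R : Raw mode L Y I F n s (0, 1) q1) (hL : 4 ≤ L) {D ε y : ℤ}
    (hx : (ε * D, y) ∈ Y) (hD : 0 < D) : ∃ t m : ℤ, (ε, t) ∈ Y ∧ D * t = y + m ∧ 0 ≤ m ∧ m < D := by
  have h0 : 0 ≤ (-y) % D := Int.emod_nonneg _ (by omega)
  have h1 : (-y) % D < D := Int.emod_lt_of_pos _ hD
  obtain ⟨t, ht⟩ : D ∣ y + (-y) % D := by
    have : D ∣ -y - (-y) % D := Int.dvd_self_sub_emod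
    have := (dvd_neg).2 this
    have e : -(-y - (-y) % D) = y + (-y) % D := by ring
    rwa [e] at this
  refine ⟨t, (-y) % D, ?_, ht.symm, h0, h1⟩
  have := (R.far hL (j := 1) (m := (-y) % D) (t := t) hx (by omega) h0 (by omega)
    (by linear_combination ht)).1
  simpa using this

theorem Raw.height (R : Raw mode L Y I F n s (0, 1) q1) (hL : 4 ≤ L) {y b : ℤ} (h1 : (1, y) ∈ Y)
    (h2 : (-1, b) ∈ Y) : 0 ≤ y + b ∧ y + b ≤ Mach.EE mode := by
  constructor
  · by_contra hc
    obtain ⟨c1, c2, c3⟩ := R.comb (0, 1) (1, y) (-1, b) (0, 0) (-(y + b)) 1 1 (R.sub R.qI) h1 h2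
      (by omega) (by omega) (by omega) (by omega) (by simp) (by simp)
    exact R.zI (c3 (Or.inl ⟨by omega, R.qI⟩))
  · by_contra hc
    have hE : 4 ≤ (Mach.EE mode : ℤ) := by cases mode <;> simp [Mach.EE]
    obtain ⟨c1, c2, c3⟩ := R.comb (0, 0) (1, y) (-1, b) (0, 1) (y + b - 2) 1 1 R.zY h1 h2
      (by omega) (by omega) (by omega) (by omega) (by simp) (by simp; ring)
    have f1 := R.Fnn _ h1
    have f2 := R.Fnn _ h2
    have f3 := R.F0
    have f4 := R.capq
    have h6 : (4:ℝ) ≤ L := by exact_mod_cast hL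
    push_cast at c2
    have h7 : ((Mach.EE mode : ℤ) : ℝ) < y + b := by exact_mod_cast not_le.1 hc
    cases mode
    · simp [Mach.EE, _root_.capq] at h7 f4; nlinarith
    · simp [Mach.EE, _root_.capq] at h7 f4; nlinarith

theorem Raw.axis (R : Raw mode L Y I F n s (0, 1) q1) (hL : 4 ≤ L) {y : ℤ} (h1 : (0, y) ∈ Y) :
    0 ≤ y ∧ y ≤ Mach.EE mode / 2 := by
  constructor
  · by_contra hc
    obtain ⟨c1, c2, c3⟩ := R.comb2 (0, 1) (0, y) (0, 0) (-y) 1 (R.sub R.qI) h1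
      (by omega) (by omega) (by omega) (by simp) (by simp)
    exact R.zI (c3 (Or.inl ⟨by omega, R.qI⟩))
  · by_contra hc
    have hE : 2 ≤ (Mach.EE mode / 2 : ℤ) := by cases mode <;> simp [Mach.EE]
    obtain ⟨c1, c2, c3⟩ := R.comb2 (0, 0) (0, y) (0, 1) (y - 1) 1 R.zY h1
      (by omega) (by omega) (by omega) (by simp) (by simp)
    have f1 := R.Fnn _ h1
    have f3 := R.F0
    have f4 := R.capq
    have h6 : (4:ℝ) ≤ L := by exact_mod_cast hL
    push_cast at c2
    have h7 : ((Mach.EE mode / 2 : ℤ) : ℝ) < y := by exact_mod_cast not_le.1 hc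
    cases mode
    · simp [Mach.EE, _root_.capq] at h7 f4
      nlinarith
    · simp [Mach.EE, _root_.capq] at h7 f4
      nlinarith

theorem countP_le_one {p : ℕ → Bool} {l : List ℕ} (hl : l.Nodup)
    (h : ∀ a ∈ l, ∀ b ∈ l, p a = true → p b = true → a = b) : l.countP p ≤ 1 := by
  rw [List.countP_eq_length_filter]
  have hn := hl.filter p
  rcases hf : l.filter p with _ | ⟨a, _ | ⟨b, t⟩⟩
  · simp
  · simp
  · exfalso
    have ha : a ∈ l.filter p := by rw [hf]; simp
    have hb : b ∈ l.filter p := by rw [hf]; simp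
    rw [List.mem_filter] at ha hb
    have := h a ha.1 b hb.1 ha.2 hb.2
    rw [hf] at hn
    simp [this] at hn

theorem Raw.viab (R : Raw mode L Y I F n s (0, 1) q1) (hL : 4 ≤ L) {ε y : ℤ} {D u : ℕ}
    (hε : ε * ε = 1) (hx : (ε * D, y) ∈ Y) (hD : (D : ℤ) ∣ y + u) : Mach.viab mode D u = true := by
  obtain ⟨H1, H2, H3⟩ := R.viable hL hε hx hD
  have cast : ∀ j : ℕ, ((j * u % D : ℕ) : ℤ) = (j : ℤ) * u % D := by intro j; push_cast; rfl
  cases mode with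
  | false =>
    simp only [Mach.viab, cond_false, List.all_eq_true, List.mem_range, Bool.or_eq_true,
      Nat.beq_eq, Nat.ble_eq]
    intro j hj
    by_cases h0 : j * u % D = 0
    · exact Or.inl h0
    · right
      have hj0 : j ≠ 0 := by rintro rfl; simp at h0
      have := H2 rfl j (by omega) (by omega) (by rw [← cast]; omega)
      rw [← cast] at this
      omega
  | true =>
    simp only [Mach.viab, cond_true, List.all_eq_true, List.mem_range, Bool.or_eq_true,
      Nat.beq_eq, Nat.ble_eq, Bool.and_eq_true]
    constructor
    · intro j hj
      by_cases h0 : j * u % D = 0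
      · exact Or.inl h0
      · right
        have hj0 : j ≠ 0 := by rintro rfl; simp at h0
        have := H1 j (by omega) (by omega) (by rw [← cast]; omega)
        rw [← cast] at this
        omega
    · apply countP_le_one List.nodup_range
      intro a ha b hb hpa hpb
      simp only [List.mem_range] at ha hb
      simp only [Bool.and_eq_true, Bool.not_eq_true', Mach.beq_ff, Nat.blt_eq] at hpa hpb
      have ha0 : a ≠ 0 := by rintro rfl; simp at hpa
      have hb0 : b ≠ 0 := by rintro rfl; simp at hpb
      have := H3 a b (by omega) (by omega) (by rw [← cast]; omega) (by rw [← cast]; omega)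
        (by omega) (by omega) (by rw [← cast]; omega) (by rw [← cast]; omega)
      omega

theorem dvd_aux (D z : ℕ) (y : ℤ) (hz : y + D = z) (hle : z ≤ 200 * D) :
    (D : ℤ) ∣ y + ((200 * D - z) % D : ℕ) := by
  have h : (D : ℤ) ∣ (200 * D - z : ℤ) - (200 * D - z : ℤ) % D := Int.dvd_self_sub_emod
  have e : y + (((200 * D - z) % D : ℕ) : ℤ) =
      199 * (D : ℤ) - ((200 * D - z : ℤ) - (200 * D - z : ℤ) % D) := by
    push_cast [hle]; omega
  rw [e]
  exact dvd_sub (Dvd.intro_left _ rfl) h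

theorem dec_code {a b : ℕ} (hb : b < 128) : Mach.dec (a * 128 + b) = ((a : ℤ) - 16, (b : ℤ) - 16) := by
  simp only [Mach.dec, Mach.px, Mach.py]
  ext <;> simp <;> omega

theorem Nrm.mem_B0 (N : Nrm mode L Y I F n s q1 bb) {p : ℤ × ℤ} (hp : p ∈ Y) (h13 : |p.1| ≤ 13) :
    ∃ c ∈ Mach.B0 mode bb, Mach.dec c = p := by
  obtain ⟨x, y⟩ := p
  simp only at h13
  rw [abs_le] at h13
  have hE : Mach.EE mode ≤ 8 := by cases mode <;> simp [Mach.EE]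
  have hbb := (N.R.height N.hL N.r1 N.l1).2
  simp only [Mach.B0, List.mem_append, List.mem_map, List.mem_range, List.mem_flatMap]
  rcases lt_trichotomy x 0 with hx | hx | hx
  · obtain ⟨D, rfl⟩ : ∃ D : ℕ, x = -D := ⟨x.natAbs, by omega⟩
    have hp' : ((-1) * (D : ℤ), y) ∈ Y := by simpa using hp
    obtain ⟨t, m, ht, hty, hm, hmD⟩ := N.R.col N.hL hp' (by omega)
    have b1 := N.l2 t ht
    have b2 := (N.R.height N.hL N.r1 ht).2
    have b3 : (D : ℤ) * bb ≤ D * t := mul_le_mul_of_nonneg_left b1 (by omega)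
    have b4 : (D : ℤ) * t ≤ D * Mach.EE mode := mul_le_mul_of_nonneg_left (by omega) (by omega)
    have b5 : (D : ℤ) * bb ≥ 0 := by positivity
    obtain ⟨z, hz⟩ : ∃ z : ℕ, y + D = z := ⟨(y + D).toNat, by omega⟩
    have b6 : (D : ℤ) * Mach.EE mode ≤ D * 8 := by
      exact mul_le_mul_of_nonneg_left (by exact_mod_cast hE) (by omega)
    refine ⟨(16 - D) * 128 + (z + 16 - D), Or.inr ⟨D - 1, by omega, Or.inr ?_⟩, ?_⟩
    · rw [show D - 1 + 1 = D by omega]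
      simp only [Mach.leftC, List.mem_map, List.mem_filter, List.mem_range, Bool.and_eq_true,
        Nat.blt_eq]
      refine ⟨z, ⟨?_, ?_, ?_⟩, rfl⟩
      · zify; linarith
      · zify; linarith
      · refine N.R.viab N.hL (by norm_num) hp' ?_
        have hle : z ≤ 200 * D := by zify; linarith
        exact dvd_aux D z y hz hle
    · rw [dec_code (by omega)]
      ext <;> simp <;> omega
  · subst hx
    obtain ⟨h0, h1⟩ := N.R.axis N.hL hp
    refine ⟨2064 + y.toNat, Or.inl ⟨y.toNat, by omega, rfl⟩, ?_⟩
    simp only [Mach.dec, Mach.px, Mach.py]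
    ext <;> simp <;> omega
  · obtain ⟨D, rfl⟩ : ∃ D : ℕ, x = D := ⟨x.natAbs, by omega⟩
    have hp' : (1 * (D : ℤ), y) ∈ Y := by simpa using hp
    obtain ⟨t, m, ht, hty, hm, hmD⟩ := N.R.col N.hL hp' (by omega)
    have b1 := N.r2 t ht
    have b2 := (N.R.height N.hL ht N.l1).2
    have b3 : 0 ≤ D * t := mul_nonneg (by omega) b1
    have b4 : (D : ℤ) * t ≤ D * (Mach.EE mode - bb : ℕ) :=
      mul_le_mul_of_nonneg_left (by omega) (by omega)
    obtain ⟨z, hz⟩ : ∃ z : ℕ, y + D = z := ⟨(y + D).toNat, by omega⟩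
    have b6 : (D : ℤ) * (Mach.EE mode - bb : ℕ) ≤ D * 8 :=
      mul_le_mul_of_nonneg_left (by omega) (by omega)
    refine ⟨(D + 16) * 128 + (z + 16 - D), Or.inr ⟨D - 1, by omega, Or.inl ?_⟩, ?_⟩
    · rw [show D - 1 + 1 = D by omega]
      simp only [Mach.rightC, List.mem_map, List.mem_filter, List.mem_range, Bool.and_eq_true,
        Nat.blt_eq]
      refine ⟨z, ⟨?_, ?_, ?_⟩, rfl⟩
      · zify; linarith
      · omega
      · refine N.R.viab N.hL (by norm_num) hp' ?_
        have hle : z ≤ 200 * D := by zify; linarith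
        exact dvd_aux D z y hz hle
    · rw [dec_code (by omega)]
      ext <;> simp <;> omega
end

/-! ## Truncation, and running the certificates -/

theorem Mach.exV (mode : Bool) (bb : ℕ) (h : bb ≤ Mach.EE mode) :
    ∃ os, Mach.run ⟨mode, 4, 0, [Mach.Vs mode bb]⟩ os
      (Mach.stI bb 0 (Mach.B0 mode bb)) [] = true := by
  cases mode
  · simp only [Mach.EE, cond_false] at h
    interval_cases bb
    exacts [⟨_, Mach.rV0_0⟩, ⟨_, Mach.rV0_1⟩, ⟨_, Mach.rV0_2⟩, ⟨_, Mach.rV0_3⟩, ⟨_, Mach.rV0_4⟩,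
      ⟨_, Mach.rV0_5⟩, ⟨_, Mach.rV0_6⟩, ⟨_, Mach.rV0_7⟩, ⟨_, Mach.rV0_8⟩]
  · simp only [Mach.EE, cond_true] at h
    interval_cases bb
    exacts [⟨_, Mach.rV1_0⟩, ⟨_, Mach.rV1_1⟩, ⟨_, Mach.rV1_2⟩, ⟨_, Mach.rV1_3⟩, ⟨_, Mach.rV1_4⟩]

theorem Mach.Vs_px (mode : Bool) (bb : ℕ) (h : bb ≤ Mach.EE mode) :
    ∀ c ∈ Mach.Vs mode bb, Mach.px c ≠ 3 ∧ Mach.px c ≠ 29 := by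
  cases mode
  · simp only [Mach.EE, cond_false] at h
    interval_cases bb <;> decide
  · simp only [Mach.EE, cond_true] at h
    interval_cases bb <;> decide

theorem Mach.exU (bb L : ℕ) (h : bb ≤ 5) (hL : 4 ≤ L) (h11 : L < 11) :
    ∃ LA LB os, LA ≤ L ∧ L ≤ LB ∧ Mach.run ⟨false, LA, 55, []⟩ os
      (Mach.stI bb LB (Mach.Vs false bb)) [] = true := by
  have h1 : L ≤ 5 ∨ L = 6 ∨ (7 ≤ L ∧ L ≤ 8) ∨ (9 ≤ L ∧ L ≤ 10) := by omega
  rcases h1 with h1 | h1 | h1 | h1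
  · refine ⟨4, 5, ?_⟩
    interval_cases bb
    exacts [⟨_, hL, h1, Mach.rL0_0_4⟩, ⟨_, hL, h1, Mach.rL0_1_4⟩, ⟨_, hL, h1, Mach.rL0_2_4⟩,
      ⟨_, hL, h1, Mach.rL0_3_4⟩, ⟨_, hL, h1, Mach.rL0_4_4⟩, ⟨_, hL, h1, Mach.rL0_5_4⟩]
  · refine ⟨6, 6, ?_⟩
    subst h1
    interval_cases bb
    exacts [⟨_, le_rfl, le_rfl, Mach.rL0_0_6⟩, ⟨_, le_rfl, le_rfl, Mach.rL0_1_6⟩,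
      ⟨_, le_rfl, le_rfl, Mach.rL0_2_6⟩, ⟨_, le_rfl, le_rfl, Mach.rL0_3_6⟩,
      ⟨_, le_rfl, le_rfl, Mach.rL0_4_6⟩, ⟨_, le_rfl, le_rfl, Mach.rL0_5_6⟩]
  · refine ⟨7, 8, ?_⟩
    obtain ⟨ha, hb⟩ := h1
    interval_cases bb
    exacts [⟨_, ha, hb, Mach.rL0_0_7⟩, ⟨_, ha, hb, Mach.rL0_1_7⟩, ⟨_, ha, hb, Mach.rL0_2_7⟩,
      ⟨_, ha, hb, Mach.rL0_3_7⟩, ⟨_, ha, hb, Mach.rL0_4_7⟩, ⟨_, ha, hb, Mach.rL0_5_7⟩]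
  · refine ⟨9, 10, ?_⟩
    obtain ⟨ha, hb⟩ := h1
    interval_cases bb
    exacts [⟨_, ha, hb, Mach.rL0_0_9⟩, ⟨_, ha, hb, Mach.rL0_1_9⟩, ⟨_, ha, hb, Mach.rL0_2_9⟩,
      ⟨_, ha, hb, Mach.rL0_3_9⟩, ⟨_, ha, hb, Mach.rL0_4_9⟩, ⟨_, ha, hb, Mach.rL0_5_9⟩]

theorem Mach.exT (bb L : ℕ) (h : bb ≤ 5) (hL : 11 ≤ L) (h11 : L ≤ 18) :
    ∃ LA LB os, LA ≤ L ∧ L ≤ LB ∧ Mach.run ⟨false, LA, 55, Mach.Tex⟩ os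
      (Mach.stI bb LB (Mach.Vs false bb)) [] = true := by
  rcases le_or_gt L 13 with h1 | h1
  · refine ⟨11, 13, ?_⟩
    interval_cases bb
    exacts [⟨_, hL, h1, Mach.rL0_0_11⟩, ⟨_, hL, h1, Mach.rL0_1_11⟩, ⟨_, hL, h1, Mach.rL0_2_11⟩,
      ⟨_, hL, h1, Mach.rL0_3_11⟩, ⟨_, hL, h1, Mach.rL0_4_11⟩, ⟨_, hL, h1, Mach.rL0_5_11⟩]
  · refine ⟨14, 18, ?_⟩
    interval_cases bb
    exacts [⟨_, h1, h11, Mach.rL0_0_14⟩, ⟨_, h1, h11, Mach.rL0_1_14⟩, ⟨_, h1, h11, Mach.rL0_2_14⟩,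
      ⟨_, h1, h11, Mach.rL0_3_14⟩, ⟨_, h1, h11, Mach.rL0_4_14⟩, ⟨_, h1, h11, Mach.rL0_5_14⟩]

theorem Mach.exN (bb L : ℕ) (h : bb ≤ 4) (hL : 4 ≤ L) (h11 : L ≤ 18) :
    ∃ LA LB os, LA ≤ L ∧ L ≤ LB ∧ Mach.run ⟨true, LA, 55, []⟩ os
      (Mach.stI bb LB (Mach.Vs true bb)) [] = true := by
  have h1 : L = 4 ∨ L = 5 ∨ L = 6 ∨ 7 ≤ L := by omega
  rcases h1 with h1 | h1 | h1 | h1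
  · refine ⟨4, 4, ?_⟩
    subst h1
    interval_cases bb
    exacts [⟨_, le_rfl, le_rfl, Mach.rL1_0_4⟩, ⟨_, le_rfl, le_rfl, Mach.rL1_1_4⟩,
      ⟨_, le_rfl, le_rfl, Mach.rL1_2_4⟩, ⟨_, le_rfl, le_rfl, Mach.rL1_3_4⟩,
      ⟨_, le_rfl, le_rfl, Mach.rL1_4_4⟩]
  · refine ⟨5, 5, ?_⟩
    subst h1
    interval_cases bb
    exacts [⟨_, le_rfl, le_rfl, Mach.rL1_0_5⟩, ⟨_, le_rfl, le_rfl, Mach.rL1_1_5⟩,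
      ⟨_, le_rfl, le_rfl, Mach.rL1_2_5⟩, ⟨_, le_rfl, le_rfl, Mach.rL1_3_5⟩,
      ⟨_, le_rfl, le_rfl, Mach.rL1_4_5⟩]
  · refine ⟨6, 6, ?_⟩
    subst h1
    interval_cases bb
    exacts [⟨_, le_rfl, le_rfl, Mach.rL1_0_6⟩, ⟨_, le_rfl, le_rfl, Mach.rL1_1_6⟩,
      ⟨_, le_rfl, le_rfl, Mach.rL1_2_6⟩, ⟨_, le_rfl, le_rfl, Mach.rL1_3_6⟩,
      ⟨_, le_rfl, le_rfl, Mach.rL1_4_6⟩]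
  · refine ⟨7, 18, ?_⟩
    interval_cases bb
    exacts [⟨_, h1, h11, Mach.rL1_0_7⟩, ⟨_, h1, h11, Mach.rL1_1_7⟩, ⟨_, h1, h11, Mach.rL1_2_7⟩,
      ⟨_, h1, h11, Mach.rL1_3_7⟩, ⟨_, h1, h11, Mach.rL1_4_7⟩]

theorem Mach.exZ (mode : Bool) (bb : ℕ) (h : bb ≤ bif mode then 4 else 5) :
    ∃ os, Mach.run ⟨mode, 19, 0, []⟩ os (Mach.stI bb 0 (Mach.Vs mode bb)) [] = true := by
  cases mode
  · simp only [cond_false] at h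
    interval_cases bb
    exacts [⟨_, Mach.rL0_0_19⟩, ⟨_, Mach.rL0_1_19⟩, ⟨_, Mach.rL0_2_19⟩, ⟨_, Mach.rL0_3_19⟩,
      ⟨_, Mach.rL0_4_19⟩, ⟨_, Mach.rL0_5_19⟩]
  · simp only [cond_true] at h
    interval_cases bb
    exacts [⟨_, Mach.rL1_0_19⟩, ⟨_, Mach.rL1_1_19⟩, ⟨_, Mach.rL1_2_19⟩, ⟨_, Mach.rL1_3_19⟩,
      ⟨_, Mach.rL1_4_19⟩]

section
variable {mode : Bool} {L : ℕ} {Y I : Set (ℤ × ℤ)} {F : ℤ × ℤ → ℝ}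
    {n s : ℤ × ℤ → ℕ} {q0 q1 : ℤ × ℤ} {bb : ℕ}

/-- Points at horizontal distance at least 14 are replaced by points at distance 13. -/
theorem Raw.shrink (R : Raw mode L Y I F n s (0, 1) q1) (hL : 4 ≤ L) {y : ℤ × ℤ} (hy : y ∈ Y)
    (h14 : ¬ |y.1| ≤ 13) : ∃ z ∈ Y, |z.1| = 13 ∧ ∀ k : ℤ × ℤ, |k.1| ≤ 12 →
      cr3 (0, 1) k y < 0 → cr3 (0, 1) k z < 0 := by
  obtain ⟨ε, D, hε, hD, hx⟩ : ∃ ε D : ℤ, ε * ε = 1 ∧ 14 ≤ D ∧ y.1 = ε * D := by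
    rcases lt_or_ge y.1 0 with h | h
    · rw [abs_of_neg h] at h14
      exact ⟨-1, -y.1, by norm_num, by omega, by ring⟩
    · rw [abs_of_nonneg h] at h14
      exact ⟨1, y.1, by norm_num, by omega, by ring⟩
  obtain ⟨x, w⟩ := y
  simp only at hx
  subst hx
  have h13 : |ε * 13| = 13 := by
    rcases mul_self_eq_one_iff.1 hε with h | h <;> subst h <;> norm_num
  have hdv : D ∣ -w - (-w) % D := Int.dvd_self_sub_emod
  obtain ⟨c, hc⟩ := hdv
  have hdv : D ∣ w + (-w) % D := ⟨-c, by linarith⟩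
  obtain ⟨H1, -, H3⟩ := R.viable hL hε hy hdv
  have hu0 : 0 ≤ (-w) % D := Int.emod_nonneg _ (by omega)
  have huD : (-w) % D < D := Int.emod_lt_of_pos _ (by omega)
  rcases gate hD hu0 huD H1 H3 with hu | hu
  · refine ⟨(ε * 13, -c * 13), ?_, h13, ?_⟩
    · exact (R.comb2 (0, 0) (ε * D, w) (ε * 13, -c * 13) (D - 13) 13 R.zY hy (by omega)
        (by omega) (by omega) (by simp; ring) (by simp; linear_combination -13 * (hu + hc))).1
    · intro k hk hlt
      rw [abs_le] at hk
      have hw : w = D * (-c) := by linarith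
      simp only [cr3] at hlt ⊢
      set g := k.1 * (-c) - (k.2 - 1) * ε with hg
      have e1 : D * g - k.1 < 0 := by
        calc _ = (k.1 - 0) * (w - 1) - (k.2 - 1) * (ε * D - 0) := by rw [hw, hg]; ring
          _ < 0 := hlt
      have e2 : (k.1 - 0) * (-c * 13 - 1) - (k.2 - 1) * (ε * 13 - 0) = 13 * g - k.1 := by
        rw [hg]; ring
      rw [e2]
      rcases lt_trichotomy g 0 with h | h | h
      · omega
      · rw [h] at e1 ⊢; omega
      · nlinarith
  · refine ⟨(ε * 13, 1 + 13 * (-1 - c)), ?_, h13, ?_⟩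
    · exact (R.comb2 (0, 1) (ε * D, w) (ε * 13, 1 + 13 * (-1 - c)) (D - 13) 13 (R.sub R.qI) hy
        (by omega) (by omega) (by omega) (by simp; ring)
        (by simp; linear_combination -13 * (hu + hc))).1
    · intro k hk hlt
      have hw : w = 1 + D * (-1 - c) := by linarith
      simp only [cr3] at hlt ⊢
      set g := k.1 * (-1 - c) - (k.2 - 1) * ε with hg
      have e1 : D * g < 0 := by
        calc _ = (k.1 - 0) * (w - 1) - (k.2 - 1) * (ε * D - 0) := by rw [hw, hg]; ring
          _ < 0 := hlt
      have e2 : (k.1 - 0) * (1 + 13 * (-1 - c) - 1) - (k.2 - 1) * (ε * 13 - 0) = 13 * g := by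
        rw [hg]; ring
      rw [e2]
      have : g < 0 := by
        by_contra hge
        have := mul_nonneg (by omega : 0 ≤ D) (not_lt.1 hge)
        omega
      omega

theorem Raw.trunc (R : Raw mode L Y I F n s (0, 1) q1) (hL : 4 ≤ L) :
    Cfg mode 4 0 (Y ∩ {p | |p.1| ≤ 13}) (I ∩ {p | |p.1| ≤ 13}) F 0 s q1 where
  fin := R.fin.subset inter_subset_left
  sub := inter_subset_inter_left _ R.sub
  comb := by
    intro k l m r a b c hk hl hm ha hb hc hp e1 e2
    obtain ⟨c1, c2, c3⟩ := R.comb k l m r a b c hk.1 hl.1 hm.1 ha hb hc hp e1 e2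
    have hr : |r.1| ≤ 13 := by
      have k1 := abs_le.1 (show |k.1| ≤ 13 from hk.2)
      have l1 := abs_le.1 (show |l.1| ≤ 13 from hl.2)
      have m1 := abs_le.1 (show |m.1| ≤ 13 from hm.2)
      rw [abs_le]
      constructor
      · by_contra hcon
        have : (a + b + c) * (r.1 + 13) < 0 := mul_neg_of_pos_of_neg hp (by omega)
        nlinarith [mul_nonneg ha (by omega : 0 ≤ k.1 + 13), mul_nonneg hb (by omega : 0 ≤ l.1 + 13),
          mul_nonneg hc (by omega : 0 ≤ m.1 + 13)]
      · by_contra hcon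
        have : (a + b + c) * (13 - r.1) < 0 := mul_neg_of_pos_of_neg hp (by omega)
        nlinarith [mul_nonneg ha (by omega : 0 ≤ 13 - k.1), mul_nonneg hb (by omega : 0 ≤ 13 - l.1),
          mul_nonneg hc (by omega : 0 ≤ 13 - m.1)]
    refine ⟨⟨c1, hr⟩, c2, fun h => ⟨c3 ?_, hr⟩⟩
    rcases h with h | h | h | h
    · exact Or.inl ⟨h.1, h.2.1⟩
    · exact Or.inr (Or.inl ⟨h.1, h.2.1⟩)
    · exact Or.inr (Or.inr (Or.inl ⟨h.1, h.2.1⟩))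
    · exact Or.inr (Or.inr (Or.inr h))
  Fnn := fun y hy => R.Fnn y hy.1
  F0 := le_trans (by exact_mod_cast hL) R.F0
  zY := ⟨R.zY, by simp⟩
  zI := fun h => R.zI h.1
  qI := ⟨R.qI, by simp⟩
  Fle := fun r hr => R.Fle r hr.1
  sU := R.sU
  sN := R.sN
  nle := fun y hy => by simpa using (R.Fnn y hy.1).trans (by linarith)
  ncap := fun y hy => by simp
  bey := by
    intro k hk h12
    obtain ⟨y, hy, hc⟩ := R.bey k hk
    by_cases h : |y.1| ≤ 13
    · exact ⟨y, ⟨hy, h⟩, hc⟩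
    · obtain ⟨z, hz, hz13, hh⟩ := R.shrink hL hy h
      exact ⟨z, ⟨hz, hz13.le⟩, hh k h12 hc⟩

theorem Raw.toCfg (R : Raw mode L Y I F n s (0, 1) q1) {LA LB : ℕ} (h1 : LA ≤ L) (h2 : L ≤ LB) :
    Cfg mode LA LB Y I F n s q1 :=
  ⟨R.fin, R.sub, R.comb, R.Fnn, le_trans (by exact_mod_cast h1) R.F0, R.zY, R.zI, R.qI, R.Fle,
    R.sU, R.sN, R.nle, fun y hy => (R.ncap y hy).trans (by omega), fun k hk _ => R.bey k hk⟩

theorem Raw.toCfg0 (R : Raw mode L Y I F n s (0, 1) q1) {LA : ℕ} (h1 : LA ≤ L) :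
    Cfg mode LA 0 Y I F 0 s q1 :=
  ⟨R.fin, R.sub, R.comb, R.Fnn, le_trans (by exact_mod_cast h1) R.F0, R.zY, R.zI, R.qI, R.Fle,
    R.sU, R.sN, fun y hy => by simpa using (R.Fnn y hy).trans (by linarith), fun y hy => by simp,
    fun k hk _ => R.bey k hk⟩

theorem sem_init {Y I : Set (ℤ × ℤ)} {n : ℤ × ℤ → ℕ} {B : List ℕ} {LB : ℕ} (h0 : (0, 0) ∈ Y)
    (hq : (0, 1) ∈ I) (hs : I ⊆ Y) (h1 : (1, 0) ∈ Y) (h2 : (-1, (bb : ℤ)) ∈ Y) (hbb : bb ≤ 8)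
    (hB : ∀ y ∈ Y, ∃ c ∈ B, Mach.dec c = y) (hn : ∀ y ∈ Y, n y ≤ LB + 1) :
    Mach.Sem (Mach.stI bb LB B) Y I n q1 where
  hK := by
    intro k hk
    simp only [Mach.stI, List.mem_cons, List.not_mem_nil, or_false] at hk
    rcases hk with rfl | rfl | rfl | rfl
    · rw [Mach.dec_cO]; exact h0
    · rw [Mach.dec_cQ]; exact hs hq
    · exact h1
    · rw [show 1936 + bb = 15 * 128 + (16 + bb) by ring, dec_code (by omega)]
      convert h2 using 2 <;> omega
  hI := by
    intro k hk
    simp only [Mach.stI, List.mem_cons, List.not_mem_nil, or_false] at hk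
    rw [hk, Mach.dec_cQ]; exact hq
  hB := by
    intro y hy
    obtain ⟨c, hc, h⟩ := hB y hy
    exact ⟨(c, LB), by simpa [Mach.stI] using hc, h⟩
  hU := by
    intro e he hY
    simp only [Mach.stI, List.mem_map] at he
    obtain ⟨c, -, rfl⟩ := he
    exact hn _ hY
  hq := by simp [Mach.stI]
  hns := by simp [Mach.stI]

theorem Nrm.bb_le (N : Nrm mode L Y I F n s q1 bb) : bb ≤ Mach.EE mode := by
  have := (N.R.height N.hL N.r1 N.l1).2
  omega

theorem Nrm.inVs' (N : Nrm mode L Y I F n s q1 bb) {p : ℤ × ℤ} (hp : p ∈ Y) (h13 : |p.1| ≤ 13) :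
    ∃ c ∈ Mach.Vs mode bb, Mach.dec c = p := by
  by_contra hcon
  push Not at hcon
  obtain ⟨os, hos⟩ := Mach.exV mode bb N.bb_le
  have C := N.R.trunc N.hL
  have hE : Mach.EE mode ≤ 8 := by cases mode <;> simp [Mach.EE]
  refine (Mach.run_sound C ⟨⟨C.fin.toFinset, by simp, by simp⟩, ?_⟩ os _ _ hos).1
    (sem_init C.zY C.qI C.sub ⟨N.r1, by simp⟩ ⟨N.l1, by simp⟩ (N.bb_le.trans hE)
      (fun y hy => N.mem_B0 hy.1 hy.2) (by simp))
  intro T hT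
  simp only [List.mem_cons, List.not_mem_nil, or_false] at hT
  subst hT
  exact ⟨p, ⟨hp, h13⟩, hcon⟩

theorem Nrm.inVs (N : Nrm mode L Y I F n s q1 bb) {p : ℤ × ℤ} (hp : p ∈ Y) :
    ∃ c ∈ Mach.Vs mode bb, Mach.dec c = p := by
  by_cases h13 : |p.1| ≤ 13
  · exact N.inVs' hp h13
  · exfalso
    obtain ⟨z, hz, hz13, -⟩ := N.R.shrink N.hL hp h13
    obtain ⟨c, hc, hcz⟩ := N.inVs' hz hz13.le
    have := Mach.Vs_px mode bb N.bb_le c hc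
    rw [← hcz] at hz13
    simp only [Mach.dec] at hz13
    rcases abs_eq (by norm_num) |>.1 hz13 with h | h <;> omega

theorem Nrm.bb_le' (N : Nrm mode L Y I F n s q1 bb) : bb ≤ bif mode then 4 else 5 := by
  have h := N.bb_le
  obtain ⟨c, hc, -⟩ := N.inVs N.R.zY
  cases mode
  · simp only [Mach.EE, cond_false] at h ⊢
    by_contra hcon
    interval_cases bb <;> simp_all [Mach.Vs]
  · simpa [Mach.EE] using h

/-- The outcome of the certificate runs. -/
theorem Nrm.main (N : Nrm mode L Y I F n s q1 bb) (A : Finset (ℤ × ℤ)) (hA : (A : Set (ℤ × ℤ)) = Y)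
    (h55 : 55 ≤ ∑ y ∈ A, n y) :
    mode = false ∧ 11 ≤ L ∧ L ≤ 18 ∧ ∃ T ∈ Mach.Tex, ∀ y ∈ Y, ∃ t ∈ T, Mach.dec t = y := by
  have hb := N.bb_le'
  have hb8 : bb ≤ 8 := hb.trans (by cases mode <;> simp)
  have hsem : ∀ LB, L ≤ LB → Mach.Sem (Mach.stI bb LB (Mach.Vs mode bb)) Y I n q1 := fun LB h =>
    sem_init N.R.zY N.R.qI N.R.sub N.r1 N.l1 hb8 (fun y hy => N.inVs hy)
      (fun y hy => (N.R.ncap y hy).trans (by omega))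
  have h19 : L ≤ 18 := by
    by_contra hc
    obtain ⟨os, hos⟩ := Mach.exZ mode bb hb
    refine (Mach.run_sound (N.R.toCfg0 (LA := 19) (by omega))
      ⟨⟨A, hA, by simp⟩, by simp⟩ os _ _ hos).1 ?_
    exact sem_init N.R.zY N.R.qI N.R.sub N.r1 N.l1 hb8 (fun y hy => N.inVs hy) (by simp)
  cases mode with
  | true =>
    exfalso
    obtain ⟨LA, LB, os, ha, hb', hos⟩ := Mach.exN bb L hb N.hL h19
    exact (Mach.run_sound (N.R.toCfg ha hb') ⟨⟨A, hA, h55⟩, by simp⟩ os _ _ hos).1 (hsem _ hb')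
  | false =>
    have h11 : 11 ≤ L := by
      by_contra hc
      obtain ⟨LA, LB, os, ha, hb', hos⟩ := Mach.exU bb L hb N.hL (by omega)
      exact (Mach.run_sound (N.R.toCfg ha hb') ⟨⟨A, hA, h55⟩, by simp⟩ os _ _ hos).1 (hsem _ hb')
    refine ⟨rfl, h11, h19, ?_⟩
    by_contra hcon
    push Not at hcon
    obtain ⟨LA, LB, os, ha, hb', hos⟩ := Mach.exT bb L hb h11 h19
    exact (Mach.run_sound (N.R.toCfg ha hb') ⟨⟨A, hA, h55⟩, hcon⟩ os _ _ hos).1 (hsem _ hb')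
end

/-! ## The extremal planar configuration -/

/-- The lattice points of the projection of the extremal simplex. -/
def Std7 : Finset (ℤ × ℤ) := {(0, 0), (1, 0), (2, 0), (0, 1), (0, 2), (0, 3), (1, 1)}

/-- The planar description of the extremal configuration. -/
def Concl (L : ℕ) (Y : Set (ℤ × ℤ)) (F : ℤ × ℤ → ℝ) (n : ℤ × ℤ → ℕ) : Prop :=
  L = 18 ∧ ∃ a b c d : ℤ, (a * d - b * c) * (a * d - b * c) = 1 ∧
    gl a b c d ⁻¹' Y = Std7 ∧ (∀ p ∈ Std7, F (gl a b c d p) ≤ 18 - 9 * p.1 - 6 * p.2) ∧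
    (∀ p ∈ Std7, (n (gl a b c d p) : ℤ) = 19 - 9 * p.1 - 6 * p.2)

theorem Concl.push {L : ℕ} {Y : Set (ℤ × ℤ)} {F : ℤ × ℤ → ℝ} {n : ℤ × ℤ → ℕ} {a b c d : ℤ}
    (h1 : (a * d - b * c) * (a * d - b * c) = 1)
    (h : Concl L (gl a b c d ⁻¹' Y) (F ∘ gl a b c d) (n ∘ gl a b c d)) : Concl L Y F n := by
  obtain ⟨hL, a', b', c', d', e1, e2, e4, e5⟩ := h
  have hcomp : ∀ p, gl a b c d (gl a' b' c' d' p) =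
      gl (a * a' + b * c') (a * b' + b * d') (c * a' + d * c') (c * b' + d * d') p := by
    intro p; simp only [gl]; ext <;> simp <;> ring
  simp only [Function.comp, hcomp] at e4 e5
  refine ⟨hL, _, _, _, _, ?_, ?_, e4, e5⟩
  · calc _ = ((a * d - b * c) * (a * d - b * c)) * ((a' * d' - b' * c') * (a' * d' - b' * c')) := by
          ring
      _ = 1 := by rw [h1, e1]; norm_num
  · rw [← e2]
    ext p
    simp only [mem_preimage, hcomp]

section
variable {mode : Bool} {L : ℕ} {Y I : Set (ℤ × ℤ)} {F : ℤ × ℤ → ℝ}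
    {n s : ℤ × ℤ → ℕ} {q0 q1 : ℤ × ℤ} {bb : ℕ}

theorem sum_pull {a b c d e : ℤ} (h : a * d - b * c = e) (he : e * e = 1) (A : Finset (ℤ × ℤ))
    (hA : (A : Set (ℤ × ℤ)) = Y) : ∃ A' : Finset (ℤ × ℤ), (A' : Set (ℤ × ℤ)) = gl a b c d ⁻¹' Y ∧
      ∑ y ∈ A', (n ∘ gl a b c d) y = ∑ y ∈ A, n y := by
  refine ⟨A.preimage (gl a b c d) (gl_inj h he).injOn, by simp [hA], ?_⟩
  exact Finset.sum_preimage _ _ (gl_inj h he).injOn n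
    (fun x _ hx => (hx ⟨_, gl_inv h he x⟩).elim)

theorem Raw.std7 (R : Raw false L Y I F n s (1, 1) q1) (hY : Y ⊆ Std7) (A : Finset (ℤ × ℤ))
    (hA : (A : Set (ℤ × ℤ)) = Y) (h55 : 55 ≤ ∑ y ∈ A, n y) :
    ∑ y ∈ A, n y = 55 ∧ Concl L Y F n := by
  have mem : ∀ p : ℤ × ℤ, p ∈ Y → p = (0, 0) ∨ p = (1, 0) ∨ p = (2, 0) ∨ p = (0, 1) ∨ p = (0, 2) ∨
      p = (0, 3) ∨ p = (1, 1) := by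
    intro p hp; simpa [Std7] using hY hp
  have y2 : (2, 0) ∈ Y := by
    obtain ⟨y, hy, hc⟩ := R.bey (1, 2) (by decide)
    rcases mem y hy with h | h | h | h | h | h | h <;> subst h <;> simp [cr3] at hc
    exact hy
  have y3 : (0, 3) ∈ Y := by
    obtain ⟨y, hy, hc⟩ := R.bey (0, 2) (by decide)
    rcases mem y hy with h | h | h | h | h | h | h <;> subst h <;> simp [cr3] at hc
    exact hy
  have yu : (1, 0) ∈ Y := (R.comb2 (0, 0) (2, 0) (1, 0) 1 1 R.zY y2 (by norm_num) (by norm_num)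
    (by norm_num) (by norm_num) (by norm_num)).1
  have yv : (0, 1) ∈ Y := (R.comb2 (0, 0) (0, 3) (0, 1) 2 1 R.zY y3 (by norm_num) (by norm_num)
    (by norm_num) (by norm_num) (by norm_num)).1
  have yw : (0, 2) ∈ Y := (R.comb2 (0, 0) (0, 3) (0, 2) 1 2 R.zY y3 (by norm_num) (by norm_num)
    (by norm_num) (by norm_num) (by norm_num)).1
  have yq := R.sub R.qI
  have hYeq : Y = Std7 := by
    refine Subset.antisymm hY ?_
    intro p hp
    simp only [Std7, Finset.coe_insert, Finset.coe_singleton, mem_insert_iff,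
      mem_singleton_iff] at hp
    rcases hp with h | h | h | h | h | h | h <;> subst h
    exacts [R.zY, yu, y2, yv, yw, y3, yq]
  have hAeq : A = Std7 := by rw [hYeq] at hA; exact_mod_cast hA
  have hsum : ∑ y ∈ A, n y = n (0, 0) + (n (1, 0) + (n (2, 0) + (n (0, 1) + (n (0, 2) +
      (n (0, 3) + n (1, 1)))))) := by
    rw [hAeq, Std7]
    rw [Finset.sum_insert (by decide), Finset.sum_insert (by decide), Finset.sum_insert (by decide),
      Finset.sum_insert (by decide), Finset.sum_insert (by decide), Finset.sum_insert (by decide),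
      Finset.sum_singleton]
  have c0 : F (1, 1) ≤ 3 := by simpa [_root_.capq] using R.capq
  have c1 := (R.comb (0, 3) (2, 0) (0, 0) (1, 1) 2 3 1 y3 y2 R.zY (by norm_num) (by norm_num)
    (by norm_num) (by norm_num) (by norm_num) (by norm_num)).2.1
  have c2 := (R.comb (1, 0) (2, 0) (0, 3) (1, 1) 1 1 1 yu y2 y3 (by norm_num) (by norm_num)
    (by norm_num) (by norm_num) (by norm_num) (by norm_num)).2.1
  have c3 := (R.comb (0, 1) (0, 3) (2, 0) (1, 1) 1 1 2 yv y3 y2 (by norm_num) (by norm_num)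
    (by norm_num) (by norm_num) (by norm_num) (by norm_num)).2.1
  have c4 := (R.comb2 (0, 2) (2, 0) (1, 1) 1 1 yw y2 (by norm_num) (by norm_num)
    (by norm_num) (by norm_num) (by norm_num)).2.1
  push_cast at c1 c2 c3 c4
  have f2 := R.Fnn _ y2
  have f3 := R.Fnn _ y3
  have fz := R.F0
  have n0 := R.ncap _ R.zY
  have n1 := R.nle _ yu
  have n2 := R.nle _ y2
  have n3 := R.nle _ yv
  have n4 := R.nle _ yw
  have n5 := R.nle _ y3
  have n6 := R.nle _ yq
  have m1 : n (1, 0) ≤ 10 := by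
    have : (n (1, 0) : ℝ) ≤ 10 := by linarith
    exact_mod_cast this
  have m3 : n (0, 1) ≤ 13 := by
    have : (n (0, 1) : ℝ) ≤ 13 := by linarith
    exact_mod_cast this
  have m4 : n (0, 2) ≤ 7 := by
    have : (n (0, 2) : ℝ) ≤ 7 := by linarith
    exact_mod_cast this
  have m6 : n (1, 1) ≤ 4 := by
    have : (n (1, 1) : ℝ) ≤ 4 := by linarith
    exact_mod_cast this
  have m2 : 3 * n (2, 0) + L ≤ 21 := by
    have : 3 * (n (2, 0) : ℝ) + L ≤ 21 := by linarith
    exact_mod_cast this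
  have m5 : 2 * n (0, 3) + L ≤ 20 := by
    have : 2 * (n (0, 3) : ℝ) + L ≤ 20 := by linarith
    exact_mod_cast this
  have m7 : L ≤ 18 := by
    have : (L : ℝ) ≤ 18 := by linarith
    exact_mod_cast this
  have hL18 : L = 18 := by omega
  subst hL18
  push_cast at fz
  have hgl : ∀ p, gl 1 0 0 1 p = p := by intro p; simp [gl]
  refine ⟨by omega, rfl, 1, 0, 0, 1, by norm_num, ?_, ?_, ?_⟩
  · rw [← hYeq]; ext p; simp [gl]
  · intro p hp
    rw [hgl]
    rcases mem p (by rw [hYeq]; exact_mod_cast hp) with h | h | h | h | h | h | h <;> subst h <;>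
      norm_num <;> linarith
  · intro p hp
    rw [hgl]
    rcases mem p (by rw [hYeq]; exact_mod_cast hp) with h | h | h | h | h | h | h <;> subst h <;>
      norm_num <;> omega

theorem Nrm.final (N : Nrm mode L Y I F n s q1 bb) (A : Finset (ℤ × ℤ))
    (hA : (A : Set (ℤ × ℤ)) = Y) (h55 : 55 ≤ ∑ y ∈ A, n y) :
    ∑ y ∈ A, n y = 55 ∧ Concl L Y F n := by
  obtain ⟨hm, h11, h18, T, hT, hYT⟩ := N.main A hA h55
  subst hm
  have key : ∀ a b c d e : ℤ, a * d - b * c = e → e * e = 1 → gl a b c d (1, 1) = (0, 1) →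
      (∀ t ∈ T, gl (e * d) (-(e * b)) (-(e * c)) (e * a) (Mach.dec t) ∈ Std7) →
      ∑ y ∈ A, n y = 55 ∧ Concl L Y F n := by
    intro a b c d e h he hq hh
    obtain ⟨A', hA', hs⟩ := sum_pull (n := n) h he A hA
    have R := N.R.pull h he hq (gl_inv h he q1)
    obtain ⟨c1, c2⟩ := R.std7 (fun p hp => by
      obtain ⟨t, ht, htp⟩ := hYT _ hp
      have := hh t ht
      rwa [htp, gl_inv' h he] at this) A' hA' (by rw [hs]; exact h55)
    exact ⟨hs ▸ c1, c2.push (h ▸ he)⟩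
  simp only [Mach.Tex, List.mem_cons, List.not_mem_nil, or_false] at hT
  rcases hT with rfl | rfl
  · exact key 1 (-1) 0 1 1 (by norm_num) (by norm_num) (by decide) (by decide)
  · exact key (-1) 1 1 0 (-1) (by norm_num) (by norm_num) (by decide) (by decide)

theorem Raw.nrm (R : Raw mode L Y I F n s (0, 1) q1) (hL : 4 ≤ L) : ∃ (k : ℤ) (q1' : ℤ × ℤ) (bb : ℕ),
    Nrm mode L (gl 1 0 k 1 ⁻¹' Y) (gl 1 0 k 1 ⁻¹' I) (F ∘ gl 1 0 k 1) (n ∘ gl 1 0 k 1)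
      (s ∘ gl 1 0 k 1) q1' bb := by
  have fin : ∀ ε : ℤ, {t : ℤ | (ε, t) ∈ Y}.Finite := fun ε =>
    R.fin.preimage (fun x _ y _ h => (Prod.ext_iff.1 h).2)
  have hneR : {t : ℤ | (1, t) ∈ Y}.Nonempty := by
    obtain ⟨⟨x, y⟩, hy, hc⟩ := R.bey (0, 2) (by decide)
    simp [cr3] at hc
    obtain ⟨t, m, ht, -⟩ := R.col hL (ε := 1) (D := x) (y := y) (by simpa using hy) hc
    exact ⟨t, ht⟩
  have hneL : {t : ℤ | (-1, t) ∈ Y}.Nonempty := by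
    obtain ⟨⟨x, y⟩, hy, hc⟩ := R.bey (0, 0) (by decide)
    simp [cr3] at hc
    obtain ⟨t, m, ht, -⟩ := R.col hL (ε := -1) (D := -x) (y := y) (by simpa using hy) (by omega)
    exact ⟨t, ht⟩
  obtain ⟨r, hr, hr'⟩ := Set.exists_min_image _ id (fin 1) hneR
  obtain ⟨l, hl, hl'⟩ := Set.exists_min_image _ id (fin (-1)) hneL
  simp only [mem_ofPred_eq, id] at hr hr' hl hl'
  have hpos := (R.height hL hr hl).1
  have h : (1:ℤ) * 1 - 0 * r = 1 := by norm_num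
  refine ⟨r, _, (l + r).toNat, R.pull h (by norm_num) (by simp [gl]) (gl_inv h (by norm_num) q1), hL,
    ?_, ?_, ?_, ?_⟩
  · simpa [gl] using hr
  · intro t ht
    have := hr' (r + t) (by simpa [gl] using ht)
    omega
  · simp only [mem_preimage, gl]
    convert hl using 2
    · norm_num
    · omega
  · intro t ht
    have := hl' (-r + t) (by simpa [gl] using ht)
    omega

/-- The planar theorem. -/
theorem Raw.final (R : Raw mode L Y I F n s q0 q1) (hL : 4 ≤ L) (A : Finset (ℤ × ℤ))
    (hA : (A : Set (ℤ × ℤ)) = Y) (h55 : 55 ≤ ∑ y ∈ A, n y) :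
    ∑ y ∈ A, n y = 55 ∧ Concl L Y F n := by
  have hp := R.prim hL
  have hb := Int.gcd_eq_gcd_ab q0.1 q0.2
  rw [hp] at hb
  push_cast at hb
  have h1 : q0.1.gcdB q0.2 * q0.2 - q0.1 * (-q0.1.gcdA q0.2) = 1 := by linarith
  have he : (1:ℤ) * 1 = 1 := by norm_num
  have R1 := R.pull (q0' := (0, 1)) h1 he (by simp [gl]) (gl_inv h1 he q1)
  obtain ⟨A1, hA1, hs1⟩ := sum_pull (n := n) h1 he A hA
  obtain ⟨k, q1', bb, N⟩ := R1.nrm hL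
  have h2 : (1:ℤ) * 1 - 0 * k = 1 := by norm_num
  obtain ⟨A2, hA2, hs2⟩ := sum_pull (n := n ∘ gl _ _ _ _) h2 he A1 hA1
  obtain ⟨c1, c2⟩ := N.final A2 hA2 (by rw [hs2, hs1]; exact h55)
  refine ⟨by rw [← hs1, ← hs2]; exact c1, ?_⟩
  exact (c2.push (by rw [h2]; norm_num)).push (by rw [h1]; norm_num)
end

/-! ## Affine unimodular maps -/

/-- An integral affine map of `ℝ³`. -/
def uni (A : Matrix (Fin 3) (Fin 3) ℤ) (b : Fin 3 → ℤ) (x : Fin 3 → ℝ) : Fin 3 → ℝ :=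
  (A.map (Int.cast : ℤ → ℝ)).mulVec x + castPt b

theorem castPt_inj {d : ℕ} {v w : Fin d → ℤ} (h : castPt v = castPt w) : v = w := by
  ext i
  have := congrFun h i
  simpa [castPt] using this

theorem castPt_add {d : ℕ} (v w : Fin d → ℤ) : castPt (v + w) = castPt v + castPt w := by
  ext i; simp [castPt]

theorem castPt_mulVec {d e : ℕ} (A : Matrix (Fin e) (Fin d) ℤ) (v : Fin d → ℤ) :
    castPt (A.mulVec v) = (A.map (Int.cast : ℤ → ℝ)).mulVec (castPt v) := by
  ext i; simp [castPt, Matrix.mulVec, dotProduct]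

theorem uni_cast (A : Matrix (Fin 3) (Fin 3) ℤ) (b v : Fin 3 → ℤ) :
    uni A b (castPt v) = castPt (A.mulVec v + b) := by
  rw [castPt_add, castPt_mulVec]; rfl

theorem uni_comp (A A' : Matrix (Fin 3) (Fin 3) ℤ) (b b' : Fin 3 → ℤ) (x : Fin 3 → ℝ) :
    uni A b (uni A' b' x) = uni (A * A') (A.mulVec b' + b) x := by
  have h : (A * A').map (Int.cast : ℤ → ℝ) = A.map (Int.cast : ℤ → ℝ) * A'.map (Int.cast : ℤ → ℝ) :=
    Matrix.map_mul_intCast A A'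
  simp only [uni, castPt_add, castPt_mulVec, Matrix.mulVec_add, h, Matrix.mulVec_mulVec, add_assoc]

theorem uni_one (x : Fin 3 → ℝ) : uni 1 0 x = x := by
  ext i
  simp [uni, castPt]

theorem uni_inv {A : Matrix (Fin 3) (Fin 3) ℤ} (h : IsUnit A.det) (b : Fin 3 → ℤ) (x : Fin 3 → ℝ) :
    uni A⁻¹ (-(A⁻¹.mulVec b)) (uni A b x) = x := by
  rw [uni_comp, Matrix.nonsing_inv_mul _ h, add_neg_cancel, uni_one]

theorem uni_inv' {A : Matrix (Fin 3) (Fin 3) ℤ} (h : IsUnit A.det) (b : Fin 3 → ℤ) (x : Fin 3 → ℝ) :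
    uni A b (uni A⁻¹ (-(A⁻¹.mulVec b)) x) = x := by
  rw [uni_comp, Matrix.mul_nonsing_inv _ h, Matrix.mulVec_neg, Matrix.mulVec_mulVec,
    Matrix.mul_nonsing_inv _ h, Matrix.one_mulVec, neg_add_cancel, uni_one]

theorem uni_continuous (A : Matrix (Fin 3) (Fin 3) ℤ) (b : Fin 3 → ℤ) : Continuous (uni A b) := by
  unfold uni
  exact (Continuous.matrix_mulVec continuous_const continuous_id).add continuous_const

/-- A unimodular map as a homeomorphism. -/
def uniH {A : Matrix (Fin 3) (Fin 3) ℤ} (h : IsUnit A.det) (b : Fin 3 → ℤ) :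
    (Fin 3 → ℝ) ≃ₜ (Fin 3 → ℝ) where
  toFun := uni A b
  invFun := uni A⁻¹ (-(A⁻¹.mulVec b))
  left_inv := uni_inv h b
  right_inv := uni_inv' h b
  continuous_toFun := uni_continuous _ _
  continuous_invFun := uni_continuous _ _

/-- An integral affine map as an affine map. -/
def uniA (A : Matrix (Fin 3) (Fin 3) ℤ) (b : Fin 3 → ℤ) : (Fin 3 → ℝ) →ᵃ[ℝ] (Fin 3 → ℝ) :=
  (Matrix.toLin' (A.map (Int.cast : ℤ → ℝ))).toAffineMap + AffineMap.const ℝ _ (castPt b)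

theorem uniA_apply (A : Matrix (Fin 3) (Fin 3) ℤ) (b : Fin 3 → ℤ) : ⇑(uniA A b) = uni A b := by
  ext x i
  simp [uniA, uni]

theorem uni_hull (A : Matrix (Fin 3) (Fin 3) ℤ) (b : Fin 3 → ℤ) (s : Set (Fin 3 → ℝ)) :
    uni A b '' convexHull ℝ s = convexHull ℝ (uni A b '' s) := by
  rw [← uniA_apply]; exact (uniA A b).image_convexHull s

theorem uni_interior {A : Matrix (Fin 3) (Fin 3) ℤ} (h : IsUnit A.det) (b : Fin 3 → ℤ)
    (s : Set (Fin 3 → ℝ)) : uni A b '' interior s = interior (uni A b '' s) :=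
  (uniH h b).image_interior s

theorem uni_lattice (A : Matrix (Fin 3) (Fin 3) ℤ) (b : Fin 3 → ℤ) {P : Set (Fin 3 → ℝ)}
    (h : IsLatticePolytope P) : IsLatticePolytope (uni A b '' P) := by
  classical
  obtain ⟨V, hV, rfl⟩ := h
  refine ⟨V.image (fun v => A.mulVec v + b), hV.image _, ?_⟩
  rw [uni_hull, Finset.coe_image, image_image, image_image]
  congr 1
  apply image_congr
  intro v _
  exact uni_cast A b v

theorem uni_mem {A : Matrix (Fin 3) (Fin 3) ℤ} (h : IsUnit A.det) (b : Fin 3 → ℤ)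
    {s : Set (Fin 3 → ℝ)} {x : Fin 3 → ℝ} : uni A b x ∈ uni A b '' s ↔ x ∈ s :=
  (uniH h b).injective.mem_set_image

theorem uni_pts {A : Matrix (Fin 3) (Fin 3) ℤ} (h : IsUnit A.det) (b : Fin 3 → ℤ)
    (s : Set (Fin 3 → ℝ)) : {v : Fin 3 → ℤ | castPt v ∈ uni A b '' s} =
      (fun v => A.mulVec v + b) '' {v : Fin 3 → ℤ | castPt v ∈ s} := by
  ext v
  simp only [mem_ofPred_eq, mem_image]
  constructor
  · rintro ⟨x, hx, hxv⟩
    refine ⟨A⁻¹.mulVec v + -(A⁻¹.mulVec b), ?_, ?_⟩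
    · rw [← uni_cast, ← hxv, uni_inv h]; exact hx
    · apply castPt_inj
      rw [← uni_cast, ← uni_cast, uni_inv' h]
  · rintro ⟨w, hw, rfl⟩
    exact ⟨castPt w, hw, uni_cast A b w⟩

theorem uni_pts_inj {A : Matrix (Fin 3) (Fin 3) ℤ} (h : IsUnit A.det) (b : Fin 3 → ℤ) :
    Function.Injective (fun v => A.mulVec v + b) := by
  intro v w hvw
  apply castPt_inj
  apply (uniH h b).injective
  change uni A b _ = uni A b _
  rw [uni_cast, uni_cast]
  exact congrArg castPt hvw

theorem uni_ncard {A : Matrix (Fin 3) (Fin 3) ℤ} (h : IsUnit A.det) (b : Fin 3 → ℤ)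
    (s : Set (Fin 3 → ℝ)) : {v : Fin 3 → ℤ | castPt v ∈ uni A b '' s}.ncard =
      {v : Fin 3 → ℤ | castPt v ∈ s}.ncard := by
  rw [uni_pts h, ncard_image_of_injective _ (uni_pts_inj h b)]

theorem uni_int {A : Matrix (Fin 3) (Fin 3) ℤ} (h : IsUnit A.det) (b : Fin 3 → ℤ)
    (s : Set (Fin 3 → ℝ)) : (intLatPts (uni A b '' s)).ncard = (intLatPts s).ncard := by
  have := uni_ncard h b (interior s)
  rw [uni_interior h] at this
  exact this

theorem UnimodEquiv.trans3 {P Q R : Set (Fin 3 → ℝ)} (h1 : UnimodEquiv P Q)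
    (h2 : UnimodEquiv Q R) : UnimodEquiv P R := by
  obtain ⟨A, b, hA, h⟩ := h1
  obtain ⟨A', b', hA', h'⟩ := h2
  refine ⟨A' * A, A'.mulVec b + b', by rw [Matrix.det_mul]; exact hA'.mul hA, ?_⟩
  rw [← h', ← h, image_image]
  apply image_congr
  intro x _
  exact (uni_comp A' A b' b x).symm

theorem UnimodEquiv.symm3 {P Q : Set (Fin 3 → ℝ)} (h1 : UnimodEquiv P Q) : UnimodEquiv Q P := by
  obtain ⟨A, b, hA, h⟩ := h1
  refine ⟨A⁻¹, -(A⁻¹.mulVec b), by simpa using hA, ?_⟩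
  rw [← h, image_image]
  convert image_id P using 1
  apply image_congr
  intro x _
  exact uni_inv hA b x

/-- A lattice polytope with exactly two interior lattice points. -/
structure TwoPt (P : Set (Fin 3 → ℝ)) : Prop where
  lat : IsLatticePolytope P
  two : (intLatPts P).ncard = 2

theorem TwoPt.uni {P : Set (Fin 3 → ℝ)} (h : TwoPt P) {A : Matrix (Fin 3) (Fin 3) ℤ}
    (hA : IsUnit A.det) (b : Fin 3 → ℤ) : TwoPt (uni A b '' P) :=
  ⟨uni_lattice A b h.lat, by rw [uni_int hA, h.two]⟩

/-- Lattice points of `P`. -/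
def latPts (P : Set (Fin 3 → ℝ)) : Set (Fin 3 → ℤ) := {v | castPt v ∈ P}

theorem IsLatticePolytope.convex {d : ℕ} {P : Set (Fin d → ℝ)} (h : IsLatticePolytope P) :
    Convex ℝ P := by
  obtain ⟨V, -, rfl⟩ := h; exact convex_convexHull ℝ _

theorem IsLatticePolytope.compact {d : ℕ} {P : Set (Fin d → ℝ)} (h : IsLatticePolytope P) :
    IsCompact P := by
  obtain ⟨V, -, rfl⟩ := h
  exact (V.finite_toSet.image _).isCompact_convexHull ℝ

theorem compact_pts_finite {d : ℕ} {P : Set (Fin d → ℝ)} (h : IsCompact P) :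
    {v : Fin d → ℤ | castPt v ∈ P}.Finite := by
  obtain ⟨R, hR⟩ := h.isBounded.subset_closedBall 0
  refine (Set.finite_Icc (fun _ : Fin d => -⌈R⌉) (fun _ => ⌈R⌉)).subset ?_
  intro v hv
  have hv' := hR hv
  rw [mem_closedBall_zero_iff] at hv'
  have : ∀ i, |(v i : ℝ)| ≤ R := fun i => (norm_le_pi_norm (castPt v) i).trans hv'
  constructor
  · intro i
    have h1 := (abs_le.1 (this i)).1
    have h2 := Int.le_ceil R
    have : (-⌈R⌉ : ℝ) ≤ v i := by linarith
    exact_mod_cast this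
  · intro i
    have h1 := (abs_le.1 (this i)).2
    have h2 := Int.le_ceil R
    have : (v i : ℝ) ≤ ⌈R⌉ := by linarith
    exact_mod_cast this

/-! ## Projection along a chord -/

/-- The point over the lattice point `q` at height `t`. -/
def pt (q : ℤ × ℤ) (t : ℝ) : Fin 3 → ℝ := ![(q.1 : ℝ), (q.2 : ℝ), t]

theorem castPt_eq_pt (v : Fin 3 → ℤ) : castPt v = pt (v 0, v 1) (v 2) := by
  ext i; fin_cases i <;> simp [castPt, pt]

theorem pt_int (q : ℤ × ℤ) (t : ℤ) : pt q t = castPt ![q.1, q.2, t] := by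
  ext i; fin_cases i <;> simp [castPt, pt]

theorem conv3 {E : Type*} [AddCommGroup E] [Module ℝ E] {s : Set E} (hs : Convex ℝ s) {x y z : E}
    (hx : x ∈ s) (hy : y ∈ s) (hz : z ∈ s) {a b c : ℝ} (ha : 0 ≤ a) (hb : 0 ≤ b) (hc : 0 ≤ c)
    (h : a + b + c = 1) : a • x + b • y + c • z ∈ s := by
  have := hs.sum_mem (t := Finset.univ) (w := ![a, b, c]) (z := ![x, y, z])
    (by intro i _; fin_cases i <;> simpa) (by simp [Fin.sum_univ_three, h])
    (by intro i _; fin_cases i <;> simpa)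
  simpa [Fin.sum_univ_three] using this

theorem conv3_int {s : Set (Fin 3 → ℝ)} (hs : Convex ℝ s) {x y z : Fin 3 → ℝ}
    (hx : x ∈ interior s) (hy : y ∈ s) (hz : z ∈ s) {a b c : ℝ} (ha : 0 < a) (hb : 0 ≤ b)
    (hc : 0 ≤ c) (h : a + b + c = 1) : a • x + b • y + c • z ∈ interior s := by
  rcases eq_or_lt_of_le (add_nonneg hb hc) with h0 | h0
  · have hb0 : b = 0 := by linarith
    have hc0 : c = 0 := by linarith
    have ha1 : a = 1 := by linarith
    simpa [hb0, hc0, ha1] using hx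
  · have hw : (b / (b + c)) • y + (c / (b + c)) • z ∈ s := by
      refine hs hy hz (by positivity) (by positivity) ?_
      field_simp
    have := hs.combo_interior_self_subset_interior ha h0.le (by linarith)
      (Set.add_mem_add (Set.smul_mem_smul_set hx) (Set.smul_mem_smul_set hw))
    convert this using 1
    rw [smul_add, smul_smul, smul_smul, mul_div_cancel₀ _ h0.ne', mul_div_cancel₀ _ h0.ne', add_assoc]

section
variable (P : Set (Fin 3 → ℝ))

/-- The lattice points of the plane over which `P` has a nonempty fibre. -/
def pY : Set (ℤ × ℤ) := {q | ∃ t, pt q t ∈ P}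
/-- The lattice points of the plane over which `interior P` has a nonempty fibre. -/
def pI : Set (ℤ × ℤ) := {q | ∃ t, pt q t ∈ interior P}
def phi (q : ℤ × ℤ) : ℝ := sSup {t | pt q t ∈ P}
def plo (q : ℤ × ℤ) : ℝ := sInf {t | pt q t ∈ P}
def pF (q : ℤ × ℤ) : ℝ := phi P q - plo P q
def pn (q : ℤ × ℤ) : ℕ := {t : ℤ | pt q t ∈ P}.ncard
def ps (q : ℤ × ℤ) : ℕ := {t : ℤ | pt q t ∈ interior P}.ncard
end

section
variable {P : Set (Fin 3 → ℝ)}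

theorem pt_continuous (q : ℤ × ℤ) : Continuous (pt q) := by
  unfold pt
  refine continuous_pi ?_
  intro i
  fin_cases i
  · exact continuous_const
  · exact continuous_const
  · exact continuous_id

theorem pt_combo (q : ℤ × ℤ) {a b : ℝ} (h : a + b = 1) (t t' : ℝ) :
    a • pt q t + b • pt q t' = pt q (a * t + b * t') := by
  ext i
  fin_cases i <;> simp [pt] <;> rw [← add_mul, h, one_mul]

theorem fib_compact (hc : IsCompact P) (q : ℤ × ℤ) : IsCompact {t | pt q t ∈ P} := by
  have h1 : IsClosed {t | pt q t ∈ P} := hc.isClosed.preimage (pt_continuous q)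
  obtain ⟨R, hR⟩ := hc.isBounded.subset_closedBall 0
  refine (isCompact_Icc (a := -R) (b := R)).of_isClosed_subset h1 ?_
  intro t ht
  have hv' := hR ht
  rw [mem_closedBall_zero_iff] at hv'
  have : |t| ≤ R := by simpa [pt] using (norm_le_pi_norm (pt q t) 2).trans hv'
  exact abs_le.1 this

theorem fib_spec (hc : IsCompact P) {q : ℤ × ℤ} (hq : q ∈ pY P) :
    pt q (phi P q) ∈ P ∧ pt q (plo P q) ∈ P ∧ ∀ t, pt q t ∈ P → plo P q ≤ t ∧ t ≤ phi P q := by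
  have h := fib_compact hc q
  obtain ⟨t, ht⟩ := hq
  exact ⟨h.sSup_mem ⟨t, ht⟩, h.sInf_mem ⟨t, ht⟩, fun t ht =>
    ⟨csInf_le h.bddBelow ht, le_csSup h.bddAbove ht⟩⟩

theorem fib_conv (hv : Convex ℝ P) {q : ℤ × ℤ} {t1 t2 t : ℝ} (h1 : pt q t1 ∈ P) (h2 : pt q t2 ∈ P)
    (ha : t1 ≤ t) (hb : t ≤ t2) : pt q t ∈ P := by
  rcases eq_or_lt_of_le (ha.trans hb) with h | h
  · have : t = t1 := by linarith
    rwa [this]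
  · have hd : 0 < t2 - t1 := by linarith
    have := hv h1 h2 (a := (t2 - t) / (t2 - t1)) (b := (t - t1) / (t2 - t1))
      (div_nonneg (by linarith) hd.le) (div_nonneg (by linarith) hd.le) (by field_simp; ring)
    rw [pt_combo q (by field_simp; ring)] at this
    convert this using 2
    field_simp; ring

/-- Open interior of a chord through an interior point. -/
theorem fib_int (hc : IsCompact P) (hv : Convex ℝ P) {q : ℤ × ℤ} (hq : q ∈ pI P) {t : ℝ} :
    pt q t ∈ interior P ↔ plo P q < t ∧ t < phi P q := by
  have hY : q ∈ pY P := by obtain ⟨t, ht⟩ := hq; exact ⟨t, interior_subset ht⟩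
  obtain ⟨s1, s2, s3⟩ := fib_spec hc hY
  have fw : ∀ t, pt q t ∈ interior P → plo P q < t ∧ t < phi P q := by
    intro t ht
    have ho : IsOpen {t | pt q t ∈ interior P} := isOpen_interior.preimage (pt_continuous q)
    obtain ⟨ε, hε, hb⟩ := Metric.isOpen_iff.1 ho t ht
    have b1 := (s3 _ (interior_subset (hb (show t + ε / 2 ∈ Metric.ball t ε by
      rw [Metric.mem_ball, Real.dist_eq, add_sub_cancel_left, abs_of_pos (by linarith)]; linarith)))).2
    have b2 := (s3 _ (interior_subset (hb (show t - ε / 2 ∈ Metric.ball t ε by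
      rw [Metric.mem_ball, Real.dist_eq, abs_sub_comm, sub_sub_cancel, abs_of_pos (by linarith)]
      linarith)))).1
    constructor <;> linarith
  refine ⟨fw t, fun ⟨h1, h2⟩ => ?_⟩
  obtain ⟨t0, ht0⟩ := hq
  obtain ⟨g1, g2⟩ := fw t0 ht0
  have key : ∀ e, pt q e ∈ P → ∀ x, (e < x ∧ x ≤ t0) ∨ (t0 ≤ x ∧ x < e) → pt q x ∈ interior P := by
    intro e he x hx
    have hne : t0 - e ≠ 0 := by
      rcases hx with h | h
      · linarith [h.1, h.2]
      · linarith [h.1, h.2]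
    have ha : 0 < (x - e) / (t0 - e) := by
      rcases hx with h | h
      · exact div_pos (by linarith) (by linarith)
      · exact div_pos_of_neg_of_neg (by linarith) (by linarith)
    have hb : 0 ≤ (t0 - x) / (t0 - e) := by
      rcases hx with h | h
      · exact div_nonneg (by linarith) (by linarith)
      · exact div_nonneg_of_nonpos (by linarith) (by linarith)
    have hab : (x - e) / (t0 - e) + (t0 - x) / (t0 - e) = 1 := by field_simp; ring
    have := hv.combo_interior_self_subset_interior ha hb hab
      (Set.add_mem_add (Set.smul_mem_smul_set ht0) (Set.smul_mem_smul_set he))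
    rw [pt_combo q hab] at this
    convert this using 2
    field_simp; ring
  rcases le_total t t0 with h | h
  · exact key _ s2 t (Or.inl ⟨h1, h⟩)
  · exact key _ s1 t (Or.inr ⟨h, h2⟩)

theorem pt_comb3 {k l m r : ℤ × ℤ} {a b c : ℝ} (h1 : a * k.1 + b * l.1 + c * m.1 = r.1)
    (h2 : a * k.2 + b * l.2 + c * m.2 = r.2) (t u v : ℝ) :
    a • pt k t + b • pt l u + c • pt m v = pt r (a * t + b * u + c * v) := by
  ext i
  fin_cases i <;> simp [pt] <;> assumption

theorem bary_int (hv : Convex ℝ P) {o : Fin 3 → ℝ} (ho : o ∈ interior P) {k l m r : ℤ × ℤ}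
    {t u v a b c : ℝ} (hk : pt k t ∈ P) (hl : pt l u ∈ P) (hm : pt m v ∈ P) (ha : 0 < a) (hb : 0 < b)
    (hc : 0 < c) (h : a + b + c = 1) (h1 : a * k.1 + b * l.1 + c * m.1 = r.1)
    (h2 : a * k.2 + b * l.2 + c * m.2 = r.2) (hD : cr3 k l m ≠ 0) : r ∈ pI P := by
  have hD' : ((l.1 - k.1) * (m.2 - k.2) - (l.2 - k.2) * (m.1 - k.1) : ℝ) ≠ 0 := by
    simp only [cr3] at hD; exact_mod_cast hD
  obtain ⟨D, hDD⟩ : ∃ D : ℝ, D = ((l.1 - k.1) * (m.2 - k.2) - (l.2 - k.2) * (m.1 - k.1) : ℝ) :=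
    ⟨_, rfl⟩
  rw [← hDD] at hD'
  obtain ⟨b', hb'⟩ : ∃ b' : ℝ, b' * D = ((o 0 - k.1) * (m.2 - k.2) - (o 1 - k.2) * (m.1 - k.1)) :=
    ⟨_, div_mul_cancel₀ _ hD'⟩
  obtain ⟨c', hc'⟩ : ∃ c' : ℝ, c' * D = ((l.1 - k.1) * (o 1 - k.2) - (l.2 - k.2) * (o 0 - k.1)) :=
    ⟨_, div_mul_cancel₀ _ hD'⟩
  have e0 : (1 - b' - c') * k.1 + b' * l.1 + c' * m.1 = o 0 := by
    apply mul_right_cancel₀ hD'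
    linear_combination (l.1 - k.1 : ℝ) * hb' + (m.1 - k.1 : ℝ) * hc' + (k.1 - o 0 : ℝ) * hDD
  have e1 : (1 - b' - c') * k.2 + b' * l.2 + c' * m.2 = o 1 := by
    apply mul_right_cancel₀ hD'
    linear_combination (l.2 - k.2 : ℝ) * hb' + (m.2 - k.2 : ℝ) * hc' + (k.2 - o 1 : ℝ) * hDD
  obtain ⟨a', ha'⟩ : ∃ a', a' = 1 - b' - c' := ⟨_, rfl⟩
  rw [← ha'] at e0 e1
  obtain ⟨μ, hμ⟩ : ∃ μ, μ = min a (min b c) := ⟨_, rfl⟩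
  have hμ0 : 0 < μ := by rw [hμ]; exact lt_min ha (lt_min hb hc)
  have hμa : μ ≤ a := hμ ▸ min_le_left _ _
  have hμb : μ ≤ b := hμ ▸ (min_le_right _ _).trans (min_le_left _ _)
  have hμc : μ ≤ c := hμ ▸ (min_le_right _ _).trans (min_le_right _ _)
  obtain ⟨T, hT⟩ : ∃ T, T = 1 + |a - a'| + |b - b'| + |c - c'| := ⟨_, rfl⟩
  have hT0 : 0 < T := by rw [hT]; positivity
  obtain ⟨η, hη⟩ : ∃ η, η * T = μ := ⟨_, div_mul_cancel₀ _ hT0.ne'⟩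
  have hη0 : 0 < η := by
    by_contra hcon
    nlinarith
  have bd : ∀ x : ℝ, |x| ≤ T → -μ ≤ η * x := by
    intro x hx
    have := (abs_le.1 hx).1
    nlinarith
  have ba := bd (a - a') (by rw [hT]; linarith [abs_nonneg (b - b'), abs_nonneg (c - c')])
  have bb := bd (b - b') (by rw [hT]; linarith [abs_nonneg (a - a'), abs_nonneg (c - c')])
  have bc := bd (c - c') (by rw [hT]; linarith [abs_nonneg (b - b'), abs_nonneg (a - a')])
  have hx := conv3 hv hk hl hm (a := a + η * (a - a')) (b := b + η * (b - b'))
    (c := c + η * (c - c')) (by linarith) (by linarith) (by linarith)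
    (by rw [ha']; linear_combination (1 + η) * h)
  have hη1 : (1 + η) ≠ 0 := by linarith
  have hI := hv.combo_interior_self_subset_interior (a := η / (1 + η)) (b := 1 / (1 + η))
    (by positivity) (by positivity) (by field_simp; ring)
    (Set.add_mem_add (Set.smul_mem_smul_set ho) (Set.smul_mem_smul_set hx))
  obtain ⟨w, hw⟩ : ∃ w, w = (η / (1 + η)) • o + (1 / (1 + η)) •
    ((a + η * (a - a')) • pt k t + (b + η * (b - b')) • pt l u + (c + η * (c - c')) • pt m v) :=
    ⟨_, rfl⟩
  replace hI : w ∈ interior P := by rw [hw]; exact hI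
  refine ⟨w 2, ?_⟩
  have : pt r (w 2) = w := by
    ext i
    fin_cases i
    · rw [hw]
      simp [pt]
      field_simp
      linear_combination -(1 + η) * h1 + η * e0
    · rw [hw]
      simp [pt]
      field_simp
      linear_combination -(1 + η) * h2 + η * e1
    · rfl
  rw [this]
  exact hI

end

/-! ## From a polytope with a long chord to planar data -/

section
variable {P : Set (Fin 3 → ℝ)}

theorem int_move {x : Fin 3 → ℝ} (hx : x ∈ interior P) (d : Fin 3 → ℝ) :
    ∃ ε : ℝ, 0 < ε ∧ x + ε • d ∈ interior P := by
  have hc : Continuous fun t : ℝ => x + t • d := by fun_prop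
  have ho : IsOpen {t : ℝ | x + t • d ∈ interior P} := isOpen_interior.preimage hc
  obtain ⟨ε, hε, hb⟩ := Metric.isOpen_iff.1 ho 0 (by simpa using hx)
  refine ⟨ε / 2, by linarith, hb ?_⟩
  rw [Metric.mem_ball, Real.dist_eq, sub_zero, abs_of_pos (by linarith)]
  linarith

/-- A normalised vertical chord of length `L`. -/
structure Chord (P : Set (Fin 3 → ℝ)) (L : ℕ) : Prop where
  tp : TwoPt P
  four : 4 ≤ L
  bot : pt (0, 0) 0 ∈ P
  top : pt (0, 0) L ∈ P
  mid : pt (0, 0) (L / 2) ∉ interior P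
  max : ∀ (q : ℤ × ℤ) (t : ℤ) (k : ℕ), pt q t ∈ P → pt q (t + k) ∈ P →
    pt q (t + k / 2) ∉ interior P → k ≤ L

theorem fib_icc (hc : IsCompact P) (hv : Convex ℝ P) {q : ℤ × ℤ} (hq : q ∈ pY P) :
    {t : ℤ | pt q t ∈ P} = Set.Icc ⌈plo P q⌉ ⌊phi P q⌋ := by
  obtain ⟨s1, s2, s3⟩ := fib_spec hc hq
  ext t
  rw [Set.mem_Icc, Int.ceil_le, Int.le_floor]
  exact ⟨fun h => s3 _ h, fun h => fib_conv hv s2 s1 h.1 h.2⟩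

theorem pn_eq (hc : IsCompact P) (hv : Convex ℝ P) {q : ℤ × ℤ} (hq : q ∈ pY P) :
    pn P q = (⌊phi P q⌋ + 1 - ⌈plo P q⌉).toNat := by
  rw [pn, fib_icc hc hv hq, ← Finset.coe_Icc, Set.ncard_coe_finset, Int.card_Icc]

theorem ps_eq (hc : IsCompact P) (hv : Convex ℝ P) {q : ℤ × ℤ} (hq : q ∈ pI P) :
    ps P q = (⌈phi P q⌉ - ⌊plo P q⌋ - 1).toNat := by
  have : {t : ℤ | pt q t ∈ interior P} = Set.Ioo ⌊plo P q⌋ ⌈phi P q⌉ := by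
    ext t
    rw [Set.mem_Ioo, Int.floor_lt, Int.lt_ceil]
    exact fib_int hc hv hq
  rw [ps, this, ← Finset.coe_Ioo, Set.ncard_coe_finset, Int.card_Ioo]

theorem pI_sub : pI P ⊆ pY P := fun _ ⟨t, ht⟩ => ⟨t, interior_subset ht⟩

theorem pF_nonneg (hc : IsCompact P) {q : ℤ × ℤ} (hq : q ∈ pY P) : 0 ≤ pF P q := by
  obtain ⟨s1, s2, s3⟩ := fib_spec hc hq
  have := (s3 _ s1).1
  unfold pF; linarith

theorem pn_le (hc : IsCompact P) (hv : Convex ℝ P) {q : ℤ × ℤ} (hq : q ∈ pY P) :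
    (pn P q : ℝ) ≤ pF P q + 1 := by
  have h0 := pF_nonneg hc hq
  rw [pn_eq hc hv hq]
  have h1 := Int.floor_le (phi P q)
  have h2 := Int.le_ceil (plo P q)
  rcases le_total 0 (⌊phi P q⌋ + 1 - ⌈plo P q⌉) with h | h
  · have : (((⌊phi P q⌋ + 1 - ⌈plo P q⌉).toNat : ℤ) : ℝ) = (⌊phi P q⌋ + 1 - ⌈plo P q⌉ : ℝ) := by
      rw [Int.toNat_of_nonneg h]; push_cast; rfl
    rw [Int.cast_natCast] at this
    rw [this]; unfold pF; linarith
  · rw [Int.toNat_of_nonpos h]; push_cast; linarith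

theorem pF_le (hc : IsCompact P) (hv : Convex ℝ P) {q : ℤ × ℤ} (hq : q ∈ pI P) :
    pF P q ≤ 1 + ps P q := by
  rw [ps_eq hc hv hq]
  have h1 := Int.le_ceil (phi P q)
  have h2 := Int.floor_le (plo P q)
  have h : ((⌈phi P q⌉ - ⌊plo P q⌋ - 1 : ℤ) : ℝ) ≤ (((⌈phi P q⌉ - ⌊plo P q⌋ - 1).toNat : ℤ) : ℝ) := by
    exact_mod_cast Int.self_le_toNat _
  rw [Int.cast_natCast] at h
  push_cast at h
  unfold pF; linarith

theorem pY_finite (hc : IsCompact P) : (pY P).Finite := by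
  obtain ⟨R, hR⟩ := hc.isBounded.subset_closedBall 0
  refine ((Set.finite_Icc (-⌈R⌉) ⌈R⌉).prod (Set.finite_Icc (-⌈R⌉) ⌈R⌉)).subset ?_
  rintro q ⟨t, ht⟩
  have hv' := hR ht
  rw [mem_closedBall_zero_iff] at hv'
  have h0 : |(q.1 : ℝ)| ≤ R := by simpa [pt] using (norm_le_pi_norm (pt q t) 0).trans hv'
  have h1 : |(q.2 : ℝ)| ≤ R := by simpa [pt] using (norm_le_pi_norm (pt q t) 1).trans hv'
  have key : ∀ z : ℤ, |(z : ℝ)| ≤ R → z ∈ Set.Icc (-⌈R⌉) ⌈R⌉ := by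
    intro z hz
    have h2 := Int.le_ceil R
    have h3 := abs_le.1 hz
    constructor
    · have : (-⌈R⌉ : ℝ) ≤ z := by linarith
      exact_mod_cast this
    · have : (z : ℝ) ≤ ⌈R⌉ := by linarith
      exact_mod_cast this
  exact ⟨key _ h0, key _ h1⟩

theorem p_comb (hc : IsCompact P) (hv : Convex ℝ P) {o : Fin 3 → ℝ} (ho : o ∈ interior P)
    (k l m r : ℤ × ℤ) (a b c : ℤ) (hk : k ∈ pY P) (hl : l ∈ pY P) (hm : m ∈ pY P)
    (ha : 0 ≤ a) (hb : 0 ≤ b) (hc' : 0 ≤ c) (hp : 0 < a + b + c)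
    (e1 : a * k.1 + b * l.1 + c * m.1 = (a + b + c) * r.1)
    (e2 : a * k.2 + b * l.2 + c * m.2 = (a + b + c) * r.2) :
    r ∈ pY P ∧ (a : ℝ) * pF P k + b * pF P l + c * pF P m ≤ (a + b + c) * pF P r ∧
    (((0 < a ∧ k ∈ pI P) ∨ (0 < b ∧ l ∈ pI P) ∨ (0 < c ∧ m ∈ pI P) ∨
      (0 < a ∧ 0 < b ∧ 0 < c ∧ cr3 k l m ≠ 0)) → r ∈ pI P) := by
  obtain ⟨S, hS⟩ : ∃ S : ℝ, S = a + b + c := ⟨_, rfl⟩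
  have hS0 : 0 < S := by rw [hS]; exact_mod_cast hp
  have e1' : (a : ℝ) * k.1 + b * l.1 + c * m.1 = S * r.1 := by rw [hS]; exact_mod_cast e1
  have e2' : (a : ℝ) * k.2 + b * l.2 + c * m.2 = S * r.2 := by rw [hS]; exact_mod_cast e2
  obtain ⟨α, hα⟩ : ∃ α : ℝ, α = a / S := ⟨_, rfl⟩
  obtain ⟨β, hβ⟩ : ∃ β : ℝ, β = b / S := ⟨_, rfl⟩
  obtain ⟨γ, hγ⟩ : ∃ γ : ℝ, γ = c / S := ⟨_, rfl⟩
  have ha' : (0:ℝ) ≤ a := by exact_mod_cast ha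
  have hb' : (0:ℝ) ≤ b := by exact_mod_cast hb
  have hc'' : (0:ℝ) ≤ c := by exact_mod_cast hc'
  have hα0 : 0 ≤ α := by rw [hα]; positivity
  have hβ0 : 0 ≤ β := by rw [hβ]; positivity
  have hγ0 : 0 ≤ γ := by rw [hγ]; positivity
  have hαS : a = S * α := by rw [hα]; field_simp
  have hβS : b = S * β := by rw [hβ]; field_simp
  have hγS : c = S * γ := by rw [hγ]; field_simp
  have pa : 0 < a → 0 < α := fun h => by
    rw [hα]; exact div_pos (by exact_mod_cast h) hS0
  have pb : 0 < b → 0 < β := fun h => by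
    rw [hβ]; exact div_pos (by exact_mod_cast h) hS0
  have pc : 0 < c → 0 < γ := fun h => by
    rw [hγ]; exact div_pos (by exact_mod_cast h) hS0
  have hsum : α + β + γ = 1 := by
    apply mul_left_cancel₀ hS0.ne'
    rw [mul_add, mul_add, ← hαS, ← hβS, ← hγS, hS, mul_one]
  rw [hαS, hβS, hγS] at e1' e2'
  have f1 : α * k.1 + β * l.1 + γ * m.1 = r.1 := by
    apply mul_left_cancel₀ hS0.ne'; linear_combination e1'
  have f2 : α * k.2 + β * l.2 + γ * m.2 = r.2 := by
    apply mul_left_cancel₀ hS0.ne'; linear_combination e2'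
  obtain ⟨k1, k2, -⟩ := fib_spec hc hk
  obtain ⟨l1, l2, -⟩ := fib_spec hc hl
  obtain ⟨m1, m2, -⟩ := fib_spec hc hm
  have u1 := conv3 hv k1 l1 m1 hα0 hβ0 hγ0 hsum
  have u2 := conv3 hv k2 l2 m2 hα0 hβ0 hγ0 hsum
  rw [pt_comb3 f1 f2] at u1 u2
  have hr : r ∈ pY P := ⟨_, u1⟩
  obtain ⟨r1, r2, r3⟩ := fib_spec hc hr
  refine ⟨hr, ?_, ?_⟩
  · rw [← hS, hαS, hβS, hγS]
    have w1 := (r3 _ u1).2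
    have w2 := (r3 _ u2).1
    unfold pF
    nlinarith
  · rintro (⟨h, t, ht⟩ | ⟨h, t, ht⟩ | ⟨h, t, ht⟩ | ⟨h1, h2, h3, h4⟩)
    · have := conv3_int hv ht l1 m1 (pa h) hβ0 hγ0 hsum
      rw [pt_comb3 (r := r) (by linear_combination f1) (by linear_combination f2)] at this
      exact ⟨_, this⟩
    · have := conv3_int hv ht k1 m1 (pb h) hα0 hγ0 (by linarith)
      rw [pt_comb3 (r := r) (by linear_combination f1) (by linear_combination f2)] at this
      exact ⟨_, this⟩
    · have := conv3_int hv ht k1 l1 (pc h) hα0 hβ0 (by linarith)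
      rw [pt_comb3 (r := r) (by linear_combination f1) (by linear_combination f2)] at this
      exact ⟨_, this⟩
    · exact bary_int hv ho k1 l1 m1 (pa h1) (pb h2) (pc h3) hsum f1 f2 h4

theorem p_bey (hl : IsLatticePolytope P) {x : Fin 3 → ℤ} (hx : castPt x ∈ interior P) (k : ℤ × ℤ)
    (hk : k ≠ (x 0, x 1)) : ∃ y ∈ pY P, cr3 (x 0, x 1) k y < 0 := by
  by_contra hcon
  push Not at hcon
  obtain ⟨V, -, rfl⟩ := id hl
  obtain ⟨f, hf⟩ : ∃ f : (Fin 3 → ℝ) →ₗ[ℝ] ℝ, ∀ y, f y = ((k.1 - x 0 : ℤ) : ℝ) * y 1 -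
      ((k.2 - x 1 : ℤ) : ℝ) * y 0 :=
    ⟨((k.1 - x 0 : ℤ) : ℝ) • LinearMap.proj 1 - ((k.2 - x 1 : ℤ) : ℝ) • LinearMap.proj 0, by
      intro y; simp⟩
  have hV : convexHull ℝ (castPt '' (V : Set (Fin 3 → ℤ))) ⊆ {y | f (castPt x) ≤ f y} := by
    refine convexHull_min ?_ (convex_halfSpace_ge f.isLinear _)
    rintro _ ⟨v, hv, rfl⟩
    have := hcon (v 0, v 1) ⟨v 2, by
      rw [← castPt_eq_pt]; exact subset_convexHull ℝ _ ⟨v, hv, rfl⟩⟩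
    simp only [cr3] at this
    rw [mem_ofPred_eq, hf, hf]
    simp only [castPt]
    have h2 : ((k.1 - x 0) * x 1 - (k.2 - x 1) * x 0) ≤
        ((k.1 - x 0) * v 1 - (k.2 - x 1) * v 0) := by linarith
    exact_mod_cast h2
  obtain ⟨ε, hε, hm⟩ := int_move hx ![((k.2 - x 1 : ℤ) : ℝ), -((k.1 - x 0 : ℤ) : ℝ), 0]
  have := hV (interior_subset hm)
  rw [mem_ofPred_eq, hf, hf] at this
  simp only [Pi.add_apply, Pi.smul_apply, smul_eq_mul, Matrix.cons_val_zero, Matrix.cons_val_one] at this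
  have h3 : ε * (((k.1 - x 0 : ℤ) : ℝ) ^ 2 + ((k.2 - x 1 : ℤ) : ℝ) ^ 2) ≤ 0 := by
    linarith
  have h4 : (((k.1 - x 0 : ℤ) : ℝ) ^ 2 + ((k.2 - x 1 : ℤ) : ℝ) ^ 2) ≤ 0 := by
    by_contra h; push Not at h; have := mul_pos hε h; linarith
  have h5 : (k.1 - x 0) ^ 2 + (k.2 - x 1) ^ 2 ≤ 0 := by exact_mod_cast h4
  have h6 : k.1 - x 0 = 0 := by nlinarith [sq_nonneg (k.1 - x 0), sq_nonneg (k.2 - x 1)]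
  have h7 : k.2 - x 1 = 0 := by nlinarith [sq_nonneg (k.1 - x 0), sq_nonneg (k.2 - x 1)]
  exact hk (Prod.ext (by simp; linarith) (by simp; linarith))

theorem Chord.toRaw {L : ℕ} (C : Chord P L) :
    ∃ mode q0 q1, Raw mode L (pY P) (pI P) (pF P) (pn P) (ps P) q0 q1 := by
  have hc := C.tp.lat.compact
  have hv := C.tp.lat.convex
  obtain ⟨x0, x1, hne, hset⟩ := Set.ncard_eq_two.1 C.tp.two
  have hx0 : castPt x0 ∈ interior P := by
    have : x0 ∈ intLatPts P := by rw [hset]; simp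
    exact this
  have hx1 : castPt x1 ∈ interior P := by
    have : x1 ∈ intLatPts P := by rw [hset]; simp
    exact this
  have char : ∀ (q : ℤ × ℤ) (t : ℤ), pt q t ∈ interior P ↔
      (q = (x0 0, x0 1) ∧ t = x0 2) ∨ (q = (x1 0, x1 1) ∧ t = x1 2) := by
    intro q t
    constructor
    · intro h
      have : (![q.1, q.2, t] : Fin 3 → ℤ) ∈ intLatPts P := by
        show castPt _ ∈ interior P
        rwa [← pt_int]
      rw [hset] at this
      rcases this with h | h
      · left; rw [← h]; simp
      · right
        have h : _ = x1 := h
        rw [← h]; simp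
    · rintro (⟨rfl, rfl⟩ | ⟨rfl, rfl⟩)
      · rwa [← castPt_eq_pt]
      · rwa [← castPt_eq_pt]
  have hs2 : ∀ q, ps P q ≤ 2 := by
    intro q
    have : {t : ℤ | pt q t ∈ interior P} ⊆ {x0 2, x1 2} := by
      intro t ht
      rcases (char q t).1 ht with h | h
      · left; exact h.2
      · right; exact h.2
    exact (Set.ncard_le_ncard this (by simp)).trans (Set.ncard_insert_le _ _ |>.trans (by simp))
  have h0Y : (0, 0) ∈ pY P := ⟨_, C.bot⟩
  have h0F : (L : ℝ) ≤ pF P (0, 0) := by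
    obtain ⟨-, -, s3⟩ := fib_spec hc h0Y
    have h1 := (s3 _ C.bot).1
    have h2 := (s3 _ C.top).2
    unfold pF; linarith
  have h4 : (4 : ℝ) ≤ L := by exact_mod_cast C.four
  refine ⟨decide ((x1 0, x1 1) ≠ (x0 0, x0 1)), (x0 0, x0 1), (x1 0, x1 1),
    pY_finite hc, pI_sub, fun k l m r a b c hk hl hm => p_comb hc hv hx0 k l m r a b c hk hl hm,
    fun y hy => pF_nonneg hc hy, ?_, h0F, h0Y, ?_, ⟨_, (char _ (x0 2)).2 (Or.inl ⟨rfl, rfl⟩)⟩,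
    fun r hr => pF_le hc hv hr, ?_, ?_, fun y hy => pn_le hc hv hy, ?_,
    fun k hk => p_bey C.tp.lat hx0 k hk⟩
  · rintro y hy
    obtain ⟨t, ht⟩ := id hy
    have := (fib_int hc hv hy).1 ht
    unfold pF; linarith
  · intro h
    apply C.mid
    rw [fib_int hc hv h]
    obtain ⟨-, -, s3⟩ := fib_spec hc h0Y
    have h1 := (s3 _ C.bot).1
    have h2 := (s3 _ C.top).2
    constructor <;> linarith
  · intro h
    rw [decide_eq_false_iff_not, not_not] at h
    constructor
    · have : {t : ℤ | pt (x0 0, x0 1) t ∈ interior P} = {x0 2, x1 2} := by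
        ext t
        rw [mem_ofPred_eq, char, h]
        simp
      rw [ps, this, Set.ncard_pair]
      intro h2
      apply hne
      rw [Prod.ext_iff] at h
      ext i; fin_cases i
      · exact h.1.symm
      · exact h.2.symm
      · exact h2
    · intro r hr
      have : {t : ℤ | pt r t ∈ interior P} = ∅ := by
        ext t
        rw [mem_ofPred_eq, char, h]
        simp [hr]
      rw [ps, this, Set.ncard_empty]
  · intro h
    rw [decide_eq_true_eq] at h
    refine ⟨h, ?_, ?_, ?_⟩
    · have : {t : ℤ | pt (x0 0, x0 1) t ∈ interior P} = {x0 2} := by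
        ext t
        rw [mem_ofPred_eq, char]
        simp only [h.symm, true_and, false_and, or_false, mem_singleton_iff]
      rw [ps, this, Set.ncard_singleton]
    · have : {t : ℤ | pt (x1 0, x1 1) t ∈ interior P} = {x1 2} := by
        ext t
        rw [mem_ofPred_eq, char]
        simp only [h, true_and, false_and, false_or, mem_singleton_iff]
      rw [ps, this, Set.ncard_singleton]
    · intro r hr hr'
      have : {t : ℤ | pt r t ∈ interior P} = ∅ := by
        ext t
        rw [mem_ofPred_eq, char]
        simp [hr, hr']
      rw [ps, this, Set.ncard_empty]
  · intro y hy
    by_cases hI : y ∈ pI P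
    · have h1 := pn_le hc hv hy
      have h2 := pF_le hc hv hI
      have h3 : (ps P y : ℝ) ≤ 2 := by exact_mod_cast hs2 y
      have : (pn P y : ℝ) ≤ L + 1 := by linarith
      exact_mod_cast this
    · rw [pn_eq hc hv hy]
      rcases le_total (⌈plo P y⌉) ⌊phi P y⌋ with h | h
      · obtain ⟨k, hk⟩ := Int.eq_ofNat_of_zero_le (sub_nonneg.2 h)
        have hI1 := fib_icc hc hv hy
        have m1 : pt y (⌈plo P y⌉ : ℤ) ∈ P := by
          have : ⌈plo P y⌉ ∈ {t : ℤ | pt y t ∈ P} := by rw [hI1]; exact ⟨le_rfl, h⟩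
          exact this
        have m2 : pt y (⌊phi P y⌋ : ℤ) ∈ P := by
          have : ⌊phi P y⌋ ∈ {t : ℤ | pt y t ∈ P} := by rw [hI1]; exact ⟨h, le_rfl⟩
          exact this
        have e : ((⌊phi P y⌋ : ℤ) : ℝ) = (⌈plo P y⌉ : ℤ) + (k : ℝ) := by
          have : ⌊phi P y⌋ = ⌈plo P y⌉ + (k : ℤ) := by linarith
          rw [this]; push_cast; rfl
        rw [e] at m2
        have := C.max y ⌈plo P y⌉ k m1 m2 (fun hh => hI ⟨_, hh⟩)
        omega
      · have : (⌊phi P y⌋ + 1 - ⌈plo P y⌉).toNat ≤ 1 := by omega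
        omega

end

/-! ## The long chord theorem -/

section
variable {P : Set (Fin 3 → ℝ)}

theorem sum_pn (hc : IsCompact P) (A : Finset (ℤ × ℤ)) (hA : (A : Set (ℤ × ℤ)) = pY P) :
    ∑ y ∈ A, pn P y = (latPts P).ncard := by
  classical
  have hf : (latPts P).Finite := compact_pts_finite hc
  rw [Set.ncard_eq_toFinset_card _ hf]
  rw [Finset.card_eq_sum_card_fiberwise (f := fun v : Fin 3 → ℤ => (v 0, v 1)) (t := A)]
  · refine Finset.sum_congr rfl fun q _ => ?_
    rw [pn, ← Set.ncard_coe_finset]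
    have : ((hf.toFinset.filter fun v => (v 0, v 1) = q : Finset (Fin 3 → ℤ)) : Set (Fin 3 → ℤ)) =
        (fun t : ℤ => (![q.1, q.2, t] : Fin 3 → ℤ)) '' {t : ℤ | pt q t ∈ P} := by
      ext v
      simp only [Finset.coe_filter, Set.Finite.mem_toFinset, mem_ofPred_eq, mem_image]
      constructor
      · rintro ⟨h1, rfl⟩
        refine ⟨v 2, ?_, ?_⟩
        · rw [← castPt_eq_pt]; exact h1
        · ext i; fin_cases i <;> rfl
      · rintro ⟨t, ht, rfl⟩
        refine ⟨?_, by simp⟩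
        show castPt _ ∈ P
        rw [← pt_int]; exact ht
    rw [this, Set.ncard_image_of_injective]
    intro t t' h
    simpa using congrFun h 2
  · intro v hv
    rw [hA]
    rw [Set.Finite.coe_toFinset] at hv
    have hv : castPt v ∈ P := hv
    rw [castPt_eq_pt] at hv
    exact ⟨_, hv⟩

theorem S23_mem {x y z : ℝ} (hx : 0 ≤ x) (hy : 0 ≤ y) (hz : 0 ≤ z) (h : 9 * x + 6 * y + z ≤ 18) :
    (![x, y, z] : Fin 3 → ℝ) ∈ S23 := by
  have hc : Convex ℝ S23 := convex_convexHull ℝ _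
  have := hc.sum_mem (t := Finset.univ) (w := ![1 - x / 2 - y / 3 - z / 18, x / 2, y / 3, z / 18])
    (z := ![![0,0,0], ![2,0,0], ![0,3,0], ![0,0,18]])
    (by intro i _; fin_cases i <;> simp <;> linarith) (by simp [Fin.sum_univ_four]; ring)
    (by intro i _; fin_cases i <;> exact subset_convexHull ℝ _ (by simp))
  convert this using 1
  ext i
  fin_cases i <;> simp [Fin.sum_univ_four]

theorem p_comb' (hc : IsCompact P) (hv : Convex ℝ P)
    (k l m r : ℤ × ℤ) (α β γ : ℝ) (hk : k ∈ pY P) (hl : l ∈ pY P) (hm : m ∈ pY P)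
    (hα0 : 0 ≤ α) (hβ0 : 0 ≤ β) (hγ0 : 0 ≤ γ) (hsum : α + β + γ = 1)
    (f1 : α * k.1 + β * l.1 + γ * m.1 = r.1) (f2 : α * k.2 + β * l.2 + γ * m.2 = r.2) :
    α * phi P k + β * phi P l + γ * phi P m ≤ phi P r ∧
      plo P r ≤ α * plo P k + β * plo P l + γ * plo P m := by
  obtain ⟨k1, k2, -⟩ := fib_spec hc hk
  obtain ⟨l1, l2, -⟩ := fib_spec hc hl
  obtain ⟨m1, m2, -⟩ := fib_spec hc hm
  have u1 := conv3 hv k1 l1 m1 hα0 hβ0 hγ0 hsum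
  have u2 := conv3 hv k2 l2 m2 hα0 hβ0 hγ0 hsum
  rw [pt_comb3 f1 f2] at u1 u2
  obtain ⟨r1, r2, r3⟩ := fib_spec hc (⟨_, u1⟩ : r ∈ pY P)
  exact ⟨(r3 _ u1).2, (r3 _ u2).1⟩

theorem concl_equiv {L : ℕ} (hl : IsLatticePolytope P) (h : Concl L (pY P) (pF P) (pn P)) :
    UnimodEquiv P S23 := by
  have hc := hl.compact
  have hv := hl.convex
  obtain ⟨-, a, b, c, d, hdet, hY, hF, hn⟩ := h
  have hmem : ∀ p ∈ Std7, gl a b c d p ∈ pY P := by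
    intro p hp
    have : p ∈ gl a b c d ⁻¹' pY P := by rw [hY]; exact_mod_cast hp
    exact this
  have hα : ∀ p ∈ Std7, ∃ α : ℤ, plo P (gl a b c d p) = α ∧
      phi P (gl a b c d p) = α + (18 - 9 * p.1 - 6 * p.2) := by
    intro p hp
    have h1 := hF p hp
    have h2 := hn p hp
    have hpos : 0 ≤ 18 - 9 * p.1 - 6 * p.2 :=
      (by decide : ∀ p ∈ Std7, 0 ≤ 18 - 9 * p.1 - 6 * p.2) p hp
    rw [pn_eq hc hv (hmem p hp)] at h2
    have h3 : ⌊phi P (gl a b c d p)⌋ = ⌈plo P (gl a b c d p)⌉ + (18 - 9 * p.1 - 6 * p.2) := by omega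
    have h4 := Int.floor_le (phi P (gl a b c d p))
    have h5 := Int.le_ceil (plo P (gl a b c d p))
    rw [h3] at h4
    push_cast at h4
    unfold pF at h1
    exact ⟨⌈plo P (gl a b c d p)⌉, by linarith, by linarith⟩
  choose! α h1 h2 using hα
  have key : ∀ (k l m r : ℤ × ℤ) (A B C : ℝ), k ∈ Std7 → l ∈ Std7 → m ∈ Std7 → r ∈ Std7 →
      0 ≤ A → 0 ≤ B → 0 ≤ C → A + B + C = 1 → A * k.1 + B * l.1 + C * m.1 = r.1 →
      A * k.2 + B * l.2 + C * m.2 = r.2 → A * α k + B * α l + C * α m = α r := by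
    intro k l m r A B C hk hl hm hr hA hB hC hs e1 e2
    obtain ⟨g1, g2⟩ := p_comb' hc hv (gl a b c d k) (gl a b c d l) (gl a b c d m) (gl a b c d r)
      A B C (hmem k hk) (hmem l hl) (hmem m hm) hA hB hC hs
      (by simp only [gl]; push_cast; linear_combination (a : ℝ) * e1 + b * e2)
      (by simp only [gl]; push_cast; linear_combination (c : ℝ) * e1 + d * e2)
    rw [h2 k hk, h2 l hl, h2 m hm, h2 r hr] at g1
    rw [h1 k hk, h1 l hl, h1 m hm, h1 r hr] at g2
    have : A * ((18:ℝ) - 9 * k.1 - 6 * k.2) + B * (18 - 9 * l.1 - 6 * l.2) +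
        C * (18 - 9 * m.1 - 6 * m.2) = 18 - 9 * r.1 - 6 * r.2 := by
      rw [← e1, ← e2]; linear_combination 18 * hs
    linarith
  have k1 := key (0, 0) (2, 0) (0, 0) (1, 0) (1 / 2) (1 / 2) 0 (by decide) (by decide) (by decide)
    (by decide) (by norm_num) (by norm_num) (by norm_num) (by norm_num) (by norm_num) (by norm_num)
  have k2 := key (0, 0) (0, 3) (0, 0) (0, 1) (2 / 3) (1 / 3) 0 (by decide) (by decide) (by decide)
    (by decide) (by norm_num) (by norm_num) (by norm_num) (by norm_num) (by norm_num) (by norm_num)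
  have k3 := key (0, 0) (0, 3) (0, 0) (0, 2) (1 / 3) (2 / 3) 0 (by decide) (by decide) (by decide)
    (by decide) (by norm_num) (by norm_num) (by norm_num) (by norm_num) (by norm_num) (by norm_num)
  have k4 := key (0, 0) (2, 0) (0, 3) (1, 1) (1 / 6) (1 / 2) (1 / 3) (by decide) (by decide)
    (by decide) (by decide) (by norm_num) (by norm_num) (by norm_num) (by norm_num) (by norm_num)
    (by norm_num)
  obtain ⟨c1, hc1⟩ : ∃ c1, c1 = α (1, 0) - α (0, 0) := ⟨_, rfl⟩
  obtain ⟨c2, hc2⟩ : ∃ c2, c2 = α (0, 1) - α (0, 0) := ⟨_, rfl⟩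
  have lin : ∀ p ∈ Std7, (α p : ℝ) = α (0, 0) + p.1 * c1 + p.2 * c2 := by
    intro p hp
    simp only [Std7, Finset.mem_insert, Finset.mem_singleton] at hp
    rw [hc1, hc2]
    push_cast
    rcases hp with h | h | h | h | h | h | h <;> subst h <;> push_cast <;> linarith
  have hB : IsUnit (!![a, b, 0; c, d, 0; c1, c2, 1] : Matrix (Fin 3) (Fin 3) ℤ).det := by
    rw [Matrix.det_fin_three]
    simp
    exact IsUnit.of_mul_eq_one _ hdet
  have act : ∀ (p : ℤ × ℤ), p ∈ Std7 → ∀ (z : ℝ),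
      uni !![a, b, 0; c, d, 0; c1, c2, 1] ![0, 0, α (0, 0)] (pt p z) =
      pt (gl a b c d p) (α p + z) := by
    intro p hp z
    rw [lin p hp]
    ext i
    fin_cases i <;> simp [uni, pt, gl, castPt, Matrix.mulVec, dotProduct, Fin.sum_univ_three]
    ring
  have fib : ∀ p ∈ Std7, ∀ z : ℝ, pt (gl a b c d p) (α p + z) ∈ P ↔
      0 ≤ z ∧ z ≤ 18 - 9 * p.1 - 6 * p.2 := by
    intro p hp z
    obtain ⟨s1, s2, s3⟩ := fib_spec hc (hmem p hp)
    rw [h1 p hp] at s2 s3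
    rw [h2 p hp] at s1 s3
    constructor
    · intro h
      have := s3 _ h
      constructor <;> linarith
    · intro h
      exact fib_conv hv s2 s1 (by linarith) (by linarith)
  apply UnimodEquiv.symm3
  refine ⟨!![a, b, 0; c, d, 0; c1, c2, 1], ![0, 0, α (0, 0)], hB, ?_⟩
  show uni !![a, b, 0; c, d, 0; c1, c2, 1] ![0, 0, α (0, 0)] '' S23 = P
  apply Subset.antisymm
  · rw [S23, uni_hull]
    refine convexHull_min ?_ hv
    rintro _ ⟨w, hw, rfl⟩
    have pe : ∀ (p : ℤ × ℤ) (z x y : ℝ), x = p.1 → y = p.2 → ![x, y, z] = pt p z := by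
      rintro p z x y rfl rfl; rfl
    simp only [mem_insert_iff, mem_singleton_iff] at hw
    rcases hw with rfl | rfl | rfl | rfl
    · rw [pe (0, 0) 0 0 0 (by simp) (by simp), act _ (by decide), fib _ (by decide)]; norm_num
    · rw [pe (2, 0) 0 2 0 (by simp) (by simp), act _ (by decide), fib _ (by decide)]; norm_num
    · rw [pe (0, 3) 0 0 3 (by simp) (by simp), act _ (by decide), fib _ (by decide)]; norm_num
    · rw [pe (0, 0) 18 0 0 (by simp) (by simp), act _ (by decide), fib _ (by decide)]; norm_num
  · have hvS : Convex ℝ (uni !![a, b, 0; c, d, 0; c1, c2, 1] ![0, 0, α (0, 0)] '' S23) := by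
      rw [S23, uni_hull]; exact convex_convexHull ℝ _
    obtain ⟨V, -, hPV⟩ := id hl
    have : ∀ v ∈ V, castPt v ∈ P := fun v hv => by
      rw [hPV]; exact subset_convexHull ℝ _ ⟨v, hv, rfl⟩
    rw [hPV]
    refine convexHull_min ?_ hvS
    rintro _ ⟨v, hvV, rfl⟩
    have hvP := this v hvV
    rw [castPt_eq_pt] at hvP ⊢
    have hq : (v 0, v 1) ∈ pY P := ⟨_, hvP⟩
    have he : ((a * d - b * c) * (a * d - b * c)) = 1 := hdet
    obtain ⟨p, hp⟩ : ∃ p, gl a b c d p = (v 0, v 1) := ⟨_, gl_inv rfl he _⟩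
    have hp7 : p ∈ Std7 := by
      have : p ∈ gl a b c d ⁻¹' pY P := by rw [mem_preimage, hp]; exact hq
      rw [hY] at this; exact_mod_cast this
    rw [← hp] at hvP ⊢
    have e : (v 2 : ℝ) = α p + (v 2 - α p) := by ring
    rw [e] at hvP ⊢
    obtain ⟨z0, z1⟩ := (fib p hp7 _).1 hvP
    rw [← act p hp7]
    refine ⟨_, S23_mem ?_ ?_ z0 (by linarith), rfl⟩
    · have : 0 ≤ p.1 := (by decide : ∀ p ∈ Std7, 0 ≤ p.1) p hp7
      exact_mod_cast this
    · have : 0 ≤ p.2 := (by decide : ∀ p ∈ Std7, 0 ≤ p.2) p hp7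
      exact_mod_cast this

theorem Chord.final {L : ℕ} (C : Chord P L) (h55 : 55 ≤ (latPts P).ncard) :
    (latPts P).ncard = 55 ∧ UnimodEquiv P S23 := by
  obtain ⟨mode, q0, q1, R⟩ := C.toRaw
  have hc := C.tp.lat.compact
  have hA : ((pY_finite hc).toFinset : Set (ℤ × ℤ)) = pY P := by simp
  have hs := sum_pn hc _ hA
  rw [← hs] at h55 ⊢
  obtain ⟨e1, e2⟩ := R.final C.four _ hA h55
  exact ⟨e1, concl_equiv C.tp.lat e2⟩
end

/-! ## Existence of a long chord -/

/-- `P` has a lattice chord of index `k` through a lattice point whose midpoint is not interior. -/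
def HasChord (P : Set (Fin 3 → ℝ)) (k : ℕ) : Prop :=
  ∃ v g : Fin 3 → ℤ, g ≠ 0 ∧ castPt v ∈ P ∧ castPt v + (k : ℝ) • castPt g ∈ P ∧
    castPt v + (k / 2 : ℝ) • castPt g ∉ interior P

section
variable {P : Set (Fin 3 → ℝ)}

theorem uni_line (A : Matrix (Fin 3) (Fin 3) ℤ) (b v g : Fin 3 → ℤ) (c : ℝ) :
    uni A b (castPt v + c • castPt g) =
      castPt (A.mulVec v + b) + c • castPt (A.mulVec g) := by
  simp only [uni, castPt_add, castPt_mulVec, Matrix.mulVec_add, Matrix.mulVec_smul]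
  abel

theorem HasChord.map {k : ℕ} (h : HasChord P k) {A : Matrix (Fin 3) (Fin 3) ℤ} (hA : IsUnit A.det)
    (b : Fin 3 → ℤ) : HasChord (uni A b '' P) k := by
  obtain ⟨v, g, hg, h1, h2, h3⟩ := h
  refine ⟨A.mulVec v + b, A.mulVec g, ?_, ?_, ?_, ?_⟩
  · intro h0
    apply hg
    have := uni_pts_inj hA 0 (a₁ := g) (a₂ := 0)
    simp only [add_zero, Matrix.mulVec_zero] at this
    exact this h0
  · rw [← uni_cast, uni_mem hA]; exact h1
  · rw [← uni_line, uni_mem hA]; exact h2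
  · rw [← uni_line, ← uni_interior hA, uni_mem hA]; exact h3

theorem HasChord.unmap {k : ℕ} {A : Matrix (Fin 3) (Fin 3) ℤ} (hA : IsUnit A.det)
    {b : Fin 3 → ℤ} (h : HasChord (uni A b '' P) k) : HasChord P k := by
  have hA' : IsUnit A⁻¹.det := by simpa using hA
  have := h.map hA' (-(A⁻¹.mulVec b))
  rw [image_image] at this
  convert this using 1
  symm
  convert image_id P using 1
  apply image_congr
  intro x _
  exact uni_inv hA b x

theorem HasChord.bdd (hc : IsCompact P) : ∃ B : ℕ, ∀ k, HasChord P k → k ≤ B := by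
  obtain ⟨R, hR⟩ := hc.isBounded.subset_closedBall 0
  refine ⟨⌈2 * R⌉₊, ?_⟩
  rintro k ⟨v, g, hg, h1, h2, -⟩
  obtain ⟨i, hi⟩ : ∃ i, g i ≠ 0 := by
    by_contra h; push Not at h; exact hg (funext h)
  have b1 := hR h1
  have b2 := hR h2
  rw [mem_closedBall_zero_iff] at b1 b2
  have c1 := abs_le.1 ((norm_le_pi_norm _ i).trans b1)
  have c2 := abs_le.1 ((norm_le_pi_norm _ i).trans b2)
  simp only [Pi.add_apply, Pi.smul_apply, smul_eq_mul, castPt] at c1 c2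
  have hg1 : (1 : ℝ) ≤ |(g i : ℝ)| := by exact_mod_cast Int.one_le_abs hi
  have : (k : ℝ) ≤ 2 * R := by
    have h5 : |(k : ℝ) * g i| ≤ 2 * R := by
      rw [abs_le]; constructor <;> linarith [c1.1, c1.2, c2.1, c2.2]
    rw [abs_mul, Nat.abs_cast] at h5
    nlinarith [Nat.cast_nonneg (α := ℝ) k]
  exact Nat.cast_le.1 (this.trans (Nat.le_ceil _))

theorem bez (a b : ℤ) : ∃ p q r s : ℤ, p * s - q * r = 1 ∧ p * a + q * b = 0 ∧
    r * a + s * b = (Int.gcd a b : ℕ) := by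
  by_cases h : (Int.gcd a b) = 0
  · rw [Int.gcd_eq_zero_iff] at h
    obtain ⟨rfl, rfl⟩ := h
    exact ⟨1, 0, 0, 1, by norm_num, by norm_num, by simp⟩
  · have h' : ((Int.gcd a b : ℕ) : ℤ) ≠ 0 := by exact_mod_cast h
    obtain ⟨a', ha⟩ := Int.gcd_dvd_left a b
    obtain ⟨b', hb⟩ := Int.gcd_dvd_right a b
    have hg := Int.gcd_eq_gcd_ab a b
    refine ⟨b', -a', a.gcdA b, a.gcdB b, ?_, ?_, by rw [hg]; ring⟩
    · apply mul_left_cancel₀ h'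
      linear_combination -(a.gcdA b) * ha - a.gcdB b * hb - hg
    · apply mul_left_cancel₀ h'
      linear_combination b * ha - a * hb

theorem bez3 (g : Fin 3 → ℤ) (hg : g ≠ 0) : ∃ (T : Matrix (Fin 3) (Fin 3) ℤ) (h : ℕ),
    IsUnit T.det ∧ 0 < h ∧ T.mulVec g = ![0, 0, (h : ℤ)] := by
  obtain ⟨p, q, r, s, h1, h2, h3⟩ := bez (g 0) (g 1)
  obtain ⟨p', q', r', s', k1, k2, k3⟩ := bez (r * g 0 + s * g 1) (g 2)
  obtain ⟨T, hT⟩ : ∃ T : Matrix (Fin 3) (Fin 3) ℤ,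
      T = !![p, q, 0; p' * r, p' * s, q'; r' * r, r' * s, s'] := ⟨_, rfl⟩
  obtain ⟨h, hh⟩ : ∃ h, h = Int.gcd (r * g 0 + s * g 1) (g 2) := ⟨_, rfl⟩
  rw [← hh] at k3
  have e : T.mulVec g = ![0, 0, (h : ℤ)] := by
    rw [hT]
    ext i
    fin_cases i <;> simp [Matrix.mulVec, dotProduct, Fin.sum_univ_three]
    · linarith
    · linarith
    · linarith
  have hd : IsUnit T.det := by
    have : T.det = 1 := by
      rw [hT, Matrix.det_fin_three]
      simp
      linear_combination (p' * s' - q' * r') * h1 + k1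
    rw [this]; exact isUnit_one
  refine ⟨T, h, hd, ?_, e⟩
  rcases Nat.eq_zero_or_pos h with h0 | h0
  · exfalso
    apply hg
    have := uni_pts_inj hd 0 (a₁ := g) (a₂ := 0)
    simp only [add_zero, Matrix.mulVec_zero] at this
    apply this
    rw [e, h0]
    ext i; fin_cases i <;> rfl
  · exact h0

theorem mid_int (hv : Convex ℝ P) {x p m : Fin 3 → ℤ} (hx : x ∈ intLatPts P) (hp : castPt p ∈ P)
    (h : ∀ i, p i + x i = 2 * m i) : m ∈ intLatPts P := by
  show castPt m ∈ interior P
  have := hv.combo_interior_self_subset_interior (a := 1 / 2) (b := 1 / 2) (by norm_num)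
    (by norm_num) (by norm_num) (Set.add_mem_add (Set.smul_mem_smul_set hx) (Set.smul_mem_smul_set hp))
  convert this using 1
  ext i
  have h' : (p i : ℝ) + x i = 2 * m i := by exact_mod_cast h i
  simp [castPt]
  linarith

theorem exists_chord4 (h : TwoPt P) (h55 : 55 ≤ (latPts P).ncard) : HasChord P 4 := by
  classical
  have hc := h.lat.compact
  have hv := h.lat.convex
  obtain ⟨x0, x1, hne, hset⟩ := Set.ncard_eq_two.1 h.two
  have hx0 : x0 ∈ intLatPts P := by rw [hset]; simp
  have hx1 : x1 ∈ intLatPts P := by rw [hset]; simp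
  have hf : (latPts P).Finite := compact_pts_finite hc
  obtain ⟨B, hB⟩ : ∃ B : Finset (Fin 3 → ℤ), B = hf.toFinset \ {x0, x1, 2 • x1 - x0, 2 • x0 - x1} :=
    ⟨_, rfl⟩
  have hBc : 51 ≤ B.card := by
    rw [hB]
    have h1 := Finset.le_card_sdiff {x0, x1, 2 • x1 - x0, 2 • x0 - x1} hf.toFinset
    have h2 : ({x0, x1, 2 • x1 - x0, 2 • x0 - x1} : Finset (Fin 3 → ℤ)).card ≤ 4 :=
      Finset.card_le_four
    rw [Set.ncard_eq_toFinset_card _ hf] at h55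
    omega
  have hBm : ∀ p ∈ B, castPt p ∈ P ∧ p ≠ x0 ∧ p ≠ x1 ∧ p ≠ 2 • x1 - x0 ∧ p ≠ 2 • x0 - x1 := by
    intro p hp
    rw [hB, Finset.mem_sdiff, Set.Finite.mem_toFinset] at hp
    simp only [Finset.mem_insert, Finset.mem_singleton, not_or] at hp
    exact hp
  let r2 : (Fin 3 → ℤ) → Fin 3 → ZMod 2 := fun v i => (v i : ZMod 2)
  have hr2 : ∀ {v w}, r2 v = r2 w → ∀ i, (2:ℤ) ∣ w i - v i := by
    intro v w hvw i
    have := congrFun hvw i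
    exact (ZMod.intCast_eq_intCast_iff_dvd_sub _ _ 2).1 this
  have hmid : ∀ {x p}, x ∈ intLatPts P → castPt p ∈ P → r2 x = r2 p →
      ∃ m ∈ intLatPts P, ∀ i, p i + x i = 2 * m i := by
    intro x p hx hp hxp
    choose m hm using hr2 hxp
    refine ⟨fun i => x i + m i, mid_int hv hx hp ?_, ?_⟩ <;>
    · intro i; linarith [hm i]
  have h01 : r2 x0 ≠ r2 x1 := by
    intro hh
    obtain ⟨m, hm, e⟩ := hmid hx0 (interior_subset hx1) hh
    rw [hset] at hm
    apply hne
    rcases hm with rfl | hm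
    · ext i; linarith [e i]
    · have hm : m = x1 := hm
      subst hm
      ext i; linarith [e i]
  have hB2 : ∀ p ∈ B, r2 p ∈ (Finset.univ.erase (r2 x0)).erase (r2 x1) := by
    intro p hp
    obtain ⟨q1, q2, q3, q4, q5⟩ := hBm p hp
    rw [Finset.mem_erase, Finset.mem_erase]
    refine ⟨?_, ?_, Finset.mem_univ _⟩
    · intro hh
      obtain ⟨m, hm, e⟩ := hmid hx1 q1 hh.symm
      rw [hset] at hm
      rcases hm with rfl | hm
      · apply q5; ext i; simp; linarith [e i]
      · have hm : m = x1 := hm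
        subst hm
        apply q3; ext i; linarith [e i]
    · intro hh
      obtain ⟨m, hm, e⟩ := hmid hx0 q1 hh.symm
      rw [hset] at hm
      rcases hm with rfl | hm
      · apply q2; ext i; linarith [e i]
      · have hm : m = x1 := hm
        subst hm
        apply q4; ext i; simp; linarith [e i]
  have hc8 : (Finset.univ : Finset (Fin 3 → ZMod 2)).card = 8 := by
    rw [Finset.card_univ]; simp
  obtain ⟨c, -, hcc⟩ := Finset.exists_lt_card_fiber_of_mul_lt_card_of_maps_to (n := 8) hB2 (by
    rw [Finset.card_erase_of_mem, Finset.card_erase_of_mem, hc8]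
    · omega
    · exact Finset.mem_univ _
    · rw [Finset.mem_erase]; exact ⟨h01.symm, Finset.mem_univ _⟩)
  obtain ⟨p, hp, p', hp', hpp, heq⟩ := Finset.exists_ne_map_eq_of_card_lt_of_maps_to
    (f := fun v : Fin 3 → ℤ => r2 (fun i => v i / 2)) (by rw [← hc8] at hcc; exact hcc)
    (fun v _ => Finset.mem_coe.2 (Finset.mem_univ _))
  rw [Finset.mem_filter] at hp hp'
  have d1 := hr2 (hp.2.trans hp'.2.symm)
  have d2 := hr2 heq
  have d4 : ∀ i, ∃ g, p' i = p i + 4 * g := by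
    intro i
    have e1 := d1 i
    have e2 := d2 i
    exact ⟨(p' i - p i) / 4, by omega⟩
  choose g hg using d4
  have hgne : g ≠ 0 := by
    rintro rfl
    apply hpp; ext i; simpa using (hg i).symm
  obtain ⟨q1, -⟩ := hBm p hp.1
  obtain ⟨q1', -⟩ := hBm p' hp'.1
  refine ⟨p, g, hgne, q1, ?_, ?_⟩
  · convert q1' using 1
    ext i; simp [castPt, hg i]
  · intro hI
    have m2 : (fun i => p i + 2 * g i) ∈ intLatPts P := by
      show castPt _ ∈ interior P
      convert hI using 1
      ext i; simp [castPt]; left; norm_num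
    have m1 : (fun i => p i + g i) ∈ intLatPts P := mid_int hv m2 q1 (fun i => by ring)
    have m3 : (fun i => p i + 3 * g i) ∈ intLatPts P := mid_int hv m2 q1' (fun i => by
      rw [hg i]; ring)
    obtain ⟨i, hi⟩ : ∃ i, g i ≠ 0 := by
      by_contra hh; push Not at hh; exact hgne (funext hh)
    rw [hset] at m1 m2 m3
    have conv : ∀ {y : Fin 3 → ℤ}, y ∈ ({x0, x1} : Set (Fin 3 → ℤ)) → y i = x0 i ∨ y i = x1 i := by
      intro y hy
      rcases hy with rfl | hy
      · left; rfl
      · right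
        have hy : y = x1 := hy
        rw [hy]
    have n1 := conv m1
    have n2 := conv m2
    have n3 := conv m3
    omega

theorem twoPt_main (h : TwoPt P) (h55 : 55 ≤ (latPts P).ncard) :
    (latPts P).ncard = 55 ∧ UnimodEquiv P S23 := by
  obtain ⟨B, hB⟩ := HasChord.bdd h.lat.compact
  have h4 := exists_chord4 h h55
  obtain ⟨L, hL⟩ : ∃ L, L = sSup {k | HasChord P k} := ⟨_, rfl⟩
  have hbdd : BddAbove {k | HasChord P k} := ⟨B, fun k hk => hB k hk⟩
  have hLm : HasChord P L := by rw [hL]; exact Nat.sSup_mem ⟨4, h4⟩ hbdd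
  have hmax : ∀ k, HasChord P k → k ≤ L := fun k hk => by rw [hL]; exact le_csSup hbdd hk
  have hL4 : 4 ≤ L := hmax 4 h4
  obtain ⟨v, g, hg, h1, h2, h3⟩ := hLm
  obtain ⟨T, hh, hT, hh0, e⟩ := bez3 g hg
  obtain ⟨b, hb⟩ : ∃ b, b = -(T.mulVec v) := ⟨_, rfl⟩
  obtain ⟨Q, hQ⟩ : ∃ Q, Q = uni T b '' P := ⟨_, rfl⟩
  have hmaxQ : ∀ k, HasChord Q k → k ≤ L := by
    intro k hk; rw [hQ] at hk; exact hmax k (hk.unmap hT)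
  have line : ∀ c : ℝ, uni T b (castPt v + c • castPt g) = pt (0, 0) (c * hh) := by
    intro c
    rw [uni_line, e, hb, add_neg_cancel]
    ext i; fin_cases i <;> simp [castPt, pt]
  have z1 : pt (0, 0) 0 ∈ Q := by
    rw [hQ]
    refine ⟨_, h1, ?_⟩
    simpa using line 0
  have z2 : pt (0, 0) (L * hh) ∈ Q := by rw [hQ, ← line, uni_mem hT]; exact h2
  have z3 : pt (0, 0) (L / 2 * hh) ∉ interior Q := by
    rw [hQ, ← line, ← uni_interior hT, uni_mem hT]; exact h3
  have vert : ∀ (q : ℤ × ℤ) (t : ℤ) (k : ℕ), pt q t ∈ Q → pt q (t + k) ∈ Q →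
      pt q (t + k / 2) ∉ interior Q → k ≤ L := by
    intro q t k w1 w2 w3
    apply hmaxQ
    have el : ∀ c : ℝ, castPt ![q.1, q.2, t] + c • castPt ![0, 0, 1] = pt q (t + c) := by
      intro c
      ext i; fin_cases i <;> simp [castPt, pt]
    refine ⟨![q.1, q.2, t], ![0, 0, 1], ?_, ?_, ?_, ?_⟩
    · intro h0; simpa using congrFun h0 2
    · rw [← pt_int]; exact w1
    · rw [el]; exact w2
    · rw [el]; exact w3
  have hh1 : hh = 1 := by
    have := vert (0, 0) 0 (L * hh) (by simpa using z1) (by push_cast; simpa using z2) (by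
      push_cast
      have e2 : (0 : ℝ) + L * hh / 2 = L / 2 * hh := by ring
      rw [e2]; exact z3)
    have h5 : hh ≤ 1 := by
      by_contra hcon
      nlinarith
    omega
  subst hh1
  have C : Chord Q L := ⟨by rw [hQ]; exact h.uni hT b, hL4, z1, by simpa using z2, by simpa using z3,
    vert⟩
  have hN : (latPts Q).ncard = (latPts P).ncard := by rw [hQ]; exact uni_ncard hT b P
  obtain ⟨f1, f2⟩ := C.final (by rw [hN]; exact h55)
  exact ⟨by rw [← hN]; exact f1, UnimodEquiv.trans3 ⟨T, b, hT, hQ.symm⟩ f2⟩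
end

/-! ## The Pick inequality in the plane -/

/-- The planar determinant. -/
def crs {R : Type*} [CommRing R] (a b : Fin 2 → R) : R := a 0 * b 1 - a 1 * b 0

/-- Lattice points of `Q` from which the direction `d` enters `Q`. -/
def up (Q : Set (Fin 2 → ℝ)) (d : Fin 2 → ℝ) : Set (Fin 2 → ℤ) :=
  {q | castPt q ∈ Q ∧ ∃ ε : ℝ, 0 < ε ∧ castPt q + ε • d ∈ Q}

/-- The standard triangle. -/
def T0 : Set (Fin 2 → ℝ) := {x | 0 ≤ x 0 ∧ 0 ≤ x 1 ∧ x 0 + x 1 ≤ 1}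

theorem vol_T0 : volume T0 = ENNReal.ofReal (1 / 2) := by
  have hmp := volume_preserving_finTwoArrow ℝ
  obtain ⟨S, hS⟩ : ∃ S : Set (ℝ × ℝ), S = {p | 0 ≤ p.1 ∧ 0 ≤ p.2 ∧ p.1 + p.2 ≤ 1} := ⟨_, rfl⟩
  have hR : T0 = (MeasurableEquiv.finTwoArrow (α := ℝ)) ⁻¹' S := by
    ext x; rw [hS]; rfl
  have hm : MeasurableSet S := by
    rw [hS]
    apply IsClosed.measurableSet
    apply IsClosed.inter (isClosed_le continuous_const continuous_fst)
    exact IsClosed.inter (isClosed_le continuous_const continuous_snd)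
      (isClosed_le (continuous_fst.add continuous_snd) continuous_const)
  rw [hR, hmp.measure_preimage_equiv, Measure.volume_eq_prod, Measure.prod_apply hm]
  have hsl : ∀ x : ℝ, volume (Prod.mk x ⁻¹' S) =
      (Icc (0:ℝ) 1).indicator (fun x => ENNReal.ofReal (1 - x)) x := by
    intro x
    by_cases hx : x ∈ Icc (0:ℝ) 1
    · rw [indicator_of_mem hx]
      have : Prod.mk x ⁻¹' S = Icc 0 (1 - x) := by
        ext y; rw [hS]; simp only [mem_preimage, mem_ofPred_eq, mem_Icc]
        constructor
        · rintro ⟨_, h, h'⟩; exact ⟨h, by linarith⟩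
        · rintro ⟨h, h'⟩; exact ⟨hx.1, h, by linarith⟩
      rw [this, Real.volume_Icc, sub_zero]
    · rw [indicator_of_notMem hx]
      have : Prod.mk x ⁻¹' S = ∅ := by
        ext y; rw [hS]; simp only [mem_preimage, mem_ofPred_eq, mem_empty_iff_false, iff_false]
        rintro ⟨h, h', h''⟩; exact hx ⟨h, by linarith⟩
      rw [this, measure_empty]
  simp_rw [hsl]
  rw [lintegral_indicator measurableSet_Icc, ← ofReal_integral_eq_lintegral_ofReal]
  · congr 1
    rw [integral_Icc_eq_integral_Ioc, ← intervalIntegral.integral_of_le (by norm_num)]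
    rw [intervalIntegral.integral_sub (by simp) (by simp)]
    simp
    norm_num
  · exact (Continuous.integrableOn_Icc (by fun_prop))
  · exact (ae_restrict_iff' measurableSet_Icc).2 (.of_forall fun x hx => by
      have := hx.2; simp; linarith)

theorem conv_tri (p0 p1 p2 : Fin 2 → ℝ) : convexHull ℝ {p0, p1, p2} =
    (fun x : Fin 2 → ℝ => p0 + x 0 • (p1 - p0) + x 1 • (p2 - p0)) '' T0 := by
  ext y
  rw [convexHull_insert (by simp), mem_image]
  constructor
  · intro h
    rw [convexHull_pair] at h
    obtain ⟨a, ha, z, hz, hy⟩ := mem_convexJoin.1 h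
    rw [mem_singleton_iff] at ha
    subst ha
    obtain ⟨s, t, hs, ht, hst, rfl⟩ := hz
    obtain ⟨s', t', hs', ht', hst', rfl⟩ := hy
    refine ⟨![t' * s, t' * t], ⟨?_, ?_, ?_⟩, ?_⟩
    · simp; positivity
    · simp; positivity
    · simp; rw [← mul_add, hst]; linarith
    · have e1 : s = 1 - t := by linarith
      have e2 : s' = 1 - t' := by linarith
      subst e1 e2
      ext i
      simp
      ring
  · rintro ⟨x, ⟨h0, h1, h2⟩, rfl⟩
    rw [← convexHull_insert (by simp)]
    have hc : Convex ℝ (convexHull ℝ {p0, p1, p2}) := convex_convexHull ℝ _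
    have := hc.sum_mem (t := Finset.univ) (w := ![1 - x 0 - x 1, x 0, x 1]) (z := ![p0, p1, p2])
      (by intro i _; fin_cases i <;> simp <;> linarith) (by simp [Fin.sum_univ_three]; ring)
      (by intro i _; fin_cases i <;> exact subset_convexHull ℝ _ (by simp))
    convert this using 1
    ext i
    simp [Fin.sum_univ_three]
    ring

theorem vol_tri (p0 p1 p2 : Fin 2 → ℝ) : 2 * (volume (convexHull ℝ {p0, p1, p2})).toReal =
    |crs (p1 - p0) (p2 - p0)| := by
  rw [conv_tri]
  obtain ⟨M, hM⟩ : ∃ M : Matrix (Fin 2) (Fin 2) ℝ,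
    M = !![(p1 - p0) 0, (p2 - p0) 0; (p1 - p0) 1, (p2 - p0) 1] := ⟨_, rfl⟩
  have : (fun x : Fin 2 → ℝ => p0 + x 0 • (p1 - p0) + x 1 • (p2 - p0)) '' T0 =
      (fun z => p0 + z) '' (Matrix.toLin' M '' T0) := by
    rw [image_image]
    apply image_congr
    intro x _
    rw [hM]
    ext i
    fin_cases i <;> simp [Matrix.mulVec, dotProduct, Fin.sum_univ_two] <;> ring
  rw [this, Set.image_add_left, measure_preimage_add, Measure.addHaar_image_linearMap, vol_T0,
    LinearMap.det_toLin', ENNReal.toReal_mul, ENNReal.toReal_ofReal (abs_nonneg _),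
    ENNReal.toReal_ofReal (by norm_num), hM, Matrix.det_fin_two_of]
  have : crs (p1 - p0) (p2 - p0) = (p1 - p0) 0 * (p2 - p0) 1 - (p2 - p0) 0 * (p1 - p0) 1 := by
    unfold crs; ring
  rw [this]; ring

theorem eps_nonneg (x y : ℝ) (hx : 0 ≤ x) (h : 0 < x ∨ 0 < y) :
    ∃ ε : ℝ, 0 < ε ∧ ∀ δ, 0 < δ → δ ≤ ε → 0 ≤ x + δ * y := by
  rcases h with h | h
  · refine ⟨x / (1 + |y|), by positivity, fun δ h0 h1 => ?_⟩
    have h2 : δ * (1 + |y|) ≤ x := by rwa [le_div_iff₀ (by positivity)] at h1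
    nlinarith [neg_abs_le y]
  · exact ⟨1, one_pos, fun δ h0 _ => by positivity⟩

theorem tri_up (p a b d : Fin 2 → ℝ) (s t α β : ℝ) (hd : d = α • a + β • b)
    (hs : 0 ≤ s) (ht : 0 ≤ t) (hst : s + t ≤ 1) (h1 : 0 < s ∨ 0 < α) (h2 : 0 < t ∨ 0 < β)
    (h3 : s + t < 1 ∨ α + β < 0) :
    p + s • a + t • b ∈ convexHull ℝ {p, p + a, p + b} ∧
    ∃ ε : ℝ, 0 < ε ∧ p + s • a + t • b + ε • d ∈ convexHull ℝ {p, p + a, p + b} := by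
  have key : ∀ x y : ℝ, 0 ≤ x → 0 ≤ y → x + y ≤ 1 →
      p + x • a + y • b ∈ convexHull ℝ {p, p + a, p + b} := by
    intro x y hx hy hxy
    rw [conv_tri]
    exact ⟨![x, y], ⟨by simpa using hx, by simpa using hy, by simpa using hxy⟩, by simp⟩
  refine ⟨key s t hs ht hst, ?_⟩
  obtain ⟨e1, he1, h1'⟩ := eps_nonneg s α hs h1
  obtain ⟨e2, he2, h2'⟩ := eps_nonneg t β ht h2
  obtain ⟨e3, he3, h3'⟩ := eps_nonneg (1 - s - t) (-(α + β)) (by linarith)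
    (by rcases h3 with h | h
        · left; linarith
        · right; linarith)
  have hm : 0 < min e1 (min e2 e3) := lt_min he1 (lt_min he2 he3)
  refine ⟨min e1 (min e2 e3), hm, ?_⟩
  have := key (s + min e1 (min e2 e3) * α) (t + min e1 (min e2 e3) * β)
    (h1' _ hm (min_le_left _ _)) (h2' _ hm ((min_le_right _ _).trans (min_le_left _ _)))
    (by have := h3' _ hm ((min_le_right _ _).trans (min_le_right _ _)); linarith)
  convert this using 1
  rw [hd]
  ext i
  simp
  ring

theorem half_rep (s α : ℝ) : ∃ n : ℤ, 0 ≤ s + n ∧ s + n ≤ 1 ∧ (0 < s + n ∨ 0 < α) ∧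
    (s + n < 1 ∨ α ≤ 0) := by
  rcases lt_or_ge 0 α with h | h
  · refine ⟨-⌊s⌋, ?_, ?_, Or.inr h, Or.inl ?_⟩ <;> push_cast <;>
      linarith [Int.floor_le s, Int.lt_floor_add_one s]
  · refine ⟨1 - ⌈s⌉, ?_, ?_, Or.inl ?_, Or.inr h⟩ <;> push_cast <;>
      linarith [Int.le_ceil s, Int.ceil_lt_add_one s]

theorem card_quot (a b : Fin 2 → ℤ) (hD : crs a b ≠ 0) :
    ∃ N : Submodule ℤ (Fin 2 → ℤ), Nat.card ((Fin 2 → ℤ) ⧸ N) = (crs a b).natAbs ∧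
      ∀ x y : ℤ, x • a + y • b ∈ N := by
  obtain ⟨M, hM⟩ : ∃ M : Matrix (Fin 2) (Fin 2) ℤ, M = !![a 0, b 0; a 1, b 1] := ⟨_, rfl⟩
  have hdet : M.det = crs a b := by rw [hM, Matrix.det_fin_two_of]; unfold crs; ring
  have hinj : Function.Injective (Matrix.toLin' M) := by
    rw [injective_iff_map_eq_zero]
    intro v hv
    exact Matrix.eq_zero_of_mulVec_eq_zero (by rw [hdet]; exact hD) (by simpa using hv)
  refine ⟨LinearMap.range (Matrix.toLin' M), ?_, ?_⟩
  · rw [← Submodule.natAbs_det_equiv _ (LinearEquiv.ofInjective _ hinj)]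
    have : (LinearMap.range (Matrix.toLin' M)).subtype ∘ₗ
      AddMonoidHom.toIntLinearMap ((LinearEquiv.ofInjective _ hinj :
        (Fin 2 → ℤ) ≃ₗ[ℤ] LinearMap.range (Matrix.toLin' M)) :
        (Fin 2 → ℤ) →+ LinearMap.range (Matrix.toLin' M)) = Matrix.toLin' M := by
      ext; simp
    rw [this, LinearMap.det_toLin', hdet]
  · intro x y
    refine ⟨![x, y], ?_⟩
    rw [hM]
    ext i
    fin_cases i <;> simp [Matrix.mulVec, dotProduct, Fin.sum_univ_two] <;> ring

theorem castPt_zsmul {d : ℕ} (n : ℤ) (v : Fin d → ℤ) : castPt (n • v) = (n : ℝ) • castPt v := by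
  ext i; simp [castPt]

theorem castPt_sub {d : ℕ} (v w : Fin d → ℤ) : castPt (v - w) = castPt v - castPt w := by
  ext i; simp [castPt]

theorem crs_cast (a b : Fin 2 → ℤ) : crs (castPt a) (castPt b) = ((crs a b : ℤ) : ℝ) := by
  simp [crs, castPt]

theorem crs_expand (a b x : Fin 2 → ℝ) (h : crs a b ≠ 0) :
    x = (crs x b / crs a b) • a + (crs a x / crs a b) • b := by
  ext i
  simp only [Pi.add_apply, Pi.smul_apply, smul_eq_mul]
  field_simp
  unfold crs
  fin_cases i <;> simp <;> ring

theorem tri_pick (p a b : Fin 2 → ℤ) (d : Fin 2 → ℝ) (hD : crs a b ≠ 0)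
    (h1 : crs (castPt a) d ≠ 0) (h2 : crs (castPt b) d ≠ 0) (h3 : crs (castPt b - castPt a) d ≠ 0)
    (hf : {q : Fin 2 → ℤ | castPt q ∈ convexHull ℝ {castPt p, castPt (p + a), castPt (p + b)}}.Finite) :
    (crs a b).natAbs ≤ (up (convexHull ℝ {castPt p, castPt (p + a), castPt (p + b)}) d).ncard +
      (up (convexHull ℝ {castPt p, castPt (p + a), castPt (p + b)}) (-d)).ncard := by
  obtain ⟨N, hN, hN'⟩ := card_quot a b hD
  have hDr : crs (castPt a) (castPt b) ≠ 0 := by rw [crs_cast]; exact_mod_cast hD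
  obtain ⟨α, hα⟩ : ∃ α, α = crs d (castPt b) / crs (castPt a) (castPt b) := ⟨_, rfl⟩
  obtain ⟨β, hβ⟩ : ∃ β, β = crs (castPt a) d / crs (castPt a) (castPt b) := ⟨_, rfl⟩
  have hd : d = α • castPt a + β • castPt b := by rw [hα, hβ]; exact crs_expand _ _ _ hDr
  have a0 : α ≠ 0 := by
    intro h; rw [h] at hd; apply h2; rw [hd]; simp [crs]; ring
  have b0 : β ≠ 0 := by
    intro h; rw [h] at hd; apply h1; rw [hd]; simp [crs]; ring
  have ab0 : α + β ≠ 0 := by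
    intro h
    have : β = -α := by linarith
    rw [this] at hd; apply h3; rw [hd]; simp [crs]; ring
  obtain ⟨Q, hQ⟩ : ∃ Q, Q = convexHull ℝ {castPt p, castPt (p + a), castPt (p + b)} := ⟨_, rfl⟩
  rw [← hQ] at hf ⊢
  rw [castPt_add, castPt_add] at hQ
  have hex : ∀ x : (Fin 2 → ℤ) ⧸ N, ∃ q : Fin 2 → ℤ, N.mkQ q = x ∧
      (q ∈ up Q d ∨ 2 • p + a + b - q ∈ up Q (-d)) := by
    intro x
    obtain ⟨q0, rfl⟩ := N.mkQ_surjective x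
    have hq0 := crs_expand (castPt a) (castPt b) (castPt (q0 - p)) hDr
    obtain ⟨s0, hs0⟩ : ∃ s, s = crs (castPt (q0 - p)) (castPt b) / crs (castPt a) (castPt b) := ⟨_, rfl⟩
    obtain ⟨t0, ht0⟩ : ∃ s, s = crs (castPt a) (castPt (q0 - p)) / crs (castPt a) (castPt b) := ⟨_, rfl⟩
    rw [← hs0, ← ht0] at hq0
    obtain ⟨m, m1, m2, m3, m4⟩ := half_rep s0 α
    obtain ⟨n, n1, n2, n3, n4⟩ := half_rep t0 β
    obtain ⟨q, hq⟩ : ∃ q, q = q0 + (m • a + n • b) := ⟨_, rfl⟩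
    have hqe : castPt q = castPt p + (s0 + m) • castPt a + (t0 + n) • castPt b := by
      rw [hq, castPt_add, castPt_add, castPt_zsmul, castPt_zsmul]
      rw [castPt_sub] at hq0
      have : castPt q0 = castPt p + (s0 • castPt a + t0 • castPt b) := by rw [← hq0]; abel
      rw [this]; ext i; simp; ring
    refine ⟨q, ?_, ?_⟩
    · rw [hq, map_add]
      have := (Submodule.Quotient.mk_eq_zero N).2 (hN' m n)
      rw [Submodule.mkQ_apply, Submodule.mkQ_apply, this, add_zero]
    · by_cases hc : (s0 + m) + (t0 + n) < 1 ∨ ((s0 + m) + (t0 + n) ≤ 1 ∧ α + β < 0)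
      · left
        have := tri_up (castPt p) (castPt a) (castPt b) d _ _ α β hd m1 n1
          (by rcases hc with h | h <;> linarith) m3 n3 (by tauto)
        rw [← hqe, ← hQ] at this
        exact this
      · right
        have hr : castPt (2 • p + a + b - q) = castPt p + (1 - (s0 + m)) • castPt a +
            (1 - (t0 + n)) • castPt b := by
          rw [castPt_sub, hqe, castPt_add, castPt_add, two_smul, castPt_add]
          ext i; simp; ring
        push Not at hc
        have := tri_up (castPt p) (castPt a) (castPt b) (-d) (1 - (s0 + m)) (1 - (t0 + n)) (-α) (-β)
          (by rw [hd]; ext i; simp; ring) (by linarith) (by linarith) (by linarith)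
          (by rcases m4 with h | h
              · left; linarith
              · right; have := lt_of_le_of_ne h a0; linarith)
          (by rcases n4 with h | h
              · left; linarith
              · right; have := lt_of_le_of_ne h b0; linarith)
          (by rcases lt_or_eq_of_le hc.1 with h | h
              · left; linarith
              · right; have := lt_of_le_of_ne (hc.2 h.symm.le) ab0.symm; linarith)
        rw [← hr, ← hQ] at this
        exact this
  choose q hq1 hq2 using hex
  have hfin : Finite ((Fin 2 → ℤ) ⧸ N) := Nat.finite_of_card_ne_zero (by
    rw [hN]; exact Int.natAbs_ne_zero.2 hD)
  have hqi : Function.Injective q := fun x y h => by rw [← hq1 x, ← hq1 y, h]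
  have hu : (univ : Set ((Fin 2 → ℤ) ⧸ N)) ⊆
      {x | q x ∈ up Q d} ∪ {x | 2 • p + a + b - q x ∈ up Q (-d)} := fun x _ => hq2 x
  have f1 : (up Q d).Finite := hf.subset fun x hx => hx.1
  have f2 : (up Q (-d)).Finite := hf.subset fun x hx => hx.1
  rw [← hN, ← Set.ncard_univ]
  refine (Set.ncard_le_ncard hu (Set.toFinite _)).trans ((Set.ncard_union_le _ _).trans ?_)
  refine Nat.add_le_add (Set.ncard_le_ncard_of_injOn q (fun x hx => hx) hqi.injOn f1)
    (Set.ncard_le_ncard_of_injOn (fun x => 2 • p + a + b - q x) (fun x hx => hx) ?_ f2)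
  intro x _ y _ h
  exact hqi (sub_right_injective h)

theorem tri_poly (p q r : Fin 2 → ℤ) (d : Fin 2 → ℝ) (V : Finset (Fin 2 → ℤ)) (hV : V = {p, q, r})
    (hd : ∀ v ∈ V, ∀ w ∈ V, v ≠ w → crs (castPt v - castPt w) d ≠ 0) :
    2 * (volume (convexHull ℝ (castPt '' (V : Set (Fin 2 → ℤ))))).toReal ≤
      ((up (convexHull ℝ (castPt '' (V : Set (Fin 2 → ℤ)))) d).ncard : ℝ) +
      (up (convexHull ℝ (castPt '' (V : Set (Fin 2 → ℤ)))) (-d)).ncard := by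
  have e : castPt '' (V : Set (Fin 2 → ℤ)) = {castPt p, castPt q, castPt r} := by
    rw [hV]; simp [image_insert_eq]
  rw [e, vol_tri, ← castPt_sub, ← castPt_sub, crs_cast]
  by_cases hD : crs (q - p) (r - p) = 0
  · rw [hD]; simp; positivity
  · have hpq : q ≠ p := by rintro rfl; apply hD; simp [crs]
    have hpr : r ≠ p := by rintro rfl; apply hD; simp [crs]
    have hqr : r ≠ q := by rintro rfl; apply hD; simp [crs]; ring
    have hp : p ∈ V := by rw [hV]; simp
    have hq : q ∈ V := by rw [hV]; simp
    have hr : r ∈ V := by rw [hV]; simp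
    have := tri_pick p (q - p) (r - p) d hD (by rw [castPt_sub]; exact hd q hq p hp hpq)
      (by rw [castPt_sub]; exact hd r hr p hp hpr)
      (by rw [castPt_sub, castPt_sub, sub_sub_sub_cancel_right]; exact hd r hr q hq hqr)
      (by
        apply compact_pts_finite
        apply Set.Finite.isCompact_convexHull
        simp)
    rw [add_sub_cancel, add_sub_cancel] at this
    rw [← Int.cast_abs, Int.abs_eq_natAbs]
    exact_mod_cast this

/-- The hull of a finite planar set of lattice points. -/
def hl (V : Finset (Fin 2 → ℤ)) : Set (Fin 2 → ℝ) := convexHull ℝ (castPt '' (V : Set (Fin 2 → ℤ)))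

theorem hl_mono {V W : Finset (Fin 2 → ℤ)} (h : V ⊆ W) : hl V ⊆ hl W :=
  convexHull_mono (image_mono (by exact_mod_cast h))

theorem mem_hl {V : Finset (Fin 2 → ℤ)} {v : Fin 2 → ℤ} (h : v ∈ V) : castPt v ∈ hl V :=
  subset_convexHull ℝ _ ⟨v, by exact_mod_cast h, rfl⟩

theorem hl_convex (V : Finset (Fin 2 → ℤ)) : Convex ℝ (hl V) := convex_convexHull ℝ _

theorem hl_compact (V : Finset (Fin 2 → ℤ)) : IsCompact (hl V) := by
  apply Set.Finite.isCompact_convexHull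
  exact V.finite_toSet.image _

theorem line_mem {C : Set (Fin 2 → ℝ)} (hC : Convex ℝ C) {x y : Fin 2 → ℝ} (hx : x ∈ C) (hy : y ∈ C)
    {t : ℝ} (h0 : 0 ≤ t) (h1 : t ≤ 1) : x + t • (y - x) ∈ C := by
  exact hC.add_smul_sub_mem hx hy ⟨h0, h1⟩

theorem ext_le {V : Finset (Fin 2 → ℤ)} {v w : Fin 2 → ℤ} (hv : v ∈ V) (hw : w ∈ V) (hvw : v ≠ w)
    (hE : castPt w ∉ hl (V.erase w)) {l : ℝ}
    (h : castPt v + l • (castPt w - castPt v) ∈ hl V) : l ≤ 1 := by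
  by_contra hl1
  push Not at hl1
  have hv' : castPt v ∈ hl (V.erase w) := mem_hl (Finset.mem_erase.2 ⟨hvw, hv⟩)
  have e : castPt '' (V : Set (Fin 2 → ℤ)) =
      insert (castPt w) (castPt '' ((V.erase w : Finset _) : Set (Fin 2 → ℤ))) := by
    rw [← image_insert_eq, ← Finset.coe_insert, Finset.insert_erase hw]
  unfold hl at h
  rw [e, convexHull_insert ⟨_, mem_image_of_mem _ (Finset.mem_erase.2 ⟨hvw, hv⟩)⟩] at h
  obtain ⟨x, hx, u, hu, hy⟩ := mem_convexJoin.1 h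
  rw [mem_singleton_iff] at hx
  subst hx
  obtain ⟨s, t, hs, ht, hst, hy⟩ := hy
  have hs' : s = 1 - t := by linarith
  subst hs'
  apply hE
  -- t u = castPt v + l (w - v) - (1-t) w ; so  w = v + (t/(l-1+t)) (u - v)
  have := line_mem (hl_convex (V.erase w)) hv' hu (t := t / (l - 1 + t))
    (div_nonneg ht (by linarith)) (by rw [div_le_one (by linarith)]; linarith)
  convert this using 1
  have hne : l - 1 + t ≠ 0 := by linarith
  ext i
  have := congrFun hy i
  simp only [Pi.add_apply, Pi.smul_apply, Pi.sub_apply, smul_eq_mul] at this ⊢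
  field_simp
  linear_combination -this

theorem crs_zero_line {x y : Fin 2 → ℝ} (hx : x ≠ 0) (h : crs x y = 0) : ∃ l : ℝ, y = l • x := by
  unfold crs at h
  by_cases h0 : x 0 = 0
  · have h1 : x 1 ≠ 0 := by
      intro h1; apply hx; ext i; fin_cases i <;> simp [h0, h1]
    refine ⟨y 1 / x 1, ?_⟩
    ext i; fin_cases i
    · rw [h0] at h; simp [h1] at h; simp [h, h0]
    · simp; field_simp
  · refine ⟨y 0 / x 0, ?_⟩
    ext i; fin_cases i
    · simp; field_simp
    · simp; field_simp; linarith

theorem castPt_ne {d : ℕ} {v w : Fin d → ℤ} (h : v ≠ w) : castPt v - castPt w ≠ 0 := fun h' =>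
  h (castPt_inj (sub_eq_zero.1 h'))

theorem ext_line {V : Finset (Fin 2 → ℤ)} (hE : ∀ w ∈ V, castPt w ∉ hl (V.erase w))
    {v w : Fin 2 → ℤ} (hv : v ∈ V) (hw : w ∈ V) (hvw : v ≠ w) {u : Fin 2 → ℝ} (hu : u ∈ hl V)
    (h : crs (castPt w - castPt v) (u - castPt v) = 0) :
    ∃ l : ℝ, 0 ≤ l ∧ l ≤ 1 ∧ u = castPt v + l • (castPt w - castPt v) := by
  obtain ⟨l, hl⟩ := crs_zero_line (castPt_ne hvw.symm) h
  have hu' : u = castPt v + l • (castPt w - castPt v) := by rw [← hl]; abel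
  refine ⟨l, ?_, ?_, hu'⟩
  · have := ext_le hw hv hvw.symm (hE v hv) (l := 1 - l) (by
      convert hu using 1; rw [hu']; ext i; simp; ring)
    linarith
  · exact ext_le hv hw hvw (hE w hw) (hu' ▸ hu)

theorem ext_crs {V : Finset (Fin 2 → ℤ)} (hE : ∀ w ∈ V, castPt w ∉ hl (V.erase w))
    {v w u : Fin 2 → ℤ} (hv : v ∈ V) (hw : w ∈ V) (hu : u ∈ V) (hvw : v ≠ w) (huv : u ≠ v)
    (huw : u ≠ w) : crs (castPt w - castPt v) (castPt u - castPt v) ≠ 0 := by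
  intro h
  obtain ⟨l, h0, h1, e⟩ := ext_line hE hv hw hvw (mem_hl hu) h
  apply hE u hu
  rw [e]
  exact line_mem (hl_convex _) (mem_hl (Finset.mem_erase.2 ⟨huv.symm, hv⟩))
    (mem_hl (Finset.mem_erase.2 ⟨huw.symm, hw⟩)) h0 h1

theorem crs_anti (a b : Fin 2 → ℝ) : crs a b = - crs b a := by unfold crs; ring

theorem split_exists {V : Finset (Fin 2 → ℤ)} (hE : ∀ w ∈ V, castPt w ∉ hl (V.erase w))
    (hc : 4 ≤ V.card) : ∃ v ∈ V, ∃ w ∈ V, v ≠ w ∧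
      (∃ y ∈ V, 0 < crs (castPt w - castPt v) (castPt y - castPt v)) ∧
      (∃ y ∈ V, crs (castPt w - castPt v) (castPt y - castPt v) < 0) := by
  obtain ⟨W, hW, hWc⟩ := Finset.exists_subset_card_eq hc
  obtain ⟨v, a, b, c, hva, hvb, hvc, hab, hac, hbc, rfl⟩ := Finset.card_eq_four.1 hWc
  have hv : v ∈ V := hW (by simp)
  have ha : a ∈ V := hW (by simp)
  have hb : b ∈ V := hW (by simp)
  have hc' : c ∈ V := hW (by simp)
  have hA := ext_crs hE hv ha hb hva hvb.symm hab.symm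
  have hB := ext_crs hE hv hb hc' hvb hvc.symm hbc.symm
  have hC := ext_crs hE hv hc' ha hvc hva.symm hac
  refine ⟨v, hv, ?_⟩
  have A' := crs_anti (castPt a - castPt v) (castPt b - castPt v)
  have B' := crs_anti (castPt b - castPt v) (castPt c - castPt v)
  have C' := crs_anti (castPt c - castPt v) (castPt a - castPt v)
  rcases lt_or_gt_of_ne hA with hA | hA <;> rcases lt_or_gt_of_ne hB with hB | hB
  · exact ⟨b, hb, hvb, ⟨a, ha, by linarith⟩, ⟨c, hc', by linarith⟩⟩
  · rcases lt_or_gt_of_ne hC with hC | hC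
    · exact ⟨a, ha, hva, ⟨c, hc', by linarith⟩, ⟨b, hb, by linarith⟩⟩
    · exact ⟨c, hc', hvc, ⟨a, ha, by linarith⟩, ⟨b, hb, by linarith⟩⟩
  · rcases lt_or_gt_of_ne hC with hC | hC
    · exact ⟨c, hc', hvc, ⟨b, hb, by linarith⟩, ⟨a, ha, by linarith⟩⟩
    · exact ⟨a, ha, hva, ⟨b, hb, by linarith⟩, ⟨c, hc', by linarith⟩⟩
  · exact ⟨b, hb, hvb, ⟨c, hc', by linarith⟩, ⟨a, ha, by linarith⟩⟩

theorem crs_comb (e x y p : Fin 2 → ℝ) (s t : ℝ) (h : s + t = 1) :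
    crs e (s • x + t • y - p) = s * crs e (x - p) + t * crs e (y - p) := by
  have : s = 1 - t := by linarith
  subst this
  simp [crs]; ring

theorem half_convex (e p : Fin 2 → ℝ) : Convex ℝ {x : Fin 2 → ℝ | 0 ≤ crs e (x - p)} := by
  intro x hx y hy s t hs ht hst
  simp only [mem_ofPred_eq] at *
  rw [crs_comb _ _ _ _ _ _ hst]; positivity

theorem half_convex' (e p : Fin 2 → ℝ) : Convex ℝ {x : Fin 2 → ℝ | crs e (x - p) ≤ 0} := by
  intro x hx y hy s t hs ht hst
  simp only [mem_ofPred_eq] at *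
  rw [crs_comb _ _ _ _ _ _ hst]; nlinarith

theorem poly_pick : ∀ n : ℕ, ∀ V : Finset (Fin 2 → ℤ), V.card ≤ n → ∀ d : Fin 2 → ℝ,
    (∀ v ∈ V, ∀ w ∈ V, v ≠ w → crs (castPt v - castPt w) d ≠ 0) →
    2 * (volume (hl V)).toReal ≤ ((up (hl V) d).ncard : ℝ) + (up (hl V) (-d)).ncard := by
  intro n
  induction n with
  | zero =>
    intro V hV d _
    have : V = ∅ := Finset.card_eq_zero.1 (by omega)
    subst this
    simp [hl]
    positivity
  | succ n ih =>
    intro V hV d hd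
    by_cases h3 : V.card ≤ 3
    · obtain h | h | h | h : V.card = 0 ∨ V.card = 1 ∨ V.card = 2 ∨ V.card = 3 := by omega
      · exact ih V (by omega) d hd
      · obtain ⟨p, rfl⟩ := Finset.card_eq_one.1 h
        exact tri_poly p p p d _ (by simp) hd
      · obtain ⟨p, q, _, rfl⟩ := Finset.card_eq_two.1 h
        exact tri_poly p q q d _ (by simp) hd
      · obtain ⟨p, q, r, _, _, _, rfl⟩ := Finset.card_eq_three.1 h
        exact tri_poly p q r d _ rfl hd
    by_cases hE : ∀ w ∈ V, castPt w ∉ hl (V.erase w)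
    swap
    · push Not at hE
      obtain ⟨w, hw, hw'⟩ := hE
      have e : hl V = hl (V.erase w) := by
        apply Subset.antisymm _ (hl_mono (Finset.erase_subset _ _))
        apply convexHull_min _ (hl_convex _)
        rintro _ ⟨v, hv, rfl⟩
        by_cases hvw : v = w
        · rw [hvw]; exact hw'
        · exact mem_hl (Finset.mem_erase.2 ⟨hvw, by exact_mod_cast hv⟩)
      rw [e]
      refine ih (V.erase w) (by rw [Finset.card_erase_of_mem hw]; omega) d ?_
      intro v hv w hw
      exact hd v (Finset.mem_of_mem_erase hv) w (Finset.mem_of_mem_erase hw)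
    obtain ⟨v, hv, w, hw, hvw, ⟨y, hy, hy'⟩, ⟨z, hz, hz'⟩⟩ := split_exists hE (by omega)
    obtain ⟨e, he⟩ : ∃ e, e = castPt w - castPt v := ⟨_, rfl⟩
    rw [← he] at hy' hz'
    classical
    obtain ⟨Vp, hVp⟩ : ∃ W, W = V.filter (fun x => 0 ≤ crs e (castPt x - castPt v)) := ⟨_, rfl⟩
    obtain ⟨Vm, hVm⟩ : ∃ W, W = V.filter (fun x => crs e (castPt x - castPt v) ≤ 0) := ⟨_, rfl⟩
    have sp : Vp ⊆ V := by rw [hVp]; exact Finset.filter_subset _ _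
    have sm : Vm ⊆ V := by rw [hVm]; exact Finset.filter_subset _ _
    have cp : Vp.card < V.card := by
      apply Finset.card_lt_card
      refine ⟨sp, fun h => ?_⟩
      have := h hz
      rw [hVp, Finset.mem_filter] at this
      linarith [this.2]
    have cm : Vm.card < V.card := by
      apply Finset.card_lt_card
      refine ⟨sm, fun h => ?_⟩
      have := h hy
      rw [hVm, Finset.mem_filter] at this
      linarith [this.2]
    have ev : crs e (castPt v - castPt v) = 0 := by simp [crs]
    have ew : crs e (castPt w - castPt v) = 0 := by rw [he]; unfold crs; ring
    have vp : v ∈ Vp := by rw [hVp]; exact Finset.mem_filter.2 ⟨hv, ev.ge⟩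
    have vm : v ∈ Vm := by rw [hVm]; exact Finset.mem_filter.2 ⟨hv, ev.le⟩
    have wp : w ∈ Vp := by rw [hVp]; exact Finset.mem_filter.2 ⟨hw, ew.ge⟩
    have wm : w ∈ Vm := by rw [hVm]; exact Finset.mem_filter.2 ⟨hw, ew.le⟩
    have pp : hl Vp ⊆ {x | 0 ≤ crs e (x - castPt v)} := by
      apply convexHull_min _ (half_convex _ _)
      rintro _ ⟨x, hx, rfl⟩
      rw [hVp] at hx
      exact (Finset.mem_filter.1 (Finset.mem_coe.1 hx)).2
    have mm : hl Vm ⊆ {x | crs e (x - castPt v) ≤ 0} := by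
      apply convexHull_min _ (half_convex' _ _)
      rintro _ ⟨x, hx, rfl⟩
      rw [hVm] at hx
      exact (Finset.mem_filter.1 (Finset.mem_coe.1 hx)).2
    have hun : Vp ∪ Vm = V := by
      apply Finset.Subset.antisymm (Finset.union_subset sp sm)
      intro x hx
      rw [Finset.mem_union, hVp, hVm, Finset.mem_filter, Finset.mem_filter]
      rcases le_total 0 (crs e (castPt x - castPt v)) with h | h <;> tauto
    have hzero : ∀ u ∈ hl V, crs e (u - castPt v) = 0 → u ∈ hl Vp ∧ u ∈ hl Vm := by
      intro u hu h
      rw [he] at h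
      obtain ⟨l, h0, h1, rfl⟩ := ext_line hE hv hw hvw hu h
      exact ⟨line_mem (hl_convex _) (mem_hl vp) (mem_hl wp) h0 h1,
        line_mem (hl_convex _) (mem_hl vm) (mem_hl wm) h0 h1⟩
    have hcov : hl V ⊆ hl Vp ∪ hl Vm := by
      intro x hx
      have hx' := hx
      unfold hl at hx
      rw [← hun, Finset.coe_union, image_union, convexHull_union
        ⟨_, mem_image_of_mem _ vp⟩ ⟨_, mem_image_of_mem _ vm⟩] at hx
      obtain ⟨y, hy, z, hz, hxs⟩ := mem_convexJoin.1 hx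
      obtain ⟨s, t, hs, ht, hst, rfl⟩ := hxs
      have fy : 0 ≤ crs e (y - castPt v) := pp hy
      have fz : crs e (z - castPt v) ≤ 0 := mm hz
      have hfx := crs_comb e y z (castPt v) s t hst
      obtain ⟨fY, hfY⟩ : ∃ r, r = crs e (y - castPt v) := ⟨_, rfl⟩
      obtain ⟨fZ, hfZ⟩ : ∃ r, r = crs e (z - castPt v) := ⟨_, rfl⟩
      rw [← hfY] at fy
      rw [← hfZ] at fz
      rw [← hfY, ← hfZ] at hfx
      by_cases hD : fY - fZ = 0
      · have : fY = 0 := by linarith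
        have h2 : fZ = 0 := by linarith
        rw [this, h2] at hfx
        left
        exact (hzero _ hx' (by rw [hfx]; ring)).1
      · have hDp : 0 < fY - fZ := lt_of_le_of_ne (by linarith) (Ne.symm hD)
        -- the crossing point
        have hy2 : y ∈ hl V := hl_mono sp hy
        have hz2 : z ∈ hl V := hl_mono sm hz
        have hu := (hl_convex V) hy2 hz2 (a := -fZ / (fY - fZ)) (b := fY / (fY - fZ))
          (div_nonneg (by linarith) hDp.le) (div_nonneg fy hDp.le) (by field_simp; ring)
        have hu0 := crs_comb e y z (castPt v) (-fZ / (fY - fZ)) (fY / (fY - fZ))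
          (by field_simp; ring)
        rw [← hfY, ← hfZ] at hu0
        have hu1 := hzero _ hu (by rw [hu0]; field_simp; ring)
        obtain ⟨u, hu2⟩ : ∃ u, u = (-fZ / (fY - fZ)) • y + (fY / (fY - fZ)) • z := ⟨_, rfl⟩
        rw [← hu2] at hu1
        rcases le_total 0 (s * fY + t * fZ) with hpos | hneg
        · left
          by_cases hY : fY = 0
          · have : t * fZ = 0 := by
              rw [hY] at hpos; nlinarith
            exact (hzero _ hx' (by rw [hfx, hY, this]; ring)).1
          have hYp : 0 < fY := lt_of_le_of_ne fy (Ne.symm hY)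
          have := (hl_convex Vp) hy hu1.1 (a := (s * fY + t * fZ) / fY) (b := t * (fY - fZ) / fY)
            (by positivity) (by positivity)
            (by field_simp; linear_combination fY * hst)
          convert this using 1
          rw [hu2]; ext i; simp; field_simp; ring
        · right
          by_cases hZ : fZ = 0
          · have : s * fY = 0 := by
              rw [hZ] at hneg; nlinarith
            exact (hzero _ hx' (by rw [hfx, hZ, this]; ring)).2
          have hZp : 0 < -fZ := by have := lt_of_le_of_ne fz hZ; linarith
          have := (hl_convex Vm) hz hu1.2 (a := (-(s * fY + t * fZ)) / (-fZ))
            (b := s * (fY - fZ) / (-fZ))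
            (div_nonneg (by linarith) hZp.le) (by positivity)
            (by field_simp; linear_combination (fZ) * hst)
          convert this using 1
          rw [hu2]; ext i; simp; field_simp; ring
    have hvol : (volume (hl V)).toReal ≤ (volume (hl Vp)).toReal + (volume (hl Vm)).toReal := by
      rw [← ENNReal.toReal_add (hl_compact _).measure_lt_top.ne (hl_compact _).measure_lt_top.ne]
      apply ENNReal.toReal_mono
      · exact (ENNReal.add_lt_top.2 ⟨(hl_compact _).measure_lt_top, (hl_compact _).measure_lt_top⟩).ne
      · exact (measure_mono hcov).trans (measure_union_le _ _)
    have hcnt : ∀ d' : Fin 2 → ℝ, crs e d' ≠ 0 → (up (hl Vp) d').ncard + (up (hl Vm) d').ncard ≤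
        (up (hl V) d').ncard := by
      intro d' hd'
      have hfin : ∀ W : Finset (Fin 2 → ℤ), (up (hl W) d').Finite := fun W =>
        (compact_pts_finite (hl_compact W)).subset fun x hx => hx.1
      rw [← Set.ncard_union_eq _ (hfin _) (hfin _)]
      · apply Set.ncard_le_ncard _ (hfin _)
        rintro q (⟨h1, ε, h2, h3⟩ | ⟨h1, ε, h2, h3⟩)
        · exact ⟨hl_mono sp h1, ε, h2, hl_mono sp h3⟩
        · exact ⟨hl_mono sm h1, ε, h2, hl_mono sm h3⟩
      · rw [Set.disjoint_left]
        rintro q ⟨h1, ε, h2, h3⟩ ⟨h1', ε', h2', h3'⟩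
        have a1 : 0 ≤ crs e (castPt q - castPt v) := pp h1
        have a2 : crs e (castPt q - castPt v) ≤ 0 := mm h1'
        have a3 : 0 ≤ crs e (castPt q + ε • d' - castPt v) := pp h3
        have a4 : crs e (castPt q + ε' • d' - castPt v) ≤ 0 := mm h3'
        have ex : ∀ r : ℝ, crs e (castPt q + r • d' - castPt v) =
            crs e (castPt q - castPt v) + r * crs e d' := by
          intro r; simp [crs]; ring
        rw [ex, le_antisymm a2 a1, zero_add] at a3 a4
        apply hd'
        apply le_antisymm
        · exact nonpos_of_mul_nonpos_right a4 h2'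
        · exact nonneg_of_mul_nonneg_right a3 h2
    have hed : crs e d ≠ 0 := by rw [he]; exact hd w hw v hv hvw.symm
    have hed' : crs e (-d) ≠ 0 := by
      intro h; apply hed
      have : crs e (-d) = - crs e d := by simp [crs]; ring
      linarith
    have i1 := ih Vp (by omega) d (fun x hx y hy => hd x (sp hx) y (sp hy))
    have i2 := ih Vm (by omega) d (fun x hx y hy => hd x (sm hx) y (sm hy))
    have c1 := hcnt d hed
    have c2 := hcnt (-d) hed'
    have c1' : ((up (hl Vp) d).ncard : ℝ) + (up (hl Vm) d).ncard ≤ (up (hl V) d).ncard := by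
      exact_mod_cast c1
    have c2' : ((up (hl Vp) (-d)).ncard : ℝ) + (up (hl Vm) (-d)).ncard ≤ (up (hl V) (-d)).ncard := by
      exact_mod_cast c2
    linarith

/-! ## The boundary volume against boundary lattice points -/

/-- A linear functional with parameter `t`. -/
def lfn (t : ℝ) : (Fin 3 → ℝ) →ₗ[ℝ] ℝ :=
  LinearMap.proj 0 + t • LinearMap.proj 1 + t ^ 2 • LinearMap.proj 2

theorem lfn_apply (t : ℝ) (x : Fin 3 → ℝ) : lfn t x = x 0 + t * x 1 + t ^ 2 * x 2 := by
  simp [lfn]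

theorem lfn_generic (S : Set (Fin 3 → ℤ)) (hS : S.Finite) :
    ∃ t : ℝ, ∀ v ∈ S, ∀ w ∈ S, lfn t (castPt v) = lfn t (castPt w) → v = w := by
  classical
  have hfin : ∀ x : Fin 3 → ℤ, x ≠ 0 → {t : ℝ | lfn t (castPt x) = 0}.Finite := by
    intro x hx
    obtain ⟨p, hp⟩ : ∃ p : Polynomial ℝ, p = Polynomial.C (x 0 : ℝ) +
      Polynomial.C (x 1 : ℝ) * Polynomial.X + Polynomial.C (x 2 : ℝ) * Polynomial.X ^ 2 := ⟨_, rfl⟩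
    have hp0 : p ≠ 0 := by
      intro h
      apply hx
      have h0 := congrArg (fun q => Polynomial.coeff q 0) h
      have h1 := congrArg (fun q => Polynomial.coeff q 1) h
      have h2 := congrArg (fun q => Polynomial.coeff q 2) h
      rw [hp] at h0 h1 h2
      simp only [Polynomial.coeff_add, Polynomial.coeff_C_mul, Polynomial.coeff_X,
        Polynomial.coeff_C, Polynomial.coeff_X_pow, Polynomial.coeff_zero] at h0 h1 h2
      norm_num at h0 h1 h2
      ext i; fin_cases i <;> simp [h0, h1, h2]
    refine (p.roots.toFinset.finite_toSet).subset ?_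
    intro t ht
    simp only [mem_ofPred_eq, lfn_apply, castPt] at ht
    rw [Finset.mem_coe, Multiset.mem_toFinset, Polynomial.mem_roots hp0, Polynomial.IsRoot.def, hp]
    simp only [Polynomial.eval_add, Polynomial.eval_mul, Polynomial.eval_C, Polynomial.eval_X,
      Polynomial.eval_pow]
    linarith
  have hb : (⋃ p ∈ {p : (Fin 3 → ℤ) × (Fin 3 → ℤ) | p ∈ S ×ˢ S ∧ p.1 ≠ p.2},
      {t : ℝ | lfn t (castPt (p.1 - p.2)) = 0}).Finite := by
    apply Set.Finite.biUnion ((hS.prod hS).subset fun p hp => hp.1)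
    intro p hp
    exact hfin _ (sub_ne_zero.2 hp.2)
  obtain ⟨t, ht⟩ := hb.infinite_compl.nonempty
  refine ⟨t, fun v hv w hw h => ?_⟩
  by_contra hne
  apply ht
  simp only [mem_iUnion]
  refine ⟨(v, w), ⟨⟨hv, hw⟩, hne⟩, ?_⟩
  simp only [mem_ofPred_eq]
  rw [castPt_sub, map_sub, h, sub_self]

theorem face_hull (V : Finset (Fin 3 → ℤ)) (m : (Fin 3 → ℝ) →ₗ[ℝ] ℝ) (c : ℝ)
    (hm : ∀ v ∈ V, m (castPt v) ≤ c) {x : Fin 3 → ℝ}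
    (hx : x ∈ convexHull ℝ (castPt '' (V : Set (Fin 3 → ℤ)))) (hc : m x = c) :
    x ∈ convexHull ℝ (castPt '' {v | v ∈ V ∧ m (castPt v) = c}) := by
  obtain ⟨A, hA⟩ : ∃ A, A = castPt '' {v | v ∈ V ∧ m (castPt v) = c} := ⟨_, rfl⟩
  obtain ⟨B, hB⟩ : ∃ B, B = castPt '' {v | v ∈ V ∧ m (castPt v) < c} := ⟨_, rfl⟩
  have hAB : castPt '' (V : Set (Fin 3 → ℤ)) = A ∪ B := by
    rw [hA, hB, ← image_union]
    congr 1
    ext v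
    simp only [Finset.mem_coe, mem_union, mem_ofPred_eq]
    constructor
    · intro h
      rcases lt_or_eq_of_le (hm v h) with h' | h'
      · exact Or.inr ⟨h, h'⟩
      · exact Or.inl ⟨h, h'⟩
    · rintro (h | h) <;> exact h.1
  have hBc : convexHull ℝ B ⊆ {y | m y < c} := by
    apply convexHull_min
    · rw [hB]; rintro _ ⟨v, hv, rfl⟩; exact hv.2
    · exact convex_halfSpace_lt (LinearMap.isLinear m) c
  have hAc : convexHull ℝ A ⊆ {y | m y ≤ c} := by
    apply convexHull_min
    · rw [hA]; rintro _ ⟨v, hv, rfl⟩; exact hv.2.le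
    · exact convex_halfSpace_le (LinearMap.isLinear m) c
  rw [← hA]
  rw [hAB] at hx
  rcases A.eq_empty_or_nonempty with hAe | hAe
  · rw [hAe, empty_union] at hx
    exact absurd hc (hBc hx).ne
  rcases B.eq_empty_or_nonempty with hBe | hBe
  · rwa [hBe, union_empty] at hx
  rw [convexHull_union hAe hBe] at hx
  obtain ⟨y, hy, z, hz, s, t, hs, ht, hst, rfl⟩ := mem_convexJoin.1 hx
  have h1 : m y ≤ c := hAc hy
  have h2 : m z < c := hBc hz
  rw [map_add, map_smul, map_smul, smul_eq_mul, smul_eq_mul] at hc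
  have : t = 0 := by
    by_contra h0
    have : 0 < t := lt_of_le_of_ne ht (Ne.symm h0)
    have hs' : s = 1 - t := by linarith
    subst hs'
    nlinarith
  subst this
  have : s = 1 := by linarith
  subst this
  simpa using hy

/-- Lattice points of `F` from which the direction `d` stays in `F`. -/
def upF (F : Set (Fin 3 → ℝ)) (d : Fin 3 → ℝ) : Set (Fin 3 → ℤ) :=
  {q | castPt q ∈ F ∧ ∃ ε : ℝ, 0 < ε ∧ castPt q + ε • d ∈ F}

theorem facet_bound (V : Finset (Fin 3 → ℤ)) {P F : Set (Fin 3 → ℝ)}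
    (hP : P = convexHull ℝ (castPt '' (V : Set (Fin 3 → ℤ)))) (t : ℝ)
    (ht : ∀ v ∈ V, ∀ w ∈ V, lfn t (castPt v) = lfn t (castPt w) → v = w)
    (hF : IsFacetOf F P) {a : ℝ} (ha : IsNormalisedAreaOf F a) :
    ∃ d : Fin 3 → ℝ, d ≠ 0 ∧ lfn t d = 0 ∧ d ∈ (affineSpan ℝ F).direction ∧
      a ≤ ((upF F d).ncard : ℝ) + (upF F (-d)).ncard := by
  classical
  obtain ⟨⟨⟨p, hpF⟩, m, c, hm, hFe⟩, hdim⟩ := hF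
  obtain ⟨M, b, hbij, hinj, rfl⟩ := ha
  unfold faceDim at hdim
  obtain ⟨D, hD⟩ : ∃ D, D = (affineSpan ℝ F).direction := ⟨_, rfl⟩
  rw [← hD] at hdim ⊢
  obtain ⟨d', hd', hd0⟩ : ∃ d' : D, (lfn t).domRestrict D d' = 0 ∧ d' ≠ 0 := by
    have : LinearMap.ker ((lfn t).domRestrict D) ≠ ⊥ :=
      LinearMap.ker_ne_bot_of_finrank_lt (by rw [hdim]; simp)
    obtain ⟨x, hx, h0⟩ := (Submodule.ne_bot_iff _).1 this
    exact ⟨x, hx, h0⟩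
  obtain ⟨d, hd⟩ := d'
  have hd0 : d ≠ 0 := by intro h; apply hd0; ext1; exact h
  have hdl : lfn t d = 0 := hd'
  refine ⟨d, hd0, hdl, hd, ?_⟩
  obtain ⟨Mr, hMr⟩ : ∃ Mr, Mr = M.map (Int.cast : ℤ → ℝ) := ⟨_, rfl⟩
  rw [← hMr] at hinj ⊢
  have hpA : p ∈ affineSpan ℝ F := subset_affineSpan ℝ F hpF
  have hker : ∀ x ∈ D, Mr.mulVec x = 0 → x = 0 := by
    intro x hx h
    rw [hD] at hx
    have h1 : x +ᵥ p ∈ affineSpan ℝ F := AffineSubspace.vadd_mem_of_mem_direction hx hpA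
    have := hinj h1 hpA (by simp [Matrix.mulVec_add, h])
    simpa using this
  obtain ⟨VF, hVF⟩ : ∃ VF, VF = V.filter (fun v => m (castPt v) = c) := ⟨_, rfl⟩
  have hVF' : (VF : Set (Fin 3 → ℤ)) = {v | v ∈ V ∧ m (castPt v) = c} := by
    rw [hVF]; ext; simp
  have hFh : F = convexHull ℝ (castPt '' (VF : Set (Fin 3 → ℤ))) := by
    apply Subset.antisymm
    · intro x hx
      rw [hFe] at hx
      rw [hVF']
      refine face_hull V m c (fun v hv => hm _ ?_) (hP ▸ hx.1) hx.2
      rw [hP]; exact subset_convexHull ℝ _ ⟨v, hv, rfl⟩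
    · rw [hVF', hFe]
      apply convexHull_min
      · rintro _ ⟨v, hv, rfl⟩
        exact ⟨by rw [hP]; exact subset_convexHull ℝ _ ⟨v, hv.1, rfl⟩, hv.2⟩
      · apply Convex.inter
        · rw [hP]; exact convex_convexHull ℝ _
        · exact convex_hyperplane (LinearMap.isLinear m) c
  have hintr : ∀ v : Fin 3 → ℤ, castPt (M.mulVec v + b) = Mr.mulVec (castPt v) + castPt b := by
    intro v
    rw [castPt_add, castPt_mulVec, hMr]
  obtain ⟨W, hW⟩ : ∃ W, W = VF.image (fun v => M.mulVec v + b) := ⟨_, rfl⟩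
  have himg : (fun x : Fin 3 → ℝ => Mr.mulVec x + castPt b) '' F = hl W := by
    obtain ⟨f, hf⟩ : ∃ f : (Fin 3 → ℝ) →ᵃ[ℝ] (Fin 2 → ℝ), ∀ x, f x = Mr.mulVec x + castPt b :=
      ⟨(Matrix.toLin' Mr).toAffineMap + AffineMap.const ℝ _ (castPt b), fun x => by simp⟩
    have : (fun x : Fin 3 → ℝ => Mr.mulVec x + castPt b) = f := by ext1 x; rw [hf]
    rw [this, hFh, AffineMap.image_convexHull, hl, hW, Finset.coe_image, image_image, image_image]
    congr 1
    apply image_congr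
    intro v _
    rw [hf, hintr]
  rw [himg]
  have hgen : ∀ v ∈ W, ∀ w ∈ W, v ≠ w → crs (castPt v - castPt w) (Mr.mulVec d) ≠ 0 := by
    intro v hv w hw hvw h
    rw [hW, Finset.mem_image] at hv hw
    obtain ⟨x, hx, rfl⟩ := hv
    obtain ⟨y, hy, rfl⟩ := hw
    have hMd : Mr.mulVec d ≠ 0 := fun h => hd0 (hker d hd h)
    rw [crs_anti, neg_eq_zero] at h
    obtain ⟨l, hl⟩ := crs_zero_line hMd h
    have hxF : ∀ z ∈ VF, castPt z ∈ affineSpan ℝ F := by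
      intro z hz
      apply subset_affineSpan ℝ F
      rw [hFh]; exact subset_convexHull ℝ _ ⟨z, hz, rfl⟩
    have hxy : castPt x - castPt y ∈ D := by
      rw [hD]; exact AffineSubspace.vsub_mem_direction (hxF x hx) (hxF y hy)
    have := hker (castPt x - castPt y - l • d) (D.sub_mem hxy (D.smul_mem l hd)) (by
      rw [hintr, hintr, add_sub_add_right_eq_sub] at hl
      rw [Matrix.mulVec_sub, Matrix.mulVec_sub, Matrix.mulVec_smul, hl, sub_self])
    have h2 := congrArg (lfn t) this
    rw [map_sub, map_smul, hdl, map_sub, smul_zero, sub_zero, map_zero] at h2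
    apply hvw
    rw [ht x (by rw [hVF] at hx; exact (Finset.mem_filter.1 hx).1) y
      (by rw [hVF] at hy; exact (Finset.mem_filter.1 hy).1) (by linarith)]
  have hpick := poly_pick W.card W le_rfl (Mr.mulVec d) hgen
  have hFc : IsCompact F := by
    rw [hFh]; exact (VF.finite_toSet.image _).isCompact_convexHull ℝ
  have hup : ∀ e ∈ D, (up (hl W) (Mr.mulVec e)).ncard ≤ (upF F e).ncard := by
    intro e he
    have hfin : (upF F e).Finite := (compact_pts_finite hFc).subset fun x hx => hx.1
    refine (Set.ncard_le_ncard (t := (fun v => M.mulVec v + b) '' upF F e) ?_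
      (hfin.image _)).trans (Set.ncard_image_le hfin)
    rintro q ⟨h1, ε, h2, h3⟩
    obtain ⟨v, hv, rfl⟩ := hbij.surjOn (mem_univ q)
    simp only [mem_ofPred_eq] at hv
    refine ⟨v, ⟨?_, ε, h2, ?_⟩, rfl⟩
    · rw [← himg, hintr] at h1
      obtain ⟨x, hx, hx'⟩ := h1
      rwa [← hinj (subset_affineSpan ℝ F hx) hv hx']
    · rw [← himg, hintr] at h3
      obtain ⟨x, hx, hx'⟩ := h3
      have hv' : castPt v + ε • e ∈ affineSpan ℝ F := by
        have : (ε • e) +ᵥ castPt v ∈ affineSpan ℝ F :=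
          AffineSubspace.vadd_mem_of_mem_direction (by rw [← hD]; exact D.smul_mem _ he) hv
        rwa [vadd_eq_add, add_comm] at this
      rwa [← hinj (subset_affineSpan ℝ F hx) hv' (by
        simp only at hx' ⊢
        rw [hx', Matrix.mulVec_add, Matrix.mulVec_smul]; abel)]
  have u1 := hup d hd
  have u2 := hup (-d) (D.neg_mem hd)
  rw [Matrix.mulVec_neg] at u2
  have u1' : ((up (hl W) (Mr.mulVec d)).ncard : ℝ) ≤ (upF F d).ncard := by exact_mod_cast u1
  have u2' : ((up (hl W) (-Mr.mulVec d)).ncard : ℝ) ≤ (upF F (-d)).ncard := by exact_mod_cast u2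
  linarith

theorem facet_data {P F : Set (Fin 3 → ℝ)} (htop : affineSpan ℝ P = ⊤) (hF : IsFacetOf F P) :
    ∃ (m : (Fin 3 → ℝ) →ₗ[ℝ] ℝ) (c : ℝ), (∀ x ∈ P, m x ≤ c) ∧ F = {x ∈ P | m x = c} ∧
      (∀ o ∈ interior P, m o < c) ∧ ∀ d ∈ (affineSpan ℝ F).direction, m d = 0 := by
  obtain ⟨⟨⟨p, hpF⟩, m, c, hm, hFe⟩, hdim⟩ := hF
  refine ⟨m, c, hm, hFe, ?_, ?_⟩
  · intro o ho
    refine lt_of_le_of_ne (hm o (interior_subset ho)) fun h => ?_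
    have h1 : ∀ d, m d ≤ 0 := by
      intro d
      obtain ⟨ε, hε, h2⟩ := int_move ho d
      have h3 := hm _ (interior_subset h2)
      rw [map_add, map_smul, h, smul_eq_mul] at h3
      have h4 : ε * m d ≤ 0 := by linarith
      exact nonpos_of_mul_nonpos_right h4 hε
    have h2 : ∀ d, m d = 0 := fun d => le_antisymm (h1 d) (by
      have := h1 (-d); rw [map_neg] at this; linarith)
    have h3 : F = P := by
      rw [hFe]; ext x
      constructor
      · exact fun h => h.1
      · intro hx; exact ⟨hx, by rw [h2, ← h, h2]⟩
    rw [h3] at hdim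
    unfold faceDim at hdim
    rw [htop, AffineSubspace.direction_top, finrank_top] at hdim
    simp at hdim
  · have : (affineSpan ℝ F).direction ≤ LinearMap.ker m := by
      rw [direction_affineSpan, vectorSpan_def, Submodule.span_le]
      rintro _ ⟨x, hx, y, hy, rfl⟩
      rw [hFe] at hx hy
      simp [hx.2, hy.2]
    exact fun d hd => this hd

theorem side_unique (V : Finset (Fin 3 → ℤ)) {P F1 F2 : Set (Fin 3 → ℝ)}
    (hP : P = convexHull ℝ (castPt '' (V : Set (Fin 3 → ℤ)))) (t : ℝ)
    (ht : ∀ v ∈ V, ∀ w ∈ V, lfn t (castPt v) = lfn t (castPt w) → v = w)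
    {m1 m2 : (Fin 3 → ℝ) →ₗ[ℝ] ℝ} {c1 c2 : ℝ} (hm1 : ∀ x ∈ P, m1 x ≤ c1) (hm2 : ∀ x ∈ P, m2 x ≤ c2)
    (hF1 : F1 = {x ∈ P | m1 x = c1}) (hF2 : F2 = {x ∈ P | m2 x = c2})
    {w1 w2 e : Fin 3 → ℝ} {q : Fin 3 → ℤ} (hq1 : q ∈ upF F1 w1) (hq2 : q ∈ upF F2 w2)
    (lw1 : lfn t w1 = 0) (le : lfn t e = 0) (mw1 : m1 w1 = 0) (mw2 : m2 w2 = 0)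
    (w10 : w1 ≠ 0) (me1 : m1 e < 0) (me2 : m2 e < 0) {α β : ℝ}
    (hw : w2 = α • e + β • w1) (hβ : 0 < β) : F1 = F2 ∧ w2 = β • w1 := by
  obtain ⟨qF1, ε1, he1, hm1'⟩ := hq1
  obtain ⟨qF2, ε2, he2, hm2'⟩ := hq2
  have qP : castPt q ∈ P := by rw [hF1] at qF1; exact qF1.1
  have q1 : m1 (castPt q) = c1 := by rw [hF1] at qF1; exact qF1.2
  have q2 : m2 (castPt q) = c2 := by rw [hF2] at qF2; exact qF2.2
  have p1 : castPt q + ε1 • w1 ∈ P := by rw [hF1] at hm1'; exact hm1'.1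
  have p2 : castPt q + ε2 • w2 ∈ P := by rw [hF2] at hm2'; exact hm2'.1
  have a1 : m1 w2 ≤ 0 := by
    have := hm1 _ p2
    rw [map_add, map_smul, q1, smul_eq_mul] at this
    exact nonpos_of_mul_nonpos_right (by linarith : ε2 * m1 w2 ≤ 0) he2
  have a2 : m2 w1 ≤ 0 := by
    have := hm2 _ p1
    rw [map_add, map_smul, q2, smul_eq_mul] at this
    exact nonpos_of_mul_nonpos_right (by linarith : ε1 * m2 w1 ≤ 0) he1
  have b1 : 0 ≤ α := by
    rw [hw, map_add, map_smul, map_smul, mw1, smul_eq_mul, smul_zero, add_zero] at a1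
    by_contra h
    push Not at h
    nlinarith
  have b2 : α ≤ 0 := by
    rw [hw, map_add, map_smul, map_smul, smul_eq_mul, smul_eq_mul] at mw2
    by_contra h
    push Not at h
    nlinarith
  have ha : α = 0 := le_antisymm b2 b1
  subst ha
  rw [zero_smul, zero_add] at hw
  refine ⟨?_, hw⟩
  have m2w1 : m2 w1 = 0 := by
    rw [hw, map_smul, smul_eq_mul] at mw2
    rcases mul_eq_zero.1 mw2 with h | h
    · exact absurd h hβ.ne'
    · exact h
  -- two vertices on the common face
  have hmV : ∀ v ∈ V, m1 (castPt v) ≤ c1 ∧ m2 (castPt v) ≤ c2 := by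
    intro v hv
    have : castPt v ∈ P := by rw [hP]; exact subset_convexHull ℝ _ ⟨v, hv, rfl⟩
    exact ⟨hm1 _ this, hm2 _ this⟩
  have f1 := face_hull V (m1 + m2) (c1 + c2) (fun v hv => by
    have := hmV v hv; simp only [LinearMap.add_apply]; linarith) (x := castPt q) (hP ▸ qP)
    (by simp [q1, q2])
  have f2 := face_hull V (m1 + m2) (c1 + c2) (fun v hv => by
    have := hmV v hv; simp only [LinearMap.add_apply]; linarith) (x := castPt q + ε1 • w1)
    (hP ▸ p1) (by simp [q1, q2, mw1, m2w1])
  have hne : ∃ v v', v ≠ v' ∧ (v ∈ V ∧ (m1 + m2) (castPt v) = c1 + c2) ∧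
      (v' ∈ V ∧ (m1 + m2) (castPt v') = c1 + c2) := by
    by_contra hcon
    push Not at hcon
    have hsub : (castPt '' {v | v ∈ V ∧ (m1 + m2) (castPt v) = c1 + c2}).Subsingleton := by
      rintro _ ⟨v, hv, rfl⟩ _ ⟨v', hv', rfl⟩
      by_contra h
      exact hcon v v' (fun h' => h (by rw [h'])) hv hv'.1 hv'.2
    have hs2 := (Set.Subsingleton.convex (𝕜 := ℝ) hsub).convexHull_eq
    rw [hs2] at f1 f2
    have := hsub f1 f2
    rw [left_eq_add] at this
    rcases smul_eq_zero.1 this with h | h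
    · exact he1.ne' h
    · exact w10 h
  obtain ⟨v, v', hvv, ⟨hv, sv⟩, ⟨hv', sv'⟩⟩ := hne
  have hzl : lfn t (castPt v - castPt v') ≠ 0 := by
    intro h; rw [map_sub, sub_eq_zero] at h; exact hvv (ht v hv v' hv' h)
  obtain ⟨z, hz⟩ : ∃ z, z = castPt v - castPt v' := ⟨_, rfl⟩
  rw [← hz] at hzl
  have mz : m1 z = 0 ∧ m2 z = 0 := by
    have h1 := hmV v hv
    have h2 := hmV v' hv'
    rw [LinearMap.add_apply] at sv sv'
    rw [hz, map_sub, map_sub]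
    constructor <;> linarith
  have hli : LinearIndependent ℝ ![z, w1, e] := by
    rw [Fintype.linearIndependent_iff]
    intro g hg
    rw [Fin.sum_univ_three] at hg
    simp only [Matrix.cons_val_zero, Matrix.cons_val_one, Matrix.cons_val] at hg
    have g0 : g 0 = 0 := by
      have := congrArg (lfn t) hg
      rw [map_add, map_add, map_smul, map_smul, map_smul, lw1, le, map_zero] at this
      simpa [hzl] using this
    have g2 : g 2 = 0 := by
      have := congrArg m1 hg
      rw [map_add, map_add, map_smul, map_smul, map_smul, mw1, mz.1, map_zero] at this
      simpa [me1.ne] using this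
    have g1 : g 1 = 0 := by
      rw [g0, g2] at hg
      simpa [w10] using hg
    intro i; fin_cases i
    · exact g0
    · exact g1
    · exact g2
  have hspan := hli.span_eq_top_of_card_eq_finrank' (by simp)
  have hg0 : ∀ y, m1 e * m2 y = m2 e * m1 y := by
    have hle : (⊤ : Submodule ℝ (Fin 3 → ℝ)) ≤ LinearMap.ker (m1 e • m2 - m2 e • m1) := by
      rw [← hspan, Submodule.span_le]
      rintro _ ⟨i, rfl⟩
      fin_cases i
      · simp [mz.1, mz.2]
      · simp [mw1, m2w1]
      · simp; ring
    intro y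
    have := hle (Submodule.mem_top (x := y))
    simp at this
    linarith
  rw [hF1, hF2]
  ext x
  have h1 := hg0 (x - castPt q)
  rw [map_sub, map_sub, q1, q2] at h1
  constructor
  · rintro ⟨hx, hx'⟩
    refine ⟨hx, ?_⟩
    rw [hx', sub_self, mul_zero] at h1
    rcases mul_eq_zero.1 h1 with h | h <;> linarith
  · rintro ⟨hx, hx'⟩
    refine ⟨hx, ?_⟩
    rw [hx', sub_self, mul_zero] at h1
    rcases mul_eq_zero.1 h1.symm with h | h <;> linarith

theorem lfn_plane {t : ℝ} {e x : Fin 3 → ℝ} (he : lfn t e = 0) (hx : lfn t x = 0) (e0 : e ≠ 0)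
    (h : e 1 * x 2 - e 2 * x 1 = 0) : ∃ l : ℝ, x = l • e := by
  rw [lfn_apply] at he hx
  have h0 : (![e 1, e 2] : Fin 2 → ℝ) ≠ 0 := by
    intro h0
    have h1 : e 1 = 0 := congrFun h0 0
    have h2 : e 2 = 0 := congrFun h0 1
    rw [h1, h2] at he
    apply e0
    ext i; fin_cases i
    · simp; linarith
    · exact h1
    · exact h2
  obtain ⟨l, hl⟩ := crs_zero_line h0 (y := ![x 1, x 2]) (by simp [crs]; linarith)
  have h1 : x 1 = l * e 1 := congrFun hl 0
  have h2 : x 2 = l * e 2 := congrFun hl 1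
  refine ⟨l, ?_⟩
  ext i; fin_cases i
  · simp; rw [h1, h2] at hx; linear_combination hx - l * he
  · exact h1
  · exact h2

theorem upF_max (V : Finset (Fin 3 → ℤ)) {P F : Set (Fin 3 → ℝ)}
    (hP : P = convexHull ℝ (castPt '' (V : Set (Fin 3 → ℤ)))) (L : (Fin 3 → ℝ) →ₗ[ℝ] ℝ)
    (ht : ∀ v ∈ V, ∀ w ∈ V, L (castPt v) = L (castPt w) → v = w) (hFP : F ⊆ P)
    {q : Fin 3 → ℤ} (hmax : ∀ v ∈ V, L (castPt v) ≤ L (castPt q)) {w : Fin 3 → ℝ} (hw : L w = 0)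
    (hw0 : w ≠ 0) : q ∉ upF F w := by
  rintro ⟨h1, ε, hε, h2⟩
  have f1 := face_hull V L _ hmax (hP ▸ hFP h1) rfl
  have f2 := face_hull V L _ hmax (hP ▸ hFP h2) (by rw [map_add, map_smul, hw]; simp)
  have hsub : (castPt '' {v | v ∈ V ∧ L (castPt v) = L (castPt q)}).Subsingleton := by
    rintro _ ⟨v, hv, rfl⟩ _ ⟨v', hv', rfl⟩
    rw [ht v hv.1 v' hv'.1 (by rw [hv.2, hv'.2])]
  have hs2 := (Set.Subsingleton.convex (𝕜 := ℝ) hsub).convexHull_eq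
  rw [hs2] at f1 f2
  have := hsub f1 f2
  rw [left_eq_add] at this
  rcases smul_eq_zero.1 this with h | h
  · exact hε.ne' h
  · exact hw0 h

theorem seg_interior {P : Set (Fin 3 → ℝ)} (hc : Convex ℝ P) {o p : Fin 3 → ℝ}
    (ho : o ∈ interior P) (hp : p ∈ P) (L : (Fin 3 → ℝ) →ₗ[ℝ] ℝ) {y : ℝ}
    (h1 : L o ≤ y) (h2 : y < L p) : ∃ x ∈ interior P, L x = y := by
  have hD : 0 < L p - L o := by linarith
  refine ⟨((L p - y) / (L p - L o)) • o + ((y - L o) / (L p - L o)) • p, ?_, ?_⟩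
  · exact hc.combo_interior_self_mem_interior ho hp (div_pos (by linarith) hD)
      (div_nonneg (by linarith) hD.le) (by field_simp; ring)
  · rw [map_add, map_smul, map_smul, smul_eq_mul, smul_eq_mul]
    field_simp
    ring

theorem boundary_bound {P : Set (Fin 3 → ℝ)} (h : TwoPt P) (htop : affineSpan ℝ P = ⊤)
    (Fs : Finset (Set (Fin 3 → ℝ))) (hFs : ∀ F ∈ Fs, IsFacetOf F P)
    (a : Set (Fin 3 → ℝ) → ℝ) (ha : ∀ F ∈ Fs, IsNormalisedAreaOf F (a F)) :
    (∑ F ∈ Fs, a F) + 8 ≤ 2 * ((latPts P).ncard : ℝ) := by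
  classical
  have hLfin : (latPts P).Finite := compact_pts_finite h.lat.compact
  have hconv := h.lat.convex
  obtain ⟨V, hVne, hV⟩ := h.lat
  obtain ⟨t, ht'⟩ := lfn_generic _ hLfin
  have hVP : ∀ v ∈ V, castPt v ∈ P := fun v hv => by
    rw [hV]; exact subset_convexHull ℝ _ ⟨v, hv, rfl⟩
  have ht : ∀ v ∈ V, ∀ w ∈ V, lfn t (castPt v) = lfn t (castPt w) → v = w :=
    fun v hv w hw => ht' v (hVP v hv) w (hVP w hw)
  -- interior points
  have hIfin : (intLatPts P).Finite := hLfin.subset fun v (hv : castPt v ∈ interior P) => (interior_subset hv : castPt v ∈ P)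
  obtain ⟨o, ho⟩ : (intLatPts P).Nonempty := by
    rw [← Set.ncard_pos hIfin, h.two]; norm_num
  have ho : castPt o ∈ interior P := ho
  obtain ⟨qM, hqM, hqM'⟩ := V.exists_max_image (fun v => lfn t (castPt v)) hVne
  obtain ⟨qm, hqm, hqm'⟩ := V.exists_min_image (fun v => lfn t (castPt v)) hVne
  have hPM : ∀ x ∈ P, lfn t x ≤ lfn t (castPt qM) := by
    have : P ⊆ {x | lfn t x ≤ lfn t (castPt qM)} := by
      rw [hV]
      apply convexHull_min
      · rintro _ ⟨v, hv, rfl⟩; exact hqM' v hv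
      · exact convex_halfSpace_le (LinearMap.isLinear _) _
    exact fun x hx => this hx
  have hPm : ∀ x ∈ P, lfn t (castPt qm) ≤ lfn t x := by
    have : P ⊆ {x | lfn t (castPt qm) ≤ lfn t x} := by
      rw [hV]
      apply convexHull_min
      · rintro _ ⟨v, hv, rfl⟩; exact hqm' v hv
      · exact convex_halfSpace_ge (LinearMap.isLinear _) _
    exact fun x hx => this hx
  have hintr : ∀ x ∈ interior P, lfn t (castPt qm) < lfn t x ∧ lfn t x < lfn t (castPt qM) := by
    intro x hx
    constructor
    · obtain ⟨ε, hε, h1⟩ := int_move hx (![-1, 0, 0])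
      have h2 := hPm _ (interior_subset h1)
      rw [map_add, map_smul, lfn_apply t ![-1, 0, 0]] at h2
      simp at h2
      linarith
    · obtain ⟨ε, hε, h1⟩ := int_move hx (![1, 0, 0])
      have h2 := hPM _ (interior_subset h1)
      rw [map_add, map_smul, lfn_apply t ![1, 0, 0]] at h2
      simp at h2
      linarith
  -- directions
  have hdir : ∀ F : Set (Fin 3 → ℝ), ∃ d : Fin 3 → ℝ, F ∈ Fs → d ≠ 0 ∧ lfn t d = 0 ∧
      d ∈ (affineSpan ℝ F).direction ∧ a F ≤ ((upF F d).ncard : ℝ) + (upF F (-d)).ncard := by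
    intro F
    by_cases hF : F ∈ Fs
    · obtain ⟨d, hd⟩ := facet_bound V hV t ht (hFs F hF) (ha F hF)
      exact ⟨d, fun _ => hd⟩
    · exact ⟨0, fun h => absurd h hF⟩
  choose dir hdir using hdir
  obtain ⟨w, hw⟩ : ∃ w : Set (Fin 3 → ℝ) × Bool → (Fin 3 → ℝ),
      w = fun j => if j.2 then dir j.1 else - dir j.1 := ⟨_, rfl⟩
  have hwt : ∀ F, w (F, true) = dir F := fun F => by rw [hw]; rfl
  have hwf : ∀ F, w (F, false) = - dir F := fun F => by rw [hw]; rfl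
  have hwp : ∀ F ∈ Fs, ∀ s, w (F, s) ≠ 0 ∧ lfn t (w (F, s)) = 0 ∧
      w (F, s) ∈ (affineSpan ℝ F).direction := by
    intro F hF s
    obtain ⟨h1, h2, h3, -⟩ := hdir F hF
    cases s
    · rw [hwf]
      exact ⟨neg_ne_zero.2 h1, by rw [map_neg, h2, neg_zero], Submodule.neg_mem _ h3⟩
    · rw [hwt]; exact ⟨h1, h2, h3⟩
  obtain ⟨L, hL⟩ : ∃ L : Finset (Fin 3 → ℤ), L = hLfin.toFinset := ⟨_, rfl⟩
  obtain ⟨I, hI⟩ : ∃ I : Finset (Fin 3 → ℤ), I = hIfin.toFinset := ⟨_, rfl⟩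
  have mL : ∀ v, v ∈ L ↔ castPt v ∈ P := fun v => by rw [hL]; simp [latPts]
  have mI : ∀ v, v ∈ I ↔ castPt v ∈ interior P := fun v => by rw [hI]; simp [intLatPts]
  have cL : L.card = (latPts P).ncard := by rw [hL, Set.ncard_eq_toFinset_card _ hLfin]
  have cI : I.card = 2 := by rw [hI, ← Set.ncard_eq_toFinset_card _ hIfin, h.two]
  obtain ⟨B, hB⟩ : ∃ B : Finset (Fin 3 → ℤ), B = (L \ I) \ {qM, qm} := ⟨_, rfl⟩
  have cB : B.card + 4 = L.card := by
    have hne : qM ≠ qm := by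
      rintro rfl
      have := hintr _ ho
      linarith [this.1, this.2]
    have hs1 : I ⊆ L := fun v hv => (mL v).2 (interior_subset ((mI v).1 hv))
    have hs2 : ({qM, qm} : Finset _) ⊆ L \ I := by
      intro v hv
      rw [Finset.mem_sdiff, mL, mI]
      rcases Finset.mem_insert.1 hv with rfl | hv
      · exact ⟨hVP _ hqM, fun h => lt_irrefl _ (hintr _ h).2⟩
      · rw [Finset.mem_singleton] at hv
        subst hv
        exact ⟨hVP _ hqm, fun h => lt_irrefl _ (hintr _ h).1⟩
    have e1 := Finset.card_sdiff_add_card_eq_card hs1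
    have e2 := Finset.card_sdiff_add_card_eq_card hs2
    rw [Finset.card_pair hne, ← hB] at e2
    omega
  obtain ⟨J, hJ⟩ : ∃ J : Finset (Set (Fin 3 → ℝ) × Bool), J = Fs ×ˢ Finset.univ := ⟨_, rfl⟩
  have mJ : ∀ j, j ∈ J ↔ j.1 ∈ Fs := fun j => by rw [hJ]; simp
  have hFP : ∀ F ∈ Fs, F ⊆ P := by
    intro F hF x hx
    obtain ⟨⟨-, m, c, -, rfl⟩, -⟩ := hFs F hF
    exact hx.1
  have hU : ∀ j ∈ J, ∀ q ∈ upF j.1 (w j), q ∈ B := by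
    rintro ⟨F, s⟩ hj q hq
    have hF : F ∈ Fs := (mJ _).1 hj
    obtain ⟨w0, wl, wd⟩ := hwp F hF s
    obtain ⟨m, c, m1, m2, m3, m4⟩ := facet_data htop (hFs F hF)
    have hqP := hFP F hF hq.1
    rw [hB, Finset.mem_sdiff, Finset.mem_sdiff, mL, mI]
    refine ⟨⟨hqP, fun hi => ?_⟩, fun hi => ?_⟩
    · have h1 := m3 _ hi
      have h2 := hq.1
      simp only [m2] at h2
      exact h1.ne h2.2
    · rcases Finset.mem_insert.1 hi with rfl | hi
      · exact upF_max V hV (lfn t) ht (hFP F hF) hqM' wl w0 hq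
      · rw [Finset.mem_singleton] at hi
        subst hi
        refine upF_max V hV (-lfn t) (fun v hv w hw h => ht v hv w hw ?_) (hFP F hF) ?_ ?_ w0 hq
        · simpa using h
        · intro v hv; simpa using hqm' v hv
        · simp [wl]
  have hq2 : ∀ q ∈ B, (J.filter (fun j => q ∈ upF j.1 (w j))).card ≤ 2 := by
    intro q hq
    rw [hB, Finset.mem_sdiff, Finset.mem_sdiff, mL, mI] at hq
    obtain ⟨⟨hqP, hqI⟩, hqx⟩ := hq
    rw [Finset.mem_insert, Finset.mem_singleton] at hqx
    push Not at hqx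
    have hl1 : lfn t (castPt q) < lfn t (castPt qM) := lt_of_le_of_ne (hPM _ hqP)
      fun h => hqx.1 (ht' _ hqP _ (hVP _ hqM) h)
    have hl2 : lfn t (castPt qm) < lfn t (castPt q) := lt_of_le_of_ne (hPm _ hqP)
      fun h => hqx.2 (ht' _ hqP _ (hVP _ hqm) h.symm)
    obtain ⟨x, hx, hxl⟩ : ∃ x ∈ interior P, lfn t x = lfn t (castPt q) := by
      rcases le_total (lfn t (castPt o)) (lfn t (castPt q)) with h | h
      · exact seg_interior hconv ho (hVP _ hqM) (lfn t) h hl1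
      · obtain ⟨x, hx, hx'⟩ := seg_interior hconv ho (hVP _ hqm) (-lfn t)
          (y := - lfn t (castPt q)) (by simpa using h) (by simpa using hl2)
        exact ⟨x, hx, by simpa using hx'⟩
    obtain ⟨e, he⟩ : ∃ e, e = x - castPt q := ⟨_, rfl⟩
    have hel : lfn t e = 0 := by rw [he, map_sub, hxl, sub_self]
    have he0 : e ≠ 0 := by
      intro h0; apply hqI
      rw [h0] at he
      rw [← sub_eq_zero.1 he.symm]; exact hx
    -- data of a pair
    have hdat : ∀ j ∈ J.filter (fun j => q ∈ upF j.1 (w j)), ∃ (m : (Fin 3 → ℝ) →ₗ[ℝ] ℝ) (c : ℝ),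
        (∀ x ∈ P, m x ≤ c) ∧ j.1 = {x ∈ P | m x = c} ∧ m e < 0 ∧ m (w j) = 0 ∧ w j ≠ 0 ∧
        lfn t (w j) = 0 ∧ q ∈ upF j.1 (w j) ∧ e 1 * w j 2 - e 2 * w j 1 ≠ 0 := by
      rintro ⟨F, s⟩ hj
      rw [Finset.mem_filter, mJ] at hj
      obtain ⟨hF, hq⟩ := hj
      obtain ⟨w0, wl, wd⟩ := hwp F hF s
      obtain ⟨m, c, m1, m2, m3, m4⟩ := facet_data htop (hFs F hF)
      have hqF := hq.1
      simp only [m2] at hqF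
      have hme : m e < 0 := by
        rw [he, map_sub, hqF.2]; linarith [m3 x hx]
      refine ⟨m, c, m1, m2, hme, m4 _ wd, w0, wl, hq, fun h0 => ?_⟩
      obtain ⟨l, hl⟩ := lfn_plane hel wl he0 h0
      have := m4 _ wd
      rw [hl, map_smul, smul_eq_mul] at this
      rcases mul_eq_zero.1 this with h | h
      · rw [h, zero_smul] at hl; exact w0 hl
      · exact hme.ne h
    have hinj : Set.InjOn (fun j => decide (0 < e 1 * w j 2 - e 2 * w j 1))
        (J.filter (fun j => q ∈ upF j.1 (w j))) := by
      intro j1 hj1 j2 hj2 hs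
      obtain ⟨m1, c1, a1, a2, a3, a4, a5, a6, a7, a8⟩ := hdat j1 hj1
      obtain ⟨m2, c2, b1, b2, b3, b4, b5, b6, b7, b8⟩ := hdat j2 hj2
      simp only [decide_eq_decide] at hs
      obtain ⟨t1, ht1⟩ : ∃ r, r = e 1 * w j1 2 - e 2 * w j1 1 := ⟨_, rfl⟩
      obtain ⟨t2, ht2⟩ : ∃ r, r = e 1 * w j2 2 - e 2 * w j2 1 := ⟨_, rfl⟩
      rw [← ht1] at a8 hs
      rw [← ht2] at b8 hs
      have hβ : 0 < t2 / t1 := by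
        rcases lt_or_gt_of_ne a8 with h1 | h1 <;> rcases lt_or_gt_of_ne b8 with h2 | h2
        · exact div_pos_of_neg_of_neg h2 h1
        · exact absurd (hs.2 h2) h1.le.not_gt
        · exact absurd (hs.1 h1) h2.le.not_gt
        · exact div_pos h2 h1
      obtain ⟨α, hα⟩ := lfn_plane hel (x := w j2 - (t2 / t1) • w j1)
        (by rw [map_sub, map_smul, a6, b6]; simp) he0 (by
          simp only [Pi.sub_apply, Pi.smul_apply, smul_eq_mul]
          field_simp
          rw [ht1, ht2]; ring)
      have hw2 : w j2 = α • e + (t2 / t1) • w j1 := by rw [← hα]; abel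
      obtain ⟨hFF, hww⟩ := side_unique V hV t ht a1 b1 a2 b2 a7 b7 a6 hel a4 b4 a5 a3 b3 hw2 hβ
      obtain ⟨F1, s1⟩ := j1
      obtain ⟨F2, s2⟩ := j2
      simp only at hFF
      subst hFF
      have d0 : dir F1 ≠ 0 := (hdir F1 ((mJ _).1 (Finset.mem_filter.1 hj1).1)).1
      have key : ∀ β : ℝ, 0 < β → dir F1 ≠ - (β • dir F1) := by
        intro β hβ h
        have : (1 + β) • dir F1 = 0 := by
          rw [add_smul, one_smul]; nth_rewrite 1 [h]; simp
        rcases smul_eq_zero.1 this with h | h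
        · linarith
        · exact d0 h
      cases s1 <;> cases s2
      · rfl
      · rw [hwt, hwf, smul_neg] at hww
        exact absurd hww (key _ hβ)
      · rw [hwt, hwf] at hww
        exact absurd (neg_eq_iff_eq_neg.1 hww) (key _ hβ)
      · rfl
    exact (Finset.card_le_card_of_injOn _ (fun _ _ => Finset.mem_univ _) hinj).trans (by simp)
  -- double counting
  have h1 : (∑ F ∈ Fs, a F) ≤ ((∑ j ∈ J, (upF j.1 (w j)).ncard : ℕ) : ℝ) := by
    rw [hJ, Finset.sum_product]
    push_cast
    apply Finset.sum_le_sum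
    intro F hF
    rw [Fintype.sum_bool]
    simp only [hwt, hwf]
    exact (hdir F hF).2.2.2
  have h2 : (∑ j ∈ J, (upF j.1 (w j)).ncard) ≤ 2 * B.card := by
    have e1 : ∀ j ∈ J, (upF j.1 (w j)).ncard = (B.filter (fun q => q ∈ upF j.1 (w j))).card := by
      intro j hj
      rw [← Set.ncard_coe_finset]
      congr 1
      ext q
      simp only [Finset.coe_filter, mem_ofPred_eq]
      exact ⟨fun h => ⟨hU j hj q h, h⟩, fun h => h.2⟩
    rw [Finset.sum_congr rfl e1]
    have := Finset.sum_card_bipartiteAbove_eq_sum_card_bipartiteBelow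
      (s := J) (t := B) (fun j q => q ∈ upF j.1 (w j))
    unfold Finset.bipartiteAbove Finset.bipartiteBelow at this
    rw [this]
    refine (Finset.sum_le_card_nsmul B _ 2 hq2).trans ?_
    rw [smul_eq_mul, mul_comm]
  have h3 : ((∑ j ∈ J, (upF j.1 (w j)).ncard : ℕ) : ℝ) ≤ 2 * B.card := by exact_mod_cast h2
  have h4 : (B.card : ℝ) + 4 = (latPts P).ncard := by rw [← cL]; exact_mod_cast cB
  linarith

/-! ## The equality case: the facets of the extremal simplex -/

theorem tri_area (q u v : Fin 3 → ℤ) (α β : ℤ) (F : Set (Fin 3 → ℝ))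
    (hF : F = convexHull ℝ {castPt q, castPt (q + α • u), castPt (q + β • v)})
    (hl : ∀ w : Fin 3 → ℤ, castPt w ∈ affineSpan ℝ F → ∃ s t : ℤ, w = q + s • u + t • v)
    {a : ℝ} (ha : IsNormalisedAreaOf F a) : a = |(α : ℝ) * β| := by
  obtain ⟨M, b, hbij, -, rfl⟩ := ha
  obtain ⟨f, hf⟩ : ∃ f : (Fin 3 → ℝ) →ᵃ[ℝ] (Fin 2 → ℝ), ⇑f =
      (fun x : Fin 3 → ℝ => (M.map (Int.cast : ℤ → ℝ)).mulVec x + castPt b) :=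
    ⟨(Matrix.toLin' (M.map (Int.cast : ℤ → ℝ))).toAffineMap + AffineMap.const ℝ _ (castPt b), by
      ext x i; simp⟩
  have hfc : ∀ w : Fin 3 → ℤ, f (castPt w) = castPt (M.mulVec w + b) := fun w => by
    rw [hf, castPt_add, castPt_mulVec]
  rw [← hf, hF, AffineMap.image_convexHull, image_insert_eq, image_pair, hfc, hfc, hfc, vol_tri,
    ← castPt_sub, ← castPt_sub, crs_cast]
  have e1 : M.mulVec (q + α • u) + b - (M.mulVec q + b) = α • M.mulVec u := by
    rw [Matrix.mulVec_add, Matrix.mulVec_smul]; abel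
  have e2 : M.mulVec (q + β • v) + b - (M.mulVec q + b) = β • M.mulVec v := by
    rw [Matrix.mulVec_add, Matrix.mulVec_smul]; abel
  rw [e1, e2]
  have key : ∀ d : Fin 2 → ℤ, ∃ s t : ℤ, d = s • M.mulVec u + t • M.mulVec v := by
    intro d
    obtain ⟨w, hw, hwd⟩ := hbij.surjOn (mem_univ (M.mulVec q + b + d))
    obtain ⟨s, t, rfl⟩ := hl w hw
    refine ⟨s, t, ?_⟩
    simp only [Matrix.mulVec_add, Matrix.mulVec_smul] at hwd
    have : d = (M.mulVec q + s • M.mulVec u + t • M.mulVec v + b) - (M.mulVec q + b) := by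
      rw [hwd]; abel
    rw [this]; abel
  obtain ⟨s, t, h1⟩ := key ![1, 0]
  obtain ⟨s', t', h2⟩ := key ![0, 1]
  have a0 := congrFun h1 0
  have a1 := congrFun h1 1
  have b0 := congrFun h2 0
  have b1 := congrFun h2 1
  simp at a0 a1 b0 b1
  have hu : IsUnit (crs (M.mulVec u) (M.mulVec v)) := by
    apply IsUnit.of_mul_eq_one (s * t' - t * s')
    unfold crs
    linear_combination (s' * M.mulVec u 1 + t' * M.mulVec v 1) * (-a0) - b1 +
      a1 * (s' * M.mulVec u 0 + t' * M.mulVec v 0)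
  have hab : |crs (M.mulVec u) (M.mulVec v)| = 1 := by
    rcases Int.isUnit_iff.1 hu with h | h <;> rw [h] <;> simp
  have : crs (α • M.mulVec u) (β • M.mulVec v) = α * β * crs (M.mulVec u) (M.mulVec v) := by
    simp [crs]; ring
  rw [this, ← Int.cast_abs, abs_mul, hab, mul_one, Int.cast_abs, Int.cast_mul]

theorem tri_facet {A : Matrix (Fin 3) (Fin 3) ℤ} (hA : IsUnit A.det) (b : Fin 3 → ℤ)
    (S T : Set (Fin 3 → ℝ)) (m : (Fin 3 → ℝ) →ₗ[ℝ] ℝ) (c : ℝ) (q u v : Fin 3 → ℤ) (α β : ℤ)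
    (h1 : ∀ x ∈ S, m x ≤ c) (hT : T = {x ∈ S | m x = c})
    (h2 : T = convexHull ℝ {castPt q, castPt (q + α • u), castPt (q + β • v)})
    (h3 : ∀ w : Fin 3 → ℤ, m (castPt w) = c → ∃ s t : ℤ, w = q + s • u + t • v)
    (h4 : ¬ Collinear ℝ {castPt q, castPt (q + α • u), castPt (q + β • v)}) :
    IsFacetOf (uni A b '' T) (uni A b '' S) ∧
      ∀ a, IsNormalisedAreaOf (uni A b '' T) a → a = |(α : ℝ) * β| := by
  refine ⟨⟨⟨?_, m ∘ₗ Matrix.toLin' (A⁻¹.map (Int.cast : ℤ → ℝ)), c - m (castPt (-(A⁻¹.mulVec b))), ?_, ?_⟩, ?_⟩, ?_⟩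
  · rw [h2]; exact Set.Nonempty.image _ ⟨_, subset_convexHull ℝ _ (mem_insert _ _)⟩
  · rintro _ ⟨x, hx, rfl⟩
    have := h1 x hx
    rw [← uni_inv hA b x, uni, map_add] at this
    simp only [LinearMap.comp_apply, Matrix.toLin'_apply]
    linarith
  · have key : ∀ x, m (Matrix.toLin' (A⁻¹.map (Int.cast : ℤ → ℝ)) (uni A b x)) =
        m x - m (castPt (-(A⁻¹.mulVec b))) := by
      intro x
      conv_rhs => rw [← uni_inv hA b x, uni, map_add]
      simp
    ext y
    rw [hT]
    constructor
    · rintro ⟨x, hx, rfl⟩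
      exact ⟨⟨x, hx.1, rfl⟩, by rw [LinearMap.comp_apply, key, hx.2]⟩
    · rintro ⟨⟨x, hx, rfl⟩, hy⟩
      rw [LinearMap.comp_apply, key] at hy
      exact ⟨x, ⟨hx, by linarith⟩, rfl⟩
  · unfold faceDim
    rw [← affineIndependent_iff_not_collinear_set] at h4
    have hinj : Function.Injective (uniA A b) := by
      rw [uniA_apply]; exact (uniH hA b).injective
    have h5 := h4.map' (uniA A b) hinj
    have h6 := h5.finrank_vectorSpan (n := 2) (by simp)
    rw [h2, ← uniA_apply, AffineMap.image_convexHull, affineSpan_convexHull, direction_affineSpan]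
    have hr : uniA A b '' {castPt q, castPt (q + α • u), castPt (q + β • v)} =
        range (uniA A b ∘ ![castPt q, castPt (q + α • u), castPt (q + β • v)]) := by
      rw [range_comp]
      congr 1
      rw [Matrix.range_cons, Matrix.range_cons, Matrix.range_cons, Matrix.range_empty, union_empty]
      rfl
    rw [hr, h6]
  · intro a ha
    refine tri_area (A.mulVec q + b) (A.mulVec u) (A.mulVec v) α β _ ?_ ?_ ha
    · rw [h2, uni_hull, image_insert_eq, image_pair, uni_cast, uni_cast, uni_cast]
      simp only [Matrix.mulVec_add, Matrix.mulVec_smul, add_right_comm]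
    · intro w hw
      have e : affineSpan ℝ (uni A b '' T) = (affineSpan ℝ T).map (uniA A b) := by
        rw [AffineSubspace.map_span, uniA_apply]
      rw [e] at hw
      have hw' : w ∈ {v : Fin 3 → ℤ | castPt v ∈ uni A b '' (affineSpan ℝ T : Set _)} := by
        rw [← uniA_apply]; exact hw
      rw [uni_pts hA] at hw'
      obtain ⟨w0, hw0, rfl⟩ := hw'
      have hle : affineSpan ℝ T ≤ (AffineSubspace.mk' (castPt q) (LinearMap.ker m)) := by
        rw [affineSpan_le]
        intro x hx
        have hq : castPt q ∈ T := by rw [h2]; exact subset_convexHull ℝ _ (mem_insert _ _)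
        rw [hT] at hx hq
        change x ∈ AffineSubspace.mk' _ _
        rw [AffineSubspace.mem_mk', LinearMap.mem_ker, vsub_eq_sub, map_sub, hx.2, hq.2, sub_self]
      have := hle hw0
      have hq : castPt q ∈ T := by rw [h2]; exact subset_convexHull ℝ _ (mem_insert _ _)
      rw [hT] at hq
      rw [AffineSubspace.mem_mk', LinearMap.mem_ker, vsub_eq_sub, map_sub, hq.2, sub_eq_zero] at this
      obtain ⟨s, t, rfl⟩ := h3 _ this
      refine ⟨s, t, ?_⟩
      simp only [Matrix.mulVec_add, Matrix.mulVec_smul]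
      abel

/-- The linear functional with given coefficients. -/
def lco (a b c : ℝ) : (Fin 3 → ℝ) →ₗ[ℝ] ℝ :=
  a • LinearMap.proj 0 + b • LinearMap.proj 1 + c • LinearMap.proj 2

theorem lco_apply (a b c : ℝ) (x : Fin 3 → ℝ) : lco a b c x = a * x 0 + b * x 1 + c * x 2 := by
  simp [lco]

/-- The vertices of the extremal simplex. -/
def vS : Finset (Fin 3 → ℤ) := {![0,0,0], ![2,0,0], ![0,3,0], ![0,0,18]}

theorem S23_eq : S23 = convexHull ℝ (castPt '' (vS : Set (Fin 3 → ℤ))) := by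
  unfold S23 vS
  congr 1
  simp only [Finset.coe_insert, Finset.coe_singleton, image_insert_eq, image_singleton]
  have : ∀ x y z : ℤ, castPt ![x, y, z] = ![(x : ℝ), y, z] := by
    intro x y z; ext i; fin_cases i <;> simp [castPt]
  simp [this]

theorem S23_face (m : (Fin 3 → ℝ) →ₗ[ℝ] ℝ) (c : ℝ) (p q r : Fin 3 → ℤ)
    (hm : ∀ v ∈ vS, m (castPt v) ≤ c) (hp : p ∈ vS) (hq : q ∈ vS) (hr : r ∈ vS)
    (hp' : m (castPt p) = c) (hq' : m (castPt q) = c) (hr' : m (castPt r) = c)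
    (h : ∀ v ∈ vS, m (castPt v) = c → v = p ∨ v = q ∨ v = r) :
    (∀ x ∈ S23, m x ≤ c) ∧
    {x ∈ S23 | m x = c} = convexHull ℝ {castPt p, castPt q, castPt r} := by
  have hmem : ∀ v ∈ vS, castPt v ∈ S23 := fun v hv => by
    rw [S23_eq]; exact subset_convexHull ℝ _ ⟨v, hv, rfl⟩
  have hle : ∀ x ∈ S23, m x ≤ c := by
    have : S23 ⊆ {x | m x ≤ c} := by
      rw [S23_eq]
      apply convexHull_min
      · rintro _ ⟨v, hv, rfl⟩; exact hm v hv
      · exact convex_halfSpace_le (LinearMap.isLinear _) _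
    exact this
  refine ⟨hle, Subset.antisymm ?_ ?_⟩
  · rintro x ⟨hx, hxc⟩
    rw [S23_eq] at hx
    refine convexHull_mono ?_ (face_hull vS m c hm hx hxc)
    rintro _ ⟨v, ⟨hv, hvc⟩, rfl⟩
    rcases h v hv hvc with rfl | rfl | rfl <;> simp
  · apply convexHull_min
    · rintro x (rfl | rfl | rfl)
      · exact ⟨hmem _ hp, hp'⟩
      · exact ⟨hmem _ hq, hq'⟩
      · exact ⟨hmem _ hr, hr'⟩
    · exact (convex_convexHull ℝ _).inter (convex_hyperplane (LinearMap.isLinear m) c)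

theorem not_col {p q r : Fin 3 → ℤ} (i j : Fin 3)
    (h : (q i - p i) * (r j - p j) - (q j - p j) * (r i - p i) ≠ 0) :
    ¬ Collinear ℝ {castPt p, castPt q, castPt r} := by
  intro hc
  rw [collinear_iff_of_mem (p₀ := castPt p) (by simp)] at hc
  obtain ⟨w, hw⟩ := hc
  obtain ⟨s, hs⟩ := hw (castPt q) (by simp)
  obtain ⟨t, ht⟩ := hw (castPt r) (by simp)
  have s1 := congrFun hs i
  have s2 := congrFun hs j
  have t1 := congrFun ht i
  have t2 := congrFun ht j
  simp [castPt] at s1 s2 t1 t2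
  apply h
  have : ((q i - p i : ℝ)) * (r j - p j) - (q j - p j) * (r i - p i) = 0 := by
    rw [s1, s2, t1, t2]; ring
  exact_mod_cast this

/-- Facets of the extremal simplex are computed from a vertex and two primitive edge directions. -/
theorem S23_tri (m : (Fin 3 → ℝ) →ₗ[ℝ] ℝ) (c : ℝ) (q u v : Fin 3 → ℤ) (α β : ℤ)
    (hm : ∀ w ∈ vS, m (castPt w) ≤ c) (hp : q ∈ vS) (hq : q + α • u ∈ vS) (hr : q + β • v ∈ vS)
    (hp' : m (castPt q) = c) (hq' : m (castPt (q + α • u)) = c) (hr' : m (castPt (q + β • v)) = c)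
    (h : ∀ w ∈ vS, m (castPt w) = c → w = q ∨ w = q + α • u ∨ w = q + β • v)
    (h3 : ∀ w : Fin 3 → ℤ, m (castPt w) = c → ∃ s t : ℤ, w = q + s • u + t • v)
    (h4 : ¬ Collinear ℝ {castPt q, castPt (q + α • u), castPt (q + β • v)})
    {A : Matrix (Fin 3) (Fin 3) ℤ} (hA : IsUnit A.det) (b : Fin 3 → ℤ) :
    IsFacetOf (uni A b '' {x ∈ S23 | m x = c}) (uni A b '' S23) ∧
      ∀ a, IsNormalisedAreaOf (uni A b '' {x ∈ S23 | m x = c}) a → a = |(α : ℝ) * β| := by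
  obtain ⟨g1, g2⟩ := S23_face m c _ _ _ hm hp hq hr hp' hq' hr' h
  exact tri_facet hA b S23 _ m c q u v α β g1 rfl g2 h3 h4

theorem vec3_eq (w : Fin 3 → ℤ) : w = ![w 0, w 1, w 2] := by
  ext i; fin_cases i <;> rfl

theorem fac_x {A : Matrix (Fin 3) (Fin 3) ℤ} (hA : IsUnit A.det) (b : Fin 3 → ℤ) :
    IsFacetOf (uni A b '' {x ∈ S23 | lco (-1) 0 0 x = 0}) (uni A b '' S23) ∧
      ∀ a, IsNormalisedAreaOf (uni A b '' {x ∈ S23 | lco (-1) 0 0 x = 0}) a → a = 54 := by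
  have := S23_tri (lco (-1) 0 0) 0 ![0,0,0] ![0,1,0] ![0,0,1] 3 18
    (by simp [vS, lco_apply, castPt]) (by simp [vS]) (by simp [vS]) (by simp [vS])
    (by simp [lco_apply, castPt]) (by simp [lco_apply, castPt]) (by simp [lco_apply, castPt])
    (by simp [vS, lco_apply, castPt])
    (fun w hw => ⟨w 1, w 2, by
      simp only [lco_apply, castPt] at hw
      have : w 0 = 0 := by
        have : (w 0 : ℝ) = 0 := by linarith
        exact_mod_cast this
      ext i; fin_cases i <;> simp [this]⟩)
    (not_col 1 2 (by simp)) hA b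
  norm_num at this ⊢
  exact this

theorem fac_y {A : Matrix (Fin 3) (Fin 3) ℤ} (hA : IsUnit A.det) (b : Fin 3 → ℤ) :
    IsFacetOf (uni A b '' {x ∈ S23 | lco 0 (-1) 0 x = 0}) (uni A b '' S23) ∧
      ∀ a, IsNormalisedAreaOf (uni A b '' {x ∈ S23 | lco 0 (-1) 0 x = 0}) a → a = 36 := by
  have := S23_tri (lco 0 (-1) 0) 0 ![0,0,0] ![1,0,0] ![0,0,1] 2 18
    (by simp [vS, lco_apply, castPt]) (by simp [vS]) (by simp [vS]) (by simp [vS])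
    (by simp [lco_apply, castPt]) (by simp [lco_apply, castPt]) (by simp [lco_apply, castPt])
    (by simp [vS, lco_apply, castPt])
    (fun w hw => ⟨w 0, w 2, by
      simp only [lco_apply, castPt] at hw
      have : w 1 = 0 := by
        have : (w 1 : ℝ) = 0 := by linarith
        exact_mod_cast this
      ext i; fin_cases i <;> simp [this]⟩)
    (not_col 0 2 (by simp)) hA b
  norm_num at this ⊢
  exact this

theorem fac_z {A : Matrix (Fin 3) (Fin 3) ℤ} (hA : IsUnit A.det) (b : Fin 3 → ℤ) :
    IsFacetOf (uni A b '' {x ∈ S23 | lco 0 0 (-1) x = 0}) (uni A b '' S23) ∧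
      ∀ a, IsNormalisedAreaOf (uni A b '' {x ∈ S23 | lco 0 0 (-1) x = 0}) a → a = 6 := by
  have := S23_tri (lco 0 0 (-1)) 0 ![0,0,0] ![1,0,0] ![0,1,0] 2 3
    (by simp [vS, lco_apply, castPt]) (by simp [vS]) (by simp [vS]) (by simp [vS])
    (by simp [lco_apply, castPt]) (by simp [lco_apply, castPt]) (by simp [lco_apply, castPt])
    (by simp [vS, lco_apply, castPt])
    (fun w hw => ⟨w 0, w 1, by
      simp only [lco_apply, castPt] at hw
      have : w 2 = 0 := by
        have : (w 2 : ℝ) = 0 := by linarith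
        exact_mod_cast this
      ext i; fin_cases i <;> simp [this]⟩)
    (not_col 0 1 (by simp)) hA b
  norm_num at this ⊢
  exact this

theorem fac_s {A : Matrix (Fin 3) (Fin 3) ℤ} (hA : IsUnit A.det) (b : Fin 3 → ℤ) :
    IsFacetOf (uni A b '' {x ∈ S23 | lco 9 6 1 x = 18}) (uni A b '' S23) ∧
      ∀ a, IsNormalisedAreaOf (uni A b '' {x ∈ S23 | lco 9 6 1 x = 18}) a → a = 6 := by
  have := S23_tri (lco 9 6 1) 18 ![0,0,18] ![1,0,-9] ![0,1,-6] 2 3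
    (by simp [vS, lco_apply, castPt]; norm_num) (by simp [vS]) (by simp [vS]) (by simp [vS])
    (by simp [lco_apply, castPt]) (by simp [lco_apply, castPt]; norm_num)
    (by simp [lco_apply, castPt]; norm_num)
    (by simp [vS, lco_apply, castPt])
    (fun w hw => ⟨w 0, w 1, by
      simp only [lco_apply, castPt] at hw
      have : w 2 = 18 - 9 * w 0 - 6 * w 1 := by
        have : (w 2 : ℝ) = 18 - 9 * w 0 - 6 * w 1 := by linarith
        exact_mod_cast this
      ext i; fin_cases i
      · simp
      · simp
      · simp [this]; ring⟩)
    (not_col 0 1 (by simp)) hA b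
  norm_num at this ⊢
  exact this

theorem sum_ge {P : Set (Fin 3 → ℝ)} (hU : UnimodEquiv P S23)
    (Fs : Finset (Set (Fin 3 → ℝ))) (hFs : (Fs : Set (Set (Fin 3 → ℝ))) = {F | IsFacetOf F P})
    (a : Set (Fin 3 → ℝ) → ℝ) (ha : ∀ F ∈ Fs, IsNormalisedAreaOf F (a F)) :
    102 ≤ ∑ F ∈ Fs, a F := by
  classical
  obtain ⟨A, b, hA, hP⟩ := hU.symm3
  have hP : uni A b '' S23 = P := hP
  have hmem : ∀ F, IsFacetOf F P → F ∈ Fs := fun F hF => by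
    have : F ∈ (Fs : Set (Set (Fin 3 → ℝ))) := by rw [hFs]; exact hF
    exact_mod_cast this
  have hx := fac_x hA b
  have hy := fac_y hA b
  have hz := fac_z hA b
  have hs := fac_s hA b
  rw [hP] at hx hy hz hs
  have inj : Function.Injective (image (uni A b)) := (uniH hA b).injective.image_injective
  have v1 : (![2,0,0] : Fin 3 → ℝ) ∈ S23 := S23_mem (by norm_num) le_rfl le_rfl (by norm_num)
  have v2 : (![0,3,0] : Fin 3 → ℝ) ∈ S23 := S23_mem le_rfl (by norm_num) le_rfl (by norm_num)
  have v0 : (![0,0,0] : Fin 3 → ℝ) ∈ S23 := S23_mem le_rfl le_rfl le_rfl (by norm_num)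
  have nxy : uni A b '' {x ∈ S23 | lco (-1) 0 0 x = 0} ≠ uni A b '' {x ∈ S23 | lco 0 (-1) 0 x = 0} := by
    intro h
    have h' : (![2,0,0] : Fin 3 → ℝ) ∈ {x ∈ S23 | lco (-1) 0 0 x = 0} := by
      rw [inj h]; exact ⟨v1, by simp [lco_apply]⟩
    simpa [lco_apply] using h'.2
  have nxz : uni A b '' {x ∈ S23 | lco (-1) 0 0 x = 0} ≠ uni A b '' {x ∈ S23 | lco 0 0 (-1) x = 0} := by
    intro h
    have h' : (![2,0,0] : Fin 3 → ℝ) ∈ {x ∈ S23 | lco (-1) 0 0 x = 0} := by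
      rw [inj h]; exact ⟨v1, by simp [lco_apply]⟩
    simpa [lco_apply] using h'.2
  have nyz : uni A b '' {x ∈ S23 | lco 0 (-1) 0 x = 0} ≠ uni A b '' {x ∈ S23 | lco 0 0 (-1) x = 0} := by
    intro h
    have h' : (![0,3,0] : Fin 3 → ℝ) ∈ {x ∈ S23 | lco 0 (-1) 0 x = 0} := by
      rw [inj h]; exact ⟨v2, by simp [lco_apply]⟩
    simpa [lco_apply] using h'.2
  have ns : ∀ m : (Fin 3 → ℝ) →ₗ[ℝ] ℝ,
      uni A b '' {x ∈ S23 | m x = 0} ≠ uni A b '' {x ∈ S23 | lco 9 6 1 x = 18} := by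
    intro m h
    have h' : (![0,0,0] : Fin 3 → ℝ) ∈ {x ∈ S23 | lco 9 6 1 x = 18} := by
      rw [← inj h]
      refine ⟨v0, ?_⟩
      have : (![0,0,0] : Fin 3 → ℝ) = 0 := by ext i; fin_cases i <;> rfl
      rw [this, map_zero]
    simpa [lco_apply] using h'.2
  have hnn : ∀ F ∈ Fs, 0 ≤ a F := by
    intro F hF
    obtain ⟨M, b, -, -, h⟩ := ha F hF
    rw [h]; positivity
  have mx := hmem _ hx.1
  have my := hmem _ hy.1
  have mz := hmem _ hz.1
  have ms := hmem _ hs.1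
  have ax := hx.2 _ (ha _ mx)
  have ay := hy.2 _ (ha _ my)
  have az := hz.2 _ (ha _ mz)
  have as := hs.2 _ (ha _ ms)
  have n1 := ns (lco (-1) 0 0)
  have n2 := ns (lco 0 (-1) 0)
  have n3 := ns (lco 0 0 (-1))
  generalize uni A b '' {x ∈ S23 | lco (-1) 0 0 x = 0} = X at *
  generalize uni A b '' {x ∈ S23 | lco 0 (-1) 0 x = 0} = Y at *
  generalize uni A b '' {x ∈ S23 | lco 0 0 (-1) x = 0} = Z at *
  generalize uni A b '' {x ∈ S23 | lco 9 6 1 x = 18} = S at *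
  have hsub : ({X, Y, Z, S} : Finset (Set (Fin 3 → ℝ))) ⊆ Fs := by
    intro F hF
    simp only [Finset.mem_insert, Finset.mem_singleton] at hF
    rcases hF with rfl | rfl | rfl | rfl <;> assumption
  refine le_trans ?_ (Finset.sum_le_sum_of_subset_of_nonneg hsub fun F hF _ => hnn F hF)
  rw [Finset.sum_insert (by simp [nxy, nxz, n1]), Finset.sum_insert (by simp [nyz, n2]),
    Finset.sum_pair n3, ax, ay, az, as]
  norm_num

/-- Every three-dimensional lattice polytope with exactly two interior lattice points has
normalised boundary volume (the sum of the lattice-normalised areas of its facets) at most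
`102`, with equality if and only if it is unimodular equivalent to `S₂³`. -/
theorem boundary_volume_bound_two_point_three_polytopes (P : Set (Fin 3 → ℝ))
    (hP : IsKPoint3Polytope 2 P)
    (Fs : Finset (Set (Fin 3 → ℝ))) (hFs : (Fs : Set (Set (Fin 3 → ℝ))) = {F | IsFacetOf F P})
    (a : Set (Fin 3 → ℝ) → ℝ) (ha : ∀ F ∈ Fs, IsNormalisedAreaOf F (a F)) :
    (∑ F ∈ Fs, a F) ≤ 102 ∧ ((∑ F ∈ Fs, a F) = 102 ↔ UnimodEquiv P S23) := by
  obtain ⟨hl, htop, htwo⟩ := hP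
  have h : TwoPt P := ⟨hl, htwo⟩
  have hb := boundary_bound h htop Fs (fun F hF => by
    have : F ∈ (Fs : Set (Set (Fin 3 → ℝ))) := by exact_mod_cast hF
    rw [hFs] at this; exact this) a ha
  have hN : (latPts P).ncard ≤ 55 := by
    by_contra hc
    have := (twoPt_main h (by omega)).1
    omega
  have hN' : ((latPts P).ncard : ℝ) ≤ 55 := by exact_mod_cast hN
  have hle : (∑ F ∈ Fs, a F) ≤ 102 := by linarith
  refine ⟨hle, fun he => ?_, fun hU => le_antisymm hle (sum_ge hU Fs hFs a ha)⟩
  have : (55 : ℝ) ≤ (latPts P).ncard := by linarith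
  exact (twoPt_main h (by exact_mod_cast this)).2
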